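/- Let 2 < α ≤ 3 and let u ∈ C^∞(S²) be a solution of −Δu + α = e^{2u} on S². If p ∈ S² is an umbilical critical point of u (∇u(p) = 0 and D²u(p) has two equal eigenvalues), then the antipodal point is also a critical point: ∇u(−p) = 0. -/

import Mathlib

open MeasureTheory Real
open scoped RealInnerProductSpace ContDiff

noncomputable section

abbrev E3 : Type := EuclideanSpace ℝ (Fin 3)

/-- The unit sphere `S²` as a subset of `ℝ³`. -/
def S2 : Set E3 := Metric.sphere 0 1

/-- The Euclidean Laplacian of `u : ℝ³ → ℝ`.  For a `0`-homogeneous function it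
coincides on `S²` with the Laplace–Beltrami operator of the round metric applied
to the restriction of `u` to `S²`. -/
def lap (u : E3 → ℝ) (x : E3) : ℝ :=
  ∑ i : Fin 3, iteratedFDeriv ℝ 2 u x ![EuclideanSpace.single i 1, EuclideanSpace.single i 1]

/-- `u : ℝ³ → ℝ` is positively homogeneous of degree `0`, i.e. it is the radial
extension of a function on `S²`. -/
def Hom0 (u : E3 → ℝ) : Prop := ∀ (x : E3) (r : ℝ), 0 < r → u (r • x) = u x

/-- `u` represents a smooth solution of the mean field equation `-Δ_{S²} u + α = e^{2u}`
on `S²`, encoded through its degree-zero homogeneous extension to `ℝ³ \ {0}`. -/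
def MFE (u : E3 → ℝ) (α : ℝ) : Prop :=
  ContDiffOn ℝ ∞ u {(0 : E3)}ᶜ ∧ Hom0 u ∧
    ∀ x ∈ S2, -lap u x + α = Real.exp (2 * u x)

/-- Reflection of `ℝ³` across the plane `{x · y = 0}`. -/
def Refl (y x : E3) : E3 := x - (2 * ⟪x, y⟫) • y

/-- The closed half-sphere `H_y`. -/
def halfSphere (y : E3) : Set E3 := {x ∈ S2 | 0 ≤ ⟪x, y⟫}

/-- The great circle `C_y`. -/
def circleOf (y : E3) : Set E3 := {x ∈ S2 | ⟪x, y⟫ = 0}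

/-- `u` is axially symmetric with respect to `p`: on the sphere it depends only on `x · p`. -/
def AxiallySymmetric (u : E3 → ℝ) (p : E3) : Prop :=
  ∀ x ∈ S2, ∀ y ∈ S2, ⟪x, p⟫ = ⟪y, p⟫ → u x = u y

/-- `p` is an umbilical critical point of `u` (viewed as a function on `S²`):
the (intrinsic) gradient vanishes and the Hessian, as a quadratic form on the
tangent plane `p^⊥`, is a multiple of the metric. -/
def UmbilicalCritical (u : E3 → ℝ) (p : E3) : Prop :=
  fderiv ℝ u p = 0 ∧
    ∃ c : ℝ, ∀ v : E3, ⟪v, p⟫ = 0 → iteratedFDeriv ℝ 2 u p ![v, v] = c * ‖v‖ ^ 2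

/-- `z` is an eigenvector of the Hessian `D²u(q)` viewed as a symmetric bilinear
form on the tangent plane `q^⊥`. -/
def HessEigen (u : E3 → ℝ) (q z : E3) : Prop :=
  ∃ lam : ℝ, ∀ v : E3, ⟪v, q⟫ = 0 → iteratedFDeriv ℝ 2 u q ![z, v] = lam * ⟪z, v⟫

/-- Cross product on `ℝ³`. -/
def cross (a b : E3) : E3 :=
  (WithLp.equiv 2 (Fin 3 → ℝ)).symm
    (crossProduct ((WithLp.equiv 2 (Fin 3 → ℝ)) a) ((WithLp.equiv 2 (Fin 3 → ℝ)) b))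

/-- `Ω` is a nodal domain of `w` on the sphere: a connected component of
`S² \ w⁻¹(0)` (in the subspace topology of `S²`). -/
def IsNodalDomain (w : E3 → ℝ) (Ω : Set E3) : Prop :=
  ∃ x ∈ S2, w x ≠ 0 ∧ Ω = connectedComponentIn {z ∈ S2 | w z ≠ 0} x

end

noncomputable section
/-- The planar Laplacian. -/
def lapC (f : ℂ → ℝ) (z : ℂ) : ℝ :=
  fderiv ℝ (fun y => fderiv ℝ f y 1) z 1 +
    fderiv ℝ (fun y => fderiv ℝ f y Complex.I) z Complex.I

/-- The squared Euclidean norm of the gradient. -/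
def gradSq (f : ℂ → ℝ) (z : ℂ) : ℝ := (fderiv ℝ f z 1) ^ 2 + (fderiv ℝ f z Complex.I) ^ 2

/-- The Cauchy–Riemann operator `∂/∂z̄`. -/
def dbar (f : ℂ → ℂ) (z : ℂ) : ℂ :=
  (fderiv ℝ f z 1 + Complex.I * fderiv ℝ f z Complex.I) / 2
end

theorem integral_fderiv_apply_eq_zero {E : Type*} [NormedAddCommGroup E] [NormedSpace ℝ E]
    {f : ℂ → E} (hf : ContDiff ℝ 1 f)
    (hc : HasCompactSupport f) (v : ℂ) : ∫ z, fderiv ℝ f z v = 0 := by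
  have hcont : Continuous fun z => fderiv ℝ f z v :=
    (hf.continuous_fderiv one_ne_zero).clm_apply continuous_const
  have hc' : HasCompactSupport fun z => fderiv ℝ f z v := hc.fderiv_apply ℝ v
  have h := integral_smul_fderiv_eq_neg_fderiv_smul_of_integrable (𝕜 := ℝ) (f := fun _ : ℂ => (1 : ℝ))
    (g := f) (v := v) (μ := volume) (by simp) (by simpa using hcont.integrable_of_hasCompactSupport hc')
    (by simpa using hf.continuous.integrable_of_hasCompactSupport hc) (by simp)
    (fun x _ => hf.differentiable one_ne_zero x)
  simpa using h

theorem continuous_dbar {f : ℂ → ℂ} (hf : ContDiff ℝ 1 f) : Continuous (dbar f) := by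
  unfold dbar
  have := hf.continuous_fderiv one_ne_zero
  fun_prop

theorem HasCompactSupport.dbar {f : ℂ → ℂ} (hf : HasCompactSupport f) :
    HasCompactSupport (dbar f) := by
  refine (hf.fderiv (𝕜 := ℝ)).mono fun z hz => ?_
  contrapose! hz
  simp only [Function.mem_support, not_not] at hz ⊢
  simp [_root_.dbar, hz]

theorem integral_dbar_eq_zero {f : ℂ → ℂ} (hf : ContDiff ℝ 1 f) (hc : HasCompactSupport f) :
    ∫ z, dbar f z = 0 := by
  have hi : ∀ v : ℂ, Integrable fun z => fderiv ℝ f z v := fun v =>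
    ((hf.continuous_fderiv one_ne_zero).clm_apply continuous_const).integrable_of_hasCompactSupport
      (hc.fderiv_apply ℝ v)
  simp only [dbar]
  rw [integral_div, integral_add (hi _) ((hi _).const_mul _), integral_const_mul,
    integral_fderiv_apply_eq_zero hf hc, integral_fderiv_apply_eq_zero hf hc]
  simp

theorem integral_dbar_div_self {f : ℂ → ℂ} (hf : ContDiff ℝ 1 f) (hc : HasCompactSupport f) :
    ∫ z, dbar f z / z = -π * f 0 := by
  have hfd : Differentiable ℝ f := hf.differentiable one_ne_zero
  have hD : Continuous (fderiv ℝ f) := hf.continuous_fderiv one_ne_zero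
  obtain ⟨R, hR⟩ := hc.isCompact.isBounded.subset_ball 0
  set e : ℝ → ℂ := fun θ => Complex.exp (θ * Complex.I) with he
  have hec : Continuous e := by fun_prop
  have hen : ∀ θ, ‖e θ‖ = 1 := fun θ => Complex.norm_exp_ofReal_mul_I θ
  set A : ℝ × ℝ → ℂ := fun p => fderiv ℝ f (p.1 * e p.2) (e p.2) with hA
  set B : ℝ × ℝ → ℂ := fun p => fderiv ℝ f (p.1 * e p.2) (Complex.I * e p.2) with hB
  have hAc : Continuous A := by fun_prop
  have hBc : Continuous B := by fun_prop
  have hz : ∀ r : ℝ, R ≤ r → ∀ θ, fderiv ℝ f (r * e θ) = 0 := by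
    intro r hr θ
    apply image_eq_zero_of_notMem_tsupport
    intro h
    have h1 := hR (tsupport_fderiv_subset ℝ h)
    rw [mem_ball_zero_iff, norm_mul, hen, mul_one, Complex.norm_real] at h1
    exact absurd ((le_abs_self r).trans_lt h1) (not_lt.mpr hr)
  have key : ∀ F : ℝ × ℝ → ℂ, Continuous F → (∀ r, R ≤ r → ∀ θ, F (r, θ) = 0) →
      IntegrableOn F (Set.Ioi (0:ℝ) ×ˢ Set.Ioo (-π) π) (volume.prod volume) := by
    intro F hF h0
    have h1 : IntegrableOn F (Set.Icc (0:ℝ) R ×ˢ Set.Icc (-π) π) (volume.prod volume) :=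
      hF.continuousOn.integrableOn_compact (isCompact_Icc.prod isCompact_Icc)
    refine h1.of_forall_sdiff_eq_zero (measurableSet_Ioi.prod measurableSet_Ioo) ?_
    rintro ⟨r, θ⟩ ⟨⟨h2, h3⟩, h4⟩
    apply h0
    by_contra! h5
    exact h4 ⟨⟨h2.le, h5.le⟩, ⟨h3.1.le, h3.2.le⟩⟩
  have hAi := key A hAc (fun r hr θ => by simp [hA, hz r hr])
  have hBi := key B hBc (fun r hr θ => by simp [hB, hz r hr])
  have hAint : ∫ p in Set.Ioi (0:ℝ) ×ˢ Set.Ioo (-π) π, A p ∂(volume.prod volume) = -(2 * π) * f 0 := by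
    rw [← setIntegral_prod_swap, setIntegral_prod _ (by exact hAi.swap)]
    have : ∀ θ ∈ Set.Ioo (-π) π, ∫ r in Set.Ioi (0:ℝ), A (r, θ) = - f 0 := by
      intro θ _
      have hder : ∀ r ∈ Set.Ioi (0:ℝ), HasDerivAt (fun r : ℝ => f (r * e θ)) (A (r, θ)) r := by
        intro r _
        have h1 : HasDerivAt (fun r : ℝ => (r : ℂ) * e θ) (e θ) r := by
          simpa using (Complex.ofRealCLM.hasDerivAt (x := r)).mul_const (e θ)
        exact (hfd _).hasFDerivAt.comp_hasDerivAt r h1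
      have hli : IntegrableOn (fun r => A (r, θ)) (Set.Ioi 0) := by
        have h1 : IntegrableOn (fun r => A (r, θ)) (Set.Icc 0 R) :=
          (hAc.comp (by fun_prop)).continuousOn.integrableOn_compact isCompact_Icc
        refine h1.of_forall_sdiff_eq_zero measurableSet_Ioi ?_
        rintro r ⟨h2, h4⟩
        have : R ≤ r := by
          by_contra! h5
          exact h4 ⟨h2.le, h5.le⟩
        simp [hA, hz r this]
      have htop : Filter.Tendsto (fun r : ℝ => f (r * e θ)) Filter.atTop (nhds 0) := by
        refine tendsto_const_nhds.congr' ?_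
        filter_upwards [Filter.eventually_ge_atTop R] with r hr
        symm
        apply image_eq_zero_of_notMem_tsupport
        intro h
        have h1 := hR h
        rw [mem_ball_zero_iff, norm_mul, hen, mul_one, Complex.norm_real] at h1
        exact absurd ((le_abs_self r).trans_lt h1) (not_lt.mpr hr)
      have hc0 : ContinuousWithinAt (fun r : ℝ => f (r * e θ)) (Set.Ici 0) 0 := by
        have := hf.continuous
        have h : Continuous (fun r : ℝ => f (r * e θ)) := by fun_prop
        exact h.continuousWithinAt
      have := integral_Ioi_of_hasDerivAt_of_tendsto hc0 hder hli htop
      simpa using this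
    have h2 : ∫ θ in Set.Ioo (-π) π, ∫ r in Set.Ioi (0:ℝ), A (Prod.swap (θ, r))
        = ∫ θ in Set.Ioo (-π) π, - f 0 := by
      refine setIntegral_congr_fun measurableSet_Ioo fun θ hθ => ?_
      simpa using this θ hθ
    rw [h2]
    simp [Real.pi_pos.le]
    left; norm_cast; ring
  have hBint : ∫ p in Set.Ioi (0:ℝ) ×ˢ Set.Ioo (-π) π, B p ∂(volume.prod volume) = 0 := by
    rw [setIntegral_prod _ hBi]
    rw [setIntegral_congr_fun (g := fun _ => 0) measurableSet_Ioi]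
    · simp
    intro r hr
    have hr : 0 < r := hr
    have hder : ∀ θ : ℝ, HasDerivAt (fun θ : ℝ => f (r * e θ)) (r • B (r, θ)) θ := by
      intro θ
      have h0 : HasDerivAt (fun θ : ℝ => (θ : ℂ) * Complex.I) Complex.I θ := by
        simpa using (Complex.ofRealCLM.hasDerivAt (x := θ)).mul_const Complex.I
      have h1 : HasDerivAt (fun θ : ℝ => (r : ℂ) * e θ) (r * (e θ * Complex.I)) θ :=
        (h0.cexp).const_mul _
      have := (hfd _).hasFDerivAt.comp_hasDerivAt θ h1
      have h2 : r • B (r, θ) = fderiv ℝ f (r * e θ) (r * (e θ * Complex.I)) := by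
        simp only [hB]
        rw [← map_smul]
        congr 1
        simp only [Complex.real_smul]; ring
      rw [h2]
      exact this
    have h3 := intervalIntegral.integral_eq_sub_of_hasDerivAt (a := -π) (b := π) (fun θ _ => hder θ)
      (((hBc.comp (Continuous.prodMk_right r)).const_smul r).intervalIntegrable _ _)
    have h4 : e π = e (-π) := by
      simp [he, Complex.exp_pi_mul_I, Complex.exp_neg]
    rw [h4, sub_self, intervalIntegral.integral_smul,
      intervalIntegral.integral_of_le (by linarith [Real.pi_pos]),
      integral_Ioc_eq_integral_Ioo] at h3
    simpa [hr.ne'] using h3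
  rw [← Complex.integral_comp_polarCoord_symm, polarCoord_target]
  have : ∫ p in Set.Ioi (0:ℝ) ×ˢ Set.Ioo (-π) π,
      p.1 • (dbar f (Complex.polarCoord.symm p) / Complex.polarCoord.symm p)
      = ∫ p in Set.Ioi (0:ℝ) ×ˢ Set.Ioo (-π) π, (A p + Complex.I * B p) / 2 := by
    refine setIntegral_congr_fun (measurableSet_Ioi.prod measurableSet_Ioo) ?_
    rintro ⟨r, θ⟩ ⟨hr, _⟩
    have hr : 0 < r := hr
    have hpe : Complex.polarCoord.symm (r, θ) = r * e θ := by
      rw [Complex.polarCoord_symm_apply]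
      simp [he, Complex.exp_mul_I]
    simp only [hpe, hA, hB]
    set T := fderiv ℝ f (r * e θ) with hT
    have hlin : ∀ w : ℂ, T w = w.re • T 1 + w.im • T Complex.I := by
      intro w
      rw [← map_smul, ← map_smul, ← map_add]
      congr 1
      simp
    have hne : e θ ≠ 0 := Complex.exp_ne_zero _
    rw [hlin (e θ), hlin (Complex.I * e θ)]
    simp only [dbar, ← hT]
    have hcs : e θ = (e θ).re + (e θ).im * Complex.I := (Complex.re_add_im _).symm
    have hsq : ((e θ).re : ℂ) ^ 2 + ((e θ).im : ℂ) ^ 2 = 1 := by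
      have h := Complex.normSq_apply (e θ)
      rw [Complex.normSq_eq_norm_sq, hen] at h
      have : (e θ).re ^ 2 + (e θ).im ^ 2 = 1 := by nlinarith
      exact_mod_cast this
    have hr' : (r : ℂ) ≠ 0 := by exact_mod_cast hr.ne'
    simp only [Complex.real_smul, Complex.mul_re, Complex.mul_im, Complex.I_re, Complex.I_im,
      zero_mul, one_mul, zero_sub, zero_add]
    rw [mul_div_assoc', div_eq_div_iff (by simp [hr', hne]) two_ne_zero]
    push_cast
    set c : ℂ := ((e θ).re : ℂ)
    set s : ℂ := ((e θ).im : ℂ)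
    rw [hcs]
    have hI := Complex.I_sq
    linear_combination (-(r : ℂ) * (T 1 + Complex.I * T Complex.I)) * hsq - (r * (T 1 * c * s * 0 - s ^2 * T 1 + Complex.I * T Complex.I * (-s^2) + 0)) * hI -
      (r * s ^ 2 * Complex.I * T Complex.I + r * c * s * T Complex.I) * hI
  rw [this, integral_div]
  rw [show (volume : Measure (ℝ × ℝ)) = volume.prod volume from rfl]
  rw [integral_add hAi (hBi.const_mul _), integral_const_mul, hAint, hBint]
  ring

theorem integral_dbar_div_sub {f : ℂ → ℂ} (hf : ContDiff ℝ 1 f) (hc : HasCompactSupport f) (ξ : ℂ) :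
    ∫ z, dbar f z / (ξ - z) = π * f ξ := by
  have h1 : ContDiff ℝ 1 fun z => f (z + ξ) := hf.comp (contDiff_id.add contDiff_const)
  have h2 : HasCompactSupport fun z => f (z + ξ) :=
    hc.comp_homeomorph (Homeomorph.addRight ξ)
  have h3 := integral_dbar_div_self h1 h2
  have h4 : ∀ z, dbar (fun z => f (z + ξ)) z = dbar f (z + ξ) := by
    intro z
    simp only [dbar, fderiv_comp_add_right]
  rw [← integral_add_right_eq_self _ ξ]
  simp only [h4, zero_add] at h3
  have h5 : ∀ z, dbar f (z + ξ) / (ξ - (z + ξ)) = - (dbar f (z + ξ) / z) := by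
    intro z
    rw [← div_neg]
    congr 1
    ring
  simp only [h5, integral_neg, h3]
  ring

theorem continuous_mul_of_tsupport_subset {X : Type*} [TopologicalSpace X] {R : Type*}
    [TopologicalSpace R] [MulZeroClass R] [ContinuousMul R] {g f : X → R} {W : Set X}
    (hW : IsOpen W) (hg : Continuous g) (hs : tsupport g ⊆ W) (hf : ContinuousOn f W) :
    Continuous fun z => g z * f z := by
  refine continuous_iff_continuousAt.2 fun z => ?_
  by_cases hz : z ∈ tsupport g
  · exact hg.continuousAt.mul (hf.continuousAt (hW.mem_nhds (hs hz)))
  · have : (fun z => g z * f z) =ᶠ[nhds z] fun _ => 0 := by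
      filter_upwards [(isClosed_tsupport g).isOpen_compl.mem_nhds hz] with y hy
      rw [image_eq_zero_of_notMem_tsupport hy, zero_mul]
    exact continuousAt_const.congr this.symm

theorem integrable_mul_of_tsupport_subset {g f : ℂ → ℝ} {W : Set ℂ}
    (hW : IsOpen W) (hg : Continuous g) (hc : HasCompactSupport g) (hs : tsupport g ⊆ W)
    (hf : ContinuousOn f W) : Integrable fun z => g z * f z :=
  (continuous_mul_of_tsupport_subset hW hg hs hf).integrable_of_hasCompactSupport hc.mul_right

theorem ContDiffOn.continuousOn_fderiv_apply {f : ℂ → ℝ} {W : Set ℂ} (hW : IsOpen W)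
    (hf : ContDiffOn ℝ 2 f W) (v : ℂ) : ContDiffOn ℝ 1 (fun y => fderiv ℝ f y v) W :=
  (hf.fderiv_of_isOpen hW (by norm_num)).clm_apply contDiffOn_const

theorem continuousOn_lapC {f : ℂ → ℝ} {W : Set ℂ} (hW : IsOpen W)
    (hf : ContDiffOn ℝ 2 f W) : ContinuousOn (lapC f) W := by
  have h := fun v : ℂ => ((hf.continuousOn_fderiv_apply hW v).continuousOn_fderiv_of_isOpen hW
    le_rfl).clm_apply (continuousOn_const (c := v))
  exact (h 1).add (h Complex.I)

theorem integral_mul_lapC {g f : ℂ → ℝ} {W : Set ℂ} (hW : IsOpen W) (hg : ContDiff ℝ 1 g)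
    (hc : HasCompactSupport g) (hs : tsupport g ⊆ W) (hf : ContDiffOn ℝ 2 f W) :
    ∫ z, g z * lapC f z = - ∫ z, (fderiv ℝ g z 1 * fderiv ℝ f z 1 +
      fderiv ℝ g z Complex.I * fderiv ℝ f z Complex.I) := by
  have hX := hf.continuousOn_fderiv_apply hW
  have hgi : ∀ v : ℂ, Integrable fun z => fderiv ℝ g z v * fderiv ℝ f z v := fun v =>
    integrable_mul_of_tsupport_subset hW
      ((hg.continuous_fderiv one_ne_zero).clm_apply continuous_const) (hc.fderiv_apply ℝ v)
      ((tsupport_fderiv_apply_subset ℝ v).trans hs) (hX v).continuousOn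
  have hfi : ∀ v : ℂ, Integrable fun z => g z * fderiv ℝ (fun y => fderiv ℝ f y v) z v := fun v =>
    integrable_mul_of_tsupport_subset hW hg.continuous hc hs
      (((hX v).continuousOn_fderiv_of_isOpen hW le_rfl).clm_apply continuousOn_const)
  have key : ∀ v : ℂ, ∫ z, g z * fderiv ℝ (fun y => fderiv ℝ f y v) z v
      = - ∫ z, fderiv ℝ g z v * fderiv ℝ f z v := fun v =>
    integral_mul_fderiv_eq_neg_fderiv_mul_of_integrable (hgi v) (hfi v)
      (integrable_mul_of_tsupport_subset hW hg.continuous hc hs (hX v).continuousOn)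
      (fun x _ => hg.differentiable one_ne_zero x)
      (fun x hx => ((hX v).differentiableOn one_ne_zero).differentiableAt (hW.mem_nhds (hs hx)))
  simp only [lapC, mul_add]
  rw [integral_add (hfi _) (hfi _), integral_add (hgi _) (hgi _), key, key]
  ring

theorem exists_smooth_cutoff {K U : Set ℂ} (hK : IsCompact K) (hU : IsOpen U) (hKU : K ⊆ U) :
    ∃ χ : ℂ → ℝ, ContDiff ℝ ∞ χ ∧ HasCompactSupport χ ∧ tsupport χ ⊆ U ∧
      (∃ V, IsOpen V ∧ K ⊆ V ∧ ∀ x ∈ V, χ x = 1) ∧ ∀ x, 0 ≤ χ x ∧ χ x ≤ 1 := by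
  obtain ⟨L, hL, hKL, hLU⟩ := exists_compact_between hK hU hKU
  obtain ⟨f, h1, h2, h3⟩ := exists_contMDiffMap_one_nhds_of_subset_interior
    (modelWithCornersSelf ℝ ℂ) (n := ⊤) hK.isClosed hKL
  have hs : tsupport (f : ℂ → ℝ) ⊆ L :=
    closure_minimal (fun x hx => by contrapose! hx; simp [h2 x hx]) hL.isClosed
  obtain ⟨V, hV, hKV, hV1⟩ := eventually_nhdsSet_iff_exists.1 h1
  exact ⟨f, contMDiff_iff_contDiff.1 f.contMDiff, hL.of_isClosed_subset (isClosed_tsupport _) hs,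
    hs.trans hLU, ⟨V, hV, hKV, hV1⟩, h3⟩

theorem lintegral_ofReal_sub_mul_Ioi {s : ℝ} (hs : 0 < s) (c : ℝ) :
    ∫⁻ r in Set.Ioi (0 : ℝ), ENNReal.ofReal (c - s * r) ≤
      ENNReal.ofReal (max c 0 ^ 2 / (2 * s)) := by
  rcases le_or_gt c 0 with hc | hc
  · rw [setLIntegral_congr_fun (g := fun _ => 0) measurableSet_Ioi]
    · simp
    · intro r hr
      have : 0 < s * r := mul_pos hs hr
      exact ENNReal.ofReal_of_nonpos (by linarith)
  · have h1 : ∫⁻ r in Set.Ioi (0 : ℝ), ENNReal.ofReal (c - s * r) ≤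
        ∫⁻ r in Set.Ioc (0 : ℝ) (c / s), ENNReal.ofReal (c - s * r) := by
      rw [← lintegral_indicator measurableSet_Ioi, ← lintegral_indicator measurableSet_Ioc]
      refine lintegral_mono fun r => ?_
      by_cases hr : r ∈ Set.Ioi (0 : ℝ)
      · by_cases hr2 : r ≤ c / s
        · simp [Set.indicator, hr, hr2, show 0 < r from hr]
        · have : c < r * s := (div_lt_iff₀ hs).1 (not_le.1 hr2)
          rw [Set.indicator_of_mem hr, ENNReal.ofReal_of_nonpos (by linarith)]
          exact zero_le
      · rw [Set.indicator_of_notMem hr]; exact zero_le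
    refine h1.trans ?_
    rw [← ofReal_integral_eq_lintegral_ofReal]
    · rw [← intervalIntegral.integral_of_le (by positivity)]
      apply le_of_eq
      congr 1
      rw [intervalIntegral.integral_sub (by simp) ((continuous_const_mul s).intervalIntegrable _ _), intervalIntegral.integral_const_mul]
      simp [max_eq_left hc.le]
      field_simp; ring
    · exact (Continuous.integrableOn_Ioc (by fun_prop))
    · refine (ae_restrict_iff' measurableSet_Ioc).2 (Filter.Eventually.of_forall fun r hr => ?_)
      have := (le_div_iff₀ hs).1 hr.2
      simp only [Pi.zero_apply]; linarith

theorem lintegral_ofReal_re_inv_sub {s : ℝ} (hs : 0 < s) :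
    ∫⁻ z : ℂ, ENNReal.ofReal ((z⁻¹).re - s) ≤ ENNReal.ofReal (π / (4 * s)) := by
  rw [← Complex.lintegral_comp_polarCoord_symm]
  have h1 : ∀ p ∈ polarCoord.target,
      ENNReal.ofReal p.1 • ENNReal.ofReal (((Complex.polarCoord.symm p)⁻¹).re - s)
      = ENNReal.ofReal (Real.cos p.2 - s * p.1) := by
    rintro ⟨r, θ⟩ ⟨hr, -⟩
    have hr : 0 < r := hr
    have hn : Complex.normSq (Complex.polarCoord.symm (r, θ)) = r ^ 2 := by
      rw [Complex.normSq_eq_norm_sq, Complex.norm_polarCoord_symm, sq_abs]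
    have hre : (Complex.polarCoord.symm (r, θ)).re = r * Real.cos θ := by
      simp [Complex.polarCoord_symm_apply, Complex.cos_ofReal_re]
    rw [smul_eq_mul, ← ENNReal.ofReal_mul hr.le]
    congr 1
    rw [Complex.inv_re, hn, hre]
    field_simp
  rw [setLIntegral_congr_fun polarCoord.open_target.measurableSet h1, polarCoord_target,
    Measure.volume_eq_prod, ← Measure.prod_restrict,
    lintegral_prod_symm' _ (by fun_prop)]
  have h2 : ∀ θ : ℝ, ∫⁻ r in Set.Ioi (0 : ℝ), ENNReal.ofReal (Real.cos θ - s * r) ≤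
      ENNReal.ofReal (max (Real.cos θ) 0 ^ 2 / (2 * s)) := fun θ =>
    lintegral_ofReal_sub_mul_Ioi hs _
  refine (lintegral_mono fun θ => h2 θ).trans ?_
  have h3 : ∫⁻ θ in Set.Ioo (-π) π, ENNReal.ofReal (max (Real.cos θ) 0 ^ 2 / (2 * s)) ≤
      ∫⁻ θ in Set.Ioc (-(π / 2)) (π / 2), ENNReal.ofReal (Real.cos θ ^ 2 / (2 * s)) := by
    rw [← lintegral_indicator measurableSet_Ioo, ← lintegral_indicator measurableSet_Ioc]
    refine lintegral_mono fun θ => ?_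
    by_cases hθ : θ ∈ Set.Ioo (-π) π
    · rw [Set.indicator_of_mem hθ]
      by_cases h : θ ∈ Set.Ioc (-(π / 2)) (π / 2)
      · rw [Set.indicator_of_mem h, max_eq_left (Real.cos_nonneg_of_mem_Icc ⟨h.1.le, h.2⟩)]
      · have : Real.cos θ ≤ 0 := by
          rcases lt_or_ge (π / 2) θ with h4 | h4
          · exact Real.cos_nonpos_of_pi_div_two_le_of_le h4.le (by linarith [hθ.2, pi_pos])
          · have h5 : θ ≤ -(π / 2) := by
              by_contra! h5
              exact h ⟨h5, h4⟩
            rw [← Real.cos_neg]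
            exact Real.cos_nonpos_of_pi_div_two_le_of_le (by linarith) (by linarith [hθ.1, pi_pos])
        rw [max_eq_right this]; simp
    · rw [Set.indicator_of_notMem hθ]; exact zero_le
  refine h3.trans ?_
  rw [← ofReal_integral_eq_lintegral_ofReal
    (Continuous.integrableOn_Ioc (by fun_prop)) (Filter.Eventually.of_forall fun θ => by
      simp only [Pi.zero_apply]; positivity),
    ← intervalIntegral.integral_of_le (by linarith [pi_pos])]
  apply ENNReal.ofReal_le_ofReal
  rw [intervalIntegral.integral_div, integral_cos_sq]
  simp
  field_simp
  norm_num

theorem locallyIntegrable_inv : LocallyIntegrable (fun z : ℂ => z⁻¹) := by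
  refine locallyIntegrable_of_norm_le_rpow (C := 1) (α := 1) (by simp) (by simp) ?_
    (by fun_prop)
  refine Filter.Eventually.of_forall fun z => ?_
  rw [norm_inv, Real.rpow_neg_one, one_mul]

theorem integrable_mul_inv_of_compact {χ : ℂ → ℂ} (hχ : Continuous χ) (hc : HasCompactSupport χ) :
    Integrable fun z => z⁻¹ * χ z := by
  have := locallyIntegrable_inv.integrable_smul_right_of_hasCompactSupport hχ hc
  simpa [smul_eq_mul, mul_comm] using this

theorem exists_dbar_eq_norm_le {χ : ℂ → ℝ} (hχ : ContDiff ℝ ∞ χ) (hc : HasCompactSupport χ)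
    (h01 : ∀ x, 0 ≤ χ x ∧ χ x ≤ 1) :
    ∃ c : ℂ → ℂ, ContDiff ℝ 1 c ∧ (∀ ξ, dbar c ξ = χ ξ) ∧
      ∀ ξ, ‖c ξ‖ ≤ √((∫ x, χ x) / π) := by
  set g : ℂ → ℂ := fun x => (χ x : ℂ) with hg
  have hgd : ContDiff ℝ 1 g := (Complex.ofRealCLM.contDiff.comp hχ).of_le (by simp)
  have hgc : HasCompactSupport g := hc.comp_left (g := fun r : ℝ => (r : ℂ)) (by simp)
  set L := ContinuousLinearMap.mul ℝ ℂ with hL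
  set c0 : ℂ → ℂ := convolution (fun z : ℂ => z⁻¹) g L volume with hc0
  have hc0v : ∀ ξ, c0 ξ = ∫ z, z⁻¹ * g (ξ - z) := fun ξ => rfl
  have hint : ∀ (h : ℂ → ℂ), Continuous h → HasCompactSupport h → ∀ ξ,
      Integrable fun z => z⁻¹ * h (ξ - z) := fun h hh hhc ξ =>
    integrable_mul_inv_of_compact (hh.comp (by fun_prop))
      (hhc.comp_homeomorph (Homeomorph.subLeft ξ))
  have hdfd : ∀ ξ v, fderiv ℝ c0 ξ v = ∫ z, z⁻¹ * fderiv ℝ g (ξ - z) v := by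
    intro ξ v
    rw [(hgc.hasFDerivAt_convolution_right L locallyIntegrable_inv hgd ξ).fderiv,
      convolution_precompR_apply L locallyIntegrable_inv (hgc.fderiv ℝ)
        (hgd.continuous_fderiv one_ne_zero)]
    rfl
  have hdb : ∀ ξ, dbar c0 ξ = π * g ξ := by
    intro ξ
    have hi : ∀ v : ℂ, Integrable fun z => z⁻¹ * fderiv ℝ g (ξ - z) v := fun v =>
      hint _ ((hgd.continuous_fderiv one_ne_zero).clm_apply continuous_const)
        (hgc.fderiv_apply ℝ v) ξ
    rw [← integral_dbar_div_sub hgd hgc ξ, dbar, hdfd, hdfd, ← integral_const_mul,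
      ← integral_add (hi _) ((hi _).const_mul _), ← integral_div,
      ← integral_sub_left_eq_self (fun z => dbar g z / (ξ - z)) volume ξ]
    refine integral_congr_ae (Filter.Eventually.of_forall fun z => ?_)
    simp only [dbar, sub_sub_cancel]
    ring
  have hnorm : ∀ ξ, ‖c0 ξ‖ ^ 2 ≤ π * ∫ x, χ x := by
    intro ξ
    have hm : 0 ≤ ∫ x, χ x := integral_nonneg fun x => (h01 x).1
    rcases eq_or_ne (c0 ξ) 0 with h0 | h0
    · rw [h0]; simp; positivity
    set a := ‖c0 ξ‖ with ha
    have hap : 0 < a := norm_pos_iff.2 h0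
    set e : ℂ := (starRingEnd ℂ) (c0 ξ) / a with he
    have hen : ‖e‖ = 1 := by
      rw [he, norm_div, RCLike.norm_conj, Complex.norm_real, Real.norm_eq_abs, abs_of_pos hap]
      exact div_self hap.ne'
    have hea : e * c0 ξ = a := by
      rw [he, div_mul_eq_mul_div, mul_comm, Complex.mul_conj, Complex.normSq_eq_norm_sq]
      push_cast
      rw [← ha]
      field_simp
    have key : ∀ s : ℝ, 0 < s → a ≤ s * (∫ x, χ x) + π / (4 * s) := by
      intro s hs
      set P : ℂ → ℝ := fun z => max ((e * z⁻¹).re - s) 0 with hP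
      have hPl : ∫⁻ z, ENNReal.ofReal (P z) ≤ ENNReal.ofReal (π / (4 * s)) := by
        refine le_trans (le_of_eq ?_) (lintegral_ofReal_re_inv_sub hs)
        have hcirc : ∃ w : Circle, (w : ℂ) = e :=
          ⟨⟨e, by simp [Submonoid.unitSphere, hen]⟩, rfl⟩
        obtain ⟨w, hw⟩ := hcirc
        rw [← (rotation w).measurePreserving.lintegral_comp (by fun_prop)]
        refine lintegral_congr fun z => ?_
        have he0 : e ≠ 0 := by rintro h; simp [h] at hen
        rw [rotation_apply, hw, hP]
        simp only [mul_inv, mul_inv_cancel_left₀ he0, ENNReal.ofReal_max,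
          ENNReal.ofReal_zero]
        exact max_eq_left (zero_le (a := ENNReal.ofReal _))
      have hP0 : ∀ z, 0 ≤ P z := fun z => le_max_right _ _
      have hPi : Integrable P := by
        refine ⟨by fun_prop, ?_⟩
        rw [hasFiniteIntegral_iff_ofReal (Filter.Eventually.of_forall hP0)]
        exact hPl.trans_lt ENNReal.ofReal_lt_top
      have hPv : ∫ z, P z ≤ π / (4 * s) := by
        rw [integral_eq_lintegral_of_nonneg_ae (Filter.Eventually.of_forall hP0)
          hPi.1]
        exact ENNReal.toReal_le_of_le_ofReal (by positivity) hPl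
      have hχi : Integrable fun z => χ (ξ - z) :=
        (hχ.continuous.comp (by fun_prop)).integrable_of_hasCompactSupport
          (hc.comp_homeomorph (Homeomorph.subLeft ξ))
      have h1 : (a : ℝ) = ∫ z, (e * (z⁻¹ * g (ξ - z))).re := by
        have h2 := integral_re ((hint g hgd.continuous hgc ξ).const_mul e)
        simp only [RCLike.re_to_complex] at h2
        rw [h2, integral_const_mul, ← hc0v, hea]
        simp
      rw [h1]
      calc _ ≤ ∫ z, (s * χ (ξ - z) + P z) := by
            refine integral_mono ?_ ((hχi.const_mul s).add hPi) fun z => ?_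
            · exact ((hint g hgd.continuous hgc ξ).const_mul e).re
            · simp only [hg]
              rw [← mul_assoc, Complex.re_mul_ofReal]
              have h3 := h01 (ξ - z)
              have h4 : (e * z⁻¹).re - s ≤ P z := le_max_left _ _
              have h5 : 0 ≤ P z := le_max_right _ _
              nlinarith
        _ = s * (∫ x, χ x) + ∫ z, P z := by
            rw [integral_add (hχi.const_mul s) hPi, integral_const_mul,
              integral_sub_left_eq_self χ volume ξ]
        _ ≤ _ := by linarith
    have h6 := key (π / (2 * a)) (by positivity)
    have h7 : π / (4 * (π / (2 * a))) = a / 2 := by field_simp; norm_num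
    rw [h7] at h6
    have h8 : a / 2 ≤ π / (2 * a) * ∫ x, χ x := by linarith
    calc a ^ 2 = (2 * a) * (a / 2) := by ring
      _ ≤ (2 * a) * (π / (2 * a) * ∫ x, χ x) := by gcongr
      _ = _ := by field_simp
  refine ⟨fun ξ => (π : ℂ)⁻¹ * c0 ξ, contDiff_const.mul
    (hgc.contDiff_convolution_right (n := 1) L locallyIntegrable_inv hgd), fun ξ => ?_, fun ξ => ?_⟩
  · have h1 : DifferentiableAt ℝ c0 ξ :=
      ((hgc.contDiff_convolution_right (n := 1) L locallyIntegrable_inv hgd).differentiable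
        (by norm_num)) ξ
    have h2 : ∀ v, fderiv ℝ (fun ξ => (π : ℂ)⁻¹ * c0 ξ) ξ v = (π : ℂ)⁻¹ * fderiv ℝ c0 ξ v := by
      intro v
      rw [fderiv_const_mul h1]; simp
    have h3 := hdb ξ
    have hpi : (π : ℂ) ≠ 0 := by exact_mod_cast pi_ne_zero
    rw [dbar] at h3 ⊢
    rw [h2, h2]
    calc _ = (π : ℂ)⁻¹ * ((fderiv ℝ c0 ξ 1 + Complex.I * fderiv ℝ c0 ξ Complex.I) / 2) := by ring
      _ = _ := by rw [h3]; field_simp; rfl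
  · apply Real.le_sqrt_of_sq_le
    rw [norm_mul, mul_pow, norm_inv, Complex.norm_real, Real.norm_eq_abs, abs_of_pos pi_pos]
    calc _ ≤ π⁻¹ ^ 2 * (π * ∫ x, χ x) := by gcongr; exact hnorm ξ
      _ = _ := by field_simp

theorem contDiff_of_forall_mem_tsupport {n : WithTop ℕ∞} {E : Type*} [NormedAddCommGroup E]
    [NormedSpace ℝ E] {f : ℂ → E} (h : ∀ z ∈ tsupport f, ContDiffAt ℝ n f z) : ContDiff ℝ n f := by
  refine contDiff_iff_contDiffAt.2 fun z => ?_
  by_cases hz : z ∈ tsupport f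
  · exact h z hz
  · exact contDiffAt_const.congr_of_eventuallyEq (notMem_tsupport_iff_eventuallyEq.1 hz)

theorem dbar_mul {f g : ℂ → ℂ} {z : ℂ} (hf : DifferentiableAt ℝ f z)
    (hg : DifferentiableAt ℝ g z) :
    dbar (fun z => f z * g z) z = dbar f z * g z + f z * dbar g z := by
  have h : fderiv ℝ (fun z => f z * g z) z = _ := (hf.hasFDerivAt.mul hg.hasFDerivAt).fderiv
  simp only [dbar]
  rw [h]
  simp only [add_apply, smul_apply, smul_eq_mul]
  ring

theorem fderiv_real_apply_of_differentiableAt {f : ℂ → ℂ} {z : ℂ} (hf : DifferentiableAt ℂ f z)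
    (v : ℂ) : fderiv ℝ f z v = deriv f z * v := by
  rw [(hf.hasDerivAt.hasFDerivAt.restrictScalars ℝ).fderiv]
  simp [mul_comm]

theorem dbar_of_differentiableAt {f : ℂ → ℂ} {z : ℂ} (hf : DifferentiableAt ℂ f z) :
    dbar f z = 0 := by
  rw [dbar, fderiv_real_apply_of_differentiableAt hf, fderiv_real_apply_of_differentiableAt hf]
  linear_combination (deriv f z / 2) * Complex.I_mul_I

theorem dbar_comp_of_differentiableAt {c F : ℂ → ℂ} {z : ℂ} (hc : DifferentiableAt ℝ c (F z))
    (hF : DifferentiableAt ℂ F z) :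
    dbar (fun z => c (F z)) z = (starRingEnd ℂ) (deriv F z) * dbar c (F z) := by
  have h : ∀ v : ℂ, fderiv ℝ (fun z => c (F z)) z v = fderiv ℝ c (F z) (deriv F z * v) := by
    intro v
    have h1 := (hc.hasFDerivAt.comp z (hF.restrictScalars ℝ).hasFDerivAt).fderiv
    simp only [Function.comp_def] at h1
    rw [h1, ContinuousLinearMap.comp_apply, fderiv_real_apply_of_differentiableAt hF]
  have h2 : ∀ a : ℂ, fderiv ℝ c (F z) a =
      a.re * fderiv ℝ c (F z) 1 + a.im * fderiv ℝ c (F z) Complex.I := by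
    intro a
    have h3 : a = a.re • (1 : ℂ) + a.im • Complex.I := by
      simp [Complex.re_add_im]
    conv_lhs => rw [h3]
    rw [map_add, map_smul, map_smul]
    simp
  simp only [dbar]
  rw [h, h, h2, h2 (_ * Complex.I)]
  set p := fderiv ℝ c (F z) 1
  set q := fderiv ℝ c (F z) Complex.I
  rw [← Complex.re_add_im (deriv F z)]
  set x := (deriv F z).re
  set y := (deriv F z).im
  simp
  linear_combination ((y * q) / 2 : ℂ) * Complex.I_sq

theorem Filter.EventuallyEq.dbar_eq {f g : ℂ → ℂ} {z : ℂ} (h : f =ᶠ[nhds z] g) :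
    dbar f z = dbar g z := by
  simp only [dbar, h.fderiv_eq]

theorem norm_dbar_ofReal {f : ℂ → ℝ} {z : ℂ} (hf : DifferentiableAt ℝ f z) :
    ‖dbar (fun z => (f z : ℂ)) z‖ = √(gradSq f z) / 2 := by
  have h : ∀ v : ℂ, fderiv ℝ (fun z => (f z : ℂ)) z v = (fderiv ℝ f z v : ℂ) := by
    intro v
    have := (Complex.ofRealCLM.hasFDerivAt.comp z hf.hasFDerivAt).fderiv
    simp only [Function.comp_def, Complex.ofRealCLM_apply] at this
    rw [this]; simp
  rw [dbar, h, h, norm_div, mul_comm Complex.I, Complex.norm_add_mul_I, gradSq]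
  simp

/-- A weighted isoperimetric inequality for the flat metric `|F'|²|dz|²`. -/
theorem sq_integral_mul_normSq_deriv_le {W : Set ℂ} (hW : IsOpen W) {F : ℂ → ℂ}
    (hF : DifferentiableOn ℂ F W) {f : ℂ → ℝ} (hf : ContDiff ℝ 1 f) (hfc : HasCompactSupport f)
    (hfW : tsupport f ⊆ W) :
    4 * π * (∫ z, f z * ‖deriv F z‖ ^ 2) ^ 2 ≤
      (∫ z, √(gradSq f z) * ‖deriv F z‖) ^ 2 * ∫ z in tsupport f, ‖deriv F z‖ ^ 2 := by
  set K := tsupport f with hKdef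
  have hK : IsCompact K := hfc
  have hFd : ∀ z ∈ W, DifferentiableAt ℂ F z := fun z hz => hF.differentiableAt (hW.mem_nhds hz)
  have hF'd : DifferentiableOn ℂ (deriv F) W := hF.deriv hW
  have hF'c : ContinuousOn (deriv F) W := hF'd.continuousOn
  set m := ∫ z in K, ‖deriv F z‖ ^ 2 with hm
  have hm0 : 0 ≤ m := integral_nonneg fun z => by positivity
  set J := ∫ z, √(gradSq f z) * ‖deriv F z‖ with hJ
  have hJ0 : 0 ≤ J := integral_nonneg fun z => by positivity
  have harea : volume (F '' K) ≤ ENNReal.ofReal m := by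
    refine (addHaar_image_le_lintegral_abs_det_fderiv volume hK.measurableSet
      (f' := fun z => ((ContinuousLinearMap.toSpanSingleton ℂ (deriv F z)).restrictScalars ℝ))
      fun z hz => ?_).trans (le_of_eq ?_)
    · exact ((hFd z (hfW hz)).hasDerivAt.hasFDerivAt.restrictScalars ℝ).hasFDerivWithinAt
    · rw [hm, ofReal_integral_eq_lintegral_ofReal]
      · refine lintegral_congr fun z => ?_
        congr 1
        have := LinearMap.det_restrictScalars (R := ℝ) (S := ℂ)
          (f := (ContinuousLinearMap.toSpanSingleton ℂ (deriv F z)).toLinearMap)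
        have h2 : ((ContinuousLinearMap.toSpanSingleton ℂ (deriv F z)).restrictScalars ℝ).det =
            ‖deriv F z‖ ^ 2 := by
          rw [ContinuousLinearMap.det]
          refine Eq.trans rfl (this.trans ?_)
          rw [Algebra.norm_complex_apply, Complex.normSq_eq_norm_sq]
          simp [ContinuousLinearMap.toSpanSingleton]
        rw [h2, abs_of_nonneg (by positivity)]
      · exact ((hF'c.mono hfW).norm.pow 2).integrableOn_compact hK
      · exact Filter.Eventually.of_forall fun z => by simp only [Pi.zero_apply]; positivity
  have hFK : IsCompact (F '' K) := hK.image_of_continuousOn (hF.continuousOn.mono hfW)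
  have key : ∀ M, m < M → 4 * π * (∫ z, f z * ‖deriv F z‖ ^ 2) ^ 2 ≤ J ^ 2 * M := by
    intro M hM
    obtain ⟨U, hFU, hU, hUM⟩ := (F '' K).exists_isOpen_lt_of_lt (ENNReal.ofReal M)
      (harea.trans_lt ((ENNReal.ofReal_lt_ofReal_iff (hm0.trans_lt hM)).2 hM))
    obtain ⟨χ, hχ, hχc, hχU, ⟨V, hV, hKV, hV1⟩, hχ01⟩ := exists_smooth_cutoff hFK hU hFU
    obtain ⟨c, hc1, hcd, hcn⟩ := exists_dbar_eq_norm_le hχ hχc hχ01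
    have hχM : ∫ x, χ x ≤ M := by
      have h1 : ∫ x, χ x ≤ ∫ x, U.indicator (fun _ => (1 : ℝ)) x := by
        refine integral_mono (hχ.continuous.integrable_of_hasCompactSupport hχc) ?_ fun x => ?_
        · exact (integrable_indicator_iff hU.measurableSet).2
            (integrableOn_const (hUM.trans ENNReal.ofReal_lt_top).ne)
        · by_cases hx : x ∈ U
          · simp [hx, (hχ01 x).2]
          · simp [hx, image_eq_zero_of_notMem_tsupport fun h => hx (hχU h)]
      refine h1.trans ?_
      rw [integral_indicator_const _ hU.measurableSet, smul_eq_mul, mul_one, measureReal_def]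
      exact ENNReal.toReal_le_of_le_ofReal (hm0.trans hM.le) hUM.le
    have hχ0 : 0 ≤ ∫ x, χ x := integral_nonneg fun x => (hχ01 x).1
    set A := √((∫ x, χ x) / π) with hA
    have hfd : Differentiable ℝ fun z => (f z : ℂ) :=
      (Complex.ofRealCLM.contDiff.comp hf).differentiable one_ne_zero
    set g : ℂ → ℂ := fun z => (f z : ℂ) * (c (F z) * deriv F z) with hg
    have hgs : tsupport g ⊆ K :=
      tsupport_mul_subset_left.trans (closure_mono fun z hz => by
        contrapose! hz; simp [Function.notMem_support.1 hz])
    have hgd : ContDiff ℝ 1 g := by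
      refine contDiff_of_forall_mem_tsupport fun z hz => ?_
      have hzW := hfW (hgs hz)
      have hFa : ContDiffAt ℝ 1 F z :=
        ((hF.contDiffOn hW (n := 1)).contDiffAt (hW.mem_nhds hzW)).restrict_scalars ℝ
      have hFa' : ContDiffAt ℝ 1 (deriv F) z :=
        ((hF'd.contDiffOn hW (n := 1)).contDiffAt (hW.mem_nhds hzW)).restrict_scalars ℝ
      exact (Complex.ofRealCLM.contDiff.comp hf).contDiffAt.mul
        ((hc1.contDiffAt.comp z hFa).mul hFa')
    have hgc : HasCompactSupport g := hK.of_isClosed_subset (isClosed_tsupport _) hgs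
    have hdb : ∀ z, dbar g z = dbar (fun z => (f z : ℂ)) z * (c (F z) * deriv F z) +
        ((f z * ‖deriv F z‖ ^ 2 : ℝ) : ℂ) := by
      intro z
      by_cases hz : z ∈ K
      · have hzW := hfW hz
        have h1 : DifferentiableAt ℝ c (F z) := hc1.differentiable one_ne_zero _
        have h2 : DifferentiableAt ℝ (fun z => c (F z)) z :=
          h1.comp z ((hFd z hzW).restrictScalars ℝ)
        have h3 := hF'd.differentiableAt (hW.mem_nhds hzW)
        rw [hg, dbar_mul (g := fun z => c (F z) * deriv F z) (hfd z)
          (h2.mul (h3.restrictScalars ℝ)),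
          dbar_mul h2 (h3.restrictScalars ℝ), dbar_comp_of_differentiableAt h1 (hFd z hzW),
          dbar_of_differentiableAt h3, hcd, hV1 _ (hKV ⟨z, hz, rfl⟩)]
        have h4 := Complex.conj_mul' (deriv F z)
        push_cast
        linear_combination (f z : ℂ) * h4
      · have h1 : (fun z => (f z : ℂ)) =ᶠ[nhds z] fun _ => 0 := by
          filter_upwards [notMem_tsupport_iff_eventuallyEq.1 hz] with y hy
          simp [hy]
        have h2 : g =ᶠ[nhds z] fun _ => 0 := by
          filter_upwards [h1] with y hy
          simp only [hg, hy, zero_mul]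
        rw [h1.dbar_eq, h2.dbar_eq, image_eq_zero_of_notMem_tsupport hz]
        simp [dbar]
    have hint1 : Integrable fun z => f z * ‖deriv F z‖ ^ 2 :=
      integrable_mul_of_tsupport_subset hW hf.continuous hfc hfW (hF'c.norm.pow 2)
    have hX : ((∫ z, f z * ‖deriv F z‖ ^ 2 : ℝ) : ℂ) =
        - ∫ z, dbar (fun z => (f z : ℂ)) z * (c (F z) * deriv F z) := by
      have h0 := integral_dbar_eq_zero hgd hgc
      have h1 : Integrable fun z => dbar g z :=
        (continuous_dbar hgd).integrable_of_hasCompactSupport hgc.dbar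
      rw [← integral_complex_ofReal, eq_neg_iff_add_eq_zero, add_comm, ← integral_add _ hint1.ofReal, ← h0]
      · exact integral_congr_ae (Filter.Eventually.of_forall fun z => (hdb z).symm)
      · refine (h1.sub hint1.ofReal).congr (Filter.Eventually.of_forall fun z => ?_)
        simp only [Pi.sub_apply, hdb]
        exact add_sub_cancel_right _ _
    have hgr : Integrable fun z => √(gradSq f z) * ‖deriv F z‖ := by
      have hc' : Continuous fun z => √(gradSq f z) := by
        unfold gradSq
        have := hf.continuous_fderiv one_ne_zero
        fun_prop
      have hs : tsupport (fun z => √(gradSq f z)) ⊆ K := by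
        refine closure_minimal (fun z hz => ?_) (isClosed_tsupport _)
        contrapose! hz
        have : fderiv ℝ f z = 0 :=
          image_eq_zero_of_notMem_tsupport fun h => hz (tsupport_fderiv_subset ℝ h)
        simp [gradSq, this]
      exact integrable_mul_of_tsupport_subset hW hc'
        (hK.of_isClosed_subset (isClosed_tsupport _) hs) (hs.trans hfW) hF'c.norm
    have hle : |∫ z, f z * ‖deriv F z‖ ^ 2| ≤ A / 2 * J := by
      rw [← Real.norm_eq_abs, ← Complex.norm_real, hX, norm_neg, hJ, ← integral_const_mul]
      refine norm_integral_le_of_norm_le (hgr.const_mul _) (Filter.Eventually.of_forall fun z => ?_)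
      rw [norm_mul, norm_mul, norm_dbar_ofReal (hf.differentiable one_ne_zero z)]
      calc _ ≤ √(gradSq f z) / 2 * (A * ‖deriv F z‖) := by gcongr; exact hcn _
        _ = _ := by ring
    calc 4 * π * (∫ z, f z * ‖deriv F z‖ ^ 2) ^ 2
        = 4 * π * |∫ z, f z * ‖deriv F z‖ ^ 2| ^ 2 := by rw [sq_abs]
      _ ≤ 4 * π * (A / 2 * J) ^ 2 := by gcongr
      _ = J ^ 2 * (π * A ^ 2) := by ring
      _ ≤ J ^ 2 * M := by
          gcongr
          rw [hA, Real.sq_sqrt (by positivity)]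
          field_simp
          exact hχM
  refine ge_of_tendsto (x := nhdsWithin m (Set.Ioi m)) (f := fun M => J ^ 2 * M) ?_ ?_
  · exact tendsto_nhdsWithin_of_tendsto_nhds ((continuous_const_mul _).tendsto m)
  · filter_upwards [self_mem_nhdsWithin] with M hM using key M hM

open Filter Topology in
theorem exists_abs_deriv_smoothTransition_le : ∃ C : ℝ, 0 ≤ C ∧ ∀ x, |deriv smoothTransition x| ≤ C := by
  have hc : Continuous (deriv smoothTransition) :=
    (smoothTransition.contDiff (n := 1)).continuous_deriv le_rfl
  obtain ⟨C, hC⟩ := isCompact_Icc.exists_bound_of_continuousOn (s := Set.Icc (0 : ℝ) 1) hc.continuousOn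
  have h0 : ∀ x, x < 0 → deriv smoothTransition x = 0 := fun x hx => by
    have : smoothTransition =ᶠ[𝓝 x] fun _ => 0 := by
      filter_upwards [Iio_mem_nhds hx] with y hy using smoothTransition.zero_of_nonpos (le_of_lt hy)
    rw [this.deriv_eq, deriv_const]
  have h1 : ∀ x, 1 < x → deriv smoothTransition x = 0 := fun x hx => by
    have : smoothTransition =ᶠ[𝓝 x] fun _ => 1 := by
      filter_upwards [Ioi_mem_nhds hx] with y hy using smoothTransition.one_of_one_le (le_of_lt hy)
    rw [this.deriv_eq, deriv_const]
  refine ⟨|C|, abs_nonneg _, fun x => ?_⟩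
  rcases lt_or_ge x 0 with h | h
  · simp [h0 x h]
  rcases lt_or_ge 1 x with h' | h'
  · simp [h1 x h']
  · exact (hC x ⟨h, h'⟩).trans (le_abs_self C)

theorem deriv_smoothTransition_nonneg (x : ℝ) : 0 ≤ deriv smoothTransition x :=
  smoothTransition.monotone.deriv_nonneg

open Filter Topology in
theorem deriv_smoothTransition_eq_zero {x : ℝ} (hx : x < 0 ∨ 1 < x) : deriv smoothTransition x = 0 := by
  rcases hx with hx | hx
  · have : smoothTransition =ᶠ[𝓝 x] fun _ => 0 := by
      filter_upwards [Iio_mem_nhds hx] with y hy using smoothTransition.zero_of_nonpos (le_of_lt hy)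
    rw [this.deriv_eq, deriv_const]
  · have : smoothTransition =ᶠ[𝓝 x] fun _ => 1 := by
      filter_upwards [Ioi_mem_nhds hx] with y hy using smoothTransition.one_of_one_le (le_of_lt hy)
    rw [this.deriv_eq, deriv_const]

section Levels
variable {Ω : Type*} [MeasurableSpace Ω]

/-- The smoothed distribution function `∫ θ((w - t)/ε) g dν` of `w`. -/
noncomputable def smoothDist (ν : Measure Ω) (w g : Ω → ℝ) (ε t : ℝ) : ℝ :=
  ∫ z, smoothTransition ((w z - t) / ε) * g z ∂ν

/-- Minus the `t`-derivative of `smoothDist`. -/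
noncomputable def smoothDens (ν : Measure Ω) (w g : Ω → ℝ) (ε t : ℝ) : ℝ :=
  ∫ z, deriv smoothTransition ((w z - t) / ε) / ε * g z ∂ν

variable {ν : Measure Ω} {w g : Ω → ℝ}

theorem integrable_smoothTransition_mul (hw : Measurable w) (hg : Integrable g ν) (ε t : ℝ) :
    Integrable (fun z => smoothTransition ((w z - t) / ε) * g z) ν := by
  refine hg.bdd_mul (c := 1) ?_ ?_
  · exact (smoothTransition.continuous.measurable.comp ((hw.sub_const t).div_const ε)).aestronglyMeasurable
  · exact Filter.Eventually.of_forall fun z => by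
      rw [norm_eq_abs, abs_of_nonneg (smoothTransition.nonneg _)]; exact smoothTransition.le_one _

theorem measurable_deriv_smoothTransition_comp (hw : Measurable w) (ε t : ℝ) :
    Measurable fun z => deriv smoothTransition ((w z - t) / ε) / ε :=
  ((measurable_deriv _).comp ((hw.sub_const t).div_const ε)).div_const ε

theorem integrable_deriv_smoothTransition_mul (hw : Measurable w) (hg : Integrable g ν) (ε t : ℝ) :
    Integrable (fun z => deriv smoothTransition ((w z - t) / ε) / ε * g z) ν := by
  obtain ⟨C, hC0, hC⟩ := exists_abs_deriv_smoothTransition_le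
  refine hg.bdd_mul (c := C / |ε|) (measurable_deriv_smoothTransition_comp hw ε t).aestronglyMeasurable ?_
  exact Filter.Eventually.of_forall fun z => by
    rw [norm_eq_abs, abs_div]; gcongr; exact hC _

theorem hasDerivAt_smoothDist (hw : Measurable w) (hg : Integrable g ν) {ε : ℝ} (t : ℝ) :
    HasDerivAt (smoothDist ν w g ε) (-smoothDens ν w g ε t) t := by
  obtain ⟨C, hC0, hC⟩ := exists_abs_deriv_smoothTransition_le
  have := (hasDerivAt_integral_of_dominated_loc_of_deriv_le (μ := ν) (x₀ := t) (s := Set.univ)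
    (F := fun t z => smoothTransition ((w z - t) / ε) * g z)
    (F' := fun t z => -(deriv smoothTransition ((w z - t) / ε) / ε * g z))
    (bound := fun z => C / |ε| * ‖g z‖) Filter.univ_mem
    (Filter.Eventually.of_forall fun s => (integrable_smoothTransition_mul hw hg ε s).aestronglyMeasurable)
    (integrable_smoothTransition_mul hw hg ε t)
    (integrable_deriv_smoothTransition_mul hw hg ε t).neg.aestronglyMeasurable
    (Filter.Eventually.of_forall fun z s _ => by
      rw [norm_neg, norm_mul, norm_eq_abs, abs_div]; gcongr; exact hC _)
    (hg.norm.const_mul _) (Filter.Eventually.of_forall fun z s _ => ?_)).2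
  · rw [integral_neg] at this
    exact this
  · have h1 : HasDerivAt (fun s => (w z - s) / ε) (-1 / ε) s :=
      ((hasDerivAt_id s).const_sub (w z)).div_const ε
    have h2 := ((smoothTransition.contDiff (n := 1)).differentiable one_ne_zero
      ((w z - s) / ε)).hasDerivAt.comp s h1
    refine (h2.mul_const (g z)).congr_deriv ?_
    ring

theorem continuous_smoothDens (hw : Measurable w) (hg : Integrable g ν) {ε : ℝ} :
    Continuous (smoothDens ν w g ε) := by
  obtain ⟨C, hC0, hC⟩ := exists_abs_deriv_smoothTransition_le
  have hc : Continuous (deriv smoothTransition) :=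
    (smoothTransition.contDiff (n := 1)).continuous_deriv le_rfl
  refine continuous_of_dominated (bound := fun z => C / |ε| * ‖g z‖)
    (fun s => (integrable_deriv_smoothTransition_mul hw hg ε s).aestronglyMeasurable)
    (fun s => Filter.Eventually.of_forall fun z => by
      rw [norm_mul, norm_eq_abs, abs_div]; gcongr; exact hC _)
    (hg.norm.const_mul _) (Filter.Eventually.of_forall fun z => by fun_prop)

open Filter Topology in
theorem tendsto_smoothDist (hw : Measurable w) (hg : Integrable g ν) (t : ℝ) :
    Tendsto (fun ε => smoothDist ν w g ε t) (𝓝[>] 0) (𝓝 (∫ z in {z | t < w z}, g z ∂ν)) := by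
  have hm : MeasurableSet {z | t < w z} := measurableSet_lt measurable_const hw
  rw [← integral_indicator hm]
  refine tendsto_integral_filter_of_dominated_convergence (fun z => ‖g z‖)
    (Eventually.of_forall fun ε => (integrable_smoothTransition_mul hw hg ε t).aestronglyMeasurable)
    (Eventually.of_forall fun ε => Eventually.of_forall fun z => ?_) hg.norm
    (Eventually.of_forall fun z => ?_)
  · rw [norm_mul, norm_eq_abs, abs_of_nonneg (smoothTransition.nonneg _)]
    exact mul_le_of_le_one_left (norm_nonneg _) (smoothTransition.le_one _)
  · by_cases hz : t < w z
    · rw [Set.indicator_of_mem (s := {z | t < w z}) hz]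
      refine tendsto_const_nhds.congr' ?_
      filter_upwards [Ioo_mem_nhdsGT (sub_pos.2 hz)] with ε hε
      rw [smoothTransition.one_of_one_le, one_mul]
      rw [one_le_div hε.1]; exact hε.2.le
    · rw [Set.indicator_of_notMem (s := {z | t < w z}) hz]
      refine tendsto_const_nhds.congr' ?_
      filter_upwards [self_mem_nhdsWithin] with ε hε
      rw [smoothTransition.zero_of_nonpos, zero_mul]
      exact div_nonpos_of_nonpos_of_nonneg (by linarith) (le_of_lt hε)

theorem smoothDist_nonneg (hg : 0 ≤ g) (ε t : ℝ) : 0 ≤ smoothDist ν w g ε t :=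
  integral_nonneg fun z => mul_nonneg (smoothTransition.nonneg _) (hg z)

theorem smoothDens_nonneg (hg : 0 ≤ g) {ε : ℝ} (hε : 0 ≤ ε) (t : ℝ) : 0 ≤ smoothDens ν w g ε t :=
  integral_nonneg fun z => mul_nonneg (div_nonneg (deriv_smoothTransition_nonneg _) hε) (hg z)

theorem smoothDist_eq_zero {T : ℝ} (hT : ∀ z, w z ≤ T) {ε : ℝ} (hε : 0 ≤ ε) :
    smoothDist ν w g ε T = 0 := by
  refine integral_eq_zero_of_ae (Filter.Eventually.of_forall fun z => ?_)
  simp only [Pi.zero_apply]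
  rw [smoothTransition.zero_of_nonpos (div_nonpos_of_nonpos_of_nonneg (by linarith [hT z]) hε), zero_mul]

theorem smoothDens_le_smoothDens [IsFiniteMeasure ν] (hw : Measurable w)
    {h : Ω → ℝ} (hh : Integrable h ν) (hg : Integrable g ν) {ε t : ℝ} (hε : 0 < ε)
    (hgh : ∀ z, t ≤ w z → w z ≤ t + ε → g z ≤ h z) :
    smoothDens ν w g ε t ≤ smoothDens ν w h ε t := by
  refine integral_mono (integrable_deriv_smoothTransition_mul hw hg ε t)
    (integrable_deriv_smoothTransition_mul hw hh ε t) fun z => ?_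
  simp only
  by_cases hz : t ≤ w z ∧ w z ≤ t + ε
  · exact mul_le_mul_of_nonneg_left (hgh z hz.1 hz.2)
      (div_nonneg (deriv_smoothTransition_nonneg _) hε.le)
  · rw [deriv_smoothTransition_eq_zero]
    · simp
    · rw [div_lt_iff₀ hε, lt_div_iff₀ hε]
      by_contra! hcon
      exact hz ⟨by linarith, by linarith⟩


open Filter Topology in
theorem le_of_smoothDist_ineq [IsFiniteMeasure ν] (hw : Measurable w) {t₀ T : ℝ}
    (htT : t₀ ≤ T) (hT : ∀ z, w z ≤ T) (h0 : ∀ z, 0 ≤ w z) {lam mu kap : ℝ}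
    (hmu : 0 ≤ mu) (hml : mu ≤ lam)
    (H : ∀ t ∈ Set.Ioo t₀ T, ν {z | w z = t} = 0 → ∀ δ > 0, ∀ᶠ ε in 𝓝[>] (0 : ℝ),
      4 * π * ν.real {z | t < w z} - kap * ν.real {z | t < w z} ^ 2 - δ ≤
        (lam * smoothDist ν w (fun z => exp (2 * w z)) ε t - mu * smoothDist ν w (fun _ => 1) ε t) *
          smoothDens ν w (fun _ => 1) ε t) :
    4 * π * ((∫ z in {z | t₀ < w z}, exp (2 * w z) ∂ν) - exp (2 * t₀) * ν.real {z | t₀ < w z}) ≤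
      lam * (∫ z in {z | t₀ < w z}, exp (2 * w z) ∂ν) ^ 2 -
        mu * exp (2 * t₀) * ν.real {z | t₀ < w z} ^ 2 -
        (mu - kap) * ∫ t in t₀..T, 2 * exp (2 * t) * ν.real {z | t < w z} ^ 2 := by
  set E : Ω → ℝ := fun z => exp (2 * w z) with hE
  set A : ℝ → ℝ := fun t => ν.real {z | t < w z} with hA
  set Ψ : ℝ → ℝ := fun t => 4 * π * A t - kap * A t ^ 2 with hΨ
  set a := smoothDist ν w (fun _ => 1) with ha
  set b := smoothDist ν w E with hb
  set N := smoothDens ν w (fun _ => 1) with hN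
  set M := smoothDens ν w E with hM
  have hE1 : Integrable E ν := by
    refine Integrable.of_bound (C := exp (2 * T)) (by fun_prop) (Eventually.of_forall fun z => ?_)
    rw [norm_eq_abs, abs_of_pos (exp_pos _)]; exact exp_le_exp.2 (by linarith [hT z])
  have h1 : Integrable (fun _ : Ω => (1 : ℝ)) ν := integrable_const _
  have hmul : ∀ c, Integrable (fun _ : Ω => (c : ℝ)) ν := fun c => integrable_const _
  have hc : ∀ c ε t, smoothDens ν w (fun _ => c) ε t = c * N ε t := fun c ε t => by
    rw [hN]; simp only [smoothDens]; rw [← integral_const_mul]; congr 1; ext z; ring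
  have hML : ∀ ε > 0, ∀ t, exp (2 * t) * N ε t ≤ M ε t := fun ε hε t => by
    rw [← hc]
    exact smoothDens_le_smoothDens hw hE1 (hmul _) hε fun z hz _ => exp_le_exp.2 (by linarith)
  have hMU : ∀ ε > 0, ∀ t, M ε t ≤ exp (2 * t + 2 * ε) * N ε t := fun ε hε t => by
    rw [← hc]
    exact smoothDens_le_smoothDens hw (hmul _) hE1 hε fun z _ hz => exp_le_exp.2 (by linarith)
  have hN0 : ∀ ε > 0, ∀ t, 0 ≤ N ε t := fun ε hε t =>
    smoothDens_nonneg (fun _ => zero_le_one) (le_of_lt hε) t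
  have ha0 : ∀ ε t, 0 ≤ a ε t := fun ε t => smoothDist_nonneg (fun _ => zero_le_one) ε t
  have hb0 : ∀ ε t, 0 ≤ b ε t := fun ε t => smoothDist_nonneg (fun _ => (exp_pos _).le) ε t
  have hab : ∀ ε t, a ε t ≤ b ε t := fun ε t =>
    integral_mono (integrable_smoothTransition_mul hw h1 ε t)
      (integrable_smoothTransition_mul hw hE1 ε t) fun z =>
      mul_le_mul_of_nonneg_left (one_le_exp (by linarith [h0 z])) (smoothTransition.nonneg _)
  have hlab : ∀ ε t, 0 ≤ lam * b ε t - mu * a ε t := fun ε t => by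
    nlinarith [hab ε t, ha0 ε t, hb0 ε t]
  have hda : ∀ ε t, HasDerivAt (a ε) (-N ε t) t := fun ε t => hasDerivAt_smoothDist hw h1 t
  have hdb : ∀ ε t, HasDerivAt (b ε) (-M ε t) t := fun ε t => hasDerivAt_smoothDist hw hE1 t
  have hNc : ∀ ε, Continuous (N ε) := fun ε => continuous_smoothDens hw h1
  have hMc : ∀ ε, Continuous (M ε) := fun ε => continuous_smoothDens hw hE1
  have hac : ∀ ε, Continuous (a ε) := fun ε =>
    continuous_iff_continuousAt.2 fun t => (hda ε t).continuousAt
  have hbc : ∀ ε, Continuous (b ε) := fun ε =>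
    continuous_iff_continuousAt.2 fun t => (hdb ε t).continuousAt
  have hexp : ∀ t, HasDerivAt (fun t => exp (2 * t)) (2 * exp (2 * t)) t := fun t => by
    have := ((hasDerivAt_id t).const_mul 2).exp
    simpa [mul_comm] using this
  have haT : ∀ ε > 0, a ε T = 0 := fun ε hε => smoothDist_eq_zero hT (le_of_lt hε)
  have hbT : ∀ ε > 0, b ε T = 0 := fun ε hε => smoothDist_eq_zero hT (le_of_lt hε)
  have hA0 : ∀ t, 0 ≤ A t := fun t => measureReal_nonneg
  have hA1 : ∀ t, A t ≤ ν.real Set.univ := fun t => measureReal_mono (Set.subset_univ _)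
  have hAm : Measurable A := by
    refine Antitone.measurable fun s t hst => measureReal_mono fun z hz => ?_
    exact lt_of_le_of_lt hst hz
  have hΨm : Measurable Ψ := by fun_prop
  have hΨb : ∀ t, |Ψ t| ≤ 4 * π * ν.real Set.univ + |kap| * ν.real Set.univ ^ 2 := fun t => by
    refine (abs_sub _ _).trans ?_
    rw [abs_of_nonneg (mul_nonneg (show 0 ≤ 4 * π by positivity) (hA0 t)), abs_mul kap,
      abs_of_nonneg (sq_nonneg (A t))]
    gcongr
    · exact hA1 t
    · exact hA1 t
  have hat : ∀ t, Tendsto (fun ε => a ε t) (𝓝[>] 0) (𝓝 (A t)) := fun t => by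
    have := tendsto_smoothDist hw h1 t
    simpa [hA] using this
  have hbt : ∀ t, Tendsto (fun ε => b ε t) (𝓝[>] 0) (𝓝 (∫ z in {z | t < w z}, E z ∂ν)) :=
    fun t => tendsto_smoothDist hw hE1 t
  have haU : ∀ ε t, a ε t ≤ ν.real Set.univ := fun ε t => by
    have : a ε t ≤ ∫ z, (1 : ℝ) ∂ν := integral_mono (integrable_smoothTransition_mul hw h1 ε t) h1
      fun z => by simpa using smoothTransition.le_one _
    simpa using this
  have key : ∀ ε > 0, ∫ t in t₀..T, 2 * exp (2 * t) * min ((lam * b ε t - mu * a ε t) * N ε t) (Ψ t) ≤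
      lam * b ε t₀ ^ 2 - mu * exp (2 * t₀) * a ε t₀ ^ 2 -
        mu * ∫ t in t₀..T, 2 * exp (2 * t) * a ε t ^ 2 := by
    intro ε hε
    have hd : ∀ t, HasDerivAt (fun t => -lam * b ε t ^ 2 + mu * (exp (2 * t) * a ε t ^ 2))
        (2 * lam * b ε t * M ε t + mu * (2 * exp (2 * t) * a ε t ^ 2 - 2 * exp (2 * t) * a ε t * N ε t)) t := by
      intro t
      have := (((hdb ε t).pow 2).const_mul (-lam)).add
        (((hexp t).mul ((hda ε t).pow 2)).const_mul mu)
      refine this.congr_deriv ?_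
      simp only [Pi.pow_apply]
      ring
    have hi := intervalIntegral.integral_eq_sub_of_hasDerivAt (a := t₀) (b := T) (fun t _ => hd t)
      (Continuous.intervalIntegrable (by fun_prop) _ _)
    have hi2 : IntervalIntegrable (fun t => 2 * exp (2 * t) * a ε t ^ 2) volume t₀ T :=
      Continuous.intervalIntegrable (by fun_prop) _ _
    have hle : ∫ t in t₀..T, 2 * exp (2 * t) * min ((lam * b ε t - mu * a ε t) * N ε t) (Ψ t) ≤
        ∫ t in t₀..T, ((2 * lam * b ε t * M ε t + mu * (2 * exp (2 * t) * a ε t ^ 2 - 2 * exp (2 * t) * a ε t * N ε t)) - mu * (2 * exp (2 * t) * a ε t ^ 2)) := by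
      refine intervalIntegral.integral_mono_on htT ?_ (Continuous.intervalIntegrable (by fun_prop) _ _) ?_
      · have hX : Continuous fun t => 2 * exp (2 * t) * ((lam * b ε t - mu * a ε t) * N ε t) := by fun_prop
        have hP : IntervalIntegrable (fun t => 2 * exp (2 * t) * Ψ t) volume t₀ T := by
          rw [intervalIntegrable_iff]
          refine Integrable.mul_bdd (c := 4 * π * ν.real Set.univ + |kap| * ν.real Set.univ ^ 2) ?_
            hΨm.aestronglyMeasurable (Eventually.of_forall hΨb)
          rw [← IntegrableOn, ← intervalIntegrable_iff]
          exact Continuous.intervalIntegrable (by fun_prop) _ _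
        have : (fun t => 2 * exp (2 * t) * min ((lam * b ε t - mu * a ε t) * N ε t) (Ψ t)) =
          fun t => min (2 * exp (2 * t) * ((lam * b ε t - mu * a ε t) * N ε t)) (2 * exp (2 * t) * Ψ t) := by
          ext t; rw [mul_min_of_nonneg _ _ (by positivity)]
        rw [this]
        rw [intervalIntegrable_iff] at hP ⊢
        exact ((intervalIntegrable_iff.1 (hX.intervalIntegrable t₀ T))).inf hP
      · intro t _
        have := hML ε hε t
        have h3 := mul_le_mul_of_nonneg_left this
          (mul_nonneg (mul_nonneg zero_le_two (hmu.trans hml)) (hb0 ε t))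
        calc _ ≤ 2 * exp (2 * t) * ((lam * b ε t - mu * a ε t) * N ε t) := by
              gcongr; exact min_le_left _ _
          _ ≤ _ := by linarith
    rw [intervalIntegral.integral_sub (Continuous.intervalIntegrable (by fun_prop) _ _)
      (hi2.const_mul _), hi, intervalIntegral.integral_const_mul, haT ε hε, hbT ε hε] at hle
    linarith
  have key2 : ∀ ε > 0, exp (-(2 * ε)) * b ε t₀ - exp (2 * t₀) * a ε t₀ ≤
      ∫ t in t₀..T, 2 * exp (2 * t) * a ε t := by
    intro ε hε
    have hd : ∀ t, HasDerivAt (fun t => exp (2 * t) * a ε t + exp (-(2 * ε)) * -b ε t)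
        (2 * exp (2 * t) * a ε t - exp (2 * t) * N ε t + exp (-(2 * ε)) * M ε t) t := by
      intro t
      refine (((hexp t).mul (hda ε t)).add (((hdb ε t).neg).const_mul (exp (-(2 * ε))))).congr_deriv ?_
      ring
    have hi := intervalIntegral.integral_eq_sub_of_hasDerivAt (a := t₀) (b := T) (fun t _ => hd t)
      (Continuous.intervalIntegrable (by fun_prop) _ _)
    have hle : ∫ t in t₀..T, (2 * exp (2 * t) * a ε t - exp (2 * t) * N ε t + exp (-(2 * ε)) * M ε t) ≤
        ∫ t in t₀..T, 2 * exp (2 * t) * a ε t := by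
      refine intervalIntegral.integral_mono_on htT (Continuous.intervalIntegrable (by fun_prop) _ _)
        (Continuous.intervalIntegrable (by fun_prop) _ _) fun t _ => ?_
      have := mul_le_mul_of_nonneg_left (hMU ε hε t) (exp_pos (-(2 * ε))).le
      rw [← mul_assoc, ← exp_add] at this
      have e : -(2 * ε) + (2 * t + 2 * ε) = 2 * t := by ring
      rw [e] at this
      linarith
    rw [hi, haT ε hε, hbT ε hε] at hle
    linarith
  have hpos : ∀ᶠ ε in 𝓝[>] (0 : ℝ), 0 < ε := self_mem_nhdsWithin
  have lim2 : (∫ z in {z | t₀ < w z}, E z ∂ν) - exp (2 * t₀) * A t₀ ≤ ∫ t in t₀..T, 2 * exp (2 * t) * A t := by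
    have hl : Tendsto (fun ε => ∫ t in t₀..T, 2 * exp (2 * t) * a ε t) (𝓝[>] 0)
        (𝓝 (∫ t in t₀..T, 2 * exp (2 * t) * A t)) := by
      refine intervalIntegral.tendsto_integral_filter_of_dominated_convergence
        (fun t => 2 * exp (2 * t) * ν.real Set.univ) (Eventually.of_forall fun ε => ?_)
        (Eventually.of_forall fun ε => Eventually.of_forall fun t _ => ?_) ?_
        (Eventually.of_forall fun t _ => (hat t).const_mul _)
      · exact (Continuous.aestronglyMeasurable (by fun_prop))
      · rw [norm_eq_abs, abs_of_nonneg (mul_nonneg (by positivity) (ha0 ε t))]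
        gcongr; exact haU ε t
      · exact Continuous.intervalIntegrable (by fun_prop) _ _
    refine le_of_tendsto_of_tendsto ?_ hl (hpos.mono fun ε hε => key2 ε hε)
    have he : Tendsto (fun ε : ℝ => exp (-(2 * ε))) (𝓝[>] 0) (𝓝 1) := by
      have : Continuous fun ε : ℝ => exp (-(2 * ε)) := by fun_prop
      simpa using (this.tendsto 0).mono_left nhdsWithin_le_nhds
    simpa using (he.mul (hbt t₀)).sub ((hat t₀).const_mul (exp (2 * t₀)))
  have hl1 : Tendsto (fun ε => ∫ t in t₀..T, 2 * exp (2 * t) * a ε t ^ 2) (𝓝[>] 0)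
        (𝓝 (∫ t in t₀..T, 2 * exp (2 * t) * A t ^ 2)) := by
    refine intervalIntegral.tendsto_integral_filter_of_dominated_convergence
      (fun t => 2 * exp (2 * t) * ν.real Set.univ ^ 2) (Eventually.of_forall fun ε => ?_)
      (Eventually.of_forall fun ε => Eventually.of_forall fun t _ => ?_) ?_
      (Eventually.of_forall fun t _ => ((hat t).pow 2).const_mul _)
    · exact (Continuous.aestronglyMeasurable (by fun_prop))
    · rw [norm_eq_abs, abs_of_nonneg (by positivity)]
      gcongr
      · exact ha0 ε t
      · exact haU ε t
    · exact Continuous.intervalIntegrable (by fun_prop) _ _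
  have hcount : {t | 0 < ν {z | w z = t}}.Countable :=
    Measure.countable_meas_level_set_pos hw
  have hl3 : Tendsto (fun ε => ∫ t in t₀..T, 2 * exp (2 * t) * min ((lam * b ε t - mu * a ε t) * N ε t) (Ψ t))
      (𝓝[>] 0) (𝓝 (∫ t in t₀..T, 2 * exp (2 * t) * Ψ t)) := by
    refine intervalIntegral.tendsto_integral_filter_of_dominated_convergence
      (fun t => 2 * exp (2 * t) * (4 * π * ν.real Set.univ + |kap| * ν.real Set.univ ^ 2))
      (Eventually.of_forall fun ε => ?_)
      (hpos.mono fun ε hε => Eventually.of_forall fun t _ => ?_) ?_ ?_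
    · have hX : Continuous fun t => (lam * b ε t - mu * a ε t) * N ε t := by fun_prop
      exact ((by fun_prop : Measurable fun t : ℝ => 2 * exp (2 * t)).mul
        (hX.measurable.min hΨm)).aestronglyMeasurable
    · rw [norm_mul, norm_eq_abs, norm_eq_abs, abs_of_nonneg (by positivity : 0 ≤ 2 * exp (2 * t))]
      gcongr
      refine le_trans ?_ (hΨb t)
      have hX := mul_nonneg (hlab ε t) (hN0 ε hε t)
      rcases le_total ((lam * b ε t - mu * a ε t) * N ε t) (Ψ t) with h | h
      · rw [min_eq_left h, abs_of_nonneg hX]; exact h.trans (le_abs_self _)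
      · rw [min_eq_right h]
    · exact Continuous.intervalIntegrable (by fun_prop) _ _
    · have hae : ∀ᵐ t : ℝ, t ∉ insert T {t | 0 < ν {z | w z = t}} :=
        (hcount.insert T).ae_notMem _
      filter_upwards [hae] with t ht htI
      rw [Set.uIoc_of_le htT] at htI
      simp only [Set.mem_insert_iff, Set.mem_ofPred_eq, not_or, not_lt, nonpos_iff_eq_zero] at ht
      refine Tendsto.const_mul _ ?_
      have h := H t ⟨htI.1, lt_of_le_of_ne htI.2 ht.1⟩ ht.2
      rw [Metric.tendsto_nhds]
      intro δ hδ
      filter_upwards [h (δ / 2) (half_pos hδ)] with ε hε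
      have h2 : Ψ t - δ / 2 ≤ min ((lam * b ε t - mu * a ε t) * N ε t) (Ψ t) :=
        le_min hε (by linarith)
      have h3 := min_le_right ((lam * b ε t - mu * a ε t) * N ε t) (Ψ t)
      rw [Real.dist_eq, abs_lt]
      constructor <;> linarith
  have fin := le_of_tendsto_of_tendsto hl3
    ((((hbt t₀).pow 2).const_mul lam).sub (((hat t₀).pow 2).const_mul (mu * exp (2 * t₀))) |>.sub
      (hl1.const_mul mu)) (hpos.mono fun ε hε => key ε hε)
  have hAi : ∀ n : ℕ, IntervalIntegrable (fun t => 2 * exp (2 * t) * A t ^ n) volume t₀ T := fun n => by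
    rw [intervalIntegrable_iff]
    refine Integrable.mul_bdd (c := ν.real Set.univ ^ n) ?_
      (hAm.pow_const n).aestronglyMeasurable (Eventually.of_forall fun t => ?_)
    · rw [← IntegrableOn, ← intervalIntegrable_iff]
      exact Continuous.intervalIntegrable (by fun_prop) _ _
    · rw [norm_eq_abs, abs_of_nonneg (pow_nonneg (hA0 t) n)]
      exact pow_le_pow_left₀ (hA0 t) (hA1 t) n
  have hs : ∫ t in t₀..T, 2 * exp (2 * t) * Ψ t = 4 * π * (∫ t in t₀..T, 2 * exp (2 * t) * A t) -
      kap * ∫ t in t₀..T, 2 * exp (2 * t) * A t ^ 2 := by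
    rw [← intervalIntegral.integral_const_mul, ← intervalIntegral.integral_const_mul,
      ← intervalIntegral.integral_sub]
    · congr 1; ext t; simp only [hΨ]; ring
    · simpa using (hAi 1).const_mul (4 * π)
    · exact (hAi 2).const_mul kap
  rw [hs] at fin
  have := mul_le_mul_of_nonneg_left lim2 (show 0 ≤ 4 * π by positivity)
  linarith

end Levels

theorem deriv_smoothTransition_of_nonpos {x : ℝ} (hx : x ≤ 0) : deriv smoothTransition x = 0 := by
  rcases hx.lt_or_eq with h | rfl
  · exact deriv_smoothTransition_eq_zero (Or.inl h)
  · refine IsLocalMin.deriv_eq_zero (Filter.Eventually.of_forall fun y => ?_)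
    rw [smoothTransition.zero]; exact smoothTransition.nonneg y

theorem continuous_deriv_smoothTransition : Continuous (deriv smoothTransition) :=
  (smoothTransition.contDiff (n := 1)).continuous_deriv le_rfl

section Cut
variable {D : Set ℂ} {w : ℂ → ℝ} {t ε : ℝ}

/-- The function `φ ((w - t)/ε)` on `D`, extended by zero. -/
noncomputable def cutComp (D : Set ℂ) (w : ℂ → ℝ) (t ε : ℝ) (φ : ℝ → ℝ) : ℂ → ℝ :=
  D.indicator fun z => φ ((w z - t) / ε)

theorem tsupport_cutComp_subset (hε : 0 < ε) (hK : IsCompact {z ∈ D | t ≤ w z})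
    {φ : ℝ → ℝ} (hφ : ∀ x ≤ 0, φ x = 0) :
    tsupport (cutComp D w t ε φ) ⊆ {z ∈ D | t ≤ w z} := by
  refine closure_minimal (fun z hz => ?_) hK.isClosed
  have hzD : z ∈ D := Set.mem_of_indicator_ne_zero hz
  refine ⟨hzD, ?_⟩
  by_contra! hlt
  apply hz
  rw [cutComp, Set.indicator_of_mem hzD]
  exact hφ _ (div_nonpos_of_nonpos_of_nonneg (by linarith) hε.le)

theorem hasCompactSupport_cutComp (hε : 0 < ε) (hK : IsCompact {z ∈ D | t ≤ w z})
    {φ : ℝ → ℝ} (hφ : ∀ x ≤ 0, φ x = 0) : HasCompactSupport (cutComp D w t ε φ) :=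
  hK.of_isClosed_subset (isClosed_tsupport _) (tsupport_cutComp_subset hε hK hφ)

theorem contDiff_cutComp (hD : IsOpen D) {n : WithTop ℕ∞} (hw : ContDiffOn ℝ n w D) (hε : 0 < ε)
    (hK : IsCompact {z ∈ D | t ≤ w z}) {φ : ℝ → ℝ} (hφ : ∀ x ≤ 0, φ x = 0) (hφn : ContDiff ℝ n φ) :
    ContDiff ℝ n (cutComp D w t ε φ) := by
  refine contDiff_of_forall_mem_tsupport fun z hz => ?_
  have hzD : z ∈ D := (tsupport_cutComp_subset hε hK hφ hz).1
  have h1 : ContDiffAt ℝ n (fun z => φ ((w z - t) / ε)) z :=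
    hφn.contDiffAt.comp z (((hw.contDiffAt (hD.mem_nhds hzD)).sub contDiffAt_const).div_const ε)
  refine h1.congr_of_eventuallyEq ?_
  filter_upwards [hD.mem_nhds hzD] with y hy
  rw [cutComp, Set.indicator_of_mem hy]

theorem fderiv_cutComp (hD : IsOpen D) (hw : DifferentiableOn ℝ w D) (hε : 0 < ε)
    (hK : IsCompact {z ∈ D | t ≤ w z}) (z v : ℂ) :
    fderiv ℝ (cutComp D w t ε smoothTransition) z v =
      cutComp D w t ε (fun x => deriv smoothTransition x / ε) z * fderiv ℝ w z v := by
  by_cases hz : z ∈ D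
  · have h1 : HasFDerivAt (fun z => (w z - t) / ε) (ε⁻¹ • fderiv ℝ w z) z := by
      have := ((hw.differentiableAt (hD.mem_nhds hz)).hasFDerivAt.sub_const t).const_mul ε⁻¹
      refine this.congr_of_eventuallyEq (Filter.Eventually.of_forall fun y => ?_)
      simp only; ring
    have h2 := ((smoothTransition.contDiff (n := 1)).differentiable one_ne_zero
      ((w z - t) / ε)).hasDerivAt.comp_hasFDerivAt z h1
    have h3 : cutComp D w t ε smoothTransition =ᶠ[nhds z] smoothTransition ∘ fun z => (w z - t) / ε := by
      filter_upwards [hD.mem_nhds hz] with y hy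
      rw [cutComp, Set.indicator_of_mem hy]; rfl
    rw [h3.fderiv_eq, h2.fderiv, cutComp, Set.indicator_of_mem hz]
    simp only [smul_apply, smul_eq_mul]
    ring
  · have : z ∉ tsupport (cutComp D w t ε smoothTransition) := fun h =>
      hz (tsupport_cutComp_subset hε hK (fun x hx => smoothTransition.zero_of_nonpos hx) h).1
    rw [(notMem_tsupport_iff_eventuallyEq.1 this).fderiv_eq, cutComp, Set.indicator_of_notMem hz]
    simp

theorem sq_integral_sqrt_gradSq_cut_le (hD : IsOpen D) (hw : ContDiffOn ℝ 2 w D) (hε : 0 < ε)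
    (hK : IsCompact {z ∈ D | t ≤ w z}) {y : ℂ → ℝ} (hy : ContinuousOn y D) (hy0 : ∀ z ∈ D, 0 ≤ y z)
    {lam mu : ℝ}
    (hlap : ∀ z ∈ D, t ≤ w z → -lapC w z ≤ lam * (exp (2 * w z) * y z) - mu * y z) :
    (∫ z, √(gradSq (cutComp D w t ε smoothTransition) z) * √(y z)) ^ 2 ≤
      (lam * (∫ z, cutComp D w t ε smoothTransition z * (exp (2 * w z) * y z)) -
        mu * ∫ z, cutComp D w t ε smoothTransition z * y z) *
      ∫ z, cutComp D w t ε (fun x => deriv smoothTransition x / ε) z * y z := by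
  set f := cutComp D w t ε smoothTransition with hf
  set ψ := cutComp D w t ε (fun x => deriv smoothTransition x / ε) with hψ
  have hz1 : ∀ x ≤ 0, smoothTransition x = 0 := fun x hx => smoothTransition.zero_of_nonpos hx
  have hz2 : ∀ x ≤ 0, deriv smoothTransition x / ε = 0 := fun x hx => by
    rw [deriv_smoothTransition_of_nonpos hx, zero_div]
  have hfc := hasCompactSupport_cutComp hε hK hz1
  have hψc := hasCompactSupport_cutComp hε hK hz2
  have hft := tsupport_cutComp_subset hε hK hz1
  have hψt := tsupport_cutComp_subset hε hK hz2
  have hfD : tsupport f ⊆ D := fun z hz => (hft hz).1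
  have hψD : tsupport ψ ⊆ D := fun z hz => (hψt hz).1
  have hf1 : ContDiff ℝ 2 f := contDiff_cutComp hD hw hε hK hz1 smoothTransition.contDiff
  have hψ1 : Continuous ψ := by
    have := contDiff_cutComp (n := 0) hD (hw.of_le (by norm_num)) hε hK hz2
      (contDiff_zero.2 (continuous_deriv_smoothTransition.div_const ε))
    exact this.continuous
  have hψ0 : ∀ z, 0 ≤ ψ z := fun z => Set.indicator_nonneg (fun z _ =>
    div_nonneg (deriv_smoothTransition_nonneg _) hε.le) z
  have hf0 : ∀ z, 0 ≤ f z := fun z => Set.indicator_nonneg (fun z _ => smoothTransition.nonneg _) z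
  have hwd : DifferentiableOn ℝ w D := hw.differentiableOn two_ne_zero
  have hfd : ∀ z v, fderiv ℝ f z v = ψ z * fderiv ℝ w z v := fun z v => fderiv_cutComp hD hwd hε hK z v
  have hwc : ∀ v, ContinuousOn (fun z => fderiv ℝ w z v) D := fun v =>
    (hw.continuousOn_fderiv_apply hD v).continuousOn
  have hgc : ContinuousOn (gradSq w) D := ((hwc 1).pow 2).add ((hwc Complex.I).pow 2)
  have hg0 : ∀ z, 0 ≤ gradSq w z := fun z => add_nonneg (sq_nonneg _) (sq_nonneg _)
  have hgf : ∀ z, √(gradSq f z) = ψ z * √(gradSq w z) := fun z => by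
    have : gradSq f z = ψ z ^ 2 * gradSq w z := by simp only [gradSq, hfd]; ring
    rw [this, sqrt_mul (sq_nonneg _), sqrt_sq (hψ0 z)]
  have hP : ∫ z, ψ z * gradSq w z ≤ lam * (∫ z, f z * (exp (2 * w z) * y z)) - mu * ∫ z, f z * y z := by
    have hG := integral_mul_lapC hD (hf1.of_le (by norm_num)) hfc hfD hw
    have e1 : ∫ z, ψ z * gradSq w z = ∫ z, f z * -lapC w z := by
      simp only [mul_neg]
      rw [integral_neg, hG, neg_neg]
      congr 1; ext z; simp only [hfd, gradSq]; ring
    have i1 : Integrable fun z => f z * (exp (2 * w z) * y z) :=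
      integrable_mul_of_tsupport_subset hD hf1.continuous hfc hfD
        (((hw.continuousOn.const_mul 2).rexp).mul hy)
    have i2 : Integrable fun z => f z * y z :=
      integrable_mul_of_tsupport_subset hD hf1.continuous hfc hfD hy
    rw [e1, ← integral_const_mul, ← integral_const_mul, ← integral_sub (i1.const_mul _) (i2.const_mul _)]
    refine integral_mono (integrable_mul_of_tsupport_subset hD hf1.continuous hfc hfD
      (continuousOn_lapC hD hw).neg) ((i1.const_mul _).sub (i2.const_mul _)) fun z => ?_
    by_cases hz : z ∈ tsupport f
    · have := mul_le_mul_of_nonneg_left (hlap z (hft hz).1 (hft hz).2) (hf0 z)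
      simp only
      linarith
    · simp [image_eq_zero_of_notMem_tsupport hz]
  have hN0 : 0 ≤ ∫ z, ψ z * y z := integral_nonneg fun z => by
    by_cases hz : z ∈ tsupport ψ
    · exact mul_nonneg (hψ0 z) (hy0 z (hψD hz))
    · simp [image_eq_zero_of_notMem_tsupport hz]
  refine le_trans ?_ (mul_le_mul_of_nonneg_right hP hN0)
  have hint : ∀ g, ContinuousOn g D → Integrable fun z => ψ z * g z := fun g hg =>
    integrable_mul_of_tsupport_subset hD hψ1 hψc hψD hg
  have hJ : ∫ z, √(gradSq f z) * √(y z) = ∫ z, ψ z * (√(gradSq w z) * √(y z)) := by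
    congr 1; ext z; rw [hgf]; ring
  rw [hJ]
  have hq : ∀ s : ℝ, 0 ≤ (∫ z, ψ z * gradSq w z) * (s * s) +
      (2 * ∫ z, ψ z * (√(gradSq w z) * √(y z))) * s + ∫ z, ψ z * y z := by
    intro s
    have i1 := (hint _ hgc).mul_const (s * s)
    have i2 : Integrable fun z => 2 * (ψ z * (√(gradSq w z) * √(y z))) * s :=
      ((hint _ (hgc.sqrt.mul hy.sqrt)).const_mul 2).mul_const s
    have i3 := hint _ hy
    have i12 : Integrable fun z => ψ z * gradSq w z * (s * s) +
      2 * (ψ z * (√(gradSq w z) * √(y z))) * s := i1.add i2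
    rw [← integral_mul_const, ← integral_const_mul, ← integral_mul_const, ← integral_add i1 i2,
      ← integral_add i12 i3]
    refine integral_nonneg fun z => ?_
    by_cases hz : z ∈ tsupport ψ
    · have h1 := sq_sqrt (hg0 z)
      have h2 := sq_sqrt (hy0 z (hψD hz))
      have : 0 ≤ ψ z * (√(gradSq w z) * s + √(y z)) ^ 2 := mul_nonneg (hψ0 z) (sq_nonneg _)
      simp only [Pi.zero_apply]
      have e : ψ z * (√(gradSq w z) * s + √(y z)) ^ 2 = ψ z * √(gradSq w z) ^ 2 * (s * s) +
        2 * (ψ z * (√(gradSq w z) * √(y z))) * s + ψ z * √(y z) ^ 2 := by ring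
      rw [e, h1, h2] at this
      exact this
    · simp [image_eq_zero_of_notMem_tsupport hz]
  have := discrim_le_zero hq
  rw [discrim] at this
  nlinarith

end Cut

open Filter Topology in
theorem level_inequality {D : Set ℂ} (hD : IsOpen D) {w : ℂ → ℝ} (hw : ContDiffOn ℝ 2 w D)
    {t₀ T : ℝ} (ht₀ : 0 < t₀) (htT : t₀ ≤ T) (hT : ∀ z ∈ D, w z ≤ T)
    (hK : IsCompact {z ∈ D | t₀ ≤ w z}) {y : ℂ → ℝ} (hy : ContinuousOn y D)
    (hy0 : ∀ z ∈ D, 0 ≤ y z) {lam mu kap : ℝ} (hmu : 0 ≤ mu) (hml : mu ≤ lam)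
    (hlap : ∀ z ∈ D, t₀ ≤ w z → -lapC w z ≤ lam * (exp (2 * w z) * y z) - mu * y z)
    (hiso : ∀ t ∈ Set.Ioo t₀ T,
      ∫ z in {z ∈ D | t ≤ w z}, y z = ∫ z in {z ∈ D | t < w z}, y z → ∀ δ > 0, ∀ᶠ ε in 𝓝[>] (0 : ℝ),
      4 * π * (∫ z in {z ∈ D | t < w z}, y z) - kap * (∫ z in {z ∈ D | t < w z}, y z) ^ 2 - δ ≤
        (∫ z, √(gradSq (cutComp D w t ε smoothTransition) z) * √(y z)) ^ 2) :
    4 * π * ((∫ z in {z ∈ D | t₀ < w z}, exp (2 * w z) * y z) -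
        exp (2 * t₀) * ∫ z in {z ∈ D | t₀ < w z}, y z) ≤
      lam * (∫ z in {z ∈ D | t₀ < w z}, exp (2 * w z) * y z) ^ 2 -
        mu * exp (2 * t₀) * (∫ z in {z ∈ D | t₀ < w z}, y z) ^ 2 -
        (mu - kap) * ∫ t in t₀..T, 2 * exp (2 * t) * (∫ z in {z ∈ D | t < w z}, y z) ^ 2 := by
  set K := {z ∈ D | t₀ ≤ w z} with hKdef
  have hKm : MeasurableSet K := hK.isClosed.measurableSet
  have hKD : K ⊆ D := fun z hz => hz.1
  have hyK : IntegrableOn y K := (hy.mono hKD).integrableOn_compact hK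
  set ν := (volume.restrict K).withDensity (fun z => ENNReal.ofReal (y z)) with hν
  have : IsFiniteMeasure ν := isFiniteMeasure_withDensity_ofReal hyK.2
  set W : ℂ → ℝ := K.indicator w with hW
  have hWm : Measurable W := by
    classical
    rw [hW, ← Set.piecewise_eq_indicator]
    exact (hw.continuousOn.mono hKD).measurable_piecewise continuousOn_const hKm
  have hWK : ∀ z ∈ K, W z = w z := fun z hz => Set.indicator_of_mem hz w
  have hWn : ∀ z ∉ K, W z = 0 := fun z hz => Set.indicator_of_notMem hz w
  have hint : ∀ g : ℂ → ℝ, ∫ z, g z ∂ν = ∫ z in K, y z * g z := fun g => by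
    rw [hν, integral_withDensity_eq_integral_toReal_smul₀ hyK.1.aemeasurable.ennreal_ofReal
      (Eventually.of_forall fun z => ENNReal.ofReal_lt_top)]
    refine setIntegral_congr_fun hKm fun z hz => ?_
    simp only [smul_eq_mul, ENNReal.toReal_ofReal (hy0 z hz.1)]
  have hmemt : ∀ t, t₀ ≤ t → ∀ z, t < W z ↔ z ∈ D ∧ t < w z := fun t ht z => by
    by_cases hz : z ∈ K
    · rw [hWK z hz]; exact ⟨fun h => ⟨hz.1, h⟩, fun h => h.2⟩
    · rw [hWn z hz]
      constructor
      · intro h; linarith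
      · intro h; exact absurd ⟨h.1, ht.trans h.2.le⟩ hz
  have hmemt' : ∀ t, t₀ ≤ t → ∀ z, t ≤ W z ↔ z ∈ D ∧ t ≤ w z := fun t ht z => by
    by_cases hz : z ∈ K
    · rw [hWK z hz]; exact ⟨fun h => ⟨hz.1, h⟩, fun h => h.2⟩
    · rw [hWn z hz]
      constructor
      · intro h; linarith
      · intro h; exact absurd ⟨h.1, ht.trans h.2⟩ hz
  have hset : ∀ t, t₀ ≤ t → {z | t < W z} = {z ∈ D | t < w z} := fun t ht => by
    ext z; exact hmemt t ht z
  have hset' : ∀ t, t₀ ≤ t → {z | t ≤ W z} = {z ∈ D | t ≤ w z} := fun t ht => by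
    ext z; exact hmemt' t ht z
  have hsetint : ∀ (S : Set ℂ), MeasurableSet S → S ⊆ K → ∀ g : ℂ → ℝ,
      ∫ z in S, g z ∂ν = ∫ z in S, g z * y z := fun S hS hSK g => by
    rw [← integral_indicator hS, hint]
    have : (fun z => y z * S.indicator g z) = S.indicator fun z => g z * y z := by
      ext z
      by_cases hz : z ∈ S
      · simp [hz, mul_comm]
      · simp [hz]
    rw [this, setIntegral_indicator hS, Set.inter_eq_right.2 hSK]
  have hsm : ∀ t, MeasurableSet {z | t < W z} := fun t => measurableSet_lt measurable_const hWm
  have hsm' : ∀ t, MeasurableSet {z | t ≤ W z} := fun t => measurableSet_le measurable_const hWm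
  have hsK : ∀ t, t₀ ≤ t → {z ∈ D | t < w z} ⊆ K := fun t ht z hz => ⟨hz.1, ht.trans hz.2.le⟩
  have hsK' : ∀ t, t₀ ≤ t → {z ∈ D | t ≤ w z} ⊆ K := fun t ht z hz => ⟨hz.1, ht.trans hz.2⟩
  have hA : ∀ t, t₀ ≤ t → ν.real {z | t < W z} = ∫ z in {z ∈ D | t < w z}, y z := fun t ht => by
    have := hsetint _ (hsm t) (by rw [hset t ht]; exact hsK t ht) fun _ => 1
    rw [hset t ht] at this ⊢
    simpa using this
  have hA' : ∀ t, t₀ ≤ t → ν.real {z | t ≤ W z} = ∫ z in {z ∈ D | t ≤ w z}, y z := fun t ht => by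
    have := hsetint _ (hsm' t) (by rw [hset' t ht]; exact hsK' t ht) fun _ => 1
    rw [hset' t ht] at this ⊢
    simpa using this
  have hB : ∫ z in {z | t₀ < W z}, exp (2 * W z) ∂ν = ∫ z in {z ∈ D | t₀ < w z}, exp (2 * w z) * y z := by
    rw [hsetint _ (hsm t₀) (by rw [hset t₀ le_rfl]; exact hsK t₀ le_rfl), hset t₀ le_rfl]
    refine setIntegral_congr_fun (by rw [← hset t₀ le_rfl]; exact hsm t₀) fun z hz => ?_
    simp only [hWK z (hsK t₀ le_rfl hz)]
  have hcut : ∀ (φ : ℝ → ℝ), (∀ x ≤ 0, φ x = 0) → ∀ t, t₀ ≤ t → ∀ ε > 0, ∀ g : ℂ → ℝ, ∀ G : ℂ → ℝ,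
      (∀ z ∈ K, G z = g z) →
      ∫ z, φ ((W z - t) / ε) * G z ∂ν = ∫ z, cutComp D w t ε φ z * (g z * y z) := by
    intro φ hφ t ht ε hε g G hG
    rw [hint, ← integral_indicator hKm]
    congr 1; ext z
    by_cases hz : z ∈ K
    · rw [Set.indicator_of_mem hz, hWK z hz, hG z hz, cutComp, Set.indicator_of_mem hz.1]; ring
    · rw [Set.indicator_of_notMem hz]
      by_cases hzD : z ∈ D
      · have : w z < t₀ := by by_contra! h; exact hz ⟨hzD, h⟩
        rw [cutComp, Set.indicator_of_mem hzD,
          hφ _ (div_nonpos_of_nonpos_of_nonneg (by linarith) hε.le), zero_mul]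
      · rw [cutComp, Set.indicator_of_notMem hzD, zero_mul]
  have hz1 : ∀ x ≤ 0, smoothTransition x = 0 := fun x hx => smoothTransition.zero_of_nonpos hx
  have main := le_of_smoothDist_ineq (ν := ν) hWm htT (fun z => ?_) (fun z => ?_) hmu hml (kap := kap)
    (fun t ht hnull δ hδ => ?_)
  · rw [hA t₀ le_rfl, hB] at main
    refine main.trans (le_of_eq ?_)
    congr 2
    refine intervalIntegral.integral_congr fun t ht => ?_
    rw [Set.uIcc_of_le htT] at ht
    rw [hA t ht.1]
  · by_cases hz : z ∈ K
    · rw [hWK z hz]; exact hT z hz.1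
    · rw [hWn z hz]; linarith
  · by_cases hz : z ∈ K
    · rw [hWK z hz]; exact ht₀.le.trans hz.2
    · rw [hWn z hz]
  · have htl := ht.1.le
    have heq : ∫ z in {z ∈ D | t ≤ w z}, y z = ∫ z in {z ∈ D | t < w z}, y z := by
      rw [← hA t htl, ← hA' t htl]
      have : {z | t ≤ W z} = {z | t < W z} ∪ {z | W z = t} := by
        ext z; simp only [Set.mem_ofPred_eq, Set.mem_union]; rw [le_iff_lt_or_eq, eq_comm]
      rw [this, measureReal_def, measureReal_def,
        measure_congr (union_ae_eq_left_of_ae_eq_empty (ae_eq_empty.2 hnull))]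
    have hposn : ∀ᶠ ε in 𝓝[>] (0 : ℝ), 0 < ε := self_mem_nhdsWithin
    filter_upwards [hiso t ht heq δ hδ, hposn] with ε hε hε0
    rw [hA t htl]
    refine hε.trans ?_
    have hKt : IsCompact {z ∈ D | t ≤ w z} := by
      have : {z ∈ D | t ≤ w z} = K ∩ w ⁻¹' Set.Ici t := by
        ext z; exact ⟨fun h => ⟨⟨h.1, htl.trans h.2⟩, h.2⟩, fun h => ⟨h.1.1, h.2⟩⟩
      rw [this]
      exact hK.of_isClosed_subset
        ((hw.continuousOn.mono hKD).preimage_isClosed_of_isClosed hK.isClosed isClosed_Ici)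
        Set.inter_subset_left
    have h := sq_integral_sqrt_gradSq_cut_le hD hw hε0 hKt hy hy0
      (fun z hz hz' => hlap z hz (htl.trans hz'))
    refine h.trans (le_of_eq ?_)
    have e1 := hcut smoothTransition hz1 t htl ε hε0 (fun z => exp (2 * w z))
      (fun z => exp (2 * W z)) (fun z hz => by simp only [hWK z hz])
    have e2 := hcut smoothTransition hz1 t htl ε hε0 (fun _ => 1) (fun _ => 1) (fun _ _ => rfl)
    have e3 := hcut (fun x => deriv smoothTransition x / ε)
      (fun x hx => by simp only [deriv_smoothTransition_of_nonpos hx, zero_div])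
      t htl ε hε0 (fun _ => 1) (fun _ => 1) (fun _ _ => rfl)
    simp only [one_mul] at e2 e3
    rw [smoothDist, smoothDist, smoothDens, e1, e2, e3]

theorem lapC_sub {f g : ℂ → ℝ} {W : Set ℂ} (hW : IsOpen W) (hf : ContDiffOn ℝ 2 f W)
    (hg : ContDiffOn ℝ 2 g W) {z : ℂ} (hz : z ∈ W) :
    lapC (fun z => f z - g z) z = lapC f z - lapC g z := by
  have hd : ∀ {k : ℂ → ℝ}, ContDiffOn ℝ 2 k W → ∀ y ∈ W, DifferentiableAt ℝ k y := fun hk y hy =>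
    (hk.differentiableOn two_ne_zero).differentiableAt (hW.mem_nhds hy)
  have hd2 : ∀ {k : ℂ → ℝ}, ContDiffOn ℝ 2 k W → ∀ v, DifferentiableAt ℝ (fun y => fderiv ℝ k y v) z :=
    fun hk v => ((hk.continuousOn_fderiv_apply hW v).differentiableOn one_ne_zero).differentiableAt
      (hW.mem_nhds hz)
  have key : ∀ v, fderiv ℝ (fun y => fderiv ℝ (fun z => f z - g z) y v) z v =
      fderiv ℝ (fun y => fderiv ℝ f y v) z v - fderiv ℝ (fun y => fderiv ℝ g y v) z v := fun v => by
    have h1 : (fun y => fderiv ℝ (fun z => f z - g z) y v) =ᶠ[nhds z]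
        fun y => fderiv ℝ f y v - fderiv ℝ g y v := by
      filter_upwards [hW.mem_nhds hz] with y hy
      have : fderiv ℝ (fun z => f z - g z) y = fderiv ℝ f y - fderiv ℝ g y :=
        ((hd hf y hy).hasFDerivAt.sub (hd hg y hy).hasFDerivAt).fderiv
      rw [this]; rfl
    have h2 : fderiv ℝ (fun y => fderiv ℝ f y v - fderiv ℝ g y v) z =
        fderiv ℝ (fun y => fderiv ℝ f y v) z - fderiv ℝ (fun y => fderiv ℝ g y v) z :=
      ((hd2 hf v).hasFDerivAt.sub (hd2 hg v).hasFDerivAt).fderiv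
    rw [h1.fderiv_eq, h2]; rfl
  simp only [lapC, key]
  ring

theorem contDiffOn_re_of_differentiableOn {G : ℂ → ℂ} {W : Set ℂ} (hW : IsOpen W)
    (hG : DifferentiableOn ℂ G W) {n : WithTop ℕ∞} : ContDiffOn ℝ n (fun z => (G z).re) W := by
  have h : ContDiffOn ℝ n G W := (hG.contDiffOn hW).restrict_scalars ℝ
  exact (Complex.reCLM.contDiff).comp_contDiffOn h

theorem fderiv_re_of_differentiableAt {G : ℂ → ℂ} {z : ℂ} (hG : DifferentiableAt ℂ G z) (v : ℂ) :
    fderiv ℝ (fun z => (G z).re) z v = (deriv G z * v).re := by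
  have h := hG.restrictScalars ℝ
  have h2 : fderiv ℝ (fun z => (G z).re) z = Complex.reCLM.comp (fderiv ℝ G z) :=
    (Complex.reCLM.hasFDerivAt.comp z h.hasFDerivAt).fderiv
  rw [h2]
  simp [fderiv_real_apply_of_differentiableAt hG]

theorem lapC_re_of_differentiableOn {G : ℂ → ℂ} {W : Set ℂ} (hW : IsOpen W)
    (hG : DifferentiableOn ℂ G W) {z : ℂ} (hz : z ∈ W) : lapC (fun z => (G z).re) z = 0 := by
  have hd : ∀ y ∈ W, DifferentiableAt ℂ G y := fun y hy => hG.differentiableAt (hW.mem_nhds hy)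
  have hd2 : DifferentiableAt ℂ (deriv G) z := (hG.deriv hW).differentiableAt (hW.mem_nhds hz)
  have key : ∀ v, fderiv ℝ (fun y => fderiv ℝ (fun z => (G z).re) y v) z v =
      (deriv (deriv G) z * v * v).re := fun v => by
    have h1 : (fun y => fderiv ℝ (fun z => (G z).re) y v) =ᶠ[nhds z] fun y => (deriv G y * v).re := by
      filter_upwards [hW.mem_nhds hz] with y hy
      exact fderiv_re_of_differentiableAt (hd y hy) v
    rw [h1.fderiv_eq, fderiv_re_of_differentiableAt (hd2.mul_const v)]
    rw [deriv_mul_const hd2]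
  simp only [lapC, key]
  rw [mul_assoc _ Complex.I, Complex.I_mul_I]
  simp

open Filter Topology in
theorem tendsto_integral_cutComp_mul {D : Set ℂ} (hD : IsOpen D) {w : ℂ → ℝ} (hw : ContinuousOn w D)
    {t : ℝ} (hK : IsCompact {z ∈ D | t ≤ w z}) {y : ℂ → ℝ} (hy : ContinuousOn y D) :
    Tendsto (fun ε => ∫ z, cutComp D w t ε smoothTransition z * y z) (𝓝[>] 0)
      (𝓝 (∫ z in {z ∈ D | t < w z}, y z)) := by
  have hpos : ∀ᶠ ε in 𝓝[>] (0 : ℝ), 0 < ε := self_mem_nhdsWithin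
  have hz1 : ∀ x ≤ 0, smoothTransition x = 0 := fun x hx => smoothTransition.zero_of_nonpos hx
  have hm : MeasurableSet {z ∈ D | t < w z} := by
    have : {z ∈ D | t < w z} = D ∩ w ⁻¹' Set.Ioi t := rfl
    rw [this]
    exact (hw.isOpen_inter_preimage hD isOpen_Ioi).measurableSet
  have hyK : IntegrableOn y {z ∈ D | t ≤ w z} :=
    (hy.mono fun z hz => hz.1).integrableOn_compact hK
  have hKm := hK.isClosed.measurableSet
  rw [← integral_indicator hm]
  refine tendsto_integral_filter_of_dominated_convergence
    ({z ∈ D | t ≤ w z}.indicator fun z => ‖y z‖) (hpos.mono fun ε hε => ?_)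
    (hpos.mono fun ε hε => Eventually.of_forall fun z => ?_) ((integrable_indicator_iff hKm).2 hyK.norm)
    (Eventually.of_forall fun z => ?_)
  · have h0 := contDiff_cutComp (n := 0) hD (contDiffOn_zero.2 hw) hε hK hz1 smoothTransition.contDiff
    exact (integrable_mul_of_tsupport_subset hD h0.continuous (hasCompactSupport_cutComp hε hK hz1)
      (fun z hz => (tsupport_cutComp_subset hε hK hz1 hz).1) hy).aestronglyMeasurable
  · by_cases hz : z ∈ {z ∈ D | t ≤ w z}
    · rw [Set.indicator_of_mem hz, cutComp, Set.indicator_of_mem hz.1, norm_mul, norm_eq_abs,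
        abs_of_nonneg (smoothTransition.nonneg _)]
      exact mul_le_of_le_one_left (norm_nonneg _) (smoothTransition.le_one _)
    · rw [Set.indicator_of_notMem hz, image_eq_zero_of_notMem_tsupport
        fun h => hz (tsupport_cutComp_subset hε hK hz1 h)]
      simp
  · by_cases hzD : z ∈ D
    · by_cases hz : t < w z
      · rw [Set.indicator_of_mem (s := {z ∈ D | t < w z}) ⟨hzD, hz⟩]
        refine tendsto_const_nhds.congr' ?_
        filter_upwards [Ioo_mem_nhdsGT (sub_pos.2 hz)] with ε hε
        rw [cutComp, Set.indicator_of_mem hzD, smoothTransition.one_of_one_le, one_mul]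
        rw [one_le_div hε.1]; exact hε.2.le
      · rw [Set.indicator_of_notMem (s := {z ∈ D | t < w z}) fun h => hz h.2]
        refine tendsto_const_nhds.congr' ?_
        filter_upwards [hpos] with ε hε
        rw [cutComp, Set.indicator_of_mem hzD, smoothTransition.zero_of_nonpos, zero_mul]
        exact div_nonpos_of_nonpos_of_nonneg (by linarith) (le_of_lt hε)
    · rw [Set.indicator_of_notMem (s := {z ∈ D | t < w z}) fun h => hzD h.1]
      refine tendsto_const_nhds.congr fun ε => ?_
      rw [cutComp, Set.indicator_of_notMem hzD, zero_mul]

open Filter Topology in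
/-- Bol's inequality relative to a flat metric `|e^G|²|dz|²` which almost agrees with `e^{2V}|dz|²`
on the boundary. -/
theorem bol_inequality {W Q : Set ℂ} (hW : IsOpen W) (hQ : IsOpen Q) (hQc : IsCompact (closure Q))
    (hQW : closure Q ⊆ W) {F G : ℂ → ℂ} (hF : DifferentiableOn ℂ F W) (hG : DifferentiableOn ℂ G W)
    (hFG : ∀ z ∈ W, deriv F z = Complex.exp (G z)) {V : ℂ → ℝ} (hV : ContDiffOn ℝ 2 V W)
    {kap : ℝ} (hkap : 0 ≤ kap) (hlap : ∀ z ∈ W, -lapC V z ≤ kap * exp (2 * V z))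
    {ε : ℝ} (hε : 0 ≤ ε) (hbd : ∀ z ∈ frontier Q, V z - (G z).re ≤ ε) :
    4 * π * ((∫ z in Q, exp (2 * V z)) - exp (2 * ε) * ∫ z in Q, exp (2 * (G z).re)) ≤
      kap * (∫ z in Q, exp (2 * V z)) ^ 2 := by
  set h : ℂ → ℝ := fun z => (G z).re with hh
  set η : ℂ → ℝ := fun z => V z - h z with hη
  have hhc : ContDiffOn ℝ 2 h W := contDiffOn_re_of_differentiableOn hW hG
  have hηc : ContDiffOn ℝ 2 η W := hV.sub hhc
  have hQW' : Q ⊆ W := subset_closure.trans hQW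
  have hyc : ContinuousOn (fun z => exp (2 * h z)) W := (hhc.continuousOn.const_mul 2).rexp
  have hxc : ContinuousOn (fun z => exp (2 * V z)) W := (hV.continuousOn.const_mul 2).rexp
  have hyF : ∀ z ∈ W, exp (2 * h z) = ‖deriv F z‖ ^ 2 := fun z hz => by
    rw [hFG z hz, Complex.norm_exp, ← exp_nat_mul]; rfl
  have hKt : ∀ t, ε < t → IsCompact {z ∈ Q | t ≤ η z} := fun t ht => by
    have : {z ∈ Q | t ≤ η z} = closure Q ∩ η ⁻¹' Set.Ici t := by
      ext z
      refine ⟨fun hz => ⟨subset_closure hz.1, hz.2⟩, fun hz => ⟨?_, hz.2⟩⟩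
      by_contra hzQ
      have hzf : z ∈ frontier Q := by rw [hQ.frontier_eq]; exact ⟨hz.1, hzQ⟩
      have h1 := hbd z hzf
      have h2 : t ≤ η z := hz.2
      simp only [hη, hh] at h2
      linarith
    rw [this]
    exact hQc.of_isClosed_subset ((hηc.continuousOn.mono hQW).preimage_isClosed_of_isClosed
      hQc.isClosed isClosed_Ici) Set.inter_subset_left
  have hyi : IntegrableOn (fun z => exp (2 * h z)) Q :=
    ((hyc.mono hQW).integrableOn_compact hQc).mono_set subset_closure
  have hxi : IntegrableOn (fun z => exp (2 * V z)) Q :=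
    ((hxc.mono hQW).integrableOn_compact hQc).mono_set subset_closure
  obtain ⟨T₁, hT₁⟩ := hQc.exists_bound_of_continuousOn (hηc.continuousOn.mono hQW)
  have hxe : ∀ z, exp (2 * η z) * exp (2 * h z) = exp (2 * V z) := fun z => by
    rw [← exp_add]; congr 1; simp only [hη]; ring
  have key : ∀ t₀, ε < t₀ → 4 * π * ((∫ z in Q, exp (2 * V z)) - exp (2 * t₀) * ∫ z in Q, exp (2 * h z)) ≤
      kap * (∫ z in Q, exp (2 * V z)) ^ 2 := by
    intro t₀ ht₀
    have hl := level_inequality hQ (hηc.mono hQW') (T := max t₀ T₁) (hε.trans_lt ht₀) (le_max_left _ _)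
      (fun z hz => le_max_of_le_right ((le_abs_self _).trans (hT₁ z (subset_closure hz)))) (hKt t₀ ht₀)
      (hyc.mono hQW') (fun z _ => (exp_pos _).le) le_rfl hkap (kap := 0)
      (fun z hz _ => by
        have : lapC η z = lapC V z := by
          rw [lapC_sub hW hV hhc (hQW' hz), lapC_re_of_differentiableOn hW hG (hQW' hz), sub_zero]
        rw [this, hxe, zero_mul, sub_zero]
        exact hlap z (hQW' hz)) ?_
    · have hmeas : MeasurableSet {z ∈ Q | t₀ < η z} :=
        ((hηc.continuousOn.mono hQW').isOpen_inter_preimage hQ isOpen_Ioi).measurableSet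
      have hsub : {z ∈ Q | t₀ < η z} ⊆ Q := fun z hz => hz.1
      simp only [hxe] at hl
      simp only [zero_mul, sub_zero] at hl
      have h1 : ∫ z in {z ∈ Q | t₀ < η z}, exp (2 * V z) ≤ ∫ z in Q, exp (2 * V z) :=
        setIntegral_mono_set hxi (Eventually.of_forall fun z => (exp_pos _).le) hsub.eventuallyLE
      have h2 : (∫ z in Q, exp (2 * V z)) - exp (2 * t₀) * ∫ z in Q, exp (2 * h z) ≤
          (∫ z in {z ∈ Q | t₀ < η z}, exp (2 * V z)) - exp (2 * t₀) *
            ∫ z in {z ∈ Q | t₀ < η z}, exp (2 * h z) := by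
        rw [← integral_const_mul, ← integral_const_mul, ← integral_sub hxi (hyi.const_mul _),
          ← integral_sub (hxi.mono_set hsub) ((hyi.mono_set hsub).const_mul _),
          ← integral_indicator hQ.measurableSet, ← integral_indicator hmeas]
        refine integral_mono ((integrable_indicator_iff hQ.measurableSet).2 (hxi.sub (hyi.const_mul _)))
          ((integrable_indicator_iff hmeas).2 ((hxi.mono_set hsub).sub ((hyi.mono_set hsub).const_mul _))) fun z => ?_
        by_cases hz : z ∈ {z ∈ Q | t₀ < η z}
        · rw [Set.indicator_of_mem hz, Set.indicator_of_mem hz.1]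
        · rw [Set.indicator_of_notMem hz]
          refine Set.indicator_apply_le' (fun hzQ => ?_) fun _ => le_rfl
          have : η z ≤ t₀ := by by_contra! hc; exact hz ⟨hzQ, hc⟩
          have := exp_le_exp.2 (show 2 * η z ≤ 2 * t₀ by linarith)
          have := mul_le_mul_of_nonneg_right this (exp_pos (2 * h z)).le
          rw [hxe] at this
          linarith
      calc _ ≤ _ := mul_le_mul_of_nonneg_left h2 (by positivity)
        _ ≤ _ := hl
        _ ≤ _ := by
          refine mul_le_mul_of_nonneg_left (pow_le_pow_left₀ (integral_nonneg fun z => (exp_pos _).le) h1 2) hkap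
    · intro t ht heq δ hδ
      have htε := ht₀.trans ht.1
      set A := ∫ z in {z ∈ Q | t < η z}, exp (2 * h z) with hA
      have hA0 : 0 ≤ A := integral_nonneg fun z => (exp_pos _).le
      have hpos : ∀ᶠ ε in 𝓝[>] (0 : ℝ), 0 < ε := self_mem_nhdsWithin
      rcases hA0.eq_or_lt with hA0 | hA0
      · filter_upwards with e
        rw [← hA0]
        have := sq_nonneg (∫ z, √(gradSq (cutComp Q η t e smoothTransition) z) * √(exp (2 * h z)))
        simp only [mul_zero]
        linarith
      have hlim : Tendsto (fun e => 4 * π * (∫ z, cutComp Q η t e smoothTransition z * exp (2 * h z)) ^ 2 / A)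
          (𝓝[>] 0) (𝓝 (4 * π * A ^ 2 / A)) :=
        (((tendsto_integral_cutComp_mul hQ (hηc.continuousOn.mono hQW') (hKt t htε)
          (hyc.mono hQW')).pow 2).const_mul _).div_const _
      have hA2 : 4 * π * A ^ 2 / A = 4 * π * A := by field_simp
      rw [hA2] at hlim
      filter_upwards [hpos, hlim.eventually_const_lt (show 4 * π * A - δ < 4 * π * A by linarith)] with e he hlt
      have hz1 : ∀ x ≤ 0, smoothTransition x = 0 := fun x hx => smoothTransition.zero_of_nonpos hx
      have hts := tsupport_cutComp_subset he (hKt t htε) hz1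
      have hfl := sq_integral_mul_normSq_deriv_le hW hF
        (contDiff_cutComp hQ ((hηc.mono hQW').of_le one_le_two) he (hKt t htε) hz1 smoothTransition.contDiff)
        (hasCompactSupport_cutComp he (hKt t htε) hz1) (fun z hz => hQW' (hts hz).1)
      set f := cutComp Q η t e smoothTransition with hf
      have hfz : ∀ z, z ∉ W → f z = 0 := fun z hz =>
        image_eq_zero_of_notMem_tsupport fun h => hz (hQW' (hts h).1)
      have e1 : ∫ z, f z * ‖deriv F z‖ ^ 2 = ∫ z, f z * exp (2 * h z) := by
        congr 1; ext z
        by_cases hz : z ∈ W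
        · rw [hyF z hz]
        · rw [hfz z hz]; simp
      have e2 : ∫ z, √(gradSq f z) * ‖deriv F z‖ = ∫ z, √(gradSq f z) * √(exp (2 * h z)) := by
        congr 1; ext z
        by_cases hz : z ∈ W
        · rw [hyF z hz, sqrt_sq (norm_nonneg _)]
        · have : fderiv ℝ f z = 0 := image_eq_zero_of_notMem_tsupport fun h =>
            hz (hQW' (hts (tsupport_fderiv_subset ℝ h)).1)
          simp [gradSq, this]
      have e3 : ∫ z in tsupport f, ‖deriv F z‖ ^ 2 ≤ A := by
        rw [← heq]
        have hc : IsCompact {z ∈ Q | t ≤ η z} := hKt t htε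
        have : ∫ z in tsupport f, ‖deriv F z‖ ^ 2 = ∫ z in tsupport f, exp (2 * h z) :=
          setIntegral_congr_fun (isClosed_tsupport f).measurableSet fun z hz => (hyF z (hQW' (hts hz).1)).symm
        rw [this]
        exact setIntegral_mono_set (hyi.mono_set fun z hz => hz.1)
          (Eventually.of_forall fun z => (exp_pos _).le) hts.eventuallyLE
      rw [e1, e2] at hfl
      have hfl2 := hfl.trans (mul_le_mul_of_nonneg_left e3 (sq_nonneg _))
      rw [zero_mul, sub_zero]
      refine hlt.le.trans ?_
      rw [div_le_iff₀ hA0]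
      exact hfl2
  have hcont : Continuous fun t₀ : ℝ => 4 * π * ((∫ z in Q, exp (2 * V z)) - exp (2 * t₀) * ∫ z in Q, exp (2 * h z)) := by
    fun_prop
  refine le_of_tendsto ((hcont.tendsto ε).mono_left (nhdsWithin_le_nhds (s := Set.Ioi ε))) ?_
  filter_upwards [self_mem_nhdsWithin] with t ht using key t ht

/-- The disc automorphism `w ↦ (w - a)/(1 - ā w)`. -/
noncomputable def discMob (a w : ℂ) : ℂ := (w - a) / (1 - (starRingEnd ℂ) a * w)

theorem discMob_denom_ne {a w : ℂ} (ha : ‖a‖ < 1) (hw : ‖w‖ < 1) :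
    1 - (starRingEnd ℂ) a * w ≠ 0 := by
  intro h
  have h1 : (starRingEnd ℂ) a * w = 1 := (sub_eq_zero.1 h).symm
  have h2 := congrArg norm h1
  rw [norm_mul, RCLike.norm_conj, norm_one] at h2
  nlinarith [norm_nonneg a, norm_nonneg w]

theorem one_sub_normSq_discMob {a w : ℂ} :
    ‖1 - (starRingEnd ℂ) a * w‖ ^ 2 - ‖w - a‖ ^ 2 = (1 - ‖a‖ ^ 2) * (1 - ‖w‖ ^ 2) := by
  simp only [← Complex.normSq_eq_norm_sq, Complex.normSq_apply]
  simp
  ring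

theorem norm_discMob_lt_one {a w : ℂ} (ha : ‖a‖ < 1) (hw : ‖w‖ < 1) : ‖discMob a w‖ < 1 := by
  have h := one_sub_normSq_discMob (a := a) (w := w)
  have hd := norm_pos_iff.2 (discMob_denom_ne ha hw)
  rw [discMob, norm_div, div_lt_one hd]
  have h1 : 0 < (1 - ‖a‖ ^ 2) * (1 - ‖w‖ ^ 2) := by
    apply mul_pos <;> nlinarith [norm_nonneg a, norm_nonneg w]
  exact lt_of_pow_lt_pow_left₀ 2 hd.le (by linarith)

theorem discMob_injOn {a : ℂ} (ha : ‖a‖ < 1) : Set.InjOn (discMob a) {w | ‖w‖ < 1} := by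
  intro w hw v hv h
  have h1 := discMob_denom_ne ha hw
  have h2 := discMob_denom_ne ha hv
  simp only [discMob] at h
  rw [div_eq_div_iff h1 h2] at h
  have h3 : (w - v) * (1 - a * (starRingEnd ℂ) a) = 0 := by linear_combination h
  rcases mul_eq_zero.1 h3 with h4 | h4
  · exact sub_eq_zero.1 h4
  · rw [Complex.mul_conj, Complex.normSq_eq_norm_sq] at h4
    have : (1 : ℝ) - ‖a‖ ^ 2 = 0 := by exact_mod_cast h4
    nlinarith [norm_nonneg a]

theorem hasDerivAt_discMob {a w : ℂ} (ha : ‖a‖ < 1) (hw : ‖w‖ < 1) :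
    HasDerivAt (discMob a) ((1 - ‖a‖ ^ 2 : ℝ) / (1 - (starRingEnd ℂ) a * w) ^ 2) w := by
  have h1 := discMob_denom_ne ha hw
  have h := ((hasDerivAt_id w).sub_const a).div
    (((hasDerivAt_id w).const_mul ((starRingEnd ℂ) a)).const_sub 1) h1
  refine h.congr_deriv ?_
  have e : ((1 - ‖a‖ ^ 2 : ℝ) : ℂ) = 1 - a * (starRingEnd ℂ) a := by
    rw [Complex.mul_conj, Complex.normSq_eq_norm_sq]; push_cast; rfl
  rw [e]
  simp only [id]
  congr 1
  ring

/-- Holomorphic functions on `Q` have primitives. -/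
def HasPrimitives (Q : Set ℂ) : Prop :=
  ∀ g : ℂ → ℂ, DifferentiableOn ℂ g Q → ∃ F : ℂ → ℂ, ∀ z ∈ Q, HasDerivAt F (g z) z

theorem HasPrimitives.exists_sq_eq {Q : Set ℂ} (hQ : IsOpen Q) (hQc : IsPreconnected Q)
    (hex : HasPrimitives Q) {k : ℂ → ℂ} (hk : DifferentiableOn ℂ k Q) (hk0 : ∀ z ∈ Q, k z ≠ 0) :
    ∃ g : ℂ → ℂ, DifferentiableOn ℂ g Q ∧ ∀ z ∈ Q, g z ^ 2 = k z := by
  obtain ⟨L, hL⟩ := hex (fun z => deriv k z / k z) ((hk.deriv hQ).div hk hk0)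
  have hLd : DifferentiableOn ℂ L Q := fun z hz => (hL z hz).differentiableAt.differentiableWithinAt
  rcases Q.eq_empty_or_nonempty with rfl | ⟨z₀, hz₀⟩
  · exact ⟨0, fun z hz => absurd hz (Set.notMem_empty z), fun z hz => absurd hz (Set.notMem_empty z)⟩
  have hm : DifferentiableOn ℂ (fun z => k z * Complex.exp (-L z)) Q := hk.mul hLd.neg.cexp
  have hd : ∀ z ∈ Q, HasDerivAt (fun z => k z * Complex.exp (-L z)) 0 z := fun z hz => by
    have h1 := (hk.differentiableAt (hQ.mem_nhds hz)).hasDerivAt.mul ((hL z hz).neg.cexp)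
    refine h1.congr_deriv ?_
    field_simp [hk0 z hz]
    ring
  have hconst : ∀ z ∈ Q, k z * Complex.exp (-L z) = k z₀ * Complex.exp (-L z₀) := fun z hz =>
    hQ.is_const_of_deriv_eq_zero hQc hm (fun z hz => (hd z hz).deriv) hz hz₀
  obtain ⟨s, hs⟩ := IsAlgClosed.exists_pow_nat_eq (k z₀ * Complex.exp (-L z₀)) two_pos
  refine ⟨fun z => s * Complex.exp (L z / 2), (hLd.div_const 2).cexp.const_mul s, fun z hz => ?_⟩
  rw [mul_pow, hs, ← hconst z hz, ← Complex.exp_nat_mul, mul_assoc, ← Complex.exp_add]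
  have : -L z + (2 : ℕ) * (L z / 2) = 0 := by push_cast; ring
  rw [this, Complex.exp_zero, mul_one]

/-- Injective holomorphic maps of `Q` into the unit disc sending `z₀` to `0`. -/
def IsDiscEmbedding (Q : Set ℂ) (z₀ : ℂ) (f : ℂ → ℂ) : Prop :=
  DifferentiableOn ℂ f Q ∧ Set.InjOn f Q ∧ (∀ z ∈ Q, ‖f z‖ < 1) ∧ f z₀ = 0

/-- Koebe's square root trick. -/
theorem IsDiscEmbedding.exists_norm_deriv_eq {Q : Set ℂ} (hQ : IsOpen Q) (hQc : IsPreconnected Q)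
    (hex : HasPrimitives Q) {z₀ : ℂ} (hz₀ : z₀ ∈ Q) {f : ℂ → ℂ} (hf : IsDiscEmbedding Q z₀ f)
    {a : ℂ} (ha : ‖a‖ < 1) (haf : ∀ z ∈ Q, f z ≠ a) :
    ∃ ψ, IsDiscEmbedding Q z₀ ψ ∧
      ‖deriv ψ z₀‖ = (1 + ‖a‖) / (2 * √‖a‖) * ‖deriv f z₀‖ := by
  obtain ⟨hfd, hfi, hf1, hf0⟩ := hf
  have ha0 : a ≠ 0 := fun h => haf z₀ hz₀ (by rw [hf0, h])
  have hkd : DifferentiableOn ℂ (fun z => discMob a (f z)) Q := fun z hz =>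
    ((hasDerivAt_discMob ha (hf1 z hz)).differentiableAt.comp z
      (hfd.differentiableAt (hQ.mem_nhds hz))).differentiableWithinAt
  have hk0 : ∀ z ∈ Q, discMob a (f z) ≠ 0 := fun z hz =>
    div_ne_zero (sub_ne_zero.2 (haf z hz)) (discMob_denom_ne ha (hf1 z hz))
  obtain ⟨g, hgd, hg⟩ := hex.exists_sq_eq hQ hQc hkd hk0
  have hg1 : ∀ z ∈ Q, ‖g z‖ < 1 := fun z hz => by
    have : ‖g z‖ ^ 2 < 1 := by
      rw [← norm_pow, hg z hz]; exact norm_discMob_lt_one ha (hf1 z hz)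
    nlinarith [norm_nonneg (g z)]
  have hgz : g z₀ ^ 2 = -a := by rw [hg z₀ hz₀, hf0]; simp [discMob]
  have hb := hg1 z₀ hz₀
  set b := g z₀ with hbdef
  have hb2 : ‖b‖ ^ 2 = ‖a‖ := by rw [← norm_pow, hgz, norm_neg]
  have hbs : ‖b‖ = √‖a‖ := by rw [← hb2, sqrt_sq (norm_nonneg _)]
  have hb0 : 0 < ‖b‖ := by rw [hbs]; exact sqrt_pos.2 (norm_pos_iff.2 ha0)
  have hgz' := (hgd.differentiableAt (hQ.mem_nhds hz₀)).hasDerivAt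
  have hfz' := (hfd.differentiableAt (hQ.mem_nhds hz₀)).hasDerivAt
  have hψ' : HasDerivAt (fun z => discMob b (g z)) _ z₀ :=
    (hasDerivAt_discMob hb hb).comp z₀ hgz'
  refine ⟨fun z => discMob b (g z), ⟨fun z hz => ((hasDerivAt_discMob hb (hg1 z hz)).differentiableAt.comp z
      (hgd.differentiableAt (hQ.mem_nhds hz))).differentiableWithinAt, ?_, fun z hz =>
      norm_discMob_lt_one hb (hg1 z hz), by simp [discMob, ← hbdef]⟩, ?_⟩
  · intro z hz z' hz' h
    have h1 := discMob_injOn hb (hg1 z hz) (hg1 z' hz') h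
    have h2 : discMob a (f z) = discMob a (f z') := by rw [← hg z hz, ← hg z' hz', h1]
    exact hfi hz hz' (discMob_injOn ha (hf1 z hz) (hf1 z' hz') h2)
  · have e1 : HasDerivAt (fun z => g z ^ 2) (2 * b * deriv g z₀) z₀ := by
      refine (show HasDerivAt (fun z => g z ^ 2) _ z₀ from hgz'.pow 2).congr_deriv ?_
      simp [← hbdef]
    have e2 : HasDerivAt (fun z => discMob a (f z)) ((1 - ‖a‖ ^ 2 : ℝ) * deriv f z₀) z₀ := by
      have h1 : ‖f z₀‖ < 1 := hf1 z₀ hz₀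
      refine (show HasDerivAt (fun z => discMob a (f z)) _ z₀ from
        (hasDerivAt_discMob ha h1).comp z₀ hfz').congr_deriv ?_
      simp [hf0]
    have e3 : (fun z => g z ^ 2) =ᶠ[nhds z₀] fun z => discMob a (f z) := by
      filter_upwards [hQ.mem_nhds hz₀] with z hz using hg z hz
    have e4 := congrArg norm (e1.unique (e2.congr_of_eventuallyEq e3))
    rw [norm_mul, norm_mul, norm_mul, Complex.norm_real, norm_eq_abs,
      abs_of_pos (by nlinarith [norm_nonneg a] : 0 < 1 - ‖a‖ ^ 2)] at e4
    have e5 : ‖(1 - (starRingEnd ℂ) b * b)‖ = 1 - ‖a‖ := by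
      rw [mul_comm, Complex.mul_conj, Complex.normSq_eq_norm_sq, hb2]
      rw [← Complex.ofReal_one, ← Complex.ofReal_sub, Complex.norm_real, norm_eq_abs,
        abs_of_pos (by linarith)]
    rw [hψ'.deriv, norm_mul, norm_div, norm_pow, e5, Complex.norm_real, norm_eq_abs, hb2,
      abs_of_pos (by linarith : 0 < 1 - ‖a‖), ← hbs]
    have h6 : 1 - ‖a‖ ≠ 0 := by linarith
    simp only [RCLike.norm_ofNat] at e4
    field_simp
    nlinarith [e4]

/-- Holomorphic maps of `Q` into the unit disc sending `z₀` to `0`. -/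
def IsDiscMap (Q : Set ℂ) (z₀ : ℂ) (f : ℂ → ℂ) : Prop :=
  DifferentiableOn ℂ f Q ∧ (∀ z ∈ Q, ‖f z‖ < 1) ∧ f z₀ = 0

theorem norm_sq_le_of_ball_subset {Q : Set ℂ} {c : ℂ} {r : ℝ} (hr : 0 < r)
    (hcr : Metric.ball c (2 * r) ⊆ Q) {f : ℂ → ℂ} (hfd : DifferentiableOn ℂ f Q)
    (hf1 : ∀ z ∈ Q, ‖f z‖ < 1) {z : ℂ} (hz : z ∈ Metric.ball c r) :
    ‖f z‖ ^ 2 ≤ 1 - 3 / 4 * (1 - ‖f c‖) ^ 2 := by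
  have hc : c ∈ Metric.ball c (2 * r) := Metric.mem_ball_self (by linarith)
  have hz2 : z ∈ Metric.ball c (2 * r) := Metric.ball_subset_ball (by linarith) hz
  have ha := hf1 c (hcr hc)
  have hw := hf1 z (hcr hz2)
  have hd : DifferentiableOn ℂ (fun z => discMob (f c) (f z)) (Metric.ball c (2 * r)) := fun x hx =>
    ((hasDerivAt_discMob ha (hf1 x (hcr hx))).differentiableAt.comp x
      ((hfd.mono hcr).differentiableAt (Metric.isOpen_ball.mem_nhds hx))).differentiableWithinAt
  have h0 : discMob (f c) (f c) = 0 := by simp [discMob]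
  have hmaps : Set.MapsTo (fun z => discMob (f c) (f z)) (Metric.ball c (2 * r))
      (Metric.closedBall (discMob (f c) (f c)) 1) := fun x hx => by
    rw [h0, mem_closedBall_zero_iff]
    exact (norm_discMob_lt_one ha (hf1 x (hcr hx))).le
  have h1 := Complex.dist_le_div_mul_dist_of_mapsTo_ball hd hmaps hz2
  simp only [h0, dist_zero_right] at h1
  have h2 : ‖discMob (f c) (f z)‖ ≤ 1 / 2 := by
    have : dist z c < r := hz
    refine h1.trans ?_
    rw [div_mul_eq_mul_div, div_le_iff₀ (by positivity)]
    linarith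
  have hden := norm_pos_iff.2 (discMob_denom_ne ha hw)
  rw [discMob, norm_div, div_le_iff₀ hden] at h2
  have h3 := one_sub_normSq_discMob (a := f c) (w := f z)
  have h4 : 1 - ‖f c‖ ≤ ‖1 - (starRingEnd ℂ) (f c) * f z‖ := by
    have := norm_sub_norm_le (1 : ℂ) ((starRingEnd ℂ) (f c) * f z)
    rw [norm_one, norm_mul, RCLike.norm_conj] at this
    nlinarith [norm_nonneg (f c), norm_nonneg (f z)]
  have h5 : (1 - ‖f c‖) ^ 2 ≤ ‖1 - (starRingEnd ℂ) (f c) * f z‖ ^ 2 :=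
    pow_le_pow_left₀ (by linarith) h4 2
  have h6 : ‖f z - f c‖ ^ 2 ≤ (1 / 2 * ‖1 - (starRingEnd ℂ) (f c) * f z‖) ^ 2 :=
    pow_le_pow_left₀ (norm_nonneg _) h2 2
  have h7 : (1 - ‖f c‖ ^ 2) * (1 - ‖f z‖ ^ 2) ≤ 1 - ‖f z‖ ^ 2 := by
    have : ‖f z‖ ^ 2 ≤ 1 := pow_le_one₀ (norm_nonneg _) hw.le
    nlinarith [sq_nonneg ‖f c‖]
  nlinarith

/-- Schwarz-Pick: disc maps are uniformly bounded away from the circle on compact sets. -/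
theorem exists_forall_isDiscMap_le {Q : Set ℂ} (hQ : IsOpen Q) (hQc : IsPreconnected Q)
    {z₀ : ℂ} (hz₀ : z₀ ∈ Q) {K : Set ℂ} (hK : IsCompact K) (hKQ : K ⊆ Q) :
    ∃ ρ < (1 : ℝ), ∀ f, IsDiscMap Q z₀ f → ∀ z ∈ K, ‖f z‖ ≤ ρ := by
  set P : Set ℂ := {z | z ∈ Q ∧ ∃ ρ < (1 : ℝ), ∀ f, IsDiscMap Q z₀ f → ‖f z‖ ≤ ρ} with hP
  have key : ∀ c ∈ P, ∀ r > 0, Metric.ball c (2 * r) ⊆ Q →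
      ∃ ρ < (1 : ℝ), ∀ f, IsDiscMap Q z₀ f → ∀ z ∈ Metric.ball c r, ‖f z‖ ≤ ρ := by
    rintro c ⟨hcQ, ρ, hρ, hb⟩ r hr hcr
    refine ⟨√(1 - 3 / 4 * (1 - ρ) ^ 2), ?_, fun f hf z hz => ?_⟩
    · rw [sqrt_lt' one_pos]; nlinarith [sq_pos_of_pos (sub_pos.2 hρ)]
    · apply le_sqrt_of_sq_le
      refine (norm_sq_le_of_ball_subset hr hcr hf.1 hf.2.1 hz).trans ?_
      have : (1 - ρ) ^ 2 ≤ (1 - ‖f c‖) ^ 2 :=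
        pow_le_pow_left₀ (by linarith) (by linarith [hb f hf]) 2
      linarith
  have hball : ∀ z ∈ Q, ∃ r > 0, Metric.ball z (2 * r) ⊆ Q := fun z hz => by
    obtain ⟨r, hr, h⟩ := Metric.isOpen_iff.1 hQ z hz
    exact ⟨r / 2, by positivity, by rwa [mul_div_cancel₀ r two_ne_zero]⟩
  have hPo : IsOpen P := Metric.isOpen_iff.2 fun c hc => by
    obtain ⟨r, hr, h⟩ := hball c hc.1
    obtain ⟨ρ, hρ, hb⟩ := key c hc r hr h
    exact ⟨r, hr, fun z hz => ⟨h (Metric.ball_subset_ball (by linarith) hz), ρ, hρ,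
      fun f hf => hb f hf z hz⟩⟩
  have hQP : Q ⊆ P := by
    refine hQc.subset_of_closure_inter_subset hPo
      ⟨z₀, hz₀, hz₀, 0, zero_lt_one, fun f hf => by rw [hf.2.2, norm_zero]⟩ ?_
    rintro z ⟨hzc, hzQ⟩
    obtain ⟨r, hr, h⟩ := hball z hzQ
    obtain ⟨c, hcP, hzc⟩ := Metric.mem_closure_iff.1 hzc (r / 2) (by positivity)
    obtain ⟨ρ, hρ, hb⟩ := key c hcP (r / 2) (by positivity) ((Metric.ball_subset_ball' (by
      rw [dist_comm]; linarith)).trans h)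
    exact ⟨hzQ, ρ, hρ, fun f hf => hb f hf z hzc⟩
  refine hK.induction_on (p := fun s => ∃ ρ < (1 : ℝ), ∀ f, IsDiscMap Q z₀ f → ∀ z ∈ s, ‖f z‖ ≤ ρ)
    ⟨0, zero_lt_one, fun f hf z hz => absurd hz (Set.notMem_empty z)⟩
    (fun s t hst ⟨ρ, hρ, h⟩ => ⟨ρ, hρ, fun f hf z hz => h f hf z (hst hz)⟩)
    (fun s t ⟨ρ, hρ, h⟩ ⟨ρ', hρ', h'⟩ => ⟨max ρ ρ', max_lt hρ hρ', fun f hf z hz => hz.elim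
      (fun hz => (h f hf z hz).trans (le_max_left _ _))
      (fun hz => (h' f hf z hz).trans (le_max_right _ _))⟩) fun z hz => ?_
  obtain ⟨r, hr, h⟩ := hball z (hKQ hz)
  obtain ⟨ρ, hρ, hb⟩ := key z (hQP (hKQ hz)) r hr h
  exact ⟨_, mem_nhdsWithin_of_mem_nhds (Metric.ball_mem_nhds z hr), ρ, hρ, hb⟩

/-- Disc embeddings with large image. -/
theorem exists_isDiscEmbedding_ball_subset {Q : Set ℂ} (hQ : IsOpen Q) (hQc : IsPreconnected Q)
    (hQb : Bornology.IsBounded Q) (hex : HasPrimitives Q) {z₀ : ℂ} (hz₀ : z₀ ∈ Q) {r : ℝ}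
    (hr0 : 0 < r) (hr : r < 1) : ∃ f, IsDiscEmbedding Q z₀ f ∧ Metric.ball 0 r ⊆ f '' Q := by
  set A : Set ℝ := {x | ∃ f, IsDiscEmbedding Q z₀ f ∧ x = ‖deriv f z₀‖} with hA
  obtain ⟨R, hR0, hR⟩ := hQb.subset_ball_lt 0 z₀
  have hd1 : HasDerivAt (fun z : ℂ => (z - z₀) / R) (1 / R) z₀ :=
    ((hasDerivAt_id z₀).sub_const z₀).div_const _
  have h1 : IsDiscEmbedding Q z₀ fun z => (z - z₀) / R := by
    refine ⟨by fun_prop, fun z _ w _ h => ?_, fun z hz => ?_, by simp⟩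
    · have : (R : ℂ) ≠ 0 := by exact_mod_cast hR0.ne'
      field_simp at h
      simpa using h
    · rw [norm_div, Complex.norm_real, norm_eq_abs, abs_of_pos hR0, div_lt_one hR0, ← dist_eq_norm]
      exact hR hz
  have hmem1 : 1 / R ∈ A := ⟨_, h1, by
    rw [hd1.deriv, norm_div, norm_one, Complex.norm_real, norm_eq_abs, abs_of_pos hR0]⟩
  obtain ⟨d, hd0, hd⟩ := Metric.isOpen_iff.1 hQ z₀ hz₀
  have hbdd : BddAbove A := by
    refine ⟨1 / d, ?_⟩
    rintro x ⟨f, hf, rfl⟩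
    refine Complex.norm_deriv_le_div_of_mapsTo_ball (hf.1.mono hd) (fun z hz => ?_) hd0
    rw [hf.2.2.2, mem_closedBall_zero_iff]
    exact (hf.2.2.1 z (hd hz)).le
  have hpos : 0 < sSup A := (by positivity : 0 < 1 / R).trans_le (le_csSup hbdd hmem1)
  have hsr : 0 < √r := sqrt_pos.2 hr0
  have hsr2 : √r ^ 2 = r := sq_sqrt hr0.le
  have hsr1 : √r < 1 := by rw [sqrt_lt' one_pos]; linarith
  have hη : 2 * √r / (1 + r) < 1 := by
    rw [div_lt_one (by positivity)]; nlinarith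
  obtain ⟨_, ⟨f, hf, rfl⟩, hlt⟩ := exists_lt_of_lt_csSup ⟨_, hmem1⟩
    (mul_lt_of_lt_one_left hpos hη)
  refine ⟨f, hf, fun a ha => ?_⟩
  by_contra hna
  rw [mem_ball_zero_iff] at ha
  obtain ⟨ψ, hψ, hψ'⟩ := hf.exists_norm_deriv_eq hQ hQc hex hz₀ (ha.trans hr)
    fun z hz h => hna ⟨z, hz, h⟩
  have ha0 : 0 < ‖a‖ := norm_pos_iff.2 fun h => hna ⟨z₀, hz₀, by rw [hf.2.2.2, h]⟩
  have h2 : ‖deriv ψ z₀‖ ≤ sSup A := le_csSup hbdd ⟨ψ, hψ, rfl⟩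
  have hsa : 0 < √‖a‖ := sqrt_pos.2 ha0
  have hsa2 : √‖a‖ ^ 2 = ‖a‖ := sq_sqrt ha0.le
  have hsar : √‖a‖ ≤ √r := sqrt_le_sqrt ha.le
  have h3 : 2 * √‖a‖ / (1 + ‖a‖) ≤ 2 * √r / (1 + r) := by
    rw [div_le_div_iff₀ (by positivity) (by positivity)]
    nlinarith [mul_nonneg (sub_nonneg.2 hsar) (by nlinarith : 0 ≤ 1 - √r * √‖a‖)]
  rw [hψ', div_mul_eq_mul_div, div_le_iff₀ (by positivity)] at h2
  have h4 := (mul_le_mul_of_nonneg_right h3 hpos.le).trans_lt hlt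
  rw [div_mul_eq_mul_div, div_lt_iff₀ (by positivity)] at h4
  linarith

theorem exists_entire_re_eq_of_mem_span_fourier {r : ℝ} (hr : 0 < r)
    {φ : C(AddCircle (2 * π), ℂ)} (hφ : φ ∈ Submodule.span ℂ (Set.range (@fourier (2 * π))))
    (c : ℂ) : ∃ P : ℂ → ℂ, Differentiable ℂ P ∧
      ∀ θ : AddCircle (2 * π), (c * φ θ).re = (P (r * (AddCircle.toCircle θ : ℂ))).re := by
  have hr' : (r : ℂ) ≠ 0 := by exact_mod_cast hr.ne'
  induction hφ using Submodule.span_induction generalizing c with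
  | mem φ h =>
    obtain ⟨n, rfl⟩ := h
    obtain ⟨m, rfl | rfl⟩ := n.eq_nat_or_neg
    · refine ⟨fun z => c * (z / r) ^ m, by fun_prop, fun θ => ?_⟩
      dsimp only
      rw [mul_div_cancel_left₀ _ hr', fourier_apply]
      congr 2
      simp [AddCircle.toCircle_nsmul]
    · refine ⟨fun z => (starRingEnd ℂ) c * (z / r) ^ m, by fun_prop, fun θ => ?_⟩
      dsimp only
      rw [mul_div_cancel_left₀ _ hr', fourier_neg, ← Complex.conj_re, map_mul, Complex.conj_conj,
        fourier_apply]
      congr 2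
      simp [AddCircle.toCircle_nsmul]
  | zero => exact ⟨0, by simp, by simp⟩
  | add φ ψ _ _ h1 h2 =>
    obtain ⟨P, hP, h1⟩ := h1 c
    obtain ⟨P', hP', h2⟩ := h2 c
    exact ⟨fun z => P z + P' z, hP.add hP', fun θ => by
      rw [Complex.add_re, ← h1, ← h2, ContinuousMap.add_apply, mul_add, Complex.add_re]⟩
  | smul a φ _ h =>
    obtain ⟨P, hP, h⟩ := h (c * a)
    exact ⟨P, hP, fun θ => by rw [← h, ContinuousMap.smul_apply, smul_eq_mul, mul_assoc]⟩

/-- Continuous functions on a circle are uniform limits of real parts of entire functions. -/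
theorem exists_entire_re_near_sphere {r : ℝ} (hr : 0 < r) {h : ℂ → ℝ}
    (hh : ContinuousOn h (Metric.sphere 0 r)) {ε : ℝ} (hε : 0 < ε) :
    ∃ P : ℂ → ℂ, Differentiable ℂ P ∧ ∀ ζ ∈ Metric.sphere (0 : ℂ) r, |h ζ - (P ζ).re| ≤ ε := by
  have : Fact (0 < 2 * π) := ⟨by positivity⟩
  have hmem : ∀ θ : AddCircle (2 * π), (r * (AddCircle.toCircle θ : ℂ)) ∈ Metric.sphere (0 : ℂ) r :=
    fun θ => by
      rw [mem_sphere_zero_iff_norm, norm_mul, Circle.norm_coe, mul_one, Complex.norm_real,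
        norm_eq_abs, abs_of_pos hr]
  have hcont : Continuous fun θ : AddCircle (2 * π) =>
      ((h (r * (AddCircle.toCircle θ : ℂ)) : ℝ) : ℂ) := by
    refine Complex.continuous_ofReal.comp (hh.comp_continuous ?_ hmem)
    exact continuous_const.mul (continuous_subtype_val.comp AddCircle.continuous_toCircle)
  have hcl : (⟨_, hcont⟩ : C(AddCircle (2 * π), ℂ)) ∈
      (Submodule.span ℂ (Set.range (@fourier (2 * π)))).topologicalClosure := by
    rw [span_fourier_closure_eq_top]; trivial
  obtain ⟨φ, hφ, hd⟩ := Metric.mem_closure_iff.1 hcl ε hε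
  obtain ⟨P, hP, hre⟩ := exists_entire_re_eq_of_mem_span_fourier hr hφ 1
  refine ⟨P, hP, fun ζ hζ => ?_⟩
  obtain ⟨θ, hθ⟩ : ∃ θ : AddCircle (2 * π), r * (AddCircle.toCircle θ : ℂ) = ζ := by
    rw [mem_sphere_zero_iff_norm] at hζ
    refine ⟨(Complex.arg ζ : ℝ), ?_⟩
    rw [AddCircle.toCircle_apply_mk, Circle.coe_exp, ← hζ]
    convert Complex.norm_mul_exp_arg_mul_I ζ using 4
    field_simp
  have h1 := (ContinuousMap.dist_apply_le_dist θ).trans hd.le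
  rw [Complex.dist_eq] at h1
  refine le_trans ?_ ((Complex.abs_re_le_norm _).trans h1)
  rw [← hθ, ← hre θ, one_mul, Complex.sub_re]
  simp

/-- Interior domains on whose boundary a continuous function is almost harmonic, inside a bounded
connected open set on which holomorphic functions have primitives. -/
theorem HasPrimitives.exists_re_near_of_isPreconnected {Q : Set ℂ} (hQ : IsOpen Q)
    (hQc : IsPreconnected Q) (hQb : Bornology.IsBounded Q) (hex : HasPrimitives Q) {K : Set ℂ}
    (hK : IsCompact K) (hKQ : K ⊆ Q) {V : ℂ → ℝ} (hV : ContinuousOn V Q) {ε : ℝ} (hε : 0 < ε) :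
    ∃ (G : ℂ → ℂ) (Q' : Set ℂ), DifferentiableOn ℂ G Q ∧ IsOpen Q' ∧ K ⊆ Q' ∧ closure Q' ⊆ Q ∧
      ∀ z ∈ frontier Q', |V z - (G z).re| ≤ ε := by
  rcases Q.eq_empty_or_nonempty with rfl | ⟨z₀, hz₀⟩
  · exact ⟨0, ∅, by simp [DifferentiableOn], isOpen_empty, hKQ, by simp, by simp⟩
  obtain ⟨ρ, hρ, hb⟩ := exists_forall_isDiscMap_le hQ hQc hz₀ hK hKQ
  obtain ⟨r, hr, hr1⟩ := exists_between (max_lt hρ zero_lt_one)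
  obtain ⟨r', hr', hr1'⟩ := exists_between hr1
  have hr0 : 0 < r := (le_max_right _ _).trans_lt hr
  obtain ⟨f, hf, hsub⟩ := exists_isDiscEmbedding_ball_subset hQ hQc hQb hex hz₀
    (hr0.trans hr') hr1'
  have hopen : ∀ s ⊆ Q, IsOpen s → IsOpen (f '' s) := by
    refine ((hf.1.analyticOnNhd hQ).is_constant_or_isOpen hQc).resolve_left ?_
    rintro ⟨w, hw⟩
    obtain ⟨z, hz, hfz⟩ := hsub (show ((r / 2 : ℝ) : ℂ) ∈ Metric.ball 0 r' by
      rw [mem_ball_zero_iff, Complex.norm_real, norm_eq_abs, abs_of_pos (by positivity)]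
      linarith)
    rw [hw z hz, ← hw z₀ hz₀, hf.2.2.2] at hfz
    have : (r / 2 : ℝ) = 0 := by exact_mod_cast hfz.symm
    linarith
  set g := Function.invFunOn f Q
  have hgl : ∀ z ∈ Q, g (f z) = z := fun z hz => hf.2.1.leftInvOn_invFunOn hz
  have hsub' : Metric.closedBall (0 : ℂ) r ⊆ f '' Q :=
    (Metric.closedBall_subset_ball hr').trans hsub
  have hgr : ∀ w ∈ f '' Q, f (g w) = w := fun w hw => Function.invFunOn_eq hw
  have hgm : ∀ w ∈ f '' Q, g w ∈ Q := fun w hw => Function.invFunOn_mem hw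
  have hgc : ContinuousOn g (f '' Q) := by
    intro w hw
    refine ContinuousAt.continuousWithinAt (tendsto_nhds.2 fun O hO hwO => ?_)
    refine Filter.mem_of_superset ((hopen (O ∩ Q) Set.inter_subset_right (hO.inter hQ)).mem_nhds
      ⟨g w, ⟨hwO, hgm w hw⟩, hgr w hw⟩) ?_
    rintro _ ⟨z, ⟨hzO, hzQ⟩, rfl⟩
    rw [Set.mem_preimage, hgl z hzQ]; exact hzO
  obtain ⟨P, hP, hPV⟩ := exists_entire_re_near_sphere hr0 (h := fun w => V (g w))
    (hV.comp (hgc.mono (Metric.sphere_subset_closedBall.trans hsub'))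
      fun w hw => hgm w (hsub' (Metric.sphere_subset_closedBall hw))) hε
  have hLc : IsCompact (g '' Metric.closedBall 0 r) :=
    (isCompact_closedBall 0 r).image_of_continuousOn (hgc.mono hsub')
  have hLQ : g '' Metric.closedBall 0 r ⊆ Q := by
    rintro _ ⟨w, hw, rfl⟩; exact hgm w (hsub' hw)
  have hQo : IsOpen (Q ∩ f ⁻¹' Metric.ball 0 r) := hf.1.continuousOn.isOpen_inter_preimage hQ
    Metric.isOpen_ball
  have hcl : closure (Q ∩ f ⁻¹' Metric.ball 0 r) ⊆ g '' Metric.closedBall 0 r :=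
    closure_minimal (fun z hz => ⟨f z, Metric.ball_subset_closedBall hz.2, hgl z hz.1⟩)
      hLc.isClosed
  refine ⟨fun z => P (f z), Q ∩ f ⁻¹' Metric.ball 0 r, hP.comp_differentiableOn hf.1, hQo,
    fun z hz => ⟨hKQ hz, ?_⟩, hcl.trans hLQ, fun z hz => ?_⟩
  · rw [Set.mem_preimage, mem_ball_zero_iff]
    exact (hb f ⟨hf.1, hf.2.2⟩ z hz).trans_lt ((le_max_left _ _).trans_lt hr)
  · rw [hQo.frontier_eq] at hz
    obtain ⟨w, hw, rfl⟩ := hcl hz.1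
    have hws : w ∈ Metric.sphere 0 r := by
      rw [mem_sphere_zero_iff_norm]
      refine le_antisymm (mem_closedBall_zero_iff.1 hw) (not_lt.1 fun hlt => hz.2 ?_)
      refine ⟨hgm w (hsub' hw), ?_⟩
      rwa [Set.mem_preimage, hgr w (hsub' hw), mem_ball_zero_iff]
    have := hPV w hws
    simpa [hgr w (hsub' hw)] using this

theorem connectedComponentIn_eq_of_mem_inter {W : Set ℂ} {x y z : ℂ}
    (hx : z ∈ connectedComponentIn W x) (hy : z ∈ connectedComponentIn W y) :
    connectedComponentIn W x = connectedComponentIn W y :=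
  (connectedComponentIn_eq hx).trans (connectedComponentIn_eq hy).symm

theorem isOpen_diff_connectedComponentIn {W : Set ℂ} (hW : IsOpen W) (x : ℂ) :
    IsOpen (W \ connectedComponentIn W x) := by
  have : W \ connectedComponentIn W x =
      ⋃ z ∈ W \ connectedComponentIn W x, connectedComponentIn W z := by
    refine subset_antisymm (fun z hz => Set.mem_biUnion hz (mem_connectedComponentIn hz.1)) ?_
    refine Set.iUnion₂_subset fun z hz w hw => ⟨connectedComponentIn_subset _ _ hw, fun hwx => hz.2 ?_⟩
    rw [connectedComponentIn_eq_of_mem_inter hwx hw]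
    exact mem_connectedComponentIn hz.1
  rw [this]
  exact isOpen_biUnion fun z _ => hW.connectedComponentIn

theorem HasPrimitives.connectedComponentIn {W : Set ℂ} (hW : IsOpen W) (hex : HasPrimitives W)
    (x : ℂ) : HasPrimitives (connectedComponentIn W x) := by
  intro g hg
  have hQ : IsOpen (_root_.connectedComponentIn W x) := hW.connectedComponentIn
  obtain ⟨F, hF⟩ := hex ((_root_.connectedComponentIn W x).indicator g) fun z hz => by
    refine DifferentiableAt.differentiableWithinAt ?_
    by_cases hzQ : z ∈ _root_.connectedComponentIn W x
    · refine (hg.differentiableAt (hQ.mem_nhds hzQ)).congr_of_eventuallyEq ?_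
      filter_upwards [hQ.mem_nhds hzQ] with w hw using Set.indicator_of_mem hw _
    · refine (differentiableAt_const (0 : ℂ)).congr_of_eventuallyEq ?_
      filter_upwards [(isOpen_diff_connectedComponentIn hW x).mem_nhds ⟨hz, hzQ⟩] with w hw using
        Set.indicator_of_notMem hw.2 _
  refine ⟨F, fun z hz => ?_⟩
  have := hF z (connectedComponentIn_subset _ _ hz)
  rwa [Set.indicator_of_mem hz] at this

/-- Interior domains on whose boundary a continuous function is almost harmonic, inside a bounded
set which is open and on which holomorphic functions have primitives. -/
theorem HasPrimitives.exists_re_near {W : Set ℂ} (hW : IsOpen W) (hWb : Bornology.IsBounded W)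
    (hex : HasPrimitives W) {K : Set ℂ} (hK : IsCompact K) (hKW : K ⊆ W) {V : ℂ → ℝ}
    (hV : ContinuousOn V W) {ε : ℝ} (hε : 0 < ε) :
    ∃ (G : ℂ → ℂ) (Q' : Set ℂ), DifferentiableOn ℂ G W ∧ IsOpen Q' ∧ K ⊆ Q' ∧ closure Q' ⊆ W ∧
      ∀ z ∈ frontier Q', |V z - (G z).re| ≤ ε := by
  have H : ∀ Q : Set ℂ, ∃ (G : ℂ → ℂ) (Q' : Set ℂ), (∃ x ∈ W, Q = _root_.connectedComponentIn W x) →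
      DifferentiableOn ℂ G Q ∧ IsOpen Q' ∧ K ∩ Q ⊆ Q' ∧ closure Q' ⊆ Q ∧
      ∀ z ∈ frontier Q', |V z - (G z).re| ≤ ε := fun Q => by
    by_cases h : ∃ x ∈ W, Q = _root_.connectedComponentIn W x
    · obtain ⟨x, hx, rfl⟩ := h
      have hKc : IsCompact (K ∩ _root_.connectedComponentIn W x) := by
        have : K ∩ _root_.connectedComponentIn W x = K \ (W \ _root_.connectedComponentIn W x) := by
          ext z
          simp only [Set.mem_inter_iff, Set.mem_sdiff, not_and, not_not]
          exact ⟨fun h => ⟨h.1, fun _ => h.2⟩, fun h => ⟨h.1, h.2 (hKW h.1)⟩⟩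
        rw [this]; exact hK.diff (isOpen_diff_connectedComponentIn hW x)
      obtain ⟨G, Q', h⟩ := (hex.connectedComponentIn hW x).exists_re_near_of_isPreconnected
        hW.connectedComponentIn isPreconnected_connectedComponentIn
        (hWb.subset (connectedComponentIn_subset _ _)) hKc Set.inter_subset_right
        (hV.mono (connectedComponentIn_subset _ _)) hε
      exact ⟨G, Q', fun _ => h⟩
    · exact ⟨0, ∅, fun h' => absurd h' h⟩
  choose G Q' hGQ using H
  have hGx := fun x (hx : x ∈ W) => hGQ (_root_.connectedComponentIn W x) ⟨x, hx, rfl⟩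
  obtain ⟨t, ht, hKt⟩ := hK.elim_nhds_subcover (fun x => _root_.connectedComponentIn W x)
    fun x hx => hW.connectedComponentIn.mem_nhds (mem_connectedComponentIn (hKW hx))
  have hcl : closure (⋃ x ∈ t, Q' (_root_.connectedComponentIn W x)) ⊆
      ⋃ x ∈ t, closure (Q' (_root_.connectedComponentIn W x)) :=
    (t.finite_toSet.closure_biUnion (f := fun x => Q' (_root_.connectedComponentIn W x))).subset
  refine ⟨fun z => G (_root_.connectedComponentIn W z) z,
    ⋃ x ∈ t, Q' (_root_.connectedComponentIn W x), fun z hz => ?_,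
    isOpen_biUnion fun x hx => (hGx x (hKW (ht x hx))).2.1, fun z hz => ?_, fun z hz => ?_,
    fun z hz => ?_⟩
  · have hQ : IsOpen (_root_.connectedComponentIn W z) := hW.connectedComponentIn
    have hzm := hQ.mem_nhds (mem_connectedComponentIn hz)
    refine (((hGx z hz).1.differentiableAt hzm).congr_of_eventuallyEq ?_).differentiableWithinAt
    filter_upwards [hzm] with w hw
    rw [← connectedComponentIn_eq hw]
  · obtain ⟨x, hx, hzx⟩ := Set.mem_iUnion₂.1 (hKt hz)
    exact Set.mem_biUnion hx ((hGx x (hKW (ht x hx))).2.2.1 ⟨hz, hzx⟩)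
  · obtain ⟨x, hx, hzx⟩ := Set.mem_iUnion₂.1 (hcl hz)
    exact connectedComponentIn_subset _ _ ((hGx x (hKW (ht x hx))).2.2.2.1 hzx)
  · obtain ⟨x, hx, hzx⟩ := Set.mem_iUnion₂.1 (hcl hz.1)
    have h := hGx x (hKW (ht x hx))
    have h1 := h.2.2.2.2 z ⟨hzx, fun hzi => hz.2 (interior_mono
      (Set.subset_biUnion_of_mem (u := fun x => Q' (_root_.connectedComponentIn W x)) hx) hzi)⟩
    rwa [connectedComponentIn_eq (h.2.2.2.1 hzx)] at h1

theorem hasDerivAt_log_one_add_div {z z' ξ : ℂ} (h : ‖z' - z‖ < ‖ξ - z'‖) :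
    HasDerivAt (fun ξ => Complex.log (1 + (z' - z) / (ξ - z'))) (1 / (ξ - z) - 1 / (ξ - z')) ξ := by
  have h0 : ξ - z' ≠ 0 := norm_pos_iff.1 ((norm_nonneg _).trans_lt h)
  have h1 : ξ - z ≠ 0 := fun h1 => by
    rw [show ξ - z' = -(z' - z) by linear_combination h1, norm_neg] at h
    exact h.false
  have h2 : ‖(z' - z) / (ξ - z')‖ < 1 := by
    rwa [norm_div, div_lt_one (norm_pos_iff.2 h0)]
  have h3 := (((hasDerivAt_const ξ (z' - z)).div ((hasDerivAt_id ξ).sub_const z') h0).const_add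
    1).clog (Complex.mem_slitPlane_of_norm_lt_one h2)
  refine h3.congr_deriv ?_
  have h4 : 1 + (z' - z) / (ξ - z') ≠ 0 := by
    rw [show 1 + (z' - z) / (ξ - z') = (ξ - z) / (ξ - z') by field_simp; ring]
    exact div_ne_zero h1 h0
  simp only [id, Pi.div_apply] at h4 ⊢
  rw [show 1 + (z' - z) / (ξ - z') = (ξ - z) / (ξ - z') by field_simp; ring]
  field_simp
  ring

theorem exists_open_le_norm_sub {K : Set ℂ} (hK : IsClosed K) {z : ℂ} (hz : z ∉ K) :
    ∃ δ > 0, ∃ V, IsOpen V ∧ K ⊆ V ∧ ∀ ξ ∈ V, 4 * δ < ‖ξ - z‖ := by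
  obtain ⟨r, hr, h⟩ := Metric.isOpen_iff.1 hK.isOpen_compl z hz
  refine ⟨r / 5, by positivity, (Metric.closedBall z (4 * (r / 5)))ᶜ,
    Metric.isClosed_closedBall.isOpen_compl, fun ξ hξ hb => ?_, fun ξ hξ => ?_⟩
  · refine h ?_ hξ
    rw [Metric.mem_closedBall] at hb
    rw [Metric.mem_ball]; linarith
  · rw [Set.mem_compl_iff, Metric.mem_closedBall, dist_eq_norm, not_le] at hξ
    exact hξ

/-- Simple poles off a compact set with connected complement have primitives near it. -/
theorem exists_primitive_inv_sub {K : Set ℂ} (hK : IsCompact K) (hKc : IsPreconnected Kᶜ) {z : ℂ}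
    (hz : z ∉ K) : ∃ V, IsOpen V ∧ K ⊆ V ∧ ∃ L : ℂ → ℂ, ∀ ξ ∈ V, HasDerivAt L (1 / (ξ - z)) ξ := by
  set A : Set ℂ := {z | ∃ V, IsOpen V ∧ K ⊆ V ∧ ∃ L : ℂ → ℂ, ∀ ξ ∈ V,
    HasDerivAt L (1 / (ξ - z)) ξ} with hA
  have key : ∀ z ∉ K, ∃ δ > 0, ∀ z' ∈ Metric.ball z δ, z' ∈ A → ∀ z'' ∈ Metric.ball z δ, z'' ∈ A := by
    intro z hz
    obtain ⟨δ, hδ, V, hV, hKV, hVδ⟩ := exists_open_le_norm_sub hK.isClosed hz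
    refine ⟨δ, hδ, ?_⟩
    rintro z' hz' ⟨V', hV', hKV', L, hL⟩ z'' hz''
    refine ⟨V ∩ V', hV.inter hV', Set.subset_inter hKV hKV',
      fun ξ => Complex.log (1 + (z' - z'') / (ξ - z')) + L ξ, fun ξ hξ => ?_⟩
    have h1 := hVδ ξ hξ.1
    rw [mem_ball_iff_norm] at hz' hz''
    have h2 : ‖z' - z''‖ < ‖ξ - z'‖ := by
      have e1 : ‖z' - z''‖ ≤ ‖z' - z‖ + ‖z'' - z‖ := by
        rw [← sub_sub_sub_cancel_right z' z'' z]; exact norm_sub_le _ _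
      have e2 : ‖ξ - z‖ ≤ ‖ξ - z'‖ + ‖z' - z‖ := by
        rw [← sub_add_sub_cancel ξ z' z]; exact norm_add_le _ _
      linarith
    exact ((hasDerivAt_log_one_add_div h2).add (hL ξ hξ.2)).congr_deriv (by ring)
  have hsub : Kᶜ ⊆ interior A := by
    refine hKc.subset_of_closure_inter_subset isOpen_interior ?_ ?_
    · obtain ⟨R, hR0, hR⟩ := hK.isBounded.subset_ball_lt 0 0
      have hfar : ∀ z : ℂ, R < ‖z‖ → z ∈ A := fun z hz => by
        refine ⟨Metric.ball 0 R, Metric.isOpen_ball, hR, fun ξ => Complex.log (1 + -ξ / z), ?_⟩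
        intro ξ hξ
        rw [mem_ball_zero_iff] at hξ
        have hz0 : z ≠ 0 := norm_pos_iff.1 (hR0.trans hz)
        have hne : ξ - z ≠ 0 := fun h => by rw [sub_eq_zero.1 h] at hξ; linarith
        have h2 : ‖-ξ / z‖ < 1 := by
          rw [norm_div, norm_neg, div_lt_one (hR0.trans hz)]; linarith
        have h3 := ((((hasDerivAt_id ξ).neg).div_const z).const_add 1).clog
          (Complex.mem_slitPlane_of_norm_lt_one h2)
        refine h3.congr_deriv ?_
        simp only [Pi.neg_apply, id]
        rw [show 1 + -ξ / z = -(ξ - z) / z by field_simp; ring]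
        field_simp
      have hmem : ((R + 1 : ℝ) : ℂ) ∈ {z : ℂ | R < ‖z‖} := by
        rw [Set.mem_ofPred_eq, Complex.norm_real, norm_eq_abs, abs_of_pos (by linarith)]
        linarith
      refine ⟨((R + 1 : ℝ) : ℂ), fun h => ?_, interior_maximal (fun z hz => hfar z hz)
        (isOpen_lt continuous_const continuous_norm) hmem⟩
      have := mem_ball_zero_iff.1 (hR h)
      exact lt_asymm this hmem
    · rintro z ⟨hzc, hzK⟩
      obtain ⟨δ, hδ, h⟩ := key z hzK
      obtain ⟨z', hz'A, hz'⟩ := Metric.mem_closure_iff.1 hzc δ hδ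
      exact interior_maximal (h z' (by rwa [Metric.mem_ball, dist_comm]) (interior_subset hz'A))
        Metric.isOpen_ball (Metric.mem_ball_self hδ)
  have hzA : z ∈ A := interior_subset (hsub hz)
  exact hzA

/-- Cauchy transforms of densities supported in `s` have primitives near `K`. -/
def CauchyExact (K s : Set ℂ) : Prop :=
  ∃ s' V, s ⊆ s' ∧ MeasurableSet s' ∧ IsOpen V ∧ K ⊆ V ∧
    (∃ δ > 0, ∀ ξ ∈ V, ∀ z ∈ s', δ ≤ ‖ξ - z‖) ∧
    ∀ h : ℂ → ℂ, Integrable h → (∀ z ∉ s', h z = 0) →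
      ∃ F : ℂ → ℂ, ∀ ξ ∈ V, HasDerivAt F (∫ z, h z / (ξ - z)) ξ

theorem integrable_div_sub {s : Set ℂ} {ξ : ℂ} {δ : ℝ} (hδ : 0 < δ) (h : ∀ z ∈ s, δ ≤ ‖ξ - z‖)
    {f : ℂ → ℂ} (hf : Integrable f) (hf0 : ∀ z ∉ s, f z = 0) :
    Integrable fun z => f z / (ξ - z) := by
  refine Integrable.mono' (hf.norm.div_const δ) ?_ (ae_of_all _ fun z => ?_)
  · exact (hf.aestronglyMeasurable.aemeasurable.div (by fun_prop)).aestronglyMeasurable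
  · by_cases hz : z ∈ s
    · rw [norm_div]
      exact div_le_div_of_nonneg_left (norm_nonneg _) hδ (h z hz)
    · simp [hf0 z hz]

theorem CauchyExact.union {K s t : Set ℂ} (hs : CauchyExact K s) (ht : CauchyExact K t) :
    CauchyExact K (s ∪ t) := by
  obtain ⟨s', V, hss, hsm, hV, hKV, ⟨δ, hδ, hd⟩, hF⟩ := hs
  obtain ⟨t', U, htt, htm, hU, hKU, ⟨δ', hδ', hd'⟩, hF'⟩ := ht
  refine ⟨s' ∪ t', V ∩ U, Set.union_subset_union hss htt, hsm.union htm, hV.inter hU,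
    Set.subset_inter hKV hKU, ⟨min δ δ', lt_min hδ hδ', fun ξ hξ z hz => hz.elim
      (fun hz => (min_le_left _ _).trans (hd ξ hξ.1 z hz))
      (fun hz => (min_le_right _ _).trans (hd' ξ hξ.2 z hz))⟩, fun h hh h0 => ?_⟩
  have h1 := hh.indicator hsm
  have h2 := hh.indicator hsm.compl
  have z1 : ∀ z ∉ s', s'.indicator h z = 0 := fun z hz => Set.indicator_of_notMem hz _
  have z2 : ∀ z ∉ t', s'ᶜ.indicator h z = 0 := fun z hz => by
    by_cases hzs : z ∈ s'
    · exact Set.indicator_of_notMem (by simpa using hzs) _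
    · rw [Set.indicator_of_mem (show z ∈ s'ᶜ from hzs), h0 z (fun h => h.elim hzs hz)]
  obtain ⟨F, hF⟩ := hF _ h1 z1
  obtain ⟨F', hF'⟩ := hF' _ h2 z2
  refine ⟨fun ξ => F ξ + F' ξ, fun ξ hξ => ((hF ξ hξ.1).add (hF' ξ hξ.2)).congr_deriv ?_⟩
  rw [← integral_add (integrable_div_sub hδ (hd ξ hξ.1) h1 z1)
    (integrable_div_sub hδ' (hd' ξ hξ.2) h2 z2)]
  refine integral_congr_ae (ae_of_all _ fun z => ?_)
  dsimp only
  rw [← add_div, ← Pi.add_apply, Set.indicator_self_add_compl]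

theorem exists_cauchyExact_ball {K : Set ℂ} (hK : IsCompact K) (hKc : IsPreconnected Kᶜ) {z₀ : ℂ}
    (hz₀ : z₀ ∉ K) : ∃ δ > 0, CauchyExact K (Metric.ball z₀ δ) := by
  obtain ⟨δ, hδ, V, hV, hKV, hVδ⟩ := exists_open_le_norm_sub hK.isClosed hz₀
  obtain ⟨V', hV', hKV', L, hL⟩ := exists_primitive_inv_sub hK hKc hz₀
  have hlow : ∀ ξ ∈ V, ∀ z ∈ Metric.ball z₀ δ, δ ≤ ‖ξ - z‖ := fun ξ hξ z hz => by
    have e2 : ‖ξ - z₀‖ ≤ ‖ξ - z‖ + ‖z - z₀‖ := by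
      rw [← sub_add_sub_cancel ξ z z₀]; exact norm_add_le _ _
    rw [mem_ball_iff_norm] at hz
    linarith [hVδ ξ hξ]
  refine ⟨δ, hδ, Metric.ball z₀ δ, V ∩ V', subset_rfl, measurableSet_ball, hV.inter hV',
    Set.subset_inter hKV hKV', ⟨δ, hδ, fun ξ hξ => hlow ξ hξ.1⟩, fun h hh h0 => ?_⟩
  have hlogm : ∀ ξ : ℂ, AEStronglyMeasurable (fun z => h z * Complex.log (1 + (z₀ - z) / (ξ - z₀))) :=
    fun ξ => hh.aestronglyMeasurable.mul (by
      apply Measurable.aestronglyMeasurable; fun_prop)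
  have hI : ∀ ξ ∈ V, HasDerivAt (fun ξ => ∫ z, h z * Complex.log (1 + (z₀ - z) / (ξ - z₀)))
      (∫ z, h z * (1 / (ξ - z) - 1 / (ξ - z₀))) ξ := fun ξ hξ => by
    refine (hasDerivAt_integral_of_dominated_loc_of_deriv_le (F := fun ξ z => h z * Complex.log (1 + (z₀ - z) / (ξ - z₀)))
      (F' := fun ξ z => h z * (1 / (ξ - z) - 1 / (ξ - z₀)))
      (bound := fun z => ‖h z‖ * (1 / δ + 1 / δ)) (hV.mem_nhds hξ)
      (Filter.Eventually.of_forall hlogm) ?_ ?_ ?_ ?_ ?_).2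
    · refine Integrable.mono' (hh.norm.mul_const 1) (hlogm ξ) (ae_of_all _ fun z => ?_)
      by_cases hz : z ∈ Metric.ball z₀ δ
      · rw [norm_mul]
        have h1 : ‖(z₀ - z) / (ξ - z₀)‖ ≤ 1 / 4 := by
          rw [norm_div, div_le_iff₀ (by linarith [hVδ ξ hξ]), norm_sub_rev]
          rw [mem_ball_iff_norm] at hz
          linarith [hVδ ξ hξ]
        have h2 := Complex.norm_log_one_add_half_le_self (h1.trans (by norm_num))
        exact mul_le_mul_of_nonneg_left (by linarith) (norm_nonneg _)
      · simp [h0 z hz]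
    · exact hh.aestronglyMeasurable.mul (by apply Measurable.aestronglyMeasurable; fun_prop)
    · refine ae_of_all _ fun z x hx => ?_
      by_cases hz : z ∈ Metric.ball z₀ δ
      · rw [norm_mul]
        refine mul_le_mul_of_nonneg_left ((norm_sub_le _ _).trans (add_le_add ?_ ?_)) (norm_nonneg _)
        · rw [norm_div, norm_one]
          exact one_div_le_one_div_of_le hδ (hlow x hx z hz)
        · rw [norm_div, norm_one]
          exact one_div_le_one_div_of_le hδ (hlow x hx z₀ (Metric.mem_ball_self hδ))
      · simp [h0 z hz]
    · exact hh.norm.mul_const _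
    · refine ae_of_all _ fun z x hx => ?_
      by_cases hz : z ∈ Metric.ball z₀ δ
      · refine (hasDerivAt_log_one_add_div ?_).const_mul _
        rw [norm_sub_rev]
        exact (mem_ball_iff_norm.1 hz).trans_le (hlow x hx z₀ (Metric.mem_ball_self hδ))
      · simp only [h0 z hz, zero_mul]
        exact hasDerivAt_const _ _
  refine ⟨fun ξ => (∫ z, h z) * L ξ + ∫ z, h z * Complex.log (1 + (z₀ - z) / (ξ - z₀)),
    fun ξ hξ => (((hL ξ hξ.2).const_mul _).add (hI ξ hξ.1)).congr_deriv ?_⟩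
  have e : (fun z => h z * (1 / (ξ - z) - 1 / (ξ - z₀))) =
      fun z => h z / (ξ - z) - h z * (1 / (ξ - z₀)) := by
    funext z; ring
  rw [e, integral_sub (integrable_div_sub hδ (hlow ξ hξ.1) hh h0) (hh.mul_const _),
    integral_mul_const]
  ring

theorem exists_primitive_near_compact {K U : Set ℂ} (hK : IsCompact K) (hKc : IsPreconnected Kᶜ)
    (hU : IsOpen U) (hKU : K ⊆ U) {g : ℂ → ℂ} (hg : DifferentiableOn ℂ g U) :
    ∃ V, IsOpen V ∧ K ⊆ V ∧ ∃ F : ℂ → ℂ, ∀ ξ ∈ V, HasDerivAt F (g ξ) ξ := by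
  obtain ⟨χ, hχ, hχc, hχU, ⟨V₀, hV₀, hKV₀, hχ1⟩, -⟩ := exists_smooth_cutoff hK hU hKU
  have hf : ContDiff ℝ 1 fun z => (χ z : ℂ) * g z := by
    refine contDiff_of_forall_mem_tsupport fun z hz => ?_
    have hzU : z ∈ U := hχU (closure_mono (show Function.support (fun z => (χ z : ℂ) * g z) ⊆
      Function.support χ from fun w hw h => hw (by simp [show χ w = 0 from h])) hz)
    have h1 : ContDiffAt ℝ 1 g z := ((hg.analyticAt (hU.mem_nhds hzU)).contDiffAt).restrict_scalars ℝ
    have h2 : ContDiff ℝ 1 fun z => (χ z : ℂ) :=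
      Complex.ofRealCLM.contDiff.comp (hχ.of_le (by exact_mod_cast le_top))
    exact h2.contDiffAt.mul h1
  have hfc : HasCompactSupport fun z => (χ z : ℂ) * g z :=
    hχc.mono fun z hz h => hz (by simp [h])
  set S := tsupport χ \ V₀ with hS
  have hSc : IsCompact S := hχc.isCompact.diff hV₀
  have h0 : ∀ z ∉ S, dbar (fun z => (χ z : ℂ) * g z) z = 0 := fun z hz => by
    by_cases hzV : z ∈ V₀
    · have hzU : z ∈ U := hχU (subset_tsupport χ (by simp [hχ1 z hzV]))
      have : (fun z => (χ z : ℂ) * g z) =ᶠ[nhds z] g := by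
        filter_upwards [hV₀.mem_nhds hzV] with w hw
        rw [hχ1 w hw, Complex.ofReal_one, one_mul]
      rw [this.dbar_eq, dbar_of_differentiableAt (hg.differentiableAt (hU.mem_nhds hzU))]
    · have hzs : z ∉ tsupport χ := fun h => hz ⟨h, hzV⟩
      have : (fun z => (χ z : ℂ) * g z) =ᶠ[nhds z] fun _ => 0 := by
        filter_upwards [(isClosed_tsupport χ).isOpen_compl.mem_nhds hzs] with w hw
        rw [image_eq_zero_of_notMem_tsupport hw, Complex.ofReal_zero, zero_mul]
      rw [this.dbar_eq, dbar_of_differentiableAt (differentiableAt_const _)]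
  have hex : CauchyExact K S := by
    refine hSc.induction_on (p := CauchyExact K) ?_ ?_ (fun s t hs ht => hs.union ht) ?_
    · refine ⟨∅, Set.univ, subset_rfl, MeasurableSet.empty, isOpen_univ, Set.subset_univ _,
        ⟨1, one_pos, by simp⟩, fun h _ h0 => ⟨0, fun ξ _ => ?_⟩⟩
      have : ∀ z, h z = 0 := fun z => h0 z (Set.notMem_empty z)
      simp [this]
    · rintro s t hst ⟨s', V, h1, h2⟩
      exact ⟨s', V, hst.trans h1, h2⟩
    · rintro z ⟨-, hzV⟩
      obtain ⟨δ, hδ, h⟩ := exists_cauchyExact_ball hK hKc fun h => hzV (hKV₀ h)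
      exact ⟨_, mem_nhdsWithin_of_mem_nhds (Metric.ball_mem_nhds z hδ), h⟩
  obtain ⟨s', V, hSs, -, hV, hKV, -, hF⟩ := hex
  obtain ⟨F, hF⟩ := hF (dbar fun z => (χ z : ℂ) * g z)
    ((continuous_dbar hf).integrable_of_hasCompactSupport hfc.dbar) fun z hz => h0 z fun h => hz (hSs h)
  refine ⟨V ∩ V₀, hV.inter hV₀, Set.subset_inter hKV hKV₀, fun ξ => F ξ / π, fun ξ hξ => ?_⟩
  refine ((hF ξ hξ.1).div_const (π : ℂ)).congr_deriv ?_
  rw [integral_dbar_div_sub hf hfc, hχ1 ξ hξ.2, Complex.ofReal_one, one_mul]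
  have : (π : ℂ) ≠ 0 := by exact_mod_cast pi_ne_zero
  field_simp

theorem eq_add_of_hasDerivAt_of_isPreconnected {U V C : Set ℂ} (hU : IsOpen U) (hV : IsOpen V)
    (hC : IsPreconnected C) (hCU : C ⊆ U) (hCV : C ⊆ V) {F H g : ℂ → ℂ}
    (hF : ∀ z ∈ U, HasDerivAt F (g z) z) (hH : ∀ z ∈ V, HasDerivAt H (g z) z) {z w : ℂ}
    (hz : z ∈ C) (hw : w ∈ C) : F w - F z = H w - H z := by
  have hO : IsOpen (connectedComponentIn (U ∩ V) z) := (hU.inter hV).connectedComponentIn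
  have hsub := connectedComponentIn_subset (U ∩ V) z
  have hCs := hC.subset_connectedComponentIn hz (Set.subset_inter hCU hCV)
  have hd : ∀ x ∈ connectedComponentIn (U ∩ V) z, HasDerivAt (fun x => F x - H x) 0 x :=
    fun x hx => ((hF x (hsub hx).1).sub (hH x (hsub hx).2)).congr_deriv (sub_self _)
  have := hO.is_const_of_deriv_eq_zero isPreconnected_connectedComponentIn
    (fun x hx => (hd x hx).differentiableAt.differentiableWithinAt) (fun x hx => (hd x hx).deriv)
    (hCs hz) (hCs hw)
  linear_combination -this

theorem hasPrimitives_of_forall_compact {W : Set ℂ} (hW : IsOpen W)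
    (h : ∀ K ⊆ W, IsCompact K → ∃ K₁, K ⊆ K₁ ∧ K₁ ⊆ W ∧ IsCompact K₁ ∧ IsPreconnected K₁ᶜ) :
    HasPrimitives W := by
  intro g hg
  have hprim : ∀ K ⊆ W, IsCompact K → ∃ V, IsOpen V ∧ K ⊆ V ∧ ∃ F : ℂ → ℂ,
      ∀ ξ ∈ V, HasDerivAt F (g ξ) ξ := fun K hKW hK => by
    obtain ⟨K₁, hKK, hKW₁, hK₁, hKc⟩ := h K hKW hK
    obtain ⟨V, hV, hKV, hF⟩ := exists_primitive_near_compact hK₁ hKc hW hKW₁ hg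
    exact ⟨V, hV, hKK.trans hKV, hF⟩
  have hb : ∀ Q : Set ℂ, ∃ b, Q.Nonempty → b ∈ Q := fun Q => by
    by_cases hQ : Q.Nonempty
    · exact ⟨hQ.some, fun _ => hQ.some_mem⟩
    · exact ⟨0, fun h => absurd h hQ⟩
  choose b hb using hb
  have hbm : ∀ z ∈ W, b (connectedComponentIn W z) ∈ connectedComponentIn W z := fun z hz =>
    hb _ ⟨z, mem_connectedComponentIn hz⟩
  have hC : ∀ z, ∃ C : Set ℂ, z ∈ W → IsCompact C ∧ IsPreconnected C ∧ C ⊆ W ∧ z ∈ C ∧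
      b (connectedComponentIn W z) ∈ C := fun z => by
    by_cases hz : z ∈ W
    · have hp := (hW.connectedComponentIn.isConnected_iff_isPathConnected
        (U := connectedComponentIn W z)).1 (isConnected_connectedComponentIn_iff.2 hz)
      have hj := hp.joinedIn z (mem_connectedComponentIn hz) _ (hbm z hz)
      refine ⟨Set.range hj.somePath, fun _ => ⟨isCompact_range hj.somePath.continuous,
        isPreconnected_range hj.somePath.continuous, ?_, ⟨0, hj.somePath.source⟩,
        ⟨1, hj.somePath.target⟩⟩⟩
      rintro _ ⟨t, rfl⟩
      exact connectedComponentIn_subset _ _ (hj.somePath_mem t)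
    · exact ⟨∅, fun h => absurd h hz⟩
  choose C hC using hC
  have hP : ∀ z, ∃ (V : Set ℂ) (F : ℂ → ℂ), z ∈ W → IsOpen V ∧ C z ⊆ V ∧
      ∀ ξ ∈ V, HasDerivAt F (g ξ) ξ := fun z => by
    by_cases hz : z ∈ W
    · obtain ⟨V, hV, hCV, F, hF⟩ := hprim _ (hC z hz).2.2.1 (hC z hz).1
      exact ⟨V, F, fun _ => ⟨hV, hCV, hF⟩⟩
    · exact ⟨∅, 0, fun h => absurd h hz⟩
  choose V F hVF using hP
  refine ⟨fun z => F z z - F z (b (connectedComponentIn W z)), fun z hz => ?_⟩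
  obtain ⟨r, hr, hrW⟩ := Metric.isOpen_iff.1 hW z hz
  obtain ⟨F₀, hF₀⟩ := (hg.mono hrW).isExactOn_ball
  have hzr := Metric.mem_ball_self (x := z) hr
  refine ((hF₀ z hzr).add_const
    (F z z - F z (b (connectedComponentIn W z)) - F₀ z)).congr_of_eventuallyEq ?_
  filter_upwards [Metric.ball_mem_nhds z (half_pos hr)] with w hw
  have hwr : w ∈ Metric.ball z r := Metric.ball_subset_ball (by linarith) hw
  have hwW := hrW hwr
  have hcomp : connectedComponentIn W w = connectedComponentIn W z :=
    (connectedComponentIn_eq ((convex_ball z r).isPreconnected.subset_connectedComponentIn hzr hrW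
      hwr)).symm
  have hbW : Metric.closedBall z (r / 2) ⊆ W :=
    (Metric.closedBall_subset_ball (by linarith)).trans hrW
  obtain ⟨V', hV', hKV', H, hH⟩ := hprim (C z ∪ C w ∪ Metric.closedBall z (r / 2))
    (Set.union_subset (Set.union_subset (hC z hz).2.2.1 (hC w hwW).2.2.1) hbW)
    (((hC z hz).1.union (hC w hwW).1).union (isCompact_closedBall _ _))
  have e1 := eq_add_of_hasDerivAt_of_isPreconnected (hVF z hz).1 hV' (hC z hz).2.1 (hVF z hz).2.1
    (fun x hx => hKV' (Or.inl (Or.inl hx))) (hVF z hz).2.2 hH (hC z hz).2.2.2.2 (hC z hz).2.2.2.1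
  have e2 := eq_add_of_hasDerivAt_of_isPreconnected (hVF w hwW).1 hV' (hC w hwW).2.1 (hVF w hwW).2.1
    (fun x hx => hKV' (Or.inl (Or.inr hx))) (hVF w hwW).2.2 hH (hC w hwW).2.2.2.2
    (hC w hwW).2.2.2.1
  have e3 := eq_add_of_hasDerivAt_of_isPreconnected Metric.isOpen_ball hV'
    (convex_closedBall z (r / 2)).isPreconnected (Metric.closedBall_subset_ball (by linarith))
    (fun x hx => hKV' (Or.inr hx)) hF₀ hH (Metric.mem_closedBall_self (by positivity))
    (Metric.ball_subset_closedBall hw)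
  rw [hcomp] at e2 ⊢
  linear_combination e2 - e1 - e3

/-- The set `K` together with the components of its complement not containing `-i`. -/
def fill (K : Set ℂ) : Set ℂ := (connectedComponentIn Kᶜ (-Complex.I))ᶜ

theorem subset_fill (K : Set ℂ) : K ⊆ fill K := fun _ hz hzO =>
  connectedComponentIn_subset _ _ hzO hz

theorem fill_mono {K L : Set ℂ} (h : K ⊆ L) : fill K ⊆ fill L :=
  Set.compl_subset_compl.2 (connectedComponentIn_mono _ (Set.compl_subset_compl.2 h))

theorem IsClosed.fill {K : Set ℂ} (hK : IsClosed K) : IsClosed (fill K) :=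
  (hK.isOpen_compl.connectedComponentIn).isClosed_compl

theorem IsClosed.connectedComponentIn {F : Set ℂ} (hF : IsClosed F) (x : ℂ) :
    IsClosed (_root_.connectedComponentIn F x) := by
  by_cases hx : x ∈ F
  · refine isClosed_of_closure_subset ?_
    exact isPreconnected_connectedComponentIn.closure.subset_connectedComponentIn
      (subset_closure (mem_connectedComponentIn hx))
      (closure_minimal (connectedComponentIn_subset _ _) hF)
  · rw [connectedComponentIn_eq_empty hx]; exact isClosed_empty

theorem IsOpen.fill {K : Set ℂ} (hK : IsOpen K) : IsOpen (fill K) :=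
  (hK.isClosed_compl.connectedComponentIn _).isOpen_compl

theorem isPreconnected_compl_fill (K : Set ℂ) : IsPreconnected (fill K)ᶜ := by
  rw [fill, compl_compl]; exact isPreconnected_connectedComponentIn

theorem IsPreconnected.subset_fill {K S : Set ℂ} (hS : IsPreconnected S) (hSK : S ⊆ Kᶜ) {z : ℂ}
    (hzS : z ∈ S) (hz : z ∈ fill K) : S ⊆ fill K := by
  intro x hx hxO
  refine hz ?_
  rw [connectedComponentIn_eq hxO]
  exact hS.subset_connectedComponentIn hx hSK hzS

theorem IsPreconnected.subset_compl_fill {K S : Set ℂ} (hS : IsPreconnected S) (hSK : S ⊆ Kᶜ)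
    (hI : -Complex.I ∈ S) : S ⊆ (fill K)ᶜ := by
  rw [fill, compl_compl]; exact hS.subset_connectedComponentIn hI hSK

theorem convex_im_nonpos : Convex ℝ {z : ℂ | z.im ≤ 0} := convex_halfSpace_im_le 0

theorem fill_subset_im_pos {K : Set ℂ} (hK : K ⊆ {z | 0 < z.im}) : fill K ⊆ {z | 0 < z.im} := by
  intro z hz
  by_contra h
  exact (convex_im_nonpos.isPreconnected.subset_compl_fill
    (fun x (hx : x.im ≤ 0) hxK => (hx.trans_lt (hK hxK)).false) (by simp)) (show z.im ≤ 0 from not_lt.1 h) hz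

theorem isBounded_fill {K : Set ℂ} (hK : K ⊆ {z | 0 < z.im}) (hb : Bornology.IsBounded K) :
    Bornology.IsBounded (fill K) := by
  obtain ⟨R, hR0, hR⟩ := hb.subset_ball_lt 0 0
  have hnorm : ∀ z ∈ K, ‖z‖ < R := fun z hz => mem_ball_zero_iff.1 (hR hz)
  have key : ∀ S : Set ℂ, IsPreconnected S → (∀ z ∈ S, R ≤ ‖z‖) → ∀ x ∈ S, x ∈ (fill K)ᶜ →
      S ⊆ (fill K)ᶜ := fun S hS hSR x hxS hx z hz hzf =>
    hx (hS.subset_fill (fun y hy hyK => (hnorm y hyK).not_ge (hSR y hy)) hz hzf hxS)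
  have hlow : ∀ z : ℂ, z.im ≤ 0 → z ∈ (fill K)ᶜ := fun z hz hzf =>
    (hz.trans_lt (fill_subset_im_pos hK hzf)).false
  have h1 : {z : ℂ | z.re ≤ -R} ⊆ (fill K)ᶜ := by
    refine key _ (convex_halfSpace_re_le (-R)).isPreconnected (fun z hz => ?_) (-R : ℝ)
      (by simp) (hlow _ (by simp))
    have := Complex.abs_re_le_norm z
    exact le_trans (le_trans (by linarith [show z.re ≤ -R from hz]) (neg_le_abs _)) this
  have h2 : {z : ℂ | R ≤ z.re} ⊆ (fill K)ᶜ := by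
    refine key _ (convex_halfSpace_re_ge R).isPreconnected (fun z hz => ?_) (R : ℝ)
      (by simp) (hlow _ (by simp))
    exact le_trans (le_trans hz (le_abs_self _)) (Complex.abs_re_le_norm z)
  have h3 : {z : ℂ | R ≤ z.im} ⊆ (fill K)ᶜ := by
    refine key _ (convex_halfSpace_im_ge R).isPreconnected (fun z hz => ?_) ⟨R, R⟩ (by simp)
      (h2 (by simp))
    exact le_trans (le_trans hz (le_abs_self _)) (Complex.abs_im_le_norm z)
  refine (Metric.isBounded_ball (x := (0 : ℂ)) (r := 2 * R)).subset fun z hz => ?_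
  have i1 : -R < z.re := not_le.1 fun h => h1 h hz
  have i2 : z.re < R := not_le.1 fun h => h2 h hz
  have i3 : z.im < R := not_le.1 fun h => h3 h hz
  have i4 : 0 < z.im := fill_subset_im_pos hK hz
  rw [mem_ball_zero_iff]
  refine (Complex.norm_le_abs_re_add_abs_im z).trans_lt ?_
  have : |z.re| < R := abs_lt.2 ⟨i1, i2⟩
  rw [abs_of_pos i4]; linarith

theorem IsCompact.fill {K : Set ℂ} (hK : IsCompact K) (hKH : K ⊆ {z | 0 < z.im}) :
    IsCompact (fill K) :=
  Metric.isCompact_of_isClosed_isBounded hK.isClosed.fill (isBounded_fill hKH hK.isBounded)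

theorem frontier_fill_subset {K : Set ℂ} (hK : IsClosed K) : frontier (fill K) ⊆ K := by
  intro z hz
  by_contra hzK
  obtain ⟨r, hr, h⟩ := Metric.isOpen_iff.1 hK.isOpen_compl z hzK
  have hzf : z ∈ fill K := hK.fill.closure_subset hz.1
  exact hz.2 (interior_maximal ((convex_ball z r).isPreconnected.subset_fill h
    (Metric.mem_ball_self hr) hzf) Metric.isOpen_ball (Metric.mem_ball_self hr))

theorem fderiv_fderiv_apply_nonpos_of_isLocalMax {f : ℂ → ℝ} {z : ℂ} (hf : ContDiffAt ℝ 2 f z)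
    (hm : IsLocalMax f z) (v : ℂ) : fderiv ℝ (fun y => fderiv ℝ f y v) z v ≤ 0 := by
  by_contra! hpos
  set l : ℝ → ℂ := fun s => z + s • v with hl
  have hl0 : l 0 = z := by simp [hl]
  have hlc : Continuous l := by fun_prop
  have hld : ∀ s, HasDerivAt l v s := fun s => by
    simpa [hl] using ((hasDerivAt_id s).smul_const v).const_add z
  have htl : Filter.Tendsto l (nhds 0) (nhds z) := by simpa [hl0] using hlc.tendsto 0
  have hev : ∀ᶠ s in nhds (0 : ℝ), ContDiffAt ℝ 2 f (l s) :=
    htl.eventually (hf.eventually (by simp))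
  have hd1 : ∀ᶠ s in nhds (0 : ℝ), HasDerivAt (fun s => f (l s)) (fderiv ℝ f (l s) v) s := by
    filter_upwards [hev] with s hs
    exact (hs.differentiableAt (by norm_num)).hasFDerivAt.comp_hasDerivAt s (hld s)
  have hd1' : deriv (fun s => f (l s)) =ᶠ[nhds 0] fun s => fderiv ℝ f (l s) v :=
    hd1.mono fun s hs => hs.deriv
  have hd2 : HasDerivAt (fun s => fderiv ℝ f (l s) v) (fderiv ℝ (fun y => fderiv ℝ f y v) z v) 0 := by
    have h1 : DifferentiableAt ℝ (fun y => fderiv ℝ f y v) (l 0) := by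
      rw [hl0]
      exact ((hf.fderiv_right (m := 1) (by norm_num)).differentiableAt (by norm_num)).clm_apply
        (differentiableAt_const v)
    have := h1.hasFDerivAt.comp_hasDerivAt (0 : ℝ) (hld 0)
    rwa [hl0] at this
  have hlm : IsLocalMax (fun s => f (l s)) 0 := by
    have := htl.eventually hm
    simpa [IsLocalMax, IsMaxFilter, hl0] using this
  have hmin : IsLocalMin (fun s => f (l s)) 0 := by
    refine isLocalMin_of_deriv_deriv_pos ?_ hlm.deriv_eq_zero hd1.self_of_nhds.continuousAt
    rw [hd1'.deriv_eq, hd2.deriv]; exact hpos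
  have hc : (fun s => f (l s)) =ᶠ[nhds 0] fun _ => f (l 0) := by
    filter_upwards [hlm, hmin] with s h1 h2 using le_antisymm h1 h2
  have h0 : deriv (fun s => f (l s)) =ᶠ[nhds 0] fun _ => 0 := by
    filter_upwards [hc.eventuallyEq_nhds] with s hs
    rw [hs.deriv_eq, deriv_const]
  have := (h0.symm.trans hd1').deriv_eq
  rw [hd2.deriv, deriv_const] at this
  exact hpos.ne this

theorem lapC_nonpos_of_isLocalMax {f : ℂ → ℝ} {z : ℂ} (hf : ContDiffAt ℝ 2 f z)
    (hm : IsLocalMax f z) : lapC f z ≤ 0 :=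
  add_nonpos (fderiv_fderiv_apply_nonpos_of_isLocalMax hf hm 1)
    (fderiv_fderiv_apply_nonpos_of_isLocalMax hf hm Complex.I)

theorem lapC_neg (f : ℂ → ℝ) (z : ℂ) : lapC (fun y => -f y) z = -lapC f z := by
  simp only [lapC, fderiv_fun_neg, neg_apply]; ring

theorem lapC_nonneg_of_isLocalMin {f : ℂ → ℝ} {z : ℂ} (hf : ContDiffAt ℝ 2 f z)
    (hm : IsLocalMin f z) : 0 ≤ lapC f z := by
  have := lapC_nonpos_of_isLocalMax (f := fun y => -f y) hf.neg hm.neg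
  rw [lapC_neg] at this; linarith

theorem le_zero_of_lapC_pos {g : ℂ → ℝ} {B : Set ℂ} (hB : IsOpen B) (hBb : Bornology.IsBounded B)
    (hg : ContDiffOn ℝ 2 g B) (hgc : ContinuousOn g (closure B)) (hlap : ∀ z ∈ B, 0 < lapC g z)
    (hbd : ∀ z ∈ frontier B, g z ≤ 0) : ∀ z ∈ B, g z ≤ 0 := by
  intro z hz
  obtain ⟨m, hm, hmax⟩ := hBb.isCompact_closure.exists_isMaxOn ⟨z, subset_closure hz⟩ hgc
  refine (hmax (subset_closure hz)).trans ?_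
  by_cases hmB : m ∈ B
  · have := lapC_nonpos_of_isLocalMax (hg.contDiffAt (hB.mem_nhds hmB))
      ((hmax.on_subset subset_closure).isLocalMax (hB.mem_nhds hmB))
    exact absurd (hlap m hmB) this.not_gt
  · exact hbd m ⟨hm, by rwa [hB.interior_eq]⟩

/-- A bounded-level superharmonic configuration in the upper half plane. -/
structure LevelSystem (D : Set ℂ) (w : ℂ → ℝ) : Prop where
  isOpen : IsOpen D
  im_pos : D ⊆ {z | 0 < z.im}
  contDiff : ContDiff ℝ 2 w
  isCompact : ∀ s, 0 < s → IsCompact {z ∈ D | s ≤ w z}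
  lap_neg : ∀ z ∈ D, lapC w z < 0

namespace LevelSystem
variable {D : Set ℂ} {w : ℂ → ℝ} {s t : ℝ}

theorem level_subset (h : LevelSystem D w) : {z ∈ D | s ≤ w z} ⊆ {z | 0 < z.im} := fun _ hz => h.im_pos hz.1

theorem isCompact_fill (h : LevelSystem D w) (hs : 0 < s) : IsCompact (fill {z ∈ D | s ≤ w z}) :=
  (h.isCompact s hs).fill h.level_subset

theorem fill_anti (hst : t ≤ s) : fill {z ∈ D | s ≤ w z} ⊆ fill {z ∈ D | t ≤ w z} :=
  fill_mono fun _ hz => ⟨hz.1, hst.trans hz.2⟩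

theorem exists_notMem_of_mem_hole (h : LevelSystem D w) (hs : 0 < s) {z : ℂ} (hz : z ∈ fill {z ∈ D | s ≤ w z})
    (hzK : z ∉ {z ∈ D | s ≤ w z}) :
    ∃ z' ∈ connectedComponentIn {z ∈ D | s ≤ w z}ᶜ z, z' ∉ D := by
  by_contra! hcon
  set K := {z ∈ D | s ≤ w z} with hKdef
  set U := connectedComponentIn Kᶜ z with hU
  have hzU : z ∈ U := mem_connectedComponentIn hzK
  have hUK : U ⊆ Kᶜ := connectedComponentIn_subset _ _
  have hUf : U ⊆ fill K := isPreconnected_connectedComponentIn.subset_fill hUK hzU hz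
  have hUo : IsOpen U := (h.isCompact s hs).isClosed.isOpen_compl.connectedComponentIn
  have hcl : IsCompact (closure U) := ((h.isCompact_fill hs).isBounded.subset hUf).isCompact_closure
  obtain ⟨m, hm, hmin⟩ := hcl.exists_isMinOn ⟨z, subset_closure hzU⟩ h.contDiff.continuous.continuousOn
  have hzs : w z < s := by
    by_contra! hsz
    exact hzK ⟨hcon z hzU, hsz⟩
  have hmK : m ∈ Kᶜ := fun hmK => (hzs.trans_le hmK.2).not_ge (hmin (subset_closure hzU))
  have hmU : m ∈ U := by
    have : insert m U ⊆ U := by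
      refine IsPreconnected.subset_connectedComponentIn ?_ (Set.mem_insert_of_mem _ hzU)
        (Set.insert_subset hmK hUK)
      exact isPreconnected_connectedComponentIn.subset_closure (Set.subset_insert _ _)
        (Set.insert_subset hm subset_closure)
    exact this (Set.mem_insert _ _)
  have := lapC_nonneg_of_isLocalMin h.contDiff.contDiffAt
    ((hmin.on_subset subset_closure).isLocalMin (hUo.mem_nhds hmU))
  exact (h.lap_neg m (hcon m hmU)).not_ge this

theorem isOpen_superlevel (h : LevelSystem D w) : IsOpen {z ∈ D | t < w z} :=
  h.isOpen.inter (isOpen_lt continuous_const h.contDiff.continuous)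

/-- The filled open superlevel region is exhausted by the fills of compact levels. -/
theorem isOpen_iUnion_fill (h : LevelSystem D w) : IsOpen (⋃ s > t, fill {z ∈ D | s ≤ w z}) := by
  refine isOpen_iff_forall_mem_open.2 fun z hz => ?_
  simp only [Set.mem_iUnion] at hz
  obtain ⟨s, hs, hz⟩ := hz
  obtain ⟨s', hts, hss⟩ := exists_between hs
  refine ⟨fill {z ∈ D | s' < w z}, ?_, h.isOpen_superlevel.fill,
    fill_mono (show {z ∈ D | s ≤ w z} ⊆ _ from fun x (hx : x ∈ D ∧ s ≤ w x) =>
      (show x ∈ D ∧ s' < w x from ⟨hx.1, hss.trans_le hx.2⟩)) hz⟩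
  refine (fill_mono (show _ ⊆ {z ∈ D | s' ≤ w z} from fun x hx => ⟨hx.1, hx.2.le⟩)).trans
    (Set.subset_biUnion_of_mem (u := fun s => fill {z ∈ D | s ≤ w z}) hts)

theorem iUnion_fill_subset : (⋃ s > t, fill {z ∈ D | s ≤ w z}) ⊆ fill {z ∈ D | t ≤ w z} :=
  Set.iUnion₂_subset fun _ hs => fill_anti (le_of_lt hs)

theorem superlevel_subset : {z ∈ D | t < w z} ⊆ ⋃ s > t, fill {z ∈ D | s ≤ w z} := by
  intro z hz
  obtain ⟨s, h1, h2⟩ := exists_between hz.2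
  exact Set.mem_biUnion (show s > t from h1) (subset_fill _ ⟨hz.1, h2.le⟩)

theorem exists_fill_superset_of_isCompact (h : LevelSystem D w) {K : Set ℂ} (hK : IsCompact K)
    (hKW : K ⊆ ⋃ s > t, fill {z ∈ D | s ≤ w z}) : ∃ s > t, K ⊆ fill {z ∈ D | s ≤ w z} := by
  obtain ⟨n, hn⟩ := hK.elim_directed_cover
    (fun s : {s // t < s} => ⋃ r > (s : ℝ), fill {z ∈ D | r ≤ w z})
    (fun s => h.isOpen_iUnion_fill) (fun z hz => by
      have := hKW hz
      simp only [Set.mem_iUnion] at this ⊢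
      obtain ⟨s, hs, hz⟩ := this
      obtain ⟨s', h1, h2⟩ := exists_between hs
      exact ⟨⟨s', h1⟩, s, h2, hz⟩)
    (fun a b => ⟨⟨min a b, lt_min a.2 b.2⟩,
      Set.biUnion_subset_biUnion_left fun x (hx : (a : ℝ) < x) => (min_le_left _ _).trans_lt hx,
      Set.biUnion_subset_biUnion_left fun x (hx : (b : ℝ) < x) => (min_le_right _ _).trans_lt hx⟩)
  exact ⟨n, n.2, hn.trans iUnion_fill_subset⟩

theorem hasPrimitives (h : LevelSystem D w) (ht : 0 < t) : HasPrimitives (⋃ s > t, fill {z ∈ D | s ≤ w z}) := by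
  refine hasPrimitives_of_forall_compact h.isOpen_iUnion_fill fun K hKW hK => ?_
  obtain ⟨s, hs, hKs⟩ := h.exists_fill_superset_of_isCompact hK hKW
  exact ⟨_, hKs, Set.subset_biUnion_of_mem (u := fun s => fill {z ∈ D | s ≤ w z}) hs,
    h.isCompact_fill (ht.trans hs), isPreconnected_compl_fill _⟩

theorem exists_diff_subset_fill (h : LevelSystem D w) (ht : 0 < t) :
    ∃ s > t, (⋃ s > t, fill {z ∈ D | s ≤ w z}) \ {z ∈ D | t < w z} ⊆ fill {z ∈ D | s ≤ w z} := by
  set W := ⋃ s > t, fill {z ∈ D | s ≤ w z} with hW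
  obtain ⟨d, hd, hdD⟩ := (h.isCompact t ht).exists_thickening_subset_open h.isOpen
    (fun z hz => hz.1)
  have hball : ∀ z ∉ D, ∀ s ≥ t, Metric.ball z d ⊆ {z ∈ D | s ≤ w z}ᶜ := by
    intro z hz s hs x hx hxK
    exact hz (hdD (Metric.mem_thickening_iff.2 ⟨x, ⟨hxK.1, le_trans hs hxK.2⟩, by
      rw [dist_comm]; exact hx⟩))
  have htb : TotallyBounded (W \ D) :=
    (h.isCompact_fill ht).totallyBounded.subset (Set.sdiff_subset.trans iUnion_fill_subset)
  obtain ⟨S, hSW, hSf, hcov⟩ := totallyBounded_iff_subset.1 htb _ (Metric.dist_mem_uniformity hd)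
  have hchoose : ∀ z ∈ S, ∃ s > t, z ∈ fill {z ∈ D | s ≤ w z} := fun z hz => by
    simpa [hW] using (hSW hz).1
  choose! σ hσt hσ using hchoose
  obtain ⟨s', hs't, hs'⟩ : ∃ s' > t, ∀ z ∈ S, s' ≤ σ z := by
    rcases S.eq_empty_or_nonempty with rfl | hne
    · exact ⟨t + 1, by simp, by simp⟩
    · obtain ⟨a, ha, hmin⟩ := hSf.exists_minimalFor σ S hne
      refine ⟨σ a, hσt a ha, fun z hz => ?_⟩
      rcases le_total (σ a) (σ z) with h | h
      · exact h
      · exact hmin hz h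
  have hZ : W \ D ⊆ fill {z ∈ D | s' ≤ w z} := by
    intro z hz
    obtain ⟨a, ha, hza⟩ := Set.mem_iUnion₂.1 (hcov hz)
    refine fill_anti (hs' a ha) ?_
    exact (convex_ball z d).isPreconnected.subset_fill (hball z hz.2 _ (hσt a ha).le)
      (show a ∈ Metric.ball z d by rw [Metric.mem_ball, dist_comm]; exact hza) (hσ a ha)
      (Metric.mem_ball_self hd)
  refine ⟨s', hs't, fun z hz => ?_⟩
  obtain ⟨s, hs, hzs⟩ : ∃ s > t, z ∈ fill {z ∈ D | s ≤ w z} := by simpa [hW] using hz.1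
  have hzr : z ∈ fill {z ∈ D | min s s' ≤ w z} := fill_anti (min_le_left _ _) hzs
  have hrt : t < min s s' := lt_min hs hs't
  have hzK : z ∉ {z ∈ D | min s s' ≤ w z} := fun hk => hz.2 ⟨hk.1, hrt.trans_le hk.2⟩
  obtain ⟨z', hz', hz'D⟩ := h.exists_notMem_of_mem_hole (ht.trans hrt) hzr hzK
  have hsub := connectedComponentIn_subset {z ∈ D | min s s' ≤ w z}ᶜ z
  have hz'W : z' ∈ W := Set.mem_biUnion (show min s s' > t from hrt)
    (isPreconnected_connectedComponentIn.subset_fill hsub (mem_connectedComponentIn hzK) hzr hz')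
  exact isPreconnected_connectedComponentIn.subset_fill
    (hsub.trans (Set.compl_subset_compl.2 fun x hx => ⟨hx.1, (min_le_right _ _).trans hx.2⟩))
    hz' (hZ ⟨hz'W, hz'D⟩) (mem_connectedComponentIn hzK)

end LevelSystem

theorem lapC_const_mul_add_const {f : ℂ → ℝ} (hf : ContDiff ℝ 2 f) (c d : ℝ) (z : ℂ) :
    lapC (fun y => c * f y + d) z = c * lapC f z := by
  have hd : Differentiable ℝ f := hf.differentiable two_ne_zero
  have hd2 : ∀ v, Differentiable ℝ fun y => fderiv ℝ f y v := fun v =>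
    (((hf.fderiv_right (m := 1) (by norm_num)).differentiable one_ne_zero)).clm_apply
      (differentiable_const v)
  have h : ∀ v : ℂ, (fun y => fderiv ℝ (fun y => c * f y + d) y v) = fun y => c * fderiv ℝ f y v := by
    intro v; ext y
    have : HasFDerivAt (fun y => c * f y + d) (c • fderiv ℝ f y) y :=
      ((hd y).hasFDerivAt.const_mul c).add_const d
    rw [this.fderiv]; rfl
  have h2 : ∀ v, fderiv ℝ (fun y => c * fderiv ℝ f y v) z v = c * fderiv ℝ (fun y => fderiv ℝ f y v) z v := by
    intro v
    have : HasFDerivAt (fun y => c * fderiv ℝ f y v) (c • fderiv ℝ (fun y => fderiv ℝ f y v) z) z :=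
      ((hd2 v z).hasFDerivAt.const_mul c)
    rw [this.fderiv]; rfl
  simp only [lapC, h, h2]; ring

theorem lapC_normSq (z : ℂ) : lapC (fun z => ‖z‖ ^ 2) z = 4 := by
  have h : ∀ v : ℂ, (fun y => fderiv ℝ (fun z : ℂ => ‖z‖ ^ 2) y v) = fun y => 2 * inner ℝ y v := by
    intro v; ext y
    rw [(hasStrictFDerivAt_norm_sq y).hasFDerivAt.fderiv]
    simp; ring
  have h2 : ∀ v : ℂ, fderiv ℝ (fun y : ℂ => 2 * inner ℝ y v) z v = 2 * inner ℝ v v := by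
    intro v
    have : HasFDerivAt (fun y : ℂ => 2 * inner ℝ y v) ((2 : ℝ) • (innerSL ℝ).flip v) z := 
      (((innerSL ℝ).flip v).hasFDerivAt (x := z)).const_mul 2
    rw [this.fderiv]; rfl
  simp only [lapC, h, h2]
  simp; norm_num

theorem abs_le_of_lapC_lt {W B : Set ℂ} (hW : IsOpen W) (hB : IsOpen B)
    (hBb : Bornology.IsBounded B) (hBW : closure B ⊆ W) {f b : ℂ → ℝ} (hf : ContDiffOn ℝ 2 f W)
    (hb : ContDiff ℝ 2 b) (hlap : ∀ z ∈ B, |lapC f z| < -lapC b z)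
    (hbd : ∀ z ∈ frontier B, |f z| ≤ b z) : ∀ z ∈ B, |f z| ≤ b z := by
  have hBW' := subset_closure.trans hBW
  have key : ∀ g : ℂ → ℝ, ContDiffOn ℝ 2 g W → (∀ z ∈ B, -lapC g z < -lapC b z) →
      (∀ z ∈ frontier B, g z ≤ b z) → ∀ z ∈ B, g z ≤ b z := fun g hg hl hfr z hz => by
    have hgb : ContDiffOn ℝ 2 (fun z => g z - b z) W := hg.sub hb.contDiffOn
    have := le_zero_of_lapC_pos hB hBb (hgb.mono hBW') (hgb.continuousOn.mono hBW)
      (fun z hz => by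
        rw [lapC_sub hW hg hb.contDiffOn (hBW' hz)]
        have := hl z hz
        linarith)
      (fun z hz => by have := hfr z hz; linarith) z hz
    linarith
  intro z hz
  refine abs_le'.2 ⟨key f hf (fun z hz => (neg_le_abs _).trans_lt (hlap z hz))
    (fun z hz => (le_abs_self _).trans (hbd z hz)) z hz, key (fun z => -f z) hf.neg (fun z hz => ?_)
    (fun z hz => (neg_le_abs _).trans (hbd z hz)) z hz⟩
  rw [lapC_neg, neg_neg]
  exact (le_abs_self _).trans_lt (hlap z hz)

theorem exists_contDiff_step {η : ℝ} (h0 : 0 < η) (h1 : η < 1 / 2) :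
    ∃ ψ : ℝ → ℝ, ContDiff ℝ 1 ψ ∧ (∀ x ≤ η, ψ x = 0) ∧ ψ 1 = 1 ∧ (∀ x, 0 ≤ ψ x) ∧
      ∀ x, |deriv ψ x| ≤ 1 / (1 - 2 * η) := by
  set k : ℝ → ℝ := fun x => max 0 (min 1 (x / η - 1)) with hk
  have hkc : Continuous k := by fun_prop
  have hk0 : ∀ x, 0 ≤ k x := fun x => le_max_left _ _
  have hk1 : ∀ x, k x ≤ 1 := fun x => max_le zero_le_one (min_le_left _ _)
  have hkz : ∀ x ≤ η, k x = 0 := fun x hx => by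
    refine max_eq_left ((min_le_right _ _).trans ?_)
    rw [sub_nonpos, div_le_one h0]; exact hx
  have hko : ∀ x, 2 * η ≤ x → k x = 1 := fun x hx => by
    have : 1 ≤ x / η - 1 := by rw [le_sub_iff_add_le, le_div_iff₀ h0]; linarith
    simp [hk, min_eq_left this]
  have hi : ∀ a b, IntervalIntegrable k volume a b := fun a b => hkc.intervalIntegrable a b
  set I := ∫ x in η..1, k x with hI
  have hI1 : 1 - 2 * η ≤ I := by
    rw [hI, ← intervalIntegral.integral_add_adjacent_intervals (hi η (2 * η)) (hi (2 * η) 1)]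
    have e1 : ∫ x in (2 * η)..1, k x = 1 - 2 * η := by
      rw [intervalIntegral.integral_congr (g := fun _ => (1 : ℝ))]
      · simp
      · intro x hx
        rw [Set.uIcc_of_le (by linarith)] at hx
        exact hko x hx.1
    have e2 : 0 ≤ ∫ x in η..(2 * η), k x :=
      intervalIntegral.integral_nonneg (by linarith) fun x _ => hk0 x
    linarith
  have hpos : 0 < 1 - 2 * η := by linarith
  have hIpos : 0 < I := hpos.trans_le hI1
  have hder : ∀ x, HasDerivAt (fun x => (∫ s in η..x, k s) / I) (k x / I) x := fun x =>
    (intervalIntegral.integral_hasDerivAt_right (hi _ _) hkc.aestronglyMeasurable.stronglyMeasurableAtFilter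
      hkc.continuousAt).div_const I
  have hdeq : deriv (fun x => (∫ s in η..x, k s) / I) = fun x => k x / I := funext fun x => (hder x).deriv
  have hzero : ∀ x ≤ η, (∫ s in η..x, k s) / I = 0 := fun x hx => by
    rw [intervalIntegral.integral_congr (g := fun _ => (0 : ℝ))]
    · simp
    · intro s hs
      rw [Set.uIcc_of_ge hx] at hs
      exact hkz s hs.2
  refine ⟨fun x => (∫ s in η..x, k s) / I, ?_, hzero, div_self hIpos.ne', fun x => ?_, fun x => ?_⟩
  · rw [contDiff_one_iff_deriv, hdeq]
    exact ⟨fun x => (hder x).differentiableAt, hkc.div_const I⟩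
  · rcases le_total x η with h | h
    · exact (hzero x h).ge
    · exact div_nonneg (intervalIntegral.integral_nonneg h fun s _ => hk0 s) hIpos.le
  · rw [hdeq, abs_of_nonneg (div_nonneg (hk0 x) hIpos.le)]
    exact div_le_div₀ zero_le_one (hk1 x) hpos hI1

namespace LevelSystem
variable {D : Set ℂ} {w V : ℂ → ℝ} {t : ℝ}

theorem exists_oscillation_bound (h : LevelSystem D w) (hV : ContDiff ℝ 2 V) (ht : 0 < t) :
    ∃ s > t, ∃ N M : ℝ, 0 ≤ N ∧ ∀ (G : ℂ → ℂ) (Q : Set ℂ) (ε : ℝ), 0 ≤ ε → ε ≤ 1 →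
      DifferentiableOn ℂ G (⋃ s > t, fill {z ∈ D | s ≤ w z}) → IsOpen Q →
      closure Q ⊆ (⋃ s > t, fill {z ∈ D | s ≤ w z}) → (∀ z ∈ frontier Q, |V z - (G z).re| ≤ ε) →
      (∀ z ∈ Q, |V z - (G z).re| ≤ M) ∧
      ∀ z ∈ Q, z ∉ fill {z ∈ D | s ≤ w z} → |V z - (G z).re| ≤ N * (w z - t) + ε := by
  set W := ⋃ s > t, fill {z ∈ D | s ≤ w z} with hWdef
  have hWo : IsOpen W := h.isOpen_iUnion_fill
  have hfc := h.isCompact_fill ht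
  have hWf : W ⊆ fill {z ∈ D | t ≤ w z} := iUnion_fill_subset
  obtain ⟨s, hst, hsW⟩ := h.exists_diff_subset_fill ht
  have hlc : ∀ {f : ℂ → ℝ}, ContDiff ℝ 2 f → Continuous (lapC f) := fun hf =>
    continuousOn_univ.1 (continuousOn_lapC isOpen_univ hf.contDiffOn)
  obtain ⟨C, hC⟩ := hfc.exists_bound_of_continuousOn (hlc hV).continuousOn
  obtain ⟨R, hR⟩ := hfc.isBounded.exists_norm_le
  have hK := h.isCompact t ht
  obtain ⟨m, hm0, hm⟩ : ∃ m > 0, ∀ z ∈ {z ∈ D | t ≤ w z}, m ≤ -lapC w z := by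
    rcases Set.eq_empty_or_nonempty {z ∈ D | t ≤ w z} with he | hne
    · exact ⟨1, one_pos, by simp [he]⟩
    · obtain ⟨a, ha, hmin⟩ := hK.exists_isMinOn hne (hlc h.contDiff).neg.continuousOn
      exact ⟨_, neg_pos.2 (h.lap_neg a ha.1), fun z hz => hmin hz⟩
  set C₁ := |C| + 1 with hC₁
  have hC1 : 0 < C₁ := by positivity
  have hCW : ∀ z ∈ W, |lapC V z| < C₁ := fun z hz => by
    have := hC z (hWf hz)
    rw [Real.norm_eq_abs] at this
    linarith [le_abs_self C]
  set M := 1 + C₁ * R ^ 2 with hM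
  have hM0 : 0 < M := by positivity
  set N := C₁ / m + M / (s - t) with hN
  have hst' : 0 < s - t := sub_pos.2 hst
  have hN0 : 0 ≤ N := by positivity
  refine ⟨s, hst, N, M, hN0, fun G Q ε hε0 hε1 hG hQ hQW hfr => ?_⟩
  have hf : ContDiffOn ℝ 2 (fun z => V z - (G z).re) W :=
    hV.contDiffOn.sub (contDiffOn_re_of_differentiableOn hWo hG)
  have hlap : ∀ z ∈ W, lapC (fun z => V z - (G z).re) z = lapC V z := fun z hz => by
    rw [lapC_sub hWo hV.contDiffOn (contDiffOn_re_of_differentiableOn hWo hG) hz,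
      lapC_re_of_differentiableOn hWo hG hz, sub_zero]
  have hQW' : Q ⊆ W := subset_closure.trans hQW
  have hQb : Bornology.IsBounded Q := hfc.isBounded.subset (hQW'.trans hWf)
  have hR' : ∀ z ∈ W, ‖z‖ ^ 2 ≤ R ^ 2 := fun z hz =>
    pow_le_pow_left₀ (norm_nonneg _) (hR z (hWf hz)) 2
  have hbM : ∀ z ∈ Q, |V z - (G z).re| ≤ M := by
    have := abs_le_of_lapC_lt hWo hQ hQb hQW hf (b := fun z => (-C₁) * ‖z‖ ^ 2 + (ε + C₁ * R ^ 2))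
      ((contDiff_const.mul (contDiff_norm_sq ℝ)).add contDiff_const)
      (fun z hz => by
        rw [hlap z (hQW' hz), lapC_const_mul_add_const (contDiff_norm_sq ℝ), lapC_normSq]
        linarith [hCW z (hQW' hz)])
      (fun z hz => by
        have := hR' z (hQW (frontier_subset_closure hz))
        nlinarith [hfr z hz])
    intro z hz
    refine (this z hz).trans ?_
    nlinarith [mul_nonneg hC1.le (sq_nonneg ‖z‖)]
  refine ⟨hbM, fun z hzQ hzs => ?_⟩
  set Fs := fill {z ∈ D | s ≤ w z} with hFs
  have hFc : IsClosed Fs := (h.isCompact_fill (ht.trans hst)).isClosed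
  have hBD : Q \ Fs ⊆ {z ∈ D | t < w z} := fun z hz => by
    by_contra hcon
    exact hz.2 (hsW ⟨hQW' hz.1, hcon⟩)
  refine abs_le_of_lapC_lt hWo (hQ.sdiff hFc) (hQb.subset Set.sdiff_subset)
    ((closure_mono Set.sdiff_subset).trans hQW) hf (b := fun z => N * (w z - t) + ε) ?_ ?_ ?_ z ⟨hzQ, hzs⟩
  · exact (contDiff_const.mul (h.contDiff.sub contDiff_const)).add contDiff_const
  · intro z hz
    have e : (fun z => N * (w z - t) + ε) = fun z => N * w z + (ε - N * t) := by ext; ring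
    rw [hlap z (hQW' hz.1), e, lapC_const_mul_add_const h.contDiff]
    have h1 := hm z ⟨(hBD hz).1, (hBD hz).2.le⟩
    have h2 : C₁ ≤ N * m := by
      rw [hN, add_mul, div_mul_cancel₀ _ hm0.ne']
      have : 0 ≤ M / (s - t) * m := by positivity
      linarith
    nlinarith [hCW z (hQW' hz.1)]
  · intro z hz
    have hzc : z ∈ closure (Q \ Fs) := frontier_subset_closure hz
    have hwt : t ≤ w z := by
      have : closure (Q \ Fs) ⊆ {z | t ≤ w z} :=
        closure_minimal (fun x hx => (hBD hx).2.le) (isClosed_le continuous_const h.contDiff.continuous)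
      exact this hzc
    have hzB : z ∉ Q \ Fs := fun hzB => by
      have := hz.2
      rw [(hQ.sdiff hFc).interior_eq] at this
      exact this hzB
    by_cases hzQ : z ∈ Q
    · have hzF : z ∈ Fs := by
        by_contra hcon
        exact hzB ⟨hzQ, hcon⟩
      have hzfr : z ∈ frontier Fs := by
        rw [frontier_eq_closure_inter_closure]
        exact ⟨subset_closure hzF, closure_mono (fun x hx => hx.2) hzc⟩
      have hws : s ≤ w z := (frontier_fill_subset (h.isCompact s (ht.trans hst)).isClosed hzfr).2
      refine (hbM z hzQ).trans ?_
      have h1 : M ≤ N * (s - t) := by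
        rw [hN, add_mul, div_mul_cancel₀ _ hst'.ne']
        have : 0 ≤ C₁ / m * (s - t) := by positivity
        linarith
      nlinarith
    · have : z ∈ frontier Q := ⟨closure_mono Set.sdiff_subset hzc, by rwa [hQ.interior_eq]⟩
      have := hfr z this
      nlinarith

end LevelSystem

namespace LevelSystem
variable {D : Set ℂ} {w V : ℂ → ℝ} {t : ℝ}

open Filter Topology in
theorem exists_filled_cutoff (h : LevelSystem D w) (ht : 0 < t) {ε : ℝ} (hε : 0 < ε)
    (hε2 : ε < 1 / 2) :
    ∃ f : ℂ → ℝ, ContDiff ℝ 1 f ∧ HasCompactSupport f ∧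
      tsupport f ⊆ (⋃ s > t, fill {z ∈ D | s ≤ w z}) ∧ (∀ z, 0 ≤ f z) ∧
      (∀ z ∈ fill {z ∈ D | t + 2 * ε ≤ w z}, f z = 1) ∧
      (∀ z, √(gradSq f z) ≤ 1 / (1 - 2 * ε) * √(gradSq (cutComp D w t ε smoothTransition) z)) ∧
      ∀ z, gradSq f z ≠ 0 →
        z ∈ tsupport f ∧ z ∉ fill {z ∈ D | t + 2 * ε ≤ w z} ∧ w z < t + 2 * ε := by
  classical
  obtain ⟨ψ, hψ, hψ0, hψ1, hψn, hψd⟩ := exists_contDiff_step hε hε2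
  have hz1 : ∀ x ≤ 0, smoothTransition x = 0 := fun x hx => smoothTransition.zero_of_nonpos hx
  set g := cutComp D w t ε smoothTransition with hg
  have hgc : ContDiff ℝ 1 g := contDiff_cutComp h.isOpen (h.contDiff.of_le (by norm_num)).contDiffOn hε
    (h.isCompact t ht) hz1 smoothTransition.contDiff
  set L := fill {z ∈ D | t + 2 * ε ≤ w z} with hL
  have hLc : IsClosed L := (h.isCompact_fill (by linarith)).isClosed
  set f : ℂ → ℝ := fun z => if z ∈ L then 1 else ψ (g z) with hf
  have hin : ∀ z ∈ L, f =ᶠ[𝓝 z] fun _ => 1 := fun z hz => by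
    by_cases hzi : z ∈ interior L
    · filter_upwards [mem_interior_iff_mem_nhds.1 hzi] with x hx
      simp [hf, hx]
    · have hzK := frontier_fill_subset (h.isCompact _ (by linarith)).isClosed
        (show z ∈ frontier L from ⟨subset_closure hz, hzi⟩)
      filter_upwards [h.isOpen.mem_nhds hzK.1, h.contDiff.continuous.continuousAt.eventually
        (lt_mem_nhds (show t + ε < w z by linarith [hzK.2]))] with x hxD hxw
      have : g x = 1 := by
        rw [hg, cutComp, Set.indicator_of_mem hxD]
        refine smoothTransition.one_of_one_le ?_
        rw [le_div_iff₀ hε]; linarith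
      simp [hf, this, hψ1]
  have hout : ∀ z ∉ L, f =ᶠ[𝓝 z] fun z => ψ (g z) := fun z hz => by
    filter_upwards [hLc.isOpen_compl.mem_nhds hz] with x hx
    exact if_neg hx
  have hder : ∀ z ∉ L, ∀ v, fderiv ℝ f z v = deriv ψ (g z) * fderiv ℝ g z v := fun z hz v => by
    rw [(hout z hz).fderiv_eq]
    have := (hψ.differentiable one_ne_zero (g z)).hasDerivAt.comp_hasFDerivAt z
      (hgc.differentiable one_ne_zero z).hasFDerivAt
    rw [show (fun z => ψ (g z)) = ψ ∘ g from rfl, this.fderiv]; rfl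
  have hgradin : ∀ z ∈ L, gradSq f z = 0 := fun z hz => by
    rw [gradSq, (hin z hz).fderiv_eq]; simp
  have hgradout : ∀ z ∉ L, gradSq f z = (deriv ψ (g z)) ^ 2 * gradSq g z := fun z hz => by
    rw [gradSq, hder z hz, hder z hz, gradSq]; ring
  have htend : ∀ᶠ x in 𝓝 (0 : ℝ), smoothTransition x < ε :=
    smoothTransition.continuousAt.eventually
      (gt_mem_nhds (show smoothTransition 0 < ε by rw [smoothTransition.zero_of_nonpos le_rfl]; exact hε))
  obtain ⟨x₀, hx₀, hx₀ε⟩ : ∃ x > 0, ∀ y ≤ x, smoothTransition y ≤ ε := by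
    obtain ⟨r, hr, hrr⟩ := Metric.eventually_nhds_iff.1 htend
    refine ⟨r / 2, by positivity, fun y hy => ?_⟩
    rcases le_total y 0 with hy0 | hy0
    · rw [hz1 y hy0]; exact hε.le
    · exact (hrr (by rw [Real.dist_eq, sub_zero, abs_of_nonneg hy0]; linarith)).le
  have hts : t < t + ε * x₀ := by nlinarith [mul_pos hε hx₀]
  set L' := {z ∈ D | t + ε * x₀ ≤ w z} with hL'
  have hsupp : tsupport f ⊆ L ∪ L' := by
    refine closure_minimal (fun z hz => ?_)
      (hLc.union (h.isCompact _ (ht.trans hts)).isClosed)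
    by_cases hzL : z ∈ L
    · exact Or.inl hzL
    · right
      have hz' : ψ (g z) ≠ 0 := by simpa [hf, hzL] using hz
      have hzD : z ∈ D := by
        by_contra hzD
        apply hz'
        rw [hg, cutComp, Set.indicator_of_notMem hzD]; exact hψ0 _ hε.le
      refine ⟨hzD, ?_⟩
      by_contra! hlt
      apply hz'
      rw [hg, cutComp, Set.indicator_of_mem hzD]
      refine hψ0 _ (hx₀ε _ ?_)
      rw [div_le_iff₀ hε]; linarith
  refine ⟨f, ?_, ?_, ?_, ?_, ?_, ?_, ?_⟩
  · refine contDiff_iff_contDiffAt.2 fun z => ?_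
    by_cases hz : z ∈ L
    · exact contDiffAt_const.congr_of_eventuallyEq (hin z hz)
    · exact (hψ.comp hgc).contDiffAt.congr_of_eventuallyEq (hout z hz)
  · exact ((h.isCompact_fill (by linarith)).union (h.isCompact _ (ht.trans hts))).of_isClosed_subset
      (isClosed_tsupport _) hsupp
  · refine hsupp.trans (Set.union_subset ?_ ?_)
    · exact Set.subset_biUnion_of_mem (u := fun s => fill {z ∈ D | s ≤ w z})
        (show t + 2 * ε > t by linarith)
    · exact (subset_fill _).trans
        (Set.subset_biUnion_of_mem (u := fun s => fill {z ∈ D | s ≤ w z}) hts)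
  · intro z
    by_cases hz : z ∈ L
    · simp [hf, hz]
    · simp only [hf, hz, if_false]; exact hψn _
  · intro z hz; simp [hf, hz]
  · intro z
    by_cases hz : z ∈ L
    · rw [hgradin z hz, sqrt_zero]
      have : 0 < 1 - 2 * ε := by linarith
      positivity
    · rw [hgradout z hz, sqrt_mul (sq_nonneg _), sqrt_sq_eq_abs]
      exact mul_le_mul_of_nonneg_right (hψd _) (sqrt_nonneg _)
  · intro z hz
    have hzL : z ∉ L := fun hzL => hz (hgradin z hzL)
    refine ⟨?_, hzL, ?_⟩
    · by_contra hcon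
      apply hz
      rw [gradSq, (notMem_tsupport_iff_eventuallyEq.1 hcon).fderiv_eq]; simp
    · by_contra! hlt
      have hzD : z ∉ D := fun hzD => hzL (subset_fill _ ⟨hzD, hlt⟩)
      apply hz
      rw [hgradout z hzL, gradSq, hg, fderiv_cutComp h.isOpen
        (h.contDiff.differentiable two_ne_zero).differentiableOn hε (h.isCompact t ht),
        fderiv_cutComp h.isOpen
        (h.contDiff.differentiable two_ne_zero).differentiableOn hε (h.isCompact t ht)]
      have h0 : cutComp D w t ε (fun x => deriv smoothTransition x / ε) z = 0 := by
        rw [cutComp, Set.indicator_of_notMem hzD]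
      rw [h0]; simp

open Filter Topology in
theorem tendsto_integral_diff_fill (h : LevelSystem D w) {y : ℂ → ℝ}
    (hy : IntegrableOn y (⋃ s > t, fill {z ∈ D | s ≤ w z})) (ht : 0 < t) :
    Tendsto (fun ε : ℝ => ∫ z in (⋃ s > t, fill {z ∈ D | s ≤ w z}) \ fill {z ∈ D | t + 2 * ε ≤ w z}, y z)
      (𝓝[>] 0) (𝓝 0) := by
  set W := ⋃ s > t, fill {z ∈ D | s ≤ w z} with hWdef
  have hWm : MeasurableSet W := h.isOpen_iUnion_fill.measurableSet
  have hLm : ∀ ε > 0, MeasurableSet (fill {z ∈ D | t + 2 * ε ≤ w z}) := fun ε hε =>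
    (h.isCompact_fill (by linarith)).isClosed.measurableSet
  have hpos : ∀ᶠ ε in 𝓝[>] (0 : ℝ), 0 < ε := self_mem_nhdsWithin
  have key : Tendsto (fun ε : ℝ => ∫ z in W, (fill {z ∈ D | t + 2 * ε ≤ w z})ᶜ.indicator y z)
      (𝓝[>] 0) (𝓝 (∫ z in W, 0)) := by
    refine tendsto_integral_filter_of_dominated_convergence (fun z => ‖y z‖) ?_ ?_ hy.norm ?_
    · filter_upwards [hpos] with ε hε
      exact hy.1.indicator (hLm ε hε).compl
    · exact Eventually.of_forall fun ε => Eventually.of_forall fun z => norm_indicator_le_norm_self _ _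
    · filter_upwards [ae_restrict_mem hWm] with z hz
      obtain ⟨s, hs, hzs⟩ : ∃ s > t, z ∈ fill {z ∈ D | s ≤ w z} := by simpa [hWdef] using hz
      refine tendsto_const_nhds.congr' ?_
      filter_upwards [Ioo_mem_nhdsGT (show (0 : ℝ) < (s - t) / 2 by linarith)] with ε hε
      rw [Set.indicator_of_notMem]
      exact fun hn => hn (fill_anti (by linarith [hε.2]) hzs)
  rw [integral_zero] at key
  refine key.congr' ?_
  filter_upwards [hpos] with ε hε
  rw [setIntegral_indicator (hLm ε hε).compl]; rfl

end LevelSystem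

namespace LevelSystem
variable {D : Set ℂ} {w V : ℂ → ℝ} {t : ℝ}

open Filter Topology in
set_option maxHeartbeats 1000000 in
theorem eventually_isoperimetric_approx (h : LevelSystem D w) (hV : ContDiff ℝ 2 V) (ht : 0 < t)
    {kap : ℝ} (hk0 : 0 ≤ kap) (hk1 : kap ≤ 1) (hlap : ∀ z, -lapC V z ≤ kap * exp (2 * V z))
    (hmass : (∫ z in {z ∈ D | t < w z}, exp (2 * V z)) +
      ∫ z in ⋃ s > t, fill {z ∈ D | s ≤ w z}, exp (2 * V z) ≤ 4 * π) :
    ∃ N M : ℝ, ∀ᶠ ε in 𝓝[>] (0 : ℝ),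
      exp (-2 * ε) * (4 * π * (∫ z in {z ∈ D | t < w z}, exp (2 * V z)) -
        kap * (∫ z in {z ∈ D | t < w z}, exp (2 * V z)) ^ 2 -
        4 * π * ∫ z in (⋃ s > t, fill {z ∈ D | s ≤ w z}) \ fill {z ∈ D | t + 2 * ε ≤ w z},
          exp (2 * V z)) - 8 * π * (exp (2 * M) *
        ∫ z in (⋃ s > t, fill {z ∈ D | s ≤ w z}) \ fill {z ∈ D | t + 2 * ε ≤ w z}, exp (2 * V z)) ≤
      (exp ((2 * N + 1) * ε) / (1 - 2 * ε)) ^ 2 *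
        (∫ z, √(gradSq (cutComp D w t ε smoothTransition) z) * exp (V z)) ^ 2 := by
  obtain ⟨s, hst, N, M, hN0, hosc⟩ := h.exists_oscillation_bound hV ht
  refine ⟨N, M, ?_⟩
  set W := ⋃ s > t, fill {z ∈ D | s ≤ w z} with hWdef
  have hWo : IsOpen W := h.isOpen_iUnion_fill
  have hfc := h.isCompact_fill ht
  have hWf : W ⊆ fill {z ∈ D | t ≤ w z} := iUnion_fill_subset
  have hWb : Bornology.IsBounded W := hfc.isBounded.subset hWf
  have hyc : Continuous fun z => exp (2 * V z) := (hV.continuous.const_mul 2).rexp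
  have hyW : IntegrableOn (fun z => exp (2 * V z)) W :=
    (hyc.continuousOn.integrableOn_compact hfc).mono_set hWf
  set a := ∫ z in {z ∈ D | t < w z}, exp (2 * V z) with ha
  have hDW : {z ∈ D | t < w z} ⊆ W := superlevel_subset
  have ha0 : 0 ≤ a := integral_nonneg fun z => (exp_pos _).le
  have haW : a ≤ ∫ z in W, exp (2 * V z) := setIntegral_mono_set hyW
    (Eventually.of_forall fun z => (exp_pos _).le) hDW.eventuallyLE
  filter_upwards [Ioo_mem_nhdsGT (show (0 : ℝ) < min (1 / 4) ((s - t) / 2) from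
    lt_min (by norm_num) (by linarith))] with ε hε
  have hε0 : 0 < ε := hε.1
  have hε4 : ε < 1 / 4 := hε.2.trans_le (min_le_left _ _)
  have hεs : t + 2 * ε < s := by linarith [hε.2.trans_le (min_le_right (1 / 4) ((s - t) / 2))]
  obtain ⟨f, hf, hfc', hfW, hf0, hf1, hfg, hfs⟩ := h.exists_filled_cutoff ht hε0 (by linarith)
  obtain ⟨G, Q, hG, hQ, hKQ, hQW, hfr⟩ := (h.hasPrimitives ht).exists_re_near hWo hWb
    (K := tsupport f) hfc' hfW hV.continuous.continuousOn hε0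
  obtain ⟨F, hF⟩ := h.hasPrimitives ht (fun z => Complex.exp (G z)) hG.cexp
  have hFd : DifferentiableOn ℂ F W := fun z hz => (hF z hz).differentiableAt.differentiableWithinAt
  have hFG : ∀ z ∈ W, deriv F z = Complex.exp (G z) := fun z hz => (hF z hz).deriv
  have hFn : ∀ z ∈ W, ‖deriv F z‖ = exp (G z).re := fun z hz => by
    rw [hFG z hz, Complex.norm_exp]
  have hFn2 : ∀ z ∈ W, ‖deriv F z‖ ^ 2 = exp (2 * (G z).re) := fun z hz => by
    rw [hFn z hz, ← exp_nat_mul]; norm_num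
  obtain ⟨hM, hNb⟩ := hosc G Q ε hε0.le (by linarith) hG hQ hQW hfr
  have hQW' : Q ⊆ W := subset_closure.trans hQW
  have hQcc : IsCompact (closure Q) := (hWb.subset hQW').isCompact_closure
  have hgc : ContinuousOn (fun z => exp (2 * (G z).re)) W :=
    ((Complex.continuous_re.comp_continuousOn hG.continuousOn).const_mul 2).rexp
  have hgQ : IntegrableOn (fun z => exp (2 * (G z).re)) Q :=
    ((hgc.mono hQW).integrableOn_compact hQcc).mono_set subset_closure
  set L := fill {z ∈ D | t + 2 * ε ≤ w z} with hL
  have hLm : MeasurableSet L := (h.isCompact_fill (by linarith)).isClosed.measurableSet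
  have hLf : L ⊆ tsupport f := fun z hz => subset_tsupport f (by
    rw [Function.mem_support, hf1 z hz]; exact one_ne_zero)
  have hLQ : L ⊆ Q := hLf.trans hKQ
  set τ := ∫ z in W \ L, exp (2 * V z) with hτ
  have hτ0 : 0 ≤ τ := integral_nonneg fun z => (exp_pos _).le
  set A := ∫ z in Q, exp (2 * (G z).re) with hA
  set Y := ∫ z in Q, exp (2 * V z) with hY
  have hA0 : 0 ≤ A := integral_nonneg fun z => (exp_pos _).le
  have hY0 : 0 ≤ Y := integral_nonneg fun z => (exp_pos _).le
  have hYW : Y ≤ ∫ z in W, exp (2 * V z) := setIntegral_mono_set hyW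
    (Eventually.of_forall fun z => (exp_pos _).le) hQW'.eventuallyLE
  have hWL : (∫ z in W, exp (2 * V z)) = (∫ z in L, exp (2 * V z)) + τ := by
    rw [← integral_inter_add_sdiff hLm hyW, Set.inter_eq_self_of_subset_right (hLQ.trans hQW')]
  have hLY : ∫ z in L, exp (2 * V z) ≤ Y := setIntegral_mono_set (hyW.mono_set hQW')
    (Eventually.of_forall fun z => (exp_pos _).le) hLQ.eventuallyLE
  have hYa : a - τ ≤ Y := by linarith
  have hbol := bol_inequality hWo hQ hQcc hQW hFd hG hFG hV.contDiffOn hk0 (fun z _ => hlap z) hε0.le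
    (fun z hz => (le_abs_self _).trans (hfr z hz))
  have hτ' : ∫ z in Q \ L, exp (2 * (G z).re) ≤ exp (2 * M) * τ := by
    have h1 : ∫ z in Q \ L, exp (2 * (G z).re) ≤ ∫ z in Q \ L, exp (2 * M) * exp (2 * V z) := by
      refine setIntegral_mono_on (hgQ.mono_set Set.sdiff_subset)
        ((hyW.mono_set (Set.sdiff_subset.trans hQW')).const_mul _) (hQ.measurableSet.diff hLm)
        fun z hz => ?_
      rw [← exp_add]
      refine exp_le_exp.2 ?_
      have := (abs_le.1 (hM z hz.1)).1
      linarith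
    rw [integral_const_mul] at h1
    refine h1.trans (mul_le_mul_of_nonneg_left ?_ (exp_pos _).le)
    exact setIntegral_mono_set (hyW.mono_set Set.sdiff_subset)
      (Eventually.of_forall fun z => (exp_pos _).le) (Set.sdiff_subset_sdiff_left hQW').eventuallyLE
  have hAL : A - exp (2 * M) * τ ≤ ∫ z in L, exp (2 * (G z).re) := by
    have : A = (∫ z in L, exp (2 * (G z).re)) + ∫ z in Q \ L, exp (2 * (G z).re) := by
      rw [hA, ← integral_inter_add_sdiff hLm hgQ, Set.inter_eq_self_of_subset_right hLQ]
    linarith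
  have hFc : ContinuousOn (fun z => ‖deriv F z‖) W := (hFd.deriv hWo).continuousOn.norm
  have hI : A - exp (2 * M) * τ ≤ ∫ z, f z * ‖deriv F z‖ ^ 2 := by
    refine hAL.trans ?_
    have hint : Integrable fun z => f z * ‖deriv F z‖ ^ 2 :=
      integrable_mul_of_tsupport_subset hWo hf.continuous hfc' hfW (hFc.pow 2)
    rw [setIntegral_congr_fun (g := fun z => f z * ‖deriv F z‖ ^ 2) hLm (fun z hz => by
      simp only [hf1 z hz, one_mul]; exact (hFn2 z (hQW' (hLQ hz))).symm)]
    exact setIntegral_le_integral hint (Eventually.of_forall fun z => mul_nonneg (hf0 z) (sq_nonneg _))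
  have hA' : ∫ z in tsupport f, ‖deriv F z‖ ^ 2 ≤ A := by
    rw [setIntegral_congr_fun hfc'.isCompact.isClosed.measurableSet (fun z hz => hFn2 z (hfW hz))]
    exact setIntegral_mono_set hgQ (Eventually.of_forall fun z => (exp_pos _).le) hKQ.eventuallyLE
  set J := ∫ z, √(gradSq (cutComp D w t ε smoothTransition) z) * exp (V z) with hJ
  set c := exp ((2 * N + 1) * ε) / (1 - 2 * ε) with hc
  have hε2 : 0 < 1 - 2 * ε := by linarith
  have hJ1 : ∫ z, √(gradSq f z) * ‖deriv F z‖ ≤ c * J := by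
    rw [hJ, ← integral_const_mul]
    set g := cutComp D w t ε smoothTransition with hg
    have hz1 : ∀ x ≤ 0, smoothTransition x = 0 := fun x hx => smoothTransition.zero_of_nonpos hx
    have hgc : ContDiff ℝ 1 g := contDiff_cutComp h.isOpen (h.contDiff.of_le (by norm_num)).contDiffOn
      hε0 (h.isCompact t ht) hz1 smoothTransition.contDiff
    have hgs : HasCompactSupport g := hasCompactSupport_cutComp hε0 (h.isCompact t ht) hz1
    have hgg : Continuous fun z => √(gradSq g z) := by
      have := hgc.continuous_fderiv one_ne_zero
      unfold gradSq
      fun_prop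
    have hggs : HasCompactSupport fun z => √(gradSq g z) := by
      refine (hgs.fderiv (𝕜 := ℝ)).mono fun z hz => ?_
      contrapose! hz
      simp only [Function.mem_support, not_not] at hz ⊢
      simp [gradSq, hz]
    refine integral_mono_of_nonneg (Eventually.of_forall fun z => by positivity)
      (((hgg.mul hV.continuous.rexp).integrable_of_hasCompactSupport hggs.mul_right).const_mul _)
      (Eventually.of_forall fun z => ?_)
    by_cases hz : gradSq f z = 0
    · simp only [hz, sqrt_zero, zero_mul]; positivity
    · obtain ⟨hzt, hzL, hzw⟩ := hfs z hz
      have hzs : z ∉ fill {z ∈ D | s ≤ w z} := fun hzs => hzL (fill_anti hεs.le hzs)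
      have h1 := (abs_le.1 (hNb z (hKQ hzt) hzs)).1
      have h2 : N * (w z - t) ≤ N * (2 * ε) := mul_le_mul_of_nonneg_left (by linarith) hN0
      have h3 : ‖deriv F z‖ ≤ exp ((2 * N + 1) * ε) * exp (V z) := by
        rw [hFn z (hfW hzt), ← exp_add]
        exact exp_le_exp.2 (by linarith)
      calc √(gradSq f z) * ‖deriv F z‖ ≤ (1 / (1 - 2 * ε) * √(gradSq g z)) *
            (exp ((2 * N + 1) * ε) * exp (V z)) := mul_le_mul (hfg z) h3 (norm_nonneg _) (by positivity)
        _ = c * (√(gradSq g z) * exp (V z)) := by rw [hc]; ring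
  have hJ0 : 0 ≤ ∫ z, √(gradSq f z) * ‖deriv F z‖ := integral_nonneg fun z => by positivity
  have hflat := sq_integral_mul_normSq_deriv_le hWo hFd hf hfc' hfW
  have hJsq := pow_le_pow_left₀ hJ0 hJ1 2
  rw [mul_pow] at hJsq
  set τ' := exp (2 * M) * τ with hτ'd
  have hτ'0 : 0 ≤ τ' := by positivity
  have hmain : 4 * π * (A - 2 * τ') ≤ c ^ 2 * J ^ 2 := by
    by_cases hAτ : A ≤ 2 * τ'
    · have : 0 ≤ c ^ 2 * J ^ 2 := by positivity
      nlinarith [pi_pos]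
    · push Not at hAτ
      have hApos : 0 < A := by linarith
      have h1 : (A - τ') ^ 2 ≤ (∫ z, f z * ‖deriv F z‖ ^ 2) ^ 2 :=
        pow_le_pow_left₀ (by linarith) hI 2
      have h2 : 4 * π * (A - τ') ^ 2 ≤ (c ^ 2 * J ^ 2) * A := by
        have h3 : (∫ z, √(gradSq f z) * ‖deriv F z‖) ^ 2 * (∫ z in tsupport f, ‖deriv F z‖ ^ 2) ≤
            (c ^ 2 * J ^ 2) * A := mul_le_mul hJsq hA' (integral_nonneg fun z => by positivity) (by positivity)
        nlinarith [pi_pos]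
      refine le_of_mul_le_mul_right ?_ hApos
      have h3 : 4 * π * (A - τ') ^ 2 = 4 * π * (A - 2 * τ') * A + 4 * (π * τ' ^ 2) := by ring
      linarith [mul_nonneg pi_pos.le (sq_nonneg τ')]
  have hfa : 4 * π * a - kap * a ^ 2 - 4 * π * τ ≤ 4 * π * Y - kap * Y ^ 2 := by
    have h1 : 0 ≤ 4 * π - kap * (Y + a) := by nlinarith
    have h2 : 4 * π - kap * (Y + a) ≤ 4 * π := by nlinarith
    have h3 : 4 * π * Y - kap * Y ^ 2 - (4 * π * a - kap * a ^ 2) = (Y - a) * (4 * π - kap * (Y + a)) := by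
      ring
    rcases le_total a Y with hle | hle
    · nlinarith [pi_pos, mul_nonneg (sub_nonneg.2 hle) h1]
    · nlinarith [mul_le_mul_of_nonneg_right (show a - Y ≤ τ by linarith) h1]
  have hexp : exp (-2 * ε) * exp (2 * ε) = 1 := by rw [← exp_add]; simp
  have h4 : exp (-2 * ε) * (4 * π * Y - kap * Y ^ 2) ≤ 4 * π * A := by
    have : 4 * π * Y - kap * Y ^ 2 ≤ exp (2 * ε) * (4 * π * A) := by linarith
    calc _ ≤ exp (-2 * ε) * (exp (2 * ε) * (4 * π * A)) := mul_le_mul_of_nonneg_left this (exp_pos _).le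
      _ = 4 * π * A := by rw [← mul_assoc, hexp, one_mul]
  have h5 := mul_le_mul_of_nonneg_left hfa (exp_pos (-2 * ε)).le
  linarith

open Filter Topology in
/-- The isoperimetric inequality for superlevel sets, in its smoothed form. -/
theorem eventually_isoperimetric (h : LevelSystem D w) (hV : ContDiff ℝ 2 V) (ht : 0 < t)
    {kap : ℝ} (hk0 : 0 ≤ kap) (hk1 : kap ≤ 1) (hlap : ∀ z, -lapC V z ≤ kap * exp (2 * V z))
    (hmass : (∫ z in {z ∈ D | t < w z}, exp (2 * V z)) +
      ∫ z in ⋃ s > t, fill {z ∈ D | s ≤ w z}, exp (2 * V z) ≤ 4 * π) {δ : ℝ} (hδ : 0 < δ) :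
    ∀ᶠ ε in 𝓝[>] (0 : ℝ), 4 * π * (∫ z in {z ∈ D | t < w z}, exp (2 * V z)) -
        kap * (∫ z in {z ∈ D | t < w z}, exp (2 * V z)) ^ 2 - δ ≤
      (∫ z, √(gradSq (cutComp D w t ε smoothTransition) z) * √(exp (2 * V z))) ^ 2 := by
  obtain ⟨N, M, hNM⟩ := h.eventually_isoperimetric_approx hV ht hk0 hk1 hlap hmass
  have hyW : IntegrableOn (fun z => exp (2 * V z)) (⋃ s > t, fill {z ∈ D | s ≤ w z}) :=
    ((hV.continuous.const_mul 2).rexp.continuousOn.integrableOn_compact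
      (h.isCompact_fill ht)).mono_set iUnion_fill_subset
  have hτ := h.tendsto_integral_diff_fill hyW ht
  set τ := fun ε : ℝ => ∫ z in (⋃ s > t, fill {z ∈ D | s ≤ w z}) \ fill {z ∈ D | t + 2 * ε ≤ w z},
    exp (2 * V z) with hτd
  set E := 4 * π * (∫ z in {z ∈ D | t < w z}, exp (2 * V z)) -
        kap * (∫ z in {z ∈ D | t < w z}, exp (2 * V z)) ^ 2 with hE
  have hid : Tendsto (fun ε : ℝ => ε) (𝓝[>] 0) (𝓝 0) := nhdsWithin_le_nhds
  have hc : Tendsto (fun ε : ℝ => exp ((2 * N + 1) * ε) / (1 - 2 * ε)) (𝓝[>] 0) (𝓝 1) := by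
    have h0 : ContinuousAt (fun ε : ℝ => exp ((2 * N + 1) * ε) / (1 - 2 * ε)) 0 := by
      refine ContinuousAt.div (by fun_prop) (by fun_prop) (by norm_num)
    have := h0.tendsto
    simp only [mul_zero, exp_zero, sub_zero, div_one] at this
    exact this.mono_left nhdsWithin_le_nhds
  have he : Tendsto (fun ε : ℝ => exp (-2 * ε)) (𝓝[>] 0) (𝓝 1) := by
    have h0 : ContinuousAt (fun ε : ℝ => exp (-2 * ε)) 0 := by fun_prop
    have := h0.tendsto
    simp only [mul_zero, exp_zero] at this
    exact this.mono_left nhdsWithin_le_nhds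
  have hlim : Tendsto (fun ε => (exp (-2 * ε) * (E - 4 * π * τ ε) - 8 * π * (exp (2 * M) * τ ε)) /
      (exp ((2 * N + 1) * ε) / (1 - 2 * ε)) ^ 2) (𝓝[>] 0)
      (𝓝 ((1 * (E - 4 * π * 0) - 8 * π * (exp (2 * M) * 0)) / 1 ^ 2)) :=
    ((he.mul (tendsto_const_nhds.sub (hτ.const_mul _))).sub
      ((hτ.const_mul _).const_mul _)).div (hc.pow 2) (by norm_num)
  have hlim' : (1 * (E - 4 * π * 0) - 8 * π * (exp (2 * M) * 0)) / 1 ^ 2 = E := by ring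
  rw [hlim'] at hlim
  filter_upwards [hNM, hlim.eventually (lt_mem_nhds (show E - δ < E by linarith)),
    hc.eventually (lt_mem_nhds (show (0 : ℝ) < 1 by norm_num))] with ε h1 h2 h3
  have hs : ∀ z, √(exp (2 * V z)) = exp (V z) := fun z => by
    rw [← exp_half]; congr 1; ring
  simp only [hs]
  refine h2.le.trans ?_
  rw [div_le_iff₀ (by positivity)]
  linarith

end LevelSystem

open Filter Topology in
/-- The sphere covering inequality on a positive nodal domain of the difference of two solutions. -/
theorem LevelSystem.four_pi_lt {D : Set ℂ} {w V : ℂ → ℝ} (h : LevelSystem D w) (hne : D.Nonempty)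
    (hwpos : ∀ z ∈ D, 0 < w z) (hV : ContDiff ℝ 2 V) {kap : ℝ} (hk0 : 0 ≤ kap) (hk1 : kap < 1)
    (hlap : ∀ z, -lapC V z ≤ kap * exp (2 * V z))
    (hlapw : ∀ z ∈ D, -lapC w z = exp (2 * w z) * exp (2 * V z) - exp (2 * V z))
    (hx : Integrable fun z => exp (2 * w z) * exp (2 * V z)) (hy : Integrable fun z => exp (2 * V z)) :
    4 * π < ∫ z in fill D, (exp (2 * w z) * exp (2 * V z) + exp (2 * V z)) := by
  by_contra! hcon
  rw [integral_add hx.integrableOn hy.integrableOn] at hcon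
  have hwc : Continuous w := h.contDiff.continuous
  obtain ⟨z₀, hz₀⟩ := hne
  set t₁ := w z₀ / 2 with ht₁
  have ht₁0 : 0 < t₁ := half_pos (hwpos z₀ hz₀)
  obtain ⟨m, hm, hmax⟩ := (h.isCompact t₁ ht₁0).exists_isMaxOn
    (⟨z₀, hz₀, by linarith [hwpos z₀ hz₀]⟩ : Set.Nonempty {z ∈ D | t₁ ≤ w z}) hwc.continuousOn
  set T := w m with hTd
  have ht₁T : t₁ < T := (show t₁ < w z₀ by linarith [hwpos z₀ hz₀]).trans_le
    (hmax (show z₀ ∈ {z ∈ D | t₁ ≤ w z} from ⟨hz₀, by linarith [hwpos z₀ hz₀]⟩))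
  have hT : ∀ z ∈ D, w z ≤ T := fun z hz => by
    rcases le_total t₁ (w z) with hle | hle
    · exact hmax (show z ∈ {z ∈ D | t₁ ≤ w z} from ⟨hz, hle⟩)
    · exact hle.trans ht₁T.le
  set a : ℝ → ℝ := fun t => ∫ z in {z ∈ D | t < w z}, exp (2 * V z) with ha
  have hmeas : ∀ t, MeasurableSet {z ∈ D | t < w z} := fun t => h.isOpen_superlevel.measurableSet
  have ha0 : ∀ t, 0 ≤ a t := fun t => integral_nonneg fun z => (exp_pos _).le
  have hanti : Antitone a := fun s t hst => setIntegral_mono_set hy.integrableOn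
    (Eventually.of_forall fun z => (exp_pos _).le)
    (Eventually.of_forall fun z hz => ⟨hz.1, lt_of_le_of_lt hst hz.2⟩)
  have ha1 : 0 < a t₁ := by
    refine (setIntegral_pos_iff_support_of_nonneg_ae (Eventually.of_forall fun z => (exp_pos _).le)
      hy.integrableOn).2 ?_
    have : Function.support (fun z => exp (2 * V z)) = Set.univ :=
      Set.eq_univ_of_forall fun z => (exp_pos _).ne'
    rw [this, Set.univ_inter]
    exact h.isOpen_superlevel.measure_pos _ ⟨z₀, hz₀, by linarith [hwpos z₀ hz₀]⟩
  have hDF : ∀ t, {z ∈ D | t < w z} ⊆ fill D := fun t z hz => subset_fill D hz.1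
  have hbF : ∀ t, ∫ z in {z ∈ D | t < w z}, exp (2 * w z) * exp (2 * V z) ≤
      ∫ z in fill D, exp (2 * w z) * exp (2 * V z) := fun t => setIntegral_mono_set hx.integrableOn
    (Eventually.of_forall fun z => by positivity) (hDF t).eventuallyLE
  have hab : ∀ t, a t ≤ ∫ z in {z ∈ D | t < w z}, exp (2 * w z) * exp (2 * V z) := fun t =>
    setIntegral_mono_on hy.integrableOn hx.integrableOn (hmeas t) fun z hz => by
      have h1 : 1 ≤ exp (2 * w z) := one_le_exp (by linarith [hwpos z hz.1])
      nlinarith [exp_pos (2 * V z)]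
  have haF : ∀ t, a t ≤ ∫ z in fill D, exp (2 * V z) := fun t => setIntegral_mono_set hy.integrableOn
    (Eventually.of_forall fun z => by positivity) (hDF t).eventuallyLE
  have key : ∀ t₀, 0 < t₀ → t₀ < t₁ →
      (1 - kap) * ((exp (2 * t₁) - exp (2 * t₀)) * a t₁ ^ 2) ≤ (exp (2 * t₀) - 1) * (4 * π ^ 2) := by
    intro t₀ h0 h01
    have hlev := level_inequality h.isOpen h.contDiff.contDiffOn h0 (h01.trans ht₁T).le hT
      (h.isCompact t₀ h0) (y := fun z => exp (2 * V z)) (hV.continuous.const_mul 2).rexp.continuousOn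
      (fun z _ => (exp_pos _).le) (lam := 1) (mu := 1) (kap := kap) zero_le_one le_rfl
      (fun z hz _ => by rw [hlapw z hz]; linarith) (fun t ht _ δ hδ => by
        have ht0 : 0 < t := h0.trans ht.1
        refine h.eventually_isoperimetric hV ht0 hk0 hk1.le hlap ?_ hδ
        have h1 : ∫ z in ⋃ s > t, fill {z ∈ D | s ≤ w z}, exp (2 * V z) ≤
            ∫ z in fill D, exp (2 * V z) := by
          have hsub : (⋃ s > t, fill {z ∈ D | s ≤ w z}) ⊆ fill D :=
            Set.iUnion₂_subset fun s _ => fill_mono fun z hz => hz.1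
          exact setIntegral_mono_set hy.integrableOn (Eventually.of_forall fun z => by positivity)
            hsub.eventuallyLE
        linarith [(hab t).trans (hbF t)])
    have hint : ∀ p q, IntervalIntegrable (fun t => 2 * exp (2 * t) * a t ^ 2) volume p q := fun p q => by
      have h1 : Antitone fun t => a t ^ 2 := fun s t hst => pow_le_pow_left₀ (ha0 t) (hanti hst) 2
      exact h1.intervalIntegrable.continuousOn_mul (by fun_prop)
    have hI : (exp (2 * t₁) - exp (2 * t₀)) * a t₁ ^ 2 ≤ ∫ t in t₀..T, 2 * exp (2 * t) * a t ^ 2 := by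
      rw [← intervalIntegral.integral_add_adjacent_intervals (hint t₀ t₁) (hint t₁ T)]
      have e1 : ∫ t in t₀..t₁, 2 * exp (2 * t) * a t₁ ^ 2 = (exp (2 * t₁) - exp (2 * t₀)) * a t₁ ^ 2 := by
        rw [intervalIntegral.integral_mul_const, intervalIntegral.integral_eq_sub_of_hasDerivAt
          (f := fun t => exp (2 * t))]
        · intro x _
          exact ((hasDerivAt_id x).const_mul 2).exp.congr_deriv (by simp; ring)
        · exact (by fun_prop : Continuous fun t : ℝ => 2 * exp (2 * t)).intervalIntegrable _ _
      have e2 : ∫ t in t₀..t₁, 2 * exp (2 * t) * a t₁ ^ 2 ≤ ∫ t in t₀..t₁, 2 * exp (2 * t) * a t ^ 2 := by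
        refine intervalIntegral.integral_mono_on h01.le
          ((by fun_prop : Continuous fun t : ℝ => 2 * exp (2 * t) * a t₁ ^ 2).intervalIntegrable _ _)
          (hint _ _) fun t ht => ?_
        exact mul_le_mul_of_nonneg_left (pow_le_pow_left₀ (ha0 _) (hanti ht.2) 2) (by positivity)
      have e3 : 0 ≤ ∫ t in t₁..T, 2 * exp (2 * t) * a t ^ 2 :=
        intervalIntegral.integral_nonneg ht₁T.le fun t _ => by positivity
      linarith
    have hI' := mul_le_mul_of_nonneg_left hI (sub_nonneg.2 hk1.le)
    set b₀ := ∫ z in {z ∈ D | t₀ < w z}, exp (2 * w z) * exp (2 * V z) with hb₀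
    have hlev' : 4 * π * (b₀ - exp (2 * t₀) * a t₀) ≤ 1 * b₀ ^ 2 - 1 * exp (2 * t₀) * a t₀ ^ 2 -
        (1 - kap) * ∫ t in t₀..T, 2 * exp (2 * t) * a t ^ 2 := hlev
    have hE : 0 ≤ exp (2 * t₀) - 1 := by linarith [one_le_exp (show 0 ≤ 2 * t₀ by linarith)]
    have h1 : 0 ≤ (4 * π - a t₀ - b₀) * (b₀ - a t₀) :=
      mul_nonneg (by linarith [haF t₀, hbF t₀]) (by linarith [hab t₀])
    have h2 : (exp (2 * t₀) - 1) * (4 * π * a t₀ - a t₀ ^ 2) ≤ (exp (2 * t₀) - 1) * (4 * π ^ 2) :=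
      mul_le_mul_of_nonneg_left (by nlinarith [sq_nonneg (a t₀ - 2 * π)]) hE
    nlinarith
  have hl1 : Tendsto (fun t₀ : ℝ => (1 - kap) * ((exp (2 * t₁) - exp (2 * t₀)) * a t₁ ^ 2)) (𝓝[>] 0)
      (𝓝 ((1 - kap) * ((exp (2 * t₁) - exp (2 * 0)) * a t₁ ^ 2))) :=
    ((by fun_prop : Continuous fun t₀ : ℝ =>
      (1 - kap) * ((exp (2 * t₁) - exp (2 * t₀)) * a t₁ ^ 2)).tendsto 0).mono_left nhdsWithin_le_nhds
  have hl2 : Tendsto (fun t₀ : ℝ => (exp (2 * t₀) - 1) * (4 * π ^ 2)) (𝓝[>] 0)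
      (𝓝 ((exp (2 * 0) - 1) * (4 * π ^ 2))) :=
    ((by fun_prop : Continuous fun t₀ : ℝ => (exp (2 * t₀) - 1) * (4 * π ^ 2)).tendsto 0).mono_left
      nhdsWithin_le_nhds
  have := le_of_tendsto_of_tendsto hl1 hl2 (by
    filter_upwards [Ioo_mem_nhdsGT ht₁0] with t ht using key t ht.1 ht.2)
  simp only [mul_zero, exp_zero, sub_self, zero_mul] at this
  have h3 : 1 < exp (2 * t₁) := one_lt_exp_iff.2 (by linarith)
  have : 0 < (1 - kap) * ((exp (2 * t₁) - 1) * a t₁ ^ 2) :=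
    mul_pos (by linarith) (mul_pos (by linarith) (by positivity))
  linarith

theorem eq_of_continuous_of_exp_eq_one {φ : ℝ → ℂ} (hφ : Continuous φ)
    (h : ∀ s, Complex.exp (φ s) = 1) (a b : ℝ) : φ a = φ b := by
  choose n hn using fun s => Complex.exp_eq_one_iff.1 (h s)
  have hc : Continuous n := by
    rw [Int.isClosedEmbedding_coe_real.isInducing.continuous_iff]
    have : ((fun k : ℤ => (k : ℝ)) ∘ n) = fun s => (φ s).im / (2 * π) := by
      funext s
      rw [hn s]
      simp
    rw [this]
    fun_prop
  rw [hn a, hn b, PreconnectedSpace.constant inferInstance hc (x := a) (y := b)]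

/-- A continuous logarithm of a curve in the closed right half plane changes as the principal one. -/
theorem sub_eq_log_sub_log_of_re_nonneg {h : ℝ → ℂ} (hh : Continuous h)
    (hre : ∀ s, 0 ≤ (Complex.exp (h s)).re) (a b : ℝ) :
    (h b).im - (h a).im = (Complex.exp (h b)).arg - (Complex.exp (h a)).arg := by
  have hslit : ∀ s, Complex.exp (h s) ∈ Complex.slitPlane := fun s => by
    rcases (hre s).lt_or_eq with h1 | h1
    · exact Or.inl h1
    · exact Or.inr fun h2 => Complex.exp_ne_zero (h s) (Complex.ext h1.symm h2)
  have hc : Continuous fun s => h s - Complex.log (Complex.exp (h s)) :=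
    hh.sub (Continuous.clog (by fun_prop) hslit)
  have := eq_of_continuous_of_exp_eq_one hc (fun s => by
    rw [Complex.exp_sub, Complex.exp_log (Complex.exp_ne_zero _), div_self (Complex.exp_ne_zero _)]) a b
  have := congrArg Complex.im this
  simp only [Complex.sub_im, Complex.log_im] at this
  linarith

theorem exists_eq_of_interlaced {Γ Δ : ℝ → ℂ} (hΓ : Continuous Γ) (hΔ : Continuous Δ)
    (hΓre : ∀ t, 0 ≤ (Γ t).re) (hΔre : ∀ t, 0 ≤ (Δ t).re) (hΓ0 : (Γ 0).re = 0) (hΓ1 : (Γ 1).re = 0)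
    (hΔ0 : (Δ 0).re = 0) (hΔ1 : (Δ 1).re = 0) (h12 : (Γ 0).im < (Δ 0).im)
    (h23 : (Δ 0).im < (Γ 1).im) (h34 : (Γ 1).im < (Δ 1).im) : ∃ s t, Γ s = Δ t := by
  by_contra! hne
  obtain ⟨g, hg, hexp⟩ := Complex.exists_continuousOn_eqOn_exp_comp (X := ℝ × ℝ) (U := Set.univ)
    (g := fun x => Γ x.1 - Δ x.2) (show SimplyConnectedSpace _ from @SimplyConnectedSpace.ofContractible _ _ (convex_univ.contractibleSpace Set.univ_nonempty)) isOpen_univ (by fun_prop)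
    (by rintro ⟨x, -, hx⟩; exact hne _ _ (sub_eq_zero.1 hx))
  rw [continuousOn_univ] at hg
  have he : ∀ s t, Complex.exp (g (s, t)) = Γ s - Δ t := fun s t => hexp (Set.mem_univ (s, t))
  have argp : ∀ z : ℂ, z.re = 0 → 0 < z.im → z.arg = π / 2 := fun z h1 h2 =>
    Complex.arg_eq_pi_div_two_iff.2 ⟨h1, h2⟩
  have argn : ∀ z : ℂ, z.re = 0 → z.im < 0 → z.arg = -(π / 2) := fun z h1 h2 =>
    Complex.arg_eq_neg_pi_div_two_iff.2 ⟨h1, h2⟩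
  have eneg : ∀ s t, Complex.exp (g (s, t) + π * Complex.I) = -(Γ s - Δ t) := fun s t => by
    rw [Complex.exp_add, he, Complex.exp_pi_mul_I]; ring
  have e1 := sub_eq_log_sub_log_of_re_nonneg (h := fun s => g (s, 0)) (by fun_prop)
    (fun s => by rw [he, Complex.sub_re, hΔ0, sub_zero]; exact hΓre s) 0 1
  have e2 := sub_eq_log_sub_log_of_re_nonneg (h := fun s => g (s, 1)) (by fun_prop)
    (fun s => by rw [he, Complex.sub_re, hΔ1, sub_zero]; exact hΓre s) 0 1
  have e3 := sub_eq_log_sub_log_of_re_nonneg (h := fun t => g (0, t) + π * Complex.I) (by fun_prop)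
    (fun s => by rw [eneg]; simp [hΓ0, hΔre]) 0 1
  have e4 := sub_eq_log_sub_log_of_re_nonneg (h := fun t => g (1, t) + π * Complex.I) (by fun_prop)
    (fun s => by rw [eneg]; simp [hΓ1, hΔre]) 0 1
  simp only [he, eneg] at e1 e2 e3 e4
  rw [argp _ (by simp [*]) (by simp; linarith), argn _ (by simp [*]) (by simp; linarith)] at e1
  rw [argn _ (by simp [*]) (by simp; linarith), argn _ (by simp [*]) (by simp; linarith)] at e2
  rw [argp _ (by simp [*]) (by simp; linarith), argp _ (by simp [*]) (by simp; linarith)] at e3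
  rw [argp _ (by simp [*]) (by simp; linarith), argn _ (by simp [*]) (by simp; linarith)] at e4
  simp only [Complex.add_im] at e3 e4
  linarith [pi_pos]

/-- Two points on rays inside a connected open subset of the upper half plane can be joined in
logarithmic coordinates, staying away from the origin. -/
theorem exists_joinedIn_log {A : Set ℂ} (hAo : IsOpen A) (hAc : IsPreconnected A)
    (hA : A ⊆ {z | 0 < z.im}) {L θ θ' : ℝ} (h0 : 0 < θ) (h1 : θ < π) (h0' : 0 < θ') (h1' : θ' < π)
    (hr : ∀ x ≤ L, Complex.exp (x + θ * Complex.I) ∈ A)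
    (hr' : ∀ x ≤ L, Complex.exp (x + θ' * Complex.I) ∈ A) :
    ∃ E ≤ L, ∀ ε ≤ E, JoinedIn {ζ | ε ≤ ζ.re ∧ Complex.exp ζ ∈ A} (ε + θ * Complex.I)
      (ε + θ' * Complex.I) := by
  have hpc := (hAo.isConnected_iff_isPathConnected.1 ⟨⟨_, hr L le_rfl⟩, hAc⟩)
  have hj := hpc.joinedIn _ (hr L le_rfl) _ (hr' L le_rfl)
  have hlogc : ContinuousOn Complex.log A := fun z hz =>
    (continuousAt_clog (Or.inr (hA hz).ne')).continuousWithinAt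
  set P := hj.somePath
  have hPlog : Continuous fun t => Complex.log (P t) :=
    hlogc.comp_continuous P.continuous fun t => hj.somePath_mem t
  obtain ⟨E, hE⟩ := (isCompact_range (Complex.continuous_re.comp hPlog)).bddBelow
  have hEL : ∀ t, E ≤ (Complex.log (P t)).re := fun t => hE ⟨t, rfl⟩
  have hlogexp : ∀ θ : ℝ, 0 < θ → θ < π → Complex.log (Complex.exp (L + θ * Complex.I)) =
      L + θ * Complex.I := fun θ h0 h1 =>
    Complex.log_exp (by simp; linarith) (by simp; linarith)
  refine ⟨min E L, min_le_right _ _, fun ε hε => ?_⟩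
  have hεE := hε.trans (min_le_left _ _)
  have hεL := hε.trans (min_le_right _ _)
  have hseg : ∀ θ : ℝ, (∀ x ≤ L, Complex.exp (x + θ * Complex.I) ∈ A) →
      JoinedIn {ζ : ℂ | ε ≤ ζ.re ∧ Complex.exp ζ ∈ A} (ε + θ * Complex.I) (L + θ * Complex.I) := by
    intro θ hr
    refine JoinedIn.ofLine (f := fun t : ℝ => ((ε + t * (L - ε) : ℝ) : ℂ) + θ * Complex.I)
      (by fun_prop) (by simp) (by simp) ?_
    rintro _ ⟨t, ht, rfl⟩
    have a1 : 0 ≤ t * (L - ε) := mul_nonneg ht.1 (by linarith)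
    have a2 : t * (L - ε) ≤ 1 * (L - ε) := mul_le_mul_of_nonneg_right ht.2 (by linarith)
    refine ⟨?_, hr _ (by linarith)⟩
    simp only [Complex.add_re, Complex.ofReal_re, Complex.mul_re, Complex.I_re, Complex.I_im,
      Complex.ofReal_im]
    linarith
  refine (hseg θ hr).trans (JoinedIn.trans ?_ (hseg θ' hr').symm)
  rw [← hlogexp θ h0 h1, ← hlogexp θ' h0' h1']
  refine ⟨⟨⟨fun t => Complex.log (P t), hPlog⟩, by simp, by simp⟩, fun t => ⟨?_, ?_⟩⟩
  · exact hεE.trans (hEL t)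
  · have hm := hj.somePath_mem t
    have : P t ≠ 0 := fun h => by
      have := hA hm
      rw [show hj.somePath t = 0 from h] at this
      exact absurd this (by simp)
    show Complex.exp (Complex.log (P t)) ∈ A
    rw [Complex.exp_log this]
    exact hm

/-- Two disjoint connected open subsets of the upper half plane cannot contain interlaced rays. -/
theorem not_disjoint_of_interlaced_rays {A B : Set ℂ} (hAo : IsOpen A) (hAc : IsPreconnected A)
    (hA : A ⊆ {z | 0 < z.im}) (hBo : IsOpen B) (hBc : IsPreconnected B)
    (hB : B ⊆ {z | 0 < z.im}) {L θ₁ θ₂ θ₃ θ₄ : ℝ} (h0 : 0 < θ₁) (h12 : θ₁ < θ₂) (h23 : θ₂ < θ₃)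
    (h34 : θ₃ < θ₄) (h4 : θ₄ < π)
    (hr1 : ∀ x ≤ L, Complex.exp (x + θ₁ * Complex.I) ∈ A)
    (hr2 : ∀ x ≤ L, Complex.exp (x + θ₂ * Complex.I) ∈ B)
    (hr3 : ∀ x ≤ L, Complex.exp (x + θ₃ * Complex.I) ∈ A)
    (hr4 : ∀ x ≤ L, Complex.exp (x + θ₄ * Complex.I) ∈ B) : ¬ Disjoint A B := by
  obtain ⟨E, -, hE⟩ := exists_joinedIn_log hAo hAc hA h0 (by linarith) (by linarith) (by linarith)
    hr1 hr3
  obtain ⟨F, -, hF⟩ := exists_joinedIn_log hBo hBc hB (by linarith) (by linarith) (by linarith) h4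
    hr2 hr4
  have j1 := hE (min E F) (min_le_left _ _)
  have j2 := hF (min E F) (min_le_right _ _)
  set ε := min E F
  have m1 : ∀ t, ε ≤ (j1.somePath.extend t).re ∧ Complex.exp (j1.somePath.extend t) ∈ A := fun t => by
    have : j1.somePath.extend t ∈ Set.range j1.somePath := by
      rw [← Path.extend_range]; exact ⟨t, rfl⟩
    obtain ⟨s, hs⟩ := this
    rw [← hs]; exact j1.somePath_mem s
  have m2 : ∀ t, ε ≤ (j2.somePath.extend t).re ∧ Complex.exp (j2.somePath.extend t) ∈ B := fun t => by
    have : j2.somePath.extend t ∈ Set.range j2.somePath := by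
      rw [← Path.extend_range]; exact ⟨t, rfl⟩
    obtain ⟨s, hs⟩ := this
    rw [← hs]; exact j2.somePath_mem s
  have c1 := j1.somePath.continuous_extend
  have c2 := j2.somePath.continuous_extend
  obtain ⟨s, t, hst⟩ := exists_eq_of_interlaced (Γ := fun s => j1.somePath.extend s - ε)
    (Δ := fun s => j2.somePath.extend s - ε) (by fun_prop) (by fun_prop)
    (fun t => by simpa using (m1 t).1) (fun t => by simpa using (m2 t).1) (by simp) (by simp)
    (by simp) (by simp) (by simpa using h12) (by simpa using h23) (by simpa using h34)
  have hst : j1.somePath.extend s = j2.somePath.extend t := by simpa using hst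
  exact Set.not_disjoint_iff.2 ⟨_, (m1 s).2, hst ▸ (m2 t).2⟩

/-- Disjoint connected open subsets of the upper half plane that both reach a boundary point have
disjoint fillings. -/
theorem disjoint_fill_of_disjoint {C C' : Set ℂ} (hCo : IsOpen C) (hCc : IsPreconnected C)
    (hC : C ⊆ {z | 0 < z.im}) (hCc' : IsPreconnected C')
    (hC' : C' ⊆ {z | 0 < z.im}) (h0 : 0 ∈ closure C) (h0' : 0 ∈ closure C') (hd : Disjoint C C') :
    Disjoint (fill C) (fill C') := by
  have key : ∀ C : Set ℂ, IsPreconnected C → 0 ∈ closure C → IsPreconnected (C ∪ {z | z.im ≤ 0}) := by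
    intro C hCc h0
    have h1 : IsPreconnected (insert 0 C) := hCc.subset_closure (Set.subset_insert _ _)
      (Set.insert_subset h0 subset_closure)
    have h2 := h1.union 0 (Set.mem_insert _ _) (show (0 : ℂ) ∈ {z : ℂ | z.im ≤ 0} by simp)
      convex_im_nonpos.isPreconnected
    convert h2 using 1
    rw [Set.insert_union, Set.insert_eq_of_mem
      (show (0 : ℂ) ∈ C ∪ {z | z.im ≤ 0} from Or.inr (show (0 : ℂ).im ≤ 0 by simp))]
  have hlow : ∀ C : Set ℂ, C ⊆ {z | 0 < z.im} → {z : ℂ | z.im ≤ 0} ⊆ Cᶜ := fun C hC z hz hzC =>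
    (lt_of_lt_of_le (show 0 < z.im from hC hzC) hz).false
  have hext : C' ⊆ (fill C)ᶜ := Set.subset_union_left.trans
    ((key C' hCc' h0').subset_compl_fill
      (Set.union_subset hd.symm.subset_compl_right (hlow C hC)) (Or.inr (by simp)))
  rw [Set.disjoint_left]
  intro z hz hz'
  by_cases hzC : z ∈ C
  · exact (key C hCc h0).subset_compl_fill
      (Set.union_subset hd.subset_compl_right (hlow C' hC')) (Or.inr (by simp)) (Or.inl hzC) hz'
  set B := connectedComponentIn Cᶜ z with hBdef
  have hzB : z ∈ B := mem_connectedComponentIn hzC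
  have hBf : B ⊆ fill C := isPreconnected_connectedComponentIn.subset_fill
    (connectedComponentIn_subset _ _) hzB hz
  have hBC' : B ⊆ C'ᶜ := fun x hx hx' => hext hx' (hBf hx)
  have hmeet : (B ∩ closure C).Nonempty := by
    by_contra hne
    have hBcl : IsClosed B := hCo.isClosed_compl.connectedComponentIn z
    have hBo : IsOpen B := by
      have : B = connectedComponentIn (closure C)ᶜ z := by
        refine Set.Subset.antisymm ?_ (connectedComponentIn_mono _ (Set.compl_subset_compl.2 subset_closure))
        exact isPreconnected_connectedComponentIn.subset_connectedComponentIn hzB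
          fun x hx hxC => hne ⟨x, hx, hxC⟩
      rw [this]
      exact isClosed_closure.isOpen_compl.connectedComponentIn
    rcases isClopen_iff.1 ⟨hBcl, hBo⟩ with h | h
    · rw [h] at hzB; exact hzB
    · exact hne ⟨0, h ▸ Set.mem_univ _, h0⟩
  obtain ⟨b, hbB, hbC⟩ := hmeet
  have hBC : IsPreconnected (B ∪ insert b C) := isPreconnected_connectedComponentIn.union b hbB
    (Set.mem_insert _ _) (hCc.subset_closure (Set.subset_insert _ _)
      (Set.insert_subset hbC subset_closure))
  have hBC2 : IsPreconnected (B ∪ C) := by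
    convert hBC using 1
    rw [Set.union_insert, Set.insert_eq_of_mem (show b ∈ B ∪ C from Or.inl hbB)]
  have := (key _ hBC2 (closure_mono Set.subset_union_right h0)).subset_compl_fill
    (Set.union_subset (Set.union_subset hBC' hd.subset_compl_right) (hlow C' hC')) (Or.inr (by simp))
  exact this (Or.inl (Or.inl hzB)) hz'

theorem ray_subset_connectedComponentIn {A : Set ℂ} {L θ : ℝ}
    (hr : ∀ x ≤ L, Complex.exp (x + θ * Complex.I) ∈ A) {x : ℝ} (hx : x ≤ L) :
    Complex.exp (x + θ * Complex.I) ∈ connectedComponentIn A (Complex.exp (L + θ * Complex.I)) := by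
  have h1 : IsPreconnected ((fun x : ℝ => Complex.exp (x + θ * Complex.I)) '' Set.Iic L) :=
    isPreconnected_Iic.image _ (by fun_prop)
  exact h1.subset_connectedComponentIn ⟨L, Set.self_mem_Iic, rfl⟩
    (by rintro _ ⟨y, hy, rfl⟩; exact hr y hy) ⟨x, hx, rfl⟩

theorem zero_mem_closure_of_ray {C : Set ℂ} {L θ : ℝ}
    (hr : ∀ x ≤ L, Complex.exp (x + θ * Complex.I) ∈ C) : 0 ∈ closure C := by
  refine mem_closure_of_tendsto (f := fun x : ℝ => Complex.exp (x + θ * Complex.I))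
    (b := Filter.atBot) ?_ ((Filter.eventually_le_atBot L).mono hr)
  rw [Complex.tendsto_exp_nhds_zero_iff]
  exact Filter.tendsto_id.congr fun x => by simp

/-- Four rays with alternating signs produce three domains with disjoint fillings. -/
theorem exists_three_domains {A B : Set ℂ} (hAo : IsOpen A) (hA : A ⊆ {z | 0 < z.im})
    (hBo : IsOpen B) (hB : B ⊆ {z | 0 < z.im}) (hAB : Disjoint A B) {L θ₁ θ₂ θ₃ θ₄ : ℝ}
    (h0 : 0 < θ₁) (h12 : θ₁ < θ₂) (h23 : θ₂ < θ₃) (h34 : θ₃ < θ₄) (h4 : θ₄ < π)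
    (hr1 : ∀ x ≤ L, Complex.exp (x + θ₁ * Complex.I) ∈ A)
    (hr2 : ∀ x ≤ L, Complex.exp (x + θ₂ * Complex.I) ∈ B)
    (hr3 : ∀ x ≤ L, Complex.exp (x + θ₃ * Complex.I) ∈ A)
    (hr4 : ∀ x ≤ L, Complex.exp (x + θ₄ * Complex.I) ∈ B) :
    ∃ C : Fin 3 → Set ℂ, (∀ i, (∃ x ∈ A, C i = connectedComponentIn A x) ∨
      ∃ x ∈ B, C i = connectedComponentIn B x) ∧ Pairwise fun i j => Disjoint (fill (C i)) (fill (C j)) := by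
  have hdisj : ∀ (S T : Set ℂ) (x y : ℂ), IsOpen S → S ⊆ {z | 0 < z.im} → T ⊆ {z | 0 < z.im} →
      0 ∈ closure (connectedComponentIn S x) → 0 ∈ closure (connectedComponentIn T y) →
      Disjoint (connectedComponentIn S x) (connectedComponentIn T y) →
      Disjoint (fill (connectedComponentIn S x)) (fill (connectedComponentIn T y)) :=
    fun S T x y hS hS1 hT1 h1 h2 h3 => disjoint_fill_of_disjoint hS.connectedComponentIn
      isPreconnected_connectedComponentIn ((connectedComponentIn_subset _ _).trans hS1)
      isPreconnected_connectedComponentIn ((connectedComponentIn_subset _ _).trans hT1) h1 h2 h3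
  have hd : ∀ (S : Set ℂ) (x y : ℂ), connectedComponentIn S x ≠ connectedComponentIn S y →
      Disjoint (connectedComponentIn S x) (connectedComponentIn S y) := by
    intro S x y hne
    by_contra hnd
    obtain ⟨z, h1, h2⟩ := Set.not_disjoint_iff.1 hnd
    exact hne ((connectedComponentIn_eq h1).trans (connectedComponentIn_eq h2).symm)
  have hd2 : ∀ x y : ℂ, Disjoint (connectedComponentIn A x) (connectedComponentIn B y) :=
    fun x y => hAB.mono (connectedComponentIn_subset _ _) (connectedComponentIn_subset _ _)
  have r1 := fun x hx => ray_subset_connectedComponentIn hr1 (x := x) hx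
  have r2 := fun x hx => ray_subset_connectedComponentIn hr2 (x := x) hx
  have r3 := fun x hx => ray_subset_connectedComponentIn hr3 (x := x) hx
  have r4 := fun x hx => ray_subset_connectedComponentIn hr4 (x := x) hx
  have z1 := zero_mem_closure_of_ray r1
  have z2 := zero_mem_closure_of_ray r2
  have z3 := zero_mem_closure_of_ray r3
  have z4 := zero_mem_closure_of_ray r4
  have m1 := hr1 L le_rfl
  have m2 := hr2 L le_rfl
  have m3 := hr3 L le_rfl
  have m4 := hr4 L le_rfl
  generalize Complex.exp (L + θ₁ * Complex.I) = p1 at *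
  generalize Complex.exp (L + θ₂ * Complex.I) = p2 at *
  generalize Complex.exp (L + θ₃ * Complex.I) = p3 at *
  generalize Complex.exp (L + θ₄ * Complex.I) = p4 at *
  by_cases h13 : connectedComponentIn A p1 = connectedComponentIn A p3
  · have h24 : connectedComponentIn B p2 ≠ connectedComponentIn B p4 := fun h24 => by
      refine not_disjoint_of_interlaced_rays (hAo.connectedComponentIn (x := p1))
        isPreconnected_connectedComponentIn ((connectedComponentIn_subset _ _).trans hA)
        (hBo.connectedComponentIn (x := p2)) isPreconnected_connectedComponentIn
        ((connectedComponentIn_subset _ _).trans hB) h0 h12 h23 h34 h4 r1 r2 ?_ ?_ (hd2 _ _)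
      · rw [h13]; exact r3
      · rw [h24]; exact r4
    have d12 := hdisj A B p1 p2 hAo hA hB z1 z2 (hd2 _ _)
    have d14 := hdisj A B p1 p4 hAo hA hB z1 z4 (hd2 _ _)
    have d24 := hdisj B B p2 p4 hBo hB hB z2 z4 (hd _ _ _ h24)
    refine ⟨![connectedComponentIn A p1, connectedComponentIn B p2, connectedComponentIn B p4],
      ?_, ?_⟩
    · intro i
      fin_cases i
      · exact Or.inl ⟨p1, m1, rfl⟩
      · exact Or.inr ⟨p2, m2, rfl⟩
      · exact Or.inr ⟨p4, m4, rfl⟩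
    · intro i j hij
      fin_cases i <;> fin_cases j <;>
        first
        | exact absurd rfl hij
        | assumption
        | (refine Disjoint.symm ?_; assumption)
  · have d12 := hdisj A B p1 p2 hAo hA hB z1 z2 (hd2 _ _)
    have d32 := hdisj A B p3 p2 hAo hA hB z3 z2 (hd2 _ _)
    have d13 := hdisj A A p1 p3 hAo hA hA z1 z3 (hd _ _ _ h13)
    refine ⟨![connectedComponentIn A p1, connectedComponentIn B p2, connectedComponentIn A p3],
      ?_, ?_⟩
    · intro i
      fin_cases i
      · exact Or.inl ⟨p1, m1, rfl⟩
      · exact Or.inr ⟨p2, m2, rfl⟩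
      · exact Or.inl ⟨p3, m3, rfl⟩
    · intro i j hij
      fin_cases i <;> fin_cases j <;>
        first
        | exact absurd rfl hij
        | assumption
        | (refine Disjoint.symm ?_; assumption)

theorem lapC_eq_fderiv_fderiv {f : ℂ → ℝ} (hf : ContDiff ℝ 2 f) (z : ℂ) :
    lapC f z = fderiv ℝ (fderiv ℝ f) z 1 1 + fderiv ℝ (fderiv ℝ f) z Complex.I Complex.I := by
  have hd : DifferentiableAt ℝ (fderiv ℝ f) z :=
    (hf.fderiv_right (m := 1) (by norm_num)).differentiable one_ne_zero z
  simp only [lapC]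
  rw [fderiv_clm_apply hd (differentiableAt_const _), fderiv_clm_apply hd (differentiableAt_const _)]
  simp

/-- The Laplacian of a composition with a linear conformal map. -/
theorem lapC_comp_conformal {f : ℂ → ℝ} (hf : ContDiff ℝ 2 f) (L : ℂ →L[ℝ] ℂ) {a b : ℝ}
    (h1 : L 1 = a + b * Complex.I) (h2 : L Complex.I = -b + a * Complex.I ∨ L Complex.I = b - a * Complex.I)
    (z : ℂ) : lapC (fun y => f (L y)) z = (a ^ 2 + b ^ 2) * lapC f (L z) := by
  have hf1 : Differentiable ℝ f := hf.differentiable two_ne_zero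
  have hf2 : Differentiable ℝ (fderiv ℝ f) :=
    (hf.fderiv_right (m := 1) (by norm_num)).differentiable one_ne_zero
  have hfd : ∀ v, (fun y => fderiv ℝ (fun y => f (L y)) y v) = fun y => fderiv ℝ f (L y) (L v) := by
    intro v; funext y
    rw [show fderiv ℝ (fun y => f (L y)) y = _ from
      ((hf1 (L y)).hasFDerivAt.comp y L.hasFDerivAt).fderiv]; rfl
  have hfd2 : ∀ v, fderiv ℝ (fun y => fderiv ℝ f (L y) (L v)) z v =
      fderiv ℝ (fderiv ℝ f) (L z) (L v) (L v) := by
    intro v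
    have := ((hf2 (L z)).hasFDerivAt.comp z L.hasFDerivAt).clm_apply (hasFDerivAt_const (L v) z)
    rw [show fderiv ℝ (fun y => fderiv ℝ f (L y) (L v)) z = _ from this.fderiv]
    simp
  rw [lapC, hfd, hfd, hfd2, hfd2, lapC_eq_fderiv_fderiv hf]
  set B := fderiv ℝ (fderiv ℝ f) (L z)
  have e1 : L 1 = a • (1 : ℂ) + b • Complex.I := by rw [h1]; simp
  rw [e1]
  rcases h2 with h2 | h2
  · have e2 : L Complex.I = (-b) • (1 : ℂ) + a • Complex.I := by rw [h2]; simp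
    rw [e2]
    simp only [map_add, map_smul, add_apply, smul_apply, smul_eq_mul]
    ring
  · have e2 : L Complex.I = b • (1 : ℂ) + (-a) • Complex.I := by rw [h2]; simp; ring
    rw [e2]
    simp only [map_add, map_smul, add_apply, smul_apply, smul_eq_mul]
    ring

theorem lapC_comp_conj {f : ℂ → ℝ} (hf : ContDiff ℝ 2 f) (z : ℂ) :
    lapC (fun y => f (starRingEnd ℂ y)) z = lapC f (starRingEnd ℂ z) := by
  have := lapC_comp_conformal hf (Complex.conjCLE : ℂ →L[ℝ] ℂ) (a := 1) (b := 0) (by simp)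
    (Or.inr (by simp)) z
  simpa using this

theorem lapC_comp_mul {f : ℂ → ℝ} (hf : ContDiff ℝ 2 f) (c z : ℂ) :
    lapC (fun y => f (c * y)) z = ‖c‖ ^ 2 * lapC f (c * z) := by
  have := lapC_comp_conformal hf (ContinuousLinearMap.mul ℝ ℂ c) (a := c.re) (b := c.im)
    (by simp [Complex.re_add_im]) (Or.inl (by apply Complex.ext <;> simp)) z
  rw [Complex.sq_norm, Complex.normSq_apply, ← sq, ← sq]
  simpa using this

noncomputable section
/-- The density of the round metric in stereographic coordinates. -/
def sphDensity (z : ℂ) : ℝ := 4 / (1 + ‖z‖ ^ 2) ^ 2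
end

theorem sphDensity_pos (z : ℂ) : 0 < sphDensity z := by unfold sphDensity; positivity

theorem contDiff_sphDensity : ContDiff ℝ ∞ sphDensity := by
  unfold sphDensity
  exact contDiff_const.div ((contDiff_const.add (contDiff_norm_sq ℝ)).pow 2) fun z => by positivity

theorem sphDensity_eq_of_norm_eq {z y : ℂ} (h : ‖z‖ = ‖y‖) : sphDensity z = sphDensity y := by
  simp only [sphDensity, h]

theorem contDiff_log_one_add_normSq : ContDiff ℝ ∞ fun z : ℂ => Real.log (1 + ‖z‖ ^ 2) :=
  (contDiff_const.add (contDiff_norm_sq ℝ)).log fun z => by positivity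

theorem lapC_log_one_add_normSq (z : ℂ) :
    lapC (fun z => Real.log (1 + ‖z‖ ^ 2)) z = sphDensity z := by
  have hN : ∀ y : ℂ, HasFDerivAt (fun z : ℂ => 1 + ‖z‖ ^ 2) (2 • innerSL ℝ y) y := fun y =>
    (hasStrictFDerivAt_norm_sq y).hasFDerivAt.const_add 1
  have hp : ∀ y : ℂ, 1 + ‖y‖ ^ 2 ≠ 0 := fun y => by positivity
  have h : ∀ v : ℂ, (fun y => fderiv ℝ (fun z : ℂ => Real.log (1 + ‖z‖ ^ 2)) y v) =
      fun y => 2 * inner ℝ y v / (1 + ‖y‖ ^ 2) := by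
    intro v; ext y
    rw [((hN y).log (hp y)).fderiv]
    simp; ring
  have h2 : ∀ v : ℂ, fderiv ℝ (fun y : ℂ => 2 * inner ℝ y v / (1 + ‖y‖ ^ 2)) z v =
      (2 * inner ℝ v v * (1 + ‖z‖ ^ 2) - 4 * (inner ℝ z v) ^ 2) / (1 + ‖z‖ ^ 2) ^ 2 := by
    intro v
    have h3 : HasFDerivAt (fun y : ℂ => 2 * inner ℝ y v) ((2 : ℝ) • (innerSL ℝ).flip v) z :=
      (((innerSL ℝ).flip v).hasFDerivAt (x := z)).const_mul 2
    have h4 := h3.mul ((hasDerivAt_inv (hp z)).comp_hasFDerivAt z (hN z))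
    rw [show fderiv ℝ (fun y : ℂ => 2 * inner ℝ y v / (1 + ‖y‖ ^ 2)) z = _ from h4.fderiv]
    simp only [Function.comp_apply, add_apply, smul_apply, smul_eq_mul, ContinuousLinearMap.flip_apply,
      innerSL_apply_apply, nsmul_eq_mul]
    have := hp z
    field_simp
    push_cast
    ring
  simp only [lapC, h, h2, sphDensity]
  rw [← add_div]
  congr 1
  have : ‖z‖ ^ 2 = z.re ^ 2 + z.im ^ 2 := by rw [Complex.sq_norm, Complex.normSq_apply]; ring
  rw [this]
  simp
  ring

theorem integrable_sphDensity : Integrable sphDensity := by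
  have h := (integrable_rpow_neg_one_add_norm_sq (E := ℂ) (μ := volume) (r := 4) (by simp; norm_num)).const_mul 4
  refine h.congr (Filter.Eventually.of_forall fun z => ?_)
  simp only [sphDensity]
  rw [show (-4 / 2 : ℝ) = -(2 : ℕ) by norm_num, Real.rpow_neg (by positivity), Real.rpow_natCast]
  rfl

/-- A solution of the mean field equation in stereographic coordinates, regular at infinity. -/
structure PlaneSol (v : ℂ → ℝ) (α b : ℝ) : Prop where
  contDiff : ContDiff ℝ ∞ v
  lap : ∀ z, lapC v z = sphDensity z * (α - exp (2 * v z))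
  lim : Filter.Tendsto v (Filter.cocompact ℂ) (nhds b)

namespace PlaneSol
variable {v v' : ℂ → ℝ} {α b : ℝ}

theorem contDiff_two (h : PlaneSol v α b) : ContDiff ℝ 2 v := h.contDiff.of_le (by norm_cast)

theorem exists_abs_le (h : PlaneSol v α b) : ∃ M, ∀ z, |v z| ≤ M := by
  have h1 : ∀ᶠ z in Filter.cocompact ℂ, |v z| ≤ |b| + 1 := by
    have := h.lim.abs
    exact this.eventually (Iic_mem_nhds (by linarith))
  obtain ⟨K, hK, hK'⟩ := Filter.mem_cocompact.1 h1
  obtain ⟨M, hM⟩ := hK.exists_bound_of_continuousOn h.contDiff.continuous.continuousOn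
  refine ⟨max M (|b| + 1), fun z => ?_⟩
  by_cases hz : z ∈ K
  · exact (hM z hz).trans (le_max_left _ _)
  · exact le_trans (hK' hz) (le_max_right _ _)

theorem comp_conj (h : PlaneSol v α b) : PlaneSol (fun z => v (starRingEnd ℂ z)) α b where
  contDiff := h.contDiff.comp Complex.conjCLE.contDiff
  lap z := by
    rw [lapC_comp_conj h.contDiff_two, h.lap, sphDensity_eq_of_norm_eq (y := z) (by simp)]
  lim := h.lim.comp Complex.conjCLE.toHomeomorph.isClosedEmbedding.tendsto_cocompact

theorem comp_mul (h : PlaneSol v α b) {c : ℂ} (hc : ‖c‖ = 1) : PlaneSol (fun z => v (c * z)) α b where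
  contDiff := h.contDiff.comp (contDiff_const.mul contDiff_id)
  lap z := by
    rw [lapC_comp_mul h.contDiff_two, h.lap, hc, sphDensity_eq_of_norm_eq (y := z) (by simp [hc])]
    ring
  lim := h.lim.comp (Homeomorph.mulLeft₀ c (by rintro rfl; simp at hc)).isClosedEmbedding.tendsto_cocompact

theorem integrable (h : PlaneSol v α b) : Integrable fun z => sphDensity z * exp (2 * v z) := by
  obtain ⟨M, hM⟩ := h.exists_abs_le
  refine integrable_sphDensity.mul_bdd (c := exp (2 * M)) ?_ (Filter.Eventually.of_forall fun z => ?_)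
  · exact (Real.continuous_exp.comp (continuous_const.mul h.contDiff.continuous)).aestronglyMeasurable
  · rw [Real.norm_eq_abs, abs_exp]
    exact exp_le_exp.2 (by linarith [le_abs_self (v z), hM z])

theorem isCompact_level (h : PlaneSol v α b) (h' : PlaneSol v' α b)
    (hreal : ∀ z : ℂ, z.im = 0 → v z = v' z) (x : ℂ) {s : ℝ} (hs : 0 < s) :
    IsCompact {z ∈ connectedComponentIn {z | 0 < z.im ∧ 0 < v z - v' z} x | s ≤ v z - v' z} := by
  set A := {z : ℂ | 0 < z.im ∧ 0 < v z - v' z} with hA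
  have hcont : Continuous fun z => v z - v' z := h.contDiff.continuous.sub h'.contDiff.continuous
  have hlim : Filter.Tendsto (fun z => v z - v' z) (Filter.cocompact ℂ) (nhds 0) := by
    simpa using h.lim.sub h'.lim
  obtain ⟨K, hK, hK'⟩ := Filter.mem_cocompact.1 (hlim.eventually (Iio_mem_nhds hs))
  refine hK.of_isClosed_subset (isClosed_of_closure_subset fun z hz => ?_) fun z hz => ?_
  · have hcl : IsClosed {z : ℂ | 0 ≤ z.im ∧ s ≤ v z - v' z} :=
      (isClosed_le continuous_const Complex.continuous_im).inter (isClosed_le continuous_const hcont)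
    have h1 : z ∈ {z : ℂ | 0 ≤ z.im ∧ s ≤ v z - v' z} := closure_minimal (fun y hy =>
      show 0 ≤ y.im ∧ s ≤ v y - v' y from ⟨(connectedComponentIn_subset _ _ hy.1).1.le, hy.2⟩) hcl hz
    have hzA : z ∈ A := by
      refine ⟨lt_of_le_of_ne h1.1 fun h0 => ?_, hs.trans_le h1.2⟩
      have := h1.2
      rw [hreal z h0.symm, sub_self] at this
      linarith
    have hzc : z ∈ closure (connectedComponentIn A x) := closure_mono (fun y hy => hy.1) hz
    refine ⟨?_, h1.2⟩
    obtain ⟨y, hy⟩ := closure_nonempty_iff.1 ⟨z, hzc⟩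
    have hins : IsPreconnected (insert z (connectedComponentIn A x)) :=
      isPreconnected_connectedComponentIn.subset_closure (Set.subset_insert _ _)
        (Set.insert_subset hzc subset_closure)
    rw [connectedComponentIn_eq hy]
    exact hins.subset_connectedComponentIn (Set.mem_insert_of_mem _ hy)
      (Set.insert_subset hzA (connectedComponentIn_subset _ _)) (Set.mem_insert _ _)
  · by_contra hzK
    exact (lt_of_lt_of_le (show v z - v' z < s from hK' hzK) hz.2).false

/-- A nodal domain of the difference of two solutions has joint mass greater than `4π`. -/
theorem four_pi_lt (h : PlaneSol v α b) (h' : PlaneSol v' α b) (hα : 1 < α)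
    (hreal : ∀ z : ℂ, z.im = 0 → v z = v' z) {x : ℂ} (hx : x ∈ {z | 0 < z.im ∧ 0 < v z - v' z}) :
    4 * π < ∫ z in fill (connectedComponentIn {z | 0 < z.im ∧ 0 < v z - v' z} x),
      (sphDensity z * exp (2 * v z) + sphDensity z * exp (2 * v' z)) := by
  set A := {z : ℂ | 0 < z.im ∧ 0 < v z - v' z} with hA
  have hcont : Continuous fun z => v z - v' z := h.contDiff.continuous.sub h'.contDiff.continuous
  have hAo : IsOpen A :=
    (isOpen_lt continuous_const Complex.continuous_im).inter (isOpen_lt continuous_const hcont)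
  set V : ℂ → ℝ := fun z => v' z + (Real.log 2 - Real.log (1 + ‖z‖ ^ 2)) with hV
  have hlogc : ContDiff ℝ 2 fun z : ℂ => Real.log (1 + ‖z‖ ^ 2) :=
    contDiff_log_one_add_normSq.of_le (by norm_cast)
  have hVc : ContDiff ℝ 2 V := h'.contDiff_two.add (contDiff_const.sub hlogc)
  have eV : ∀ z, exp (2 * V z) = sphDensity z * exp (2 * v' z) := by
    intro z
    have hp : 0 < 1 + ‖z‖ ^ 2 := by positivity
    rw [show 2 * V z = 2 * v' z + (Real.log 2 - Real.log (1 + ‖z‖ ^ 2)) +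
      (Real.log 2 - Real.log (1 + ‖z‖ ^ 2)) by simp only [hV]; ring, exp_add, exp_add, exp_sub,
      exp_log two_pos, exp_log hp, sphDensity]
    field_simp
    ring
  have eW : ∀ z, exp (2 * (v z - v' z)) * exp (2 * V z) = sphDensity z * exp (2 * v z) := by
    intro z
    rw [eV, show 2 * v z = 2 * (v z - v' z) + 2 * v' z by ring, exp_add]
    ring
  have hlapw : ∀ z, lapC (fun z => v z - v' z) z =
      sphDensity z * exp (2 * v' z) - sphDensity z * exp (2 * v z) := by
    intro z
    rw [lapC_sub isOpen_univ h.contDiff_two.contDiffOn h'.contDiff_two.contDiffOn (Set.mem_univ z),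
      h.lap, h'.lap]
    ring
  have hlapV : ∀ z, lapC V z = sphDensity z * (α - exp (2 * v' z)) - sphDensity z := by
    intro z
    have e : V = fun z => v' z - ((1 : ℝ) * Real.log (1 + ‖z‖ ^ 2) + -Real.log 2) := by
      funext z; simp only [hV]; ring
    rw [e, lapC_sub isOpen_univ h'.contDiff_two.contDiffOn
      ((contDiff_const.mul hlogc).add contDiff_const).contDiffOn (Set.mem_univ z), h'.lap,
      lapC_const_mul_add_const hlogc, lapC_log_one_add_normSq, one_mul]
  obtain ⟨M, hM⟩ := h'.exists_abs_le
  set kap := max 0 (1 - (α - 1) * exp (-(2 * M)))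
  have hD : LevelSystem (connectedComponentIn A x) (fun z => v z - v' z) :=
    { isOpen := hAo.connectedComponentIn
      im_pos := fun z hz => (connectedComponentIn_subset _ _ hz).1
      contDiff := h.contDiff_two.sub h'.contDiff_two
      isCompact := fun s hs => h.isCompact_level h' hreal x hs
      lap_neg := fun z hz => by
        have hz' := (connectedComponentIn_subset _ _ hz).2
        rw [hlapw, sub_neg]
        exact mul_lt_mul_of_pos_left (exp_lt_exp.2 (by linarith)) (sphDensity_pos z) }
  have := hD.four_pi_lt (V := V) (kap := kap) ⟨x, mem_connectedComponentIn hx⟩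
    (fun z hz => (connectedComponentIn_subset _ _ hz).2) hVc (le_max_left _ _)
    (max_lt one_pos (by
      have := mul_pos (sub_pos.2 hα) (exp_pos (-(2 * M)))
      linarith))
    (fun z => by
      have h1 : (1 - (α - 1) * exp (-(2 * M))) * exp (2 * V z) ≤ kap * exp (2 * V z) :=
        mul_le_mul_of_nonneg_right (le_max_right _ _) (exp_pos _).le
      refine le_trans ?_ h1
      rw [hlapV, eV]
      have h2 : exp (-(2 * M)) * exp (2 * v' z) ≤ 1 := by
        rw [← exp_add, exp_le_one_iff]
        linarith [le_abs_self (v' z), hM z]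
      have h3 := mul_le_mul_of_nonneg_left h2 (mul_pos (sub_pos.2 hα) (sphDensity_pos z)).le
      nlinarith)
    (fun z _ => by rw [hlapw, eW, eV]; ring) (by simpa only [eW] using h.integrable)
    (by simpa only [eV] using h'.integrable)
  simp only [eW] at this
  simp only [eV] at this
  exact this

end PlaneSol

theorem integral_sphDensity : ∫ z, sphDensity z = 4 * π := by
  have h := integral_fun_norm_addHaar (E := ℂ) volume (fun r => 4 / (1 + r ^ 2) ^ 2 : ℝ → ℝ)
  have h2 : ∫ y in Set.Ioi (0 : ℝ), y * (4 / (1 + y ^ 2) ^ 2) = 0 - (-(2 / (1 + 0 ^ 2))) := by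
    refine integral_Ioi_of_hasDerivAt_of_nonneg' (g := fun y => -(2 / (1 + y ^ 2))) (fun y _ => ?_)
      (fun y hy => ?_) ?_
    · have h1 : HasDerivAt (fun y : ℝ => 1 + y ^ 2) (2 * y) y := by
        simpa using (hasDerivAt_pow 2 y).const_add 1
      refine (((hasDerivAt_const y (2 : ℝ)).fun_div h1 (by positivity)).neg).congr_deriv ?_
      ring
    · have : (0 : ℝ) < y := hy
      positivity
    · have h3 : Filter.Tendsto (fun y : ℝ => 1 + y ^ 2) Filter.atTop Filter.atTop :=
        Filter.tendsto_atTop_add_const_left _ _ (Filter.tendsto_pow_atTop two_ne_zero)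
      simpa using (h3.const_div_atTop 2).neg
  simp only [Complex.finrank_real_complex, smul_eq_mul] at h
  simp only [Nat.add_one_sub_one, pow_one, h2] at h
  rw [show (fun z => sphDensity z) = fun z : ℂ => 4 / (1 + ‖z‖ ^ 2) ^ 2 from rfl, h]
  simp [Measure.real, Complex.volume_ball]
  ring

theorem integral_mul_lapC_comm {g f : ℂ → ℝ} (hg : ContDiff ℝ 2 g)
    (hc : HasCompactSupport g) (hf : ContDiff ℝ 2 f) :
    ∫ z, g z * lapC f z = ∫ z, lapC g z * f z := by
  obtain ⟨χ, h1, h2, -, ⟨V, hV, hKV, hV1⟩, -⟩ :=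
    exists_smooth_cutoff hc isOpen_univ (Set.subset_univ _)
  have hs : ∀ z, g z * lapC f z = g z * lapC (fun y => χ y * f y) z := by
    intro z
    by_cases hz : z ∈ tsupport g
    · have he : (fun y => χ y * f y) =ᶠ[nhds z] f := by
        filter_upwards [hV.mem_nhds (hKV hz)] with y hy
        rw [hV1 y hy, one_mul]
      have he2 : ∀ v, (fun y => fderiv ℝ (fun y => χ y * f y) y v) =ᶠ[nhds z] fun y => fderiv ℝ f y v :=
        fun v => he.eventuallyEq_nhds.mono fun y hy => by
          show fderiv ℝ (fun y => χ y * f y) y v = _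
          rw [hy.fderiv_eq]
      rw [lapC, lapC, (he2 1).fderiv_eq, (he2 _).fderiv_eq]
    · rw [image_eq_zero_of_notMem_tsupport hz, zero_mul, zero_mul]
  have hs2 : ∀ z, lapC g z * f z = (χ z * f z) * lapC g z := by
    intro z
    by_cases hz : z ∈ tsupport g
    · rw [hV1 z (hKV hz)]; ring
    · have : lapC g z = 0 := by
        have h := fun v => fderiv_of_notMem_tsupport (𝕜 := ℝ) (f := fun y => fderiv ℝ g y v) (x := z)
          fun h => hz (tsupport_fderiv_apply_subset ℝ v h)
        rw [lapC, h, h]; simp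
      rw [this]; ring
  have hχ : ContDiff ℝ 2 fun y => χ y * f y := (h1.of_le (by norm_cast)).mul hf
  simp only [hs, hs2]
  rw [integral_mul_lapC isOpen_univ (hg.of_le (by norm_num)) hc (Set.subset_univ _) hχ.contDiffOn,
    integral_mul_lapC isOpen_univ (hχ.of_le (by norm_num)) h2.mul_right (Set.subset_univ _) hg.contDiffOn]
  simp only [mul_comm]

namespace PlaneSol
variable {v : ℂ → ℝ} {α b : ℝ}

open Filter Topology in
theorem integral_eq (h : PlaneSol v α b) : ∫ z, sphDensity z * exp (2 * v z) = 4 * π * α := by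
  obtain ⟨χ, h1, h2, -, ⟨V, hV, hKV, hV1⟩, h01⟩ :=
    exists_smooth_cutoff (K := {(0 : ℂ)}) isCompact_singleton isOpen_univ (Set.subset_univ _)
  have hχ0 : χ 0 = 1 := hV1 0 (hKV rfl)
  have h1' : ContDiff ℝ 2 χ := h1.of_le (by norm_cast)
  have hint : Integrable fun z => sphDensity z * (α - exp (2 * v z)) := by
    simp only [mul_sub]
    exact (integrable_sphDensity.mul_const α).sub h.integrable
  set R : ℕ → ℝ := fun n => (n : ℝ) + 1
  have hR0 : ∀ n, 0 < R n := fun n => by positivity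
  have hRt : Tendsto R atTop atTop := tendsto_natCast_atTop_atTop.atTop_add tendsto_const_nhds
  have t1 : Tendsto (fun n => ∫ z, χ (((R n)⁻¹ : ℝ) * z) * (sphDensity z * (α - exp (2 * v z)))) atTop
      (𝓝 (∫ z, sphDensity z * (α - exp (2 * v z)))) := by
    refine tendsto_integral_of_dominated_convergence
      (fun z => ‖sphDensity z * (α - exp (2 * v z))‖) (fun n => ?_) hint.norm (fun n => ?_) ?_
    · exact (((h1.continuous.comp (by fun_prop)).mul (contDiff_sphDensity.continuous.mul
        (continuous_const.sub (Real.continuous_exp.comp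
          (continuous_const.mul h.contDiff.continuous))))).aestronglyMeasurable)
    · refine Eventually.of_forall fun z => ?_
      rw [norm_mul]
      refine mul_le_of_le_one_left (norm_nonneg _) ?_
      rw [Real.norm_eq_abs, abs_of_nonneg (h01 _).1]
      exact (h01 _).2
    · refine Eventually.of_forall fun z => ?_
      have : Tendsto (fun n => χ (((R n)⁻¹ : ℝ) * z)) atTop (𝓝 1) := by
        rw [← hχ0]
        refine (h1.continuous.tendsto 0).comp ?_
        have := ((Complex.continuous_ofReal.tendsto 0).comp (tendsto_inv_atTop_zero.comp hRt)).mul_const z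
        simpa using this
      simpa using this.mul_const (sphDensity z * (α - exp (2 * v z)))
  have e : ∀ n, ∫ z, χ (((R n)⁻¹ : ℝ) * z) * (sphDensity z * (α - exp (2 * v z))) =
      ∫ y, lapC χ y * (v (R n * y) - b) := by
    intro n
    have hg : ContDiff ℝ 2 fun z : ℂ => χ (((R n)⁻¹ : ℝ) * z) := h1'.comp (contDiff_const.mul contDiff_id)
    have hgc : HasCompactSupport fun z : ℂ => χ (((R n)⁻¹ : ℝ) * z) :=
      h2.comp_homeomorph (Homeomorph.mulLeft₀ (((R n)⁻¹ : ℝ) : ℂ) (by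
        exact_mod_cast (inv_pos.2 (hR0 n)).ne'))
    have hlap : ∀ z, sphDensity z * (α - exp (2 * v z)) = lapC (fun z => v z - b) z := fun z => by
      have := lapC_const_mul_add_const h.contDiff_two 1 (-b) z
      simp only [one_mul, ← sub_eq_add_neg] at this
      rw [this, h.lap]
    simp only [hlap]
    rw [integral_mul_lapC_comm hg hgc (h.contDiff_two.sub contDiff_const)]
    simp only [lapC_comp_mul h1']
    have hsc := Measure.integral_comp_smul (volume : Measure ℂ)
      (fun z => ‖(((R n)⁻¹ : ℝ) : ℂ)‖ ^ 2 * lapC χ (((R n)⁻¹ : ℝ) * z) * (v z - b)) (R n)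
    have hRn := (hR0 n).ne'
    have hcan : ∀ y : ℂ, (((R n)⁻¹ : ℝ) : ℂ) * (R n * y) = y := fun y => by
      rw [← mul_assoc, ← Complex.ofReal_mul, inv_mul_cancel₀ hRn, Complex.ofReal_one, one_mul]
    simp only [Complex.real_smul, Complex.finrank_real_complex, hcan] at hsc
    have hn : ‖(((R n)⁻¹ : ℝ) : ℂ)‖ ^ 2 = ((R n) ^ 2)⁻¹ := by
      rw [Complex.norm_real, Real.norm_eq_abs, sq_abs, inv_pow]
    rw [hn] at hsc ⊢
    simp only [mul_assoc] at hsc ⊢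
    rw [integral_const_mul, abs_of_pos (by have := hR0 n; positivity), smul_eq_mul] at hsc
    exact (mul_left_cancel₀ (by have := hR0 n; positivity) hsc).symm
  obtain ⟨M, hM⟩ := h.exists_abs_le
  have hlapcont : Continuous (lapC χ) :=
    continuousOn_univ.1 (continuousOn_lapC isOpen_univ h1'.contDiffOn)
  have hlapc : HasCompactSupport (lapC χ) := by
    refine HasCompactSupport.intro h2 fun z hz => ?_
    have h := fun v => fderiv_of_notMem_tsupport (𝕜 := ℝ) (f := fun y => fderiv ℝ χ y v) (x := z)
      fun h => hz (tsupport_fderiv_apply_subset ℝ v h)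
    rw [lapC, h, h]; simp
  have t2 : Tendsto (fun n => ∫ y, lapC χ y * (v (R n * y) - b)) atTop (𝓝 (∫ y : ℂ, (0 : ℝ))) := by
    refine tendsto_integral_of_dominated_convergence (fun y => ‖lapC χ y‖ * (M + |b|)) (fun n => ?_)
      ((hlapcont.integrable_of_hasCompactSupport hlapc).norm.mul_const _) (fun n => ?_) ?_
    · exact (hlapcont.mul ((h.contDiff.continuous.comp (by fun_prop)).sub
        continuous_const)).aestronglyMeasurable
    · refine Eventually.of_forall fun y => ?_
      rw [norm_mul]
      refine mul_le_mul_of_nonneg_left ?_ (norm_nonneg _)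
      exact (abs_sub _ _).trans (add_le_add (hM _) le_rfl)
    · have h0 : ∀ᵐ y : ℂ, y ≠ 0 := by simp [ae_iff]
      filter_upwards [h0] with y hy
      have : Tendsto (fun n => (R n : ℂ) * y) atTop (cocompact ℂ) := by
        rw [← Metric.cobounded_eq_cocompact, ← tendsto_norm_atTop_iff_cobounded]
        simp only [norm_mul, Complex.norm_real, Real.norm_eq_abs]
        exact (tendsto_abs_atTop_atTop.comp hRt).atTop_mul_const (norm_pos_iff.2 hy)
      have := ((h.lim.comp this).sub_const b).const_mul (lapC χ y)
      simpa using this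
  simp only [e] at t1
  have := tendsto_nhds_unique t1 t2
  simp only [mul_sub] at this
  rw [integral_sub (integrable_sphDensity.mul_const α) h.integrable, integral_mul_const,
    integral_sphDensity] at this
  simp at this
  linarith

end PlaneSol

namespace PlaneSol
variable {v : ℂ → ℝ} {α b : ℝ}

theorem setIntegral_im_pos_le (h : PlaneSol v α b) :
    ∫ z in {z : ℂ | 0 < z.im}, (sphDensity z * exp (2 * v z) +
      sphDensity z * exp (2 * v (starRingEnd ℂ z))) ≤ 4 * π * α := by
  have hm1 : MeasurableSet {z : ℂ | 0 < z.im} := (isOpen_lt continuous_const Complex.continuous_im).measurableSet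
  have hm2 : MeasurableSet {z : ℂ | z.im < 0} := (isOpen_lt Complex.continuous_im continuous_const).measurableSet
  have hmp := (Complex.conjLIE).measurePreserving
  have e : ∫ z in {z : ℂ | 0 < z.im}, sphDensity z * exp (2 * v (starRingEnd ℂ z)) =
      ∫ z in {z : ℂ | z.im < 0}, sphDensity z * exp (2 * v z) := by
    have := hmp.setIntegral_preimage_emb Complex.conjLIE.toHomeomorph.measurableEmbedding
      (fun z => sphDensity z * exp (2 * v z)) {z : ℂ | z.im < 0}
    rw [← this]
    have hs : Complex.conjLIE ⁻¹' {z : ℂ | z.im < 0} = {z : ℂ | 0 < z.im} := by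
      ext z; simp
    rw [hs]
    refine setIntegral_congr_fun hm1 fun z _ => ?_
    simp only [Complex.conjLIE_apply]
    rw [sphDensity_eq_of_norm_eq (y := (starRingEnd ℂ) z) (by simp)]
  rw [integral_add h.integrable.integrableOn h.comp_conj.integrable.integrableOn, e,
    ← setIntegral_union (show Disjoint {z : ℂ | 0 < z.im} {z : ℂ | z.im < 0} from
      Set.disjoint_left.2 fun z (h1 : 0 < z.im) (h2 : z.im < 0) => by linarith) hm2
      h.integrable.integrableOn h.integrable.integrableOn, ← h.integral_eq]
  exact setIntegral_le_integral h.integrable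
    (Filter.Eventually.of_forall fun z => mul_nonneg (sphDensity_pos z).le (exp_pos _).le)

/-- The odd part of a solution with `α ≤ 3` does not alternate on four rays. -/
theorem not_alternating (h : PlaneSol v α b) (hα : 1 < α) (hα3 : α ≤ 3) {L θ₁ θ₂ θ₃ θ₄ : ℝ}
    (h0 : 0 < θ₁) (h12 : θ₁ < θ₂) (h23 : θ₂ < θ₃) (h34 : θ₃ < θ₄) (h4 : θ₄ < π)
    (hr1 : ∀ x : ℝ, x ≤ L → 0 < v (Complex.exp (x + θ₁ * Complex.I)) -
      v (starRingEnd ℂ (Complex.exp (x + θ₁ * Complex.I))))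
    (hr2 : ∀ x : ℝ, x ≤ L → 0 < v (starRingEnd ℂ (Complex.exp (x + θ₂ * Complex.I))) -
      v (Complex.exp (x + θ₂ * Complex.I)))
    (hr3 : ∀ x : ℝ, x ≤ L → 0 < v (Complex.exp (x + θ₃ * Complex.I)) -
      v (starRingEnd ℂ (Complex.exp (x + θ₃ * Complex.I))))
    (hr4 : ∀ x : ℝ, x ≤ L → 0 < v (starRingEnd ℂ (Complex.exp (x + θ₄ * Complex.I))) -
      v (Complex.exp (x + θ₄ * Complex.I))) : False := by
  set A := {z : ℂ | 0 < z.im ∧ 0 < v z - v (starRingEnd ℂ z)} with hA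
  set B := {z : ℂ | 0 < z.im ∧ 0 < v (starRingEnd ℂ z) - v z} with hB
  have hc := h.contDiff.continuous
  have hc' := h.comp_conj.contDiff.continuous
  have him : IsOpen {z : ℂ | 0 < z.im} := isOpen_lt continuous_const Complex.continuous_im
  have hAo : IsOpen A := him.inter (isOpen_lt continuous_const (hc.sub hc'))
  have hBo : IsOpen B := him.inter (isOpen_lt continuous_const (hc'.sub hc))
  have hAi : A ⊆ {z | 0 < z.im} := fun z hz => hz.1
  have hBi : B ⊆ {z | 0 < z.im} := fun z hz => hz.1
  have hAB : Disjoint A B := Set.disjoint_left.2 fun z hz hz' => by linarith [hz.2, hz'.2]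
  have hi : ∀ (x θ : ℝ), 0 < θ → θ < π → 0 < (Complex.exp (x + θ * Complex.I)).im := fun x θ h1 h2 => by
    rw [Complex.exp_im]
    simpa using mul_pos (Real.exp_pos _) (Real.sin_pos_of_pos_of_lt_pi h1 h2)
  obtain ⟨C, hC, hdisj⟩ := exists_three_domains hAo hAi hBo hBi hAB h0 h12 h23 h34 h4
    (fun x hx => ⟨hi x θ₁ h0 (by linarith), hr1 x hx⟩)
    (fun x hx => ⟨hi x θ₂ (by linarith) (by linarith), hr2 x hx⟩)
    (fun x hx => ⟨hi x θ₃ (by linarith) (by linarith), hr3 x hx⟩)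
    (fun x hx => ⟨hi x θ₄ (by linarith) (by linarith), hr4 x hx⟩)
  have hreal : ∀ z : ℂ, z.im = 0 → v z = v (starRingEnd ℂ z) := fun z hz => by
    rw [Complex.conj_eq_iff_im.2 hz]
  set F : ℂ → ℝ := fun z => sphDensity z * exp (2 * v z) + sphDensity z * exp (2 * v (starRingEnd ℂ z))
  have hF : Integrable F := h.integrable.add h.comp_conj.integrable
  have hmass : ∀ i, 4 * π < ∫ z in fill (C i), F z := by
    intro i
    rcases hC i with ⟨x, hx, he⟩ | ⟨x, hx, he⟩
    · rw [he]; exact h.four_pi_lt h.comp_conj hα hreal hx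
    · rw [he]
      have := h.comp_conj.four_pi_lt h hα (fun z hz => (hreal z hz).symm) hx
      simpa only [F, add_comm] using this
  have hsub : ∀ i, C i ⊆ {z | 0 < z.im} := fun i => by
    rcases hC i with ⟨x, hx, he⟩ | ⟨x, hx, he⟩ <;> rw [he]
    · exact (connectedComponentIn_subset _ _).trans hAi
    · exact (connectedComponentIn_subset _ _).trans hBi
  have hCo : ∀ i, IsOpen (C i) := fun i => by
    rcases hC i with ⟨x, hx, he⟩ | ⟨x, hx, he⟩ <;> rw [he]
    · exact hAo.connectedComponentIn
    · exact hBo.connectedComponentIn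
  have e := integral_iUnion_fintype (μ := volume) (f := F) (s := fun i => fill (C i))
    (fun i => (hCo i).fill.measurableSet) hdisj (fun i => hF.integrableOn)
  have le1 : ∫ z in ⋃ i, fill (C i), F z ≤ ∫ z in {z : ℂ | 0 < z.im}, F z :=
    setIntegral_mono_set hF.integrableOn (Filter.Eventually.of_forall fun z =>
      add_nonneg (mul_nonneg (sphDensity_pos z).le (exp_pos _).le)
        (mul_nonneg (sphDensity_pos z).le (exp_pos _).le))
      (Set.iUnion_subset fun i => fill_subset_im_pos (hsub i)).eventuallyLE
  have le2 := h.setIntegral_im_pos_le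
  rw [e, Fin.sum_univ_three] at le1
  have := hmass 0
  have := hmass 1
  have := hmass 2
  have h3 : 4 * π * α ≤ 4 * π * 3 := mul_le_mul_of_nonneg_left hα3 (by positivity)
  linarith

end PlaneSol

noncomputable section
/-- The homogeneous part of degree `j` of the Taylor expansion of `f` at the origin. -/
def jet (f : ℂ → ℝ) (j : ℕ) (z : ℂ) : ℝ :=
  (j.factorial : ℝ)⁻¹ * iteratedFDeriv ℝ j f 0 (fun _ => z)

/-- `f` vanishes to order at least `k` at the origin. -/
def VanishAt (f : ℂ → ℝ) (k : ℕ) : Prop :=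
  ∃ C, ∀ z, ‖z‖ ≤ 1 → |f z| ≤ C * ‖z‖ ^ k
end

section VanishAt
variable {f g : ℂ → ℝ} {k : ℕ}

theorem VanishAt.exists_nonneg (h : VanishAt f k) :
    ∃ C, 0 ≤ C ∧ ∀ z, ‖z‖ ≤ 1 → |f z| ≤ C * ‖z‖ ^ k := by
  obtain ⟨C, hC⟩ := h
  exact ⟨|C|, abs_nonneg _, fun z hz => (hC z hz).trans (by gcongr; exact le_abs_self _)⟩

theorem VanishAt.add (hf : VanishAt f k) (hg : VanishAt g k) : VanishAt (fun z => f z + g z) k := by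
  obtain ⟨C, hC⟩ := hf
  obtain ⟨D, hD⟩ := hg
  exact ⟨C + D, fun z hz => (abs_add_le _ _).trans (by linarith [hC z hz, hD z hz])⟩

theorem VanishAt.const_mul (hf : VanishAt f k) (c : ℝ) : VanishAt (fun z => c * f z) k := by
  obtain ⟨C, hC⟩ := hf
  refine ⟨|c| * C, fun z hz => ?_⟩
  rw [abs_mul, mul_assoc]
  exact mul_le_mul_of_nonneg_left (hC z hz) (abs_nonneg _)

theorem VanishAt.sub (hf : VanishAt f k) (hg : VanishAt g k) : VanishAt (fun z => f z - g z) k := by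
  simpa [sub_eq_add_neg] using hf.add (hg.const_mul (-1))

theorem VanishAt.comp (hf : VanishAt f k) {e : ℂ → ℂ} (he : ∀ z, ‖e z‖ = ‖z‖) :
    VanishAt (fun z => f (e z)) k := by
  obtain ⟨C, hC⟩ := hf
  exact ⟨C, fun z hz => (hC _ (by rw [he]; exact hz)).trans_eq (by rw [he])⟩

theorem VanishAt.of_le {j : ℕ} (hf : VanishAt f k) (hj : j ≤ k) : VanishAt f j := by
  obtain ⟨C, h0, hC⟩ := hf.exists_nonneg
  exact ⟨C, fun z hz => (hC z hz).trans
    (mul_le_mul_of_nonneg_left (pow_le_pow_of_le_one (norm_nonneg _) hz hj) h0)⟩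

theorem VanishAt.of_abs_le (hf : VanishAt f k) {M : ℝ} (hM : 0 ≤ M) (h : ∀ z, ‖z‖ ≤ 1 → |g z| ≤ M * |f z|) :
    VanishAt g k := by
  obtain ⟨C, hC⟩ := hf
  refine ⟨M * C, fun z hz => (h z hz).trans ?_⟩
  rw [mul_assoc]
  exact mul_le_mul_of_nonneg_left (hC z hz) hM

theorem VanishAt.mul_of_bounded (hf : VanishAt f k) (hg : Continuous g) :
    VanishAt (fun z => g z * f z) k := by
  obtain ⟨M, hM⟩ := (isCompact_closedBall (0 : ℂ) 1).exists_bound_of_continuousOn hg.continuousOn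
  refine hf.of_abs_le (M := M) ((norm_nonneg _).trans (hM 0 (by simp))) fun z hz => ?_
  rw [abs_mul]
  exact mul_le_mul_of_nonneg_right (hM z (by simpa using hz)) (abs_nonneg _)

open Filter Topology in
/-- A homogeneous function of degree `k` vanishing to a higher order is zero. -/
theorem VanishAt.eq_zero_of_homogeneous (h : VanishAt f (k + 1))
    (hh : ∀ (t : ℝ), 0 < t → ∀ z, f (t * z) = t ^ k * f z) (z : ℂ) : f z = 0 := by
  obtain ⟨C, h0, hC⟩ := h.exists_nonneg
  have h1 : ∀ᶠ t : ℝ in 𝓝[>] 0, |f z| ≤ C * ‖z‖ ^ (k + 1) * t := by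
    have h2 : ∀ᶠ t : ℝ in 𝓝[>] 0, t * ‖z‖ ≤ 1 := by
      have : Tendsto (fun t : ℝ => t * ‖z‖) (𝓝[>] 0) (𝓝 (0 * ‖z‖)) :=
        ((continuous_id.mul continuous_const).tendsto 0).mono_left nhdsWithin_le_nhds
      rw [zero_mul] at this
      exact this.eventually_le_const one_pos
    filter_upwards [h2, self_mem_nhdsWithin] with t ht ht0
    have ht0 : 0 < t := ht0
    have h3 := hC (t * z) (by simpa [abs_of_pos ht0] using ht)
    rw [hh t ht0, abs_mul, abs_of_pos (pow_pos ht0 k), norm_mul, Complex.norm_real, Real.norm_eq_abs,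
      abs_of_pos ht0, mul_pow, pow_succ t] at h3
    refine le_of_mul_le_mul_left ?_ (pow_pos ht0 k)
    linarith
  have h4 : Tendsto (fun t : ℝ => C * ‖z‖ ^ (k + 1) * t) (𝓝[>] 0) (𝓝 (C * ‖z‖ ^ (k + 1) * 0)) :=
    ((continuous_const.mul continuous_id).tendsto 0).mono_left nhdsWithin_le_nhds
  rw [mul_zero] at h4
  exact abs_nonpos_iff.mp (ge_of_tendsto h4 h1)

end VanishAt

section jet
variable {f : ℂ → ℝ}

theorem jet_real_mul (f : ℂ → ℝ) (j : ℕ) (t : ℝ) (z : ℂ) : jet f j (t * z) = t ^ j * jet f j z := by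
  have h := (iteratedFDeriv ℝ j f 0).map_smul_univ (fun _ => t) (fun _ => z)
  simp only [Finset.prod_const, Finset.card_univ, Fintype.card_fin, Complex.real_smul, smul_eq_mul] at h
  rw [jet, jet, h]
  ring

theorem contDiff_jet (f : ℂ → ℝ) (j : ℕ) : ContDiff ℝ ∞ (jet f j) := by
  refine contDiff_const.mul ?_
  exact ((iteratedFDeriv ℝ j f 0).contDiff).comp (contDiff_pi.2 fun _ => contDiff_id)

theorem vanishAt_sub_sum_jet (hf : ContDiff ℝ ∞ f) (n : ℕ) :
    VanishAt (fun z => f z - ∑ j ∈ Finset.range (n + 1), jet f j z) (n + 1) := by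
  obtain ⟨M, hM⟩ := (isCompact_closedBall (0 : ℂ) 1).exists_bound_of_continuousOn
    (hf.continuous_iteratedFDeriv (m := n + 1) (by norm_cast; exact le_top)).continuousOn
  refine ⟨(n.factorial : ℝ)⁻¹ * M, fun z hz => ?_⟩
  have h := map_add_eq_sum_add_integral_iteratedFDeriv (f := f) (x := 0) (y := z) (n := n)
    fun t _ => (hf.of_le (by norm_cast; exact le_top)).contDiffAt
  rw [zero_add] at h
  have h2 : f z - ∑ j ∈ Finset.range (n + 1), jet f j z = (n.factorial : ℝ)⁻¹ •
      ∫ t in 0..1, (1 - t)^n • iteratedFDeriv ℝ (n + 1) f (0 + t • z) (fun _ ↦ z) := by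
    rw [h]
    simp [jet]
  show |f z - _| ≤ _
  rw [h2, smul_eq_mul, abs_mul, abs_of_nonneg (by positivity), mul_assoc]
  refine mul_le_mul_of_nonneg_left ?_ (by positivity)
  have h3 := intervalIntegral.norm_integral_le_of_norm_le_const (a := (0 : ℝ)) (b := 1)
    (C := M * ‖z‖ ^ (n + 1))
    (f := fun t => (1 - t)^n • iteratedFDeriv ℝ (n + 1) f (0 + t • z) (fun _ ↦ z)) ?_
  · simpa using h3
  intro t ht
  rw [Set.uIoc_of_le zero_le_one] at ht
  rw [norm_smul, norm_pow, Real.norm_eq_abs, abs_of_nonneg (by linarith [ht.2])]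
  have h4 : (1 - t) ^ n ≤ 1 := pow_le_one₀ (by linarith [ht.2]) (by linarith [ht.1])
  have h5 : ‖iteratedFDeriv ℝ (n + 1) f (0 + t • z)‖ ≤ M := by
    refine hM _ ?_
    rw [zero_add, mem_closedBall_zero_iff, norm_smul, Real.norm_eq_abs, abs_of_pos ht.1]
    exact mul_le_one₀ ht.2 (norm_nonneg _) hz
  have h6 := (iteratedFDeriv ℝ (n + 1) f (0 + t • z)).le_opNorm fun _ => z
  simp only [Finset.prod_const, Finset.card_univ, Fintype.card_fin] at h6
  calc _ ≤ 1 * ‖iteratedFDeriv ℝ (n + 1) f (0 + t • z) fun _ => z‖ := by gcongr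
    _ ≤ _ := by rw [one_mul]; exact h6.trans (by gcongr)

theorem VanishAt.jet_eq_zero {k : ℕ} (hf : ContDiff ℝ ∞ f) (h : VanishAt f k) :
    ∀ j, j < k → ∀ z, jet f j z = 0 := by
  intro j
  induction j using Nat.strong_induction_on with
  | _ j ih =>
    intro hj
    refine VanishAt.eq_zero_of_homogeneous (k := j) ?_ fun t _ => jet_real_mul f j t
    refine ((h.of_le hj).sub (vanishAt_sub_sum_jet hf j)).of_abs_le zero_le_one fun z _ => ?_
    rw [one_mul, Finset.sum_range_succ,
      Finset.sum_eq_zero fun i hi => ih i (Finset.mem_range.1 hi) ((Finset.mem_range.1 hi).trans hj) z]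
    simp

theorem VanishAt.sub_jet {k : ℕ} (hf : ContDiff ℝ ∞ f) (h : VanishAt f k) :
    VanishAt (fun z => f z - jet f k z) (k + 1) := by
  refine (vanishAt_sub_sum_jet hf k).of_abs_le zero_le_one fun z _ => ?_
  rw [Finset.sum_range_succ,
    Finset.sum_eq_zero fun i hi => h.jet_eq_zero hf i (Finset.mem_range.1 hi) z]
  simp

end jet

section Homogeneous
variable {f p : ℂ → ℝ} {k : ℕ}

theorem ContDiff.fderiv_apply_const_infty (hf : ContDiff ℝ ∞ f) (v : ℂ) :
    ContDiff ℝ ∞ fun z => fderiv ℝ f z v :=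
  (hf.fderiv_right (m := ∞) (by norm_cast)).clm_apply contDiff_const

open Filter Topology in
theorem VanishAt.fderiv_apply (hf : ContDiff ℝ ∞ f) (h : VanishAt f (k + 1)) (v : ℂ) :
    VanishAt (fun z => fderiv ℝ f z v) k := by
  have hs := hf.fderiv_apply_const_infty v
  induction k with
  | zero =>
    obtain ⟨M, hM⟩ := (isCompact_closedBall (0 : ℂ) 1).exists_bound_of_continuousOn
      hs.continuous.continuousOn
    exact ⟨M, fun z hz => by simpa using hM z (by simpa using hz)⟩
  | succ k ih =>
    have h1 := ih (h.of_le (by omega))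
    have h2 := h1.sub_jet hs
    set q := jet (fun z => fderiv ℝ f z v) k with hq
    suffices hq0 : ∀ z, q z = 0 by simpa only [hq0, sub_zero] using h2
    intro z
    by_contra hz
    have hqc : Continuous q := (contDiff_jet _ _).continuous
    have hcz : Tendsto (fun s : ℝ => |q (z + s * v)|) (𝓝[≥] 0) (𝓝 |q z|) := by
      have : Continuous fun s : ℝ => |q (z + s * v)| := by fun_prop
      simpa using (this.tendsto 0).mono_left nhdsWithin_le_nhds
    have hev := hcz.eventually_const_lt (u := |q z| / 2) (by linarith [abs_pos.2 hz])
    obtain ⟨h₀, h₀p, hh⟩ := (nhdsGE_basis (0 : ℝ)).eventually_iff.1 hev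
    set η := h₀ / 2
    have hη : 0 < η := by positivity
    obtain ⟨C, hC0, hC⟩ := h.exists_nonneg
    obtain ⟨D, hD0, hD⟩ := h2.exists_nonneg
    set B := ‖z‖ + η * ‖v‖ with hB
    have hB0 : 0 ≤ B := by positivity
    have key : ∀ᶠ t : ℝ in 𝓝[>] 0, |q z| / 2 ≤ (2 * C * B ^ (k + 2) / η + D * B ^ (k + 1)) * t := by
      have e1 : ∀ᶠ t : ℝ in 𝓝[>] 0, t * B ≤ 1 := by
        have : Tendsto (fun t : ℝ => t * B) (𝓝[>] 0) (𝓝 (0 * B)) :=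
          ((continuous_id.mul continuous_const).tendsto 0).mono_left nhdsWithin_le_nhds
        rw [zero_mul] at this
        exact this.eventually_le_const one_pos
      filter_upwards [e1, self_mem_nhdsWithin] with t ht1 ht0
      have ht0 : 0 < t := ht0
      have hd : ∀ s : ℝ, HasDerivAt (fun s : ℝ => f (t * (z + s * v)))
          (t * fderiv ℝ f (t * (z + s * v)) v) s := by
        intro s
        have e2 : HasDerivAt (fun s : ℝ => (t : ℂ) * (z + s * v)) (t * v) s := by
          have := ((Complex.ofRealCLM.hasDerivAt (x := s)).mul_const v).const_add z |>.const_mul (t : ℂ)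
          simpa using this
        have e3 := ((hf.differentiable (by simp)) (t * (z + s * v))).hasFDerivAt.comp_hasDerivAt s e2
        refine e3.congr_deriv ?_
        rw [show (t : ℂ) * v = t • v from Complex.real_smul.symm, map_smul, smul_eq_mul]
      obtain ⟨s, hs1, hs2⟩ := exists_hasDerivAt_eq_slope _ _ hη
        (fun s _ => (hd s).continuousAt.continuousWithinAt) fun s _ => hd s
      have hn : ∀ s ∈ Set.Icc 0 η, ‖(t : ℂ) * (z + s * v)‖ ≤ t * B := by
        intro s hs
        rw [norm_mul, Complex.norm_real, Real.norm_eq_abs, abs_of_pos ht0]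
        refine mul_le_mul_of_nonneg_left ((norm_add_le _ _).trans ?_) ht0.le
        rw [norm_mul, Complex.norm_real, Real.norm_eq_abs, abs_of_nonneg hs.1]
        exact add_le_add_right (mul_le_mul_of_nonneg_right hs.2 (norm_nonneg _)) _
      have hfb : ∀ s ∈ Set.Icc 0 η, |f (t * (z + s * v))| ≤ C * (t * B) ^ (k + 2) := fun s hs =>
        (hC _ ((hn s hs).trans ht1)).trans (by gcongr; exact hn s hs)
      have b1 := hfb η ⟨hη.le, le_rfl⟩
      have b2 := hfb 0 ⟨le_rfl, hη.le⟩
      have b3 := hD (t * (z + s * v)) ((hn s ⟨hs1.1.le, hs1.2.le⟩).trans ht1)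
      have b4 : ‖(t : ℂ) * (z + s * v)‖ ^ (k + 1) ≤ (t * B) ^ (k + 1) := by
        gcongr; exact hn s ⟨hs1.1.le, hs1.2.le⟩
      have b5 : |q z| / 2 < |q (z + s * v)| := hh ⟨hs1.1.le, by
        have := hs1.2; have : η < h₀ := half_lt_self h₀p; linarith⟩
      rw [hq, jet_real_mul, ← hq] at b3
      have b6 : |t ^ k * q (z + s * v)| ≤ D * (t * B) ^ (k + 1) +
          |fderiv ℝ f (t * (z + s * v)) v| := by
        have := abs_sub_abs_le_abs_sub (t ^ k * q (z + s * v)) (fderiv ℝ f (t * (z + s * v)) v)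
        rw [abs_sub_comm] at this
        have := mul_le_mul_of_nonneg_left b4 hD0
        linarith
      have b7 : |fderiv ℝ f (t * (z + s * v)) v| * (t * η) ≤ 2 * C * (t * B) ^ (k + 2) := by
        have : fderiv ℝ f (t * (z + s * v)) v * (t * η) = f (t * (z + η * v)) - f (t * (z + (0 : ℝ) * v)) := by
          rw [eq_div_iff (by linarith)] at hs2
          linarith
        have h3 := congrArg abs this
        rw [abs_mul, abs_of_pos (mul_pos ht0 hη)] at h3
        rw [h3]
        exact (abs_sub _ _).trans (by linarith)
      rw [abs_mul, abs_of_pos (pow_pos ht0 k)] at b6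
      have b8 : |fderiv ℝ f (t * (z + s * v)) v| ≤ 2 * C * B ^ (k + 2) / η * t * t ^ k := by
        refine le_of_mul_le_mul_right (b7.trans_eq ?_) (mul_pos ht0 hη)
        rw [mul_pow]
        field_simp
        ring
      refine b5.le.trans (le_of_mul_le_mul_left ?_ (pow_pos ht0 k))
      refine b6.trans ?_
      rw [mul_pow, pow_succ t]
      linarith
    have h4 : Tendsto (fun t : ℝ => (2 * C * B ^ (k + 2) / η + D * B ^ (k + 1)) * t) (𝓝[>] 0)
        (𝓝 ((2 * C * B ^ (k + 2) / η + D * B ^ (k + 1)) * 0)) :=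
      ((continuous_const.mul continuous_id).tendsto 0).mono_left nhdsWithin_le_nhds
    rw [mul_zero] at h4
    linarith [ge_of_tendsto h4 key, abs_pos.2 hz]

theorem contDiff_lapC (hf : ContDiff ℝ ∞ f) : ContDiff ℝ ∞ (lapC f) :=
  ((hf.fderiv_apply_const_infty 1).fderiv_apply_const_infty 1).add
    ((hf.fderiv_apply_const_infty Complex.I).fderiv_apply_const_infty Complex.I)

theorem VanishAt.laplace (hf : ContDiff ℝ ∞ f) (h : VanishAt f (k + 2)) : VanishAt (lapC f) k :=
  ((h.fderiv_apply hf 1).fderiv_apply (hf.fderiv_apply_const_infty 1) 1).add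
    ((h.fderiv_apply hf Complex.I).fderiv_apply (hf.fderiv_apply_const_infty Complex.I) Complex.I)

theorem fderiv_apply_real_mul (hp : ContDiff ℝ ∞ p)
    (hh : ∀ t : ℝ, 0 < t → ∀ z, p (t * z) = t ^ (k + 1) * p z) (v : ℂ) {t : ℝ} (ht : 0 < t) (z : ℂ) :
    fderiv ℝ p (t * z) v = t ^ k * fderiv ℝ p z v := by
  have h1 : HasFDerivAt (fun z => p (t * z)) ((t : ℝ) • fderiv ℝ p (t * z)) z := by
    have e2 : HasFDerivAt (fun z : ℂ => (t : ℂ) * z) (t • ContinuousLinearMap.id ℝ ℂ) z := by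
      refine (t • ContinuousLinearMap.id ℝ ℂ).hasFDerivAt.congr_of_eventuallyEq ?_
      exact Filter.Eventually.of_forall fun y => by simp
    refine (((hp.differentiable (by simp)) (t * z)).hasFDerivAt.comp z e2).congr_fderiv ?_
    ext v
    simp
  have h2 : HasFDerivAt (fun z => p (t * z)) (t ^ (k + 1) • fderiv ℝ p z) z := by
    simp only [hh t ht]
    exact ((hp.differentiable (by simp)) z).hasFDerivAt.const_mul _
  have h3 := congrArg (fun L => L v) (h1.unique h2)
  simp only [smul_apply, smul_eq_mul, pow_succ] at h3
  exact mul_left_cancel₀ ht.ne' (h3.trans (by ring))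

theorem lapC_real_mul (hp : ContDiff ℝ ∞ p)
    (hh : ∀ t : ℝ, 0 < t → ∀ z, p (t * z) = t ^ (k + 2) * p z) {t : ℝ} (ht : 0 < t) (z : ℂ) :
    lapC p (t * z) = t ^ k * lapC p z := by
  have h := fun v => fderiv_apply_real_mul (hp.fderiv_apply_const_infty v)
    (fun t ht z => fderiv_apply_real_mul hp hh v ht z) v ht z
  rw [lapC, lapC, h, h]
  ring

theorem fderiv_self_of_homogeneous (hp : ContDiff ℝ ∞ p)
    (hh : ∀ t : ℝ, 0 < t → ∀ z, p (t * z) = t ^ k * p z) (z : ℂ) : fderiv ℝ p z z = k * p z := by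
  have e2 : HasDerivAt (fun s : ℝ => (s : ℂ) * z) z 1 := by
    simpa using (Complex.ofRealCLM.hasDerivAt (x := (1 : ℝ))).mul_const z
  have h1 := ((hp.differentiable (by simp)) (((1 : ℝ) : ℂ) * z)).hasFDerivAt.comp_hasDerivAt 1 e2
  have h2 : HasDerivAt (fun s : ℝ => s ^ k * p z) (k * p z) 1 := by
    simpa using (hasDerivAt_pow k (1 : ℝ)).mul_const (p z)
  have h3 := h1.unique (h2.congr_of_eventuallyEq ?_)
  · simpa using h3
  filter_upwards [lt_mem_nhds (zero_lt_one (α := ℝ))] with t ht using hh t ht z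

/-- A homogeneous harmonic function on the plane is the real part of a complex monomial. -/
theorem exists_re_mul_pow_of_homogeneous (hp : ContDiff ℝ ∞ p)
    (hh : ∀ t : ℝ, 0 < t → ∀ z, p (t * z) = t ^ (k + 1) * p z) (hl : ∀ z, lapC p z = 0) :
    ∃ c : ℂ, ∀ z, p z = (c * z ^ (k + 1)).re := by
  set G : ℂ → ℂ := fun z => (fderiv ℝ p z 1 : ℂ) - Complex.I * (fderiv ℝ p z Complex.I : ℂ) with hG
  have hp2 : ContDiff ℝ 2 p := hp.of_le (by norm_cast)
  have hd : ∀ v z, HasFDerivAt (fun z => fderiv ℝ p z v)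
      (fderiv ℝ (fun z => fderiv ℝ p z v) z) z := fun v z =>
    ((hp.fderiv_apply_const_infty v).differentiable (by simp) z).hasFDerivAt
  have hdd : ∀ v w z, fderiv ℝ (fun z => fderiv ℝ p z v) z w = fderiv ℝ (fderiv ℝ p) z w v := by
    intro v w z
    have := ((hp.fderiv_right (m := 1) (by norm_cast)).differentiable (by simp) z).hasFDerivAt.clm_apply
      (hasFDerivAt_const v z)
    rw [this.fderiv]
    simp
  have hsymm : ∀ z, fderiv ℝ (fderiv ℝ p) z 1 Complex.I = fderiv ℝ (fderiv ℝ p) z Complex.I 1 :=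
    fun z => (hp2.contDiffAt.isSymmSndFDerivAt (by simp)) 1 Complex.I
  have hGd : ∀ z, HasFDerivAt G
      (Complex.ofRealCLM.comp (fderiv ℝ (fun z => fderiv ℝ p z 1) z) -
        Complex.I • Complex.ofRealCLM.comp (fderiv ℝ (fun z => fderiv ℝ p z Complex.I) z)) z :=
    fun z => (Complex.ofRealCLM.hasFDerivAt.comp z (hd 1 z)).sub
      ((Complex.ofRealCLM.hasFDerivAt.comp z (hd Complex.I z)).const_mul Complex.I)
  have hGC : Differentiable ℂ G := by
    intro z
    rw [differentiableAt_complex_iff_differentiableAt_real]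
    refine ⟨(hGd z).differentiableAt, ?_⟩
    rw [(hGd z).fderiv]
    have h1 := hl z
    rw [lapC_eq_fderiv_fderiv hp2] at h1
    have h2 := hsymm z
    simp only [sub_apply, smul_apply, ContinuousLinearMap.comp_apply, hdd, Complex.ofRealCLM_apply,
      smul_eq_mul, h2]
    have h3 : fderiv ℝ (fderiv ℝ p) z 1 1 = - fderiv ℝ (fderiv ℝ p) z Complex.I Complex.I := by linarith
    rw [h3]
    push_cast
    linear_combination ((fderiv ℝ (fderiv ℝ p) z Complex.I 1 : ℂ)) * Complex.I_mul_I
  have hGa : AnalyticOnNhd ℂ G Set.univ := fun z _ => hGC.analyticAt z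
  have hGh : ∀ t : ℝ, 0 < t → G t = (t : ℂ) ^ k * G 1 := by
    intro t ht
    have h := fun v => fderiv_apply_real_mul hp hh v ht 1
    simp only [mul_one] at h
    simp only [hG, h]
    push_cast
    ring
  have hGe : G = fun z => z ^ k * G 1 := by
    refine hGa.eq_of_frequently_eq (z₀ := 1) (fun z _ => by fun_prop) ?_
    have h1 : Filter.Tendsto (fun t : ℝ => (t : ℂ)) (nhdsWithin 1 {1}ᶜ) (nhdsWithin 1 {1}ᶜ) := by
      refine tendsto_nhdsWithin_iff.2 ⟨?_, ?_⟩
      · exact (Complex.continuous_ofReal.tendsto' 1 1 (by simp)).mono_left nhdsWithin_le_nhds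
      · filter_upwards [self_mem_nhdsWithin] with t ht
        simpa using ht
    refine h1.frequently (Filter.Eventually.frequently ?_)
    filter_upwards [nhdsWithin_le_nhds (lt_mem_nhds (zero_lt_one (α := ℝ)))] with t ht using hGh t ht
  refine ⟨G 1 / (k + 1 : ℕ), fun z => ?_⟩
  have h1 := fderiv_self_of_homogeneous hp hh z
  have h2 : fderiv ℝ p z z = (G z * z).re := by
    conv_lhs => rw [show fderiv ℝ p z z = fderiv ℝ p z (z.re • 1 + z.im • Complex.I) by
      congr 1
      simp [Complex.re_add_im]]
    rw [map_add, map_smul, map_smul]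
    simp [hG]
    ring
  rw [h2, hGe] at h1
  have h3 : (k + 1 : ℝ) ≠ 0 := by positivity
  have h4 : G 1 / (k + 1 : ℕ) * z ^ (k + 1) = ((k + 1 : ℝ)⁻¹ : ℝ) * (z ^ k * G 1 * z) := by
    push_cast
    field_simp
    ring
  rw [h4, Complex.re_ofReal_mul, h1]
  push_cast
  field_simp

/-- The leading term of a function whose Laplacian vanishes to a higher order than expected is
harmonic. -/
theorem VanishAt.exists_sub_re_mul_pow (hf : ContDiff ℝ ∞ f) (h : VanishAt f (k + 2))
    (hl : VanishAt (lapC f) (k + 1)) :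
    ∃ c : ℂ, VanishAt (fun z => f z - (c * z ^ (k + 2)).re) (k + 3) := by
  have h1 := h.sub_jet hf
  have hs := contDiff_jet f (k + 2)
  have h2 : VanishAt (lapC (jet f (k + 2))) (k + 1) := by
    refine (hl.sub (h1.laplace (hf.sub hs))).of_abs_le zero_le_one fun z _ => ?_
    rw [lapC_sub isOpen_univ (hf.of_le (by norm_cast)).contDiffOn
      (hs.of_le (by norm_cast)).contDiffOn (Set.mem_univ z)]
    simp
  have hh : ∀ t : ℝ, 0 < t → ∀ z, jet f (k + 2) (t * z) = t ^ (k + 2) * jet f (k + 2) z :=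
    fun t _ => jet_real_mul f _ t
  obtain ⟨c, hc⟩ := exists_re_mul_pow_of_homogeneous (k := k + 1) hs hh
    (h2.eq_zero_of_homogeneous fun t ht z => lapC_real_mul hs hh ht z)
  exact ⟨c, by simpa only [← hc] using h1⟩

end Homogeneous

theorem integral_indicator_ball_inv_norm {ρ : ℝ} (hρ : 0 ≤ ρ) :
    ∫ z : ℂ, (Metric.ball (0 : ℂ) ρ).indicator (fun z => ‖z‖⁻¹) z = 2 * π * ρ := by
  have h := integral_fun_norm_addHaar (E := ℂ) volume ((Set.Iio ρ).indicator fun r : ℝ => r⁻¹)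
  have h1 : (fun z : ℂ => (Set.Iio ρ).indicator (fun r : ℝ => r⁻¹) ‖z‖) =
      (Metric.ball (0 : ℂ) ρ).indicator fun z => ‖z‖⁻¹ := by
    funext z
    simp [Set.indicator]
  have h2 : ∫ y in Set.Ioi (0 : ℝ), y * (Set.Iio ρ).indicator (fun r : ℝ => r⁻¹) y = ρ := by
    have : ∀ y ∈ Set.Ioi (0 : ℝ), y * (Set.Iio ρ).indicator (fun r : ℝ => r⁻¹) y =
        (Set.Iio ρ).indicator (fun _ => (1 : ℝ)) y := by
      intro y hy
      have : y ≠ 0 := ne_of_gt hy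
      by_cases h : y < ρ <;> simp [Set.indicator, h, this]
    rw [setIntegral_congr_fun measurableSet_Ioi this, integral_indicator measurableSet_Iio,
      Measure.restrict_restrict measurableSet_Iio, Set.Iio_inter_Ioi]
    simp [hρ]
  simp only [Complex.finrank_real_complex, smul_eq_mul] at h
  simp only [Nat.add_one_sub_one, pow_one, h2] at h
  rw [← h1, h]
  simp [Measure.real, Complex.volume_ball]
  try ring

theorem norm_le_of_norm_dbar_le {g : ℂ → ℂ} (hg : ContDiff ℝ 1 g) {R A : ℝ} (hR : 0 ≤ R)
    (hs : ∀ z, R ≤ ‖z‖ → g z = 0) (hA : ∀ z, ‖dbar g z‖ ≤ A) (ξ : ℂ) : ‖g ξ‖ ≤ 4 * R * A := by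
  have hA0 : 0 ≤ A := (norm_nonneg _).trans (hA 0)
  rcases le_or_gt R ‖ξ‖ with hξ | hξ
  · rw [hs ξ hξ, norm_zero]; positivity
  have hts : tsupport g ⊆ Metric.closedBall 0 R := by
    refine closure_minimal (fun z hz => ?_) Metric.isClosed_closedBall
    by_contra h
    exact hz (hs z (by simp at h; exact h.le))
  have hc : HasCompactSupport g := (isCompact_closedBall (0 : ℂ) R).of_isClosed_subset
    (isClosed_tsupport g) hts
  have h1 := integral_dbar_div_sub hg hc ξ
  have hd0 : ∀ z, R < ‖z‖ → dbar g z = 0 := by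
    intro z hz
    have : fderiv ℝ g z = 0 := fderiv_of_notMem_tsupport (𝕜 := ℝ) fun h => by
      have := hts h
      simp at this
      linarith
    simp [dbar, this]
  set J : ℂ → ℝ := (Metric.ball (0 : ℂ) (2 * R)).indicator fun z => ‖z‖⁻¹
  have hJ : Integrable J := by
    refine (integrable_indicator_iff measurableSet_ball).2 ?_
    have := (locallyIntegrable_inv.integrableOn_isCompact (isCompact_closedBall (0 : ℂ) (2 * R))).mono_set
      Metric.ball_subset_closedBall
    have := this.norm
    simp only [norm_inv] at this
    exact this
  have h2 : ‖∫ z, dbar g z / (ξ - z)‖ ≤ ∫ z, A * J (ξ - z) := by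
    refine norm_integral_le_of_norm_le ((hJ.comp_sub_left ξ).const_mul A)
      (Filter.Eventually.of_forall fun z => ?_)
    rw [norm_div, div_eq_mul_inv]
    rcases le_or_gt ‖z‖ R with hz | hz
    · have : ξ - z ∈ Metric.ball (0 : ℂ) (2 * R) := by
        rw [mem_ball_zero_iff]
        linarith [norm_sub_le ξ z]
      rw [show J (ξ - z) = ‖ξ - z‖⁻¹ from Set.indicator_of_mem this _]
      exact mul_le_mul_of_nonneg_right (hA z) (by positivity)
    · rw [hd0 z hz, norm_zero, zero_mul]
      exact mul_nonneg hA0 (Set.indicator_nonneg (fun _ _ => by positivity) _)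
  rw [h1, norm_mul, integral_const_mul, integral_sub_left_eq_self,
    integral_indicator_ball_inv_norm (by positivity)] at h2
  simp only [Complex.norm_real, Real.norm_eq_abs, abs_of_pos pi_pos] at h2
  exact le_of_mul_le_mul_left (h2.trans_eq (by ring)) pi_pos

theorem continuous_inv_pow_smul {E : Type*} [NormedAddCommGroup E] [NormedSpace ℂ E]
    {φ : ℂ → E} (hφ : Continuous φ) {m : ℕ} {C : ℝ} (hC : ∀ z, ‖z‖ ≤ 1 → ‖φ z‖ ≤ C * ‖z‖ ^ (m + 1)) :
    Continuous fun z => (z ^ m)⁻¹ • φ z := by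
  rw [continuous_iff_continuousAt]
  intro z
  rcases eq_or_ne z 0 with rfl | hz
  · have h0 : φ 0 = 0 := by
      have := hC 0 (by simp)
      simpa using this
    have h1 : Filter.Tendsto (fun z : ℂ => C * ‖z‖) (nhds 0) (nhds 0) :=
      (continuous_const.mul continuous_norm).tendsto' 0 0 (by simp)
    rw [ContinuousAt, h0, smul_zero]
    refine squeeze_zero_norm' ?_ h1
    filter_upwards [Metric.closedBall_mem_nhds (0 : ℂ) one_pos] with z hz
    rcases eq_or_ne z 0 with rfl | hz0
    · simp [h0]
    rw [norm_smul, norm_inv, norm_pow, inv_mul_le_iff₀ (pow_pos (norm_pos_iff.2 hz0) _)]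
    refine (hC z (by simpa using hz)).trans_eq (by ring)
  · exact ((continuousAt_id.pow m).inv₀ (pow_ne_zero m hz)).smul hφ.continuousAt

theorem Complex.norm_real_clm_le (L : ℂ →L[ℝ] ℝ) : ‖L‖ ≤ |L 1| + |L Complex.I| := by
  refine L.opNorm_le_bound (by positivity) fun z => ?_
  rw [show L z = L (z.re • 1 + z.im • Complex.I) by congr 1; simp [Complex.re_add_im]]
  rw [map_add, map_smul, map_smul, smul_eq_mul, smul_eq_mul]
  refine (norm_add_le _ _).trans ?_
  rw [norm_mul, norm_mul, add_mul]
  simp only [Real.norm_eq_abs]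
  have h1 := Complex.abs_re_le_norm z
  have h2 := Complex.abs_im_le_norm z
  nlinarith [abs_nonneg (L 1), abs_nonneg (L Complex.I)]

section flat
variable {f a : ℂ → ℝ} {n : ℕ}

theorem contDiff_one_inv_pow_mul (ha : ContDiff ℝ ∞ a) (hfl : ∀ k, VanishAt a k) (hn : 1 ≤ n) :
    ContDiff ℝ 1 fun z : ℂ => (z ^ n)⁻¹ * (a z : ℂ) := by
  set g' : ℂ → ℂ →L[ℝ] ℂ := fun z => (z ^ n)⁻¹ • Complex.ofRealCLM.comp (fderiv ℝ a z) +
    (z ^ (n + 1))⁻¹ • ((-(n : ℂ) * (a z : ℂ)) • ContinuousLinearMap.id ℝ ℂ) with hg'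
  have hac : Continuous fun z => (a z : ℂ) := Complex.continuous_ofReal.comp ha.continuous
  refine contDiff_one_iff_hasFDerivAt.2 ⟨g', ?_, fun z => ?_⟩
  · obtain ⟨C1, h1⟩ := (hfl (n + 2)).fderiv_apply ha 1
    obtain ⟨C2, h2⟩ := (hfl (n + 2)).fderiv_apply ha Complex.I
    obtain ⟨C, -, h3⟩ := (hfl (n + 2)).exists_nonneg
    refine (continuous_inv_pow_smul (C := C1 + C2) ?_ fun z hz => ?_).add
      (continuous_inv_pow_smul (C := n * C) ?_ fun z hz => ?_)
    · exact continuous_const.clm_comp (ha.continuous_fderiv (by simp))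
    · refine (ContinuousLinearMap.opNorm_comp_le _ _).trans ?_
      rw [Complex.ofRealCLM_norm, one_mul]
      refine (Complex.norm_real_clm_le _).trans ?_
      linarith [h1 z hz, h2 z hz]
    · exact (continuous_const.mul hac).smul continuous_const
    · rw [norm_smul, norm_mul, norm_neg, Complex.norm_natCast, Complex.norm_real, Real.norm_eq_abs]
      have : ‖ContinuousLinearMap.id ℝ ℂ‖ ≤ 1 := ContinuousLinearMap.norm_id_le
      calc _ ≤ (n : ℝ) * |a z| * 1 := by gcongr
        _ ≤ _ := by rw [mul_one, mul_assoc]; gcongr; exact h3 z hz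
  · rcases eq_or_ne z 0 with rfl | hz
    · have h0 : g' 0 = 0 := by ext; simp [hg', (show n ≠ 0 by omega)]
      rw [h0]
      obtain ⟨C, hC0, hC⟩ := (hfl (n + 2)).exists_nonneg
      have hz0 : (((0 : ℂ) ^ n)⁻¹ * (a 0 : ℂ)) = 0 := by simp [(show n ≠ 0 by omega)]
      refine HasFDerivAt.of_isLittleO ?_
      simp only [hz0, sub_zero, zero_apply]
      have h2 : (fun z : ℂ => (z ^ n)⁻¹ * (a z : ℂ)) =O[nhds 0] fun z : ℂ => ‖z‖ ^ 2 := by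
        refine Asymptotics.IsBigO.of_bound C ?_
        filter_upwards [Metric.closedBall_mem_nhds (0 : ℂ) one_pos] with z hz
        rcases eq_or_ne z 0 with rfl | hz0
        · simp [(show n ≠ 0 by omega)]
        rw [norm_mul, norm_inv, norm_pow, inv_mul_le_iff₀ (pow_pos (norm_pos_iff.2 hz0) _),
          Complex.norm_real, norm_pow, norm_norm]
        exact (hC z (by simpa using hz)).trans_eq (by ring)
      refine h2.trans_isLittleO ?_
      have h3 := (Asymptotics.isLittleO_norm_pow_id (E' := ℂ) one_lt_two)
      exact h3
    · have e1 : HasFDerivAt (fun z : ℂ => (z ^ n)⁻¹)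
          ((-(n * z ^ (n - 1)) / (z ^ n) ^ 2) • ContinuousLinearMap.id ℝ ℂ) z := by
        have := ((hasDerivAt_pow n z).inv (pow_ne_zero n hz)).hasFDerivAt.restrictScalars ℝ
        refine this.congr_fderiv ?_
        ext v
        simp [mul_comm]
      have e2 := Complex.ofRealCLM.hasFDerivAt.comp z (ha.differentiable (by simp) z).hasFDerivAt
      refine (e1.mul e2).congr_fderiv ?_
      obtain ⟨m, rfl⟩ : ∃ m, n = m + 1 := ⟨n - 1, by omega⟩
      ext
      · simp [hg']
        field_simp
        ring

theorem dbar_inv_pow_mul {F : ℂ → ℂ} (hF : ContDiff ℝ 1 F) {z : ℂ} (hz : z ≠ 0) :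
    dbar (fun z => (z ^ n)⁻¹ * F z) z = (z ^ n)⁻¹ * dbar F z := by
  have hd : DifferentiableAt ℂ (fun z : ℂ => (z ^ n)⁻¹) z :=
    (differentiableAt_id.pow n).inv (pow_ne_zero n hz)
  rw [dbar_mul (hd.restrictScalars ℝ) (hF.differentiable (by simp) z), dbar_of_differentiableAt hd]
  ring

end flat

section Carleman
variable {f w : ℂ → ℝ} {n : ℕ}

theorem dbar_conj_dbar (hf : ContDiff ℝ ∞ f) (z : ℂ) :
    dbar (fun z => ((fderiv ℝ f z 1 : ℂ) - Complex.I * (fderiv ℝ f z Complex.I : ℂ)) / 2) z =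
      (lapC f z : ℂ) / 4 := by
  have hd : ∀ v, HasFDerivAt (fun z => (fderiv ℝ f z v : ℂ))
      (Complex.ofRealCLM.comp (fderiv ℝ (fun z => fderiv ℝ f z v) z)) z := fun v =>
    Complex.ofRealCLM.hasFDerivAt.comp z
      ((hf.fderiv_apply_const_infty v).differentiable (by simp) z).hasFDerivAt
  have hdd : ∀ v w, fderiv ℝ (fun z => fderiv ℝ f z v) z w = fderiv ℝ (fderiv ℝ f) z w v := by
    intro v w
    have := ((hf.fderiv_right (m := 1) (by norm_cast)).differentiable (by simp) z).hasFDerivAt.clm_apply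
      (hasFDerivAt_const v z)
    rw [this.fderiv]
    simp
  have hf2 : ContDiff ℝ 2 f := hf.of_le (by norm_cast)
  have hsymm : fderiv ℝ (fderiv ℝ f) z 1 Complex.I = fderiv ℝ (fderiv ℝ f) z Complex.I 1 :=
    (hf2.contDiffAt.isSymmSndFDerivAt (by simp)) 1 Complex.I
  have h : HasFDerivAt (fun z => ((fderiv ℝ f z 1 : ℂ) - Complex.I * (fderiv ℝ f z Complex.I : ℂ)) / 2)
      _ z := ((hd 1).sub ((hd Complex.I).const_mul Complex.I)).mul_const (2⁻¹ : ℂ)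
  rw [dbar, h.fderiv, lapC_eq_fderiv_fderiv hf2]
  simp only [sub_apply, smul_apply, ContinuousLinearMap.comp_apply, hdd, Complex.ofRealCLM_apply,
    smul_eq_mul, hsymm]
  push_cast
  linear_combination (-(fderiv ℝ (fderiv ℝ f) z Complex.I Complex.I : ℂ) / 4) * Complex.I_mul_I

/-- A weighted estimate for flat functions with weight independent constants. -/
theorem abs_le_of_abs_lapC_le (hf : ContDiff ℝ ∞ f) (hfl : ∀ k, VanishAt f k) (hn : 1 ≤ n)
    {R A : ℝ} (hR : 0 ≤ R) (hs : tsupport f ⊆ Metric.ball 0 R)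
    (hA : ∀ z, |lapC f z| ≤ A * ‖z‖ ^ n) (z : ℂ) :
    |f z| ≤ 4 * R ^ 2 * A * ‖z‖ ^ n := by
  have hn0 : n ≠ 0 := by omega
  have hA0 : 0 ≤ A := by
    have := (abs_nonneg _).trans (hA 1)
    simpa using this
  have hfz : ∀ z, R ≤ ‖z‖ → f z = 0 := fun z hz => image_eq_zero_of_notMem_tsupport fun h => by
    have := hs h
    simp at this
    linarith
  have hfd : ∀ z, R ≤ ‖z‖ → fderiv ℝ f z = 0 := fun z hz =>
    fderiv_of_notMem_tsupport (𝕜 := ℝ) fun h => by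
      have := hs h
      simp at this
      linarith
  have hsm := fun v => hf.fderiv_apply_const_infty v
  have hsf := fun v k => (hfl (k + 1)).fderiv_apply hf v
  set h : ℂ → ℂ := fun z => ((fderiv ℝ f z 1 : ℂ) - Complex.I * (fderiv ℝ f z Complex.I : ℂ)) / 2 with hh
  have hhs : ContDiff ℝ 1 h := by
    have h1 := fun v => (Complex.ofRealCLM.contDiff (n := 1)).comp ((hsm v).of_le (m := 1) (by norm_cast))
    exact ((h1 1).sub (contDiff_const.mul (h1 Complex.I))).div_const 2
  have hdf : ∀ z, ‖dbar (fun z => (f z : ℂ)) z‖ = ‖h z‖ := by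
    intro z
    have h1 : ∀ v : ℂ, fderiv ℝ (fun z => (f z : ℂ)) z v = (fderiv ℝ f z v : ℂ) := by
      intro v
      rw [show fderiv ℝ (fun z => (f z : ℂ)) z = _ from
        (Complex.ofRealCLM.hasFDerivAt.comp z (hf.differentiable (by simp) z).hasFDerivAt).fderiv]
      simp
    rw [← Complex.norm_conj (h z), dbar, h1, h1]
    simp [hh]
  have hinv : ∀ z : ℂ, z ≠ 0 → ∀ B x : ℝ, x ≤ B * ‖z‖ ^ n → ‖(z ^ n)⁻¹‖ * x ≤ B := by
    intro z hz B x hx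
    rw [norm_inv, norm_pow, inv_mul_le_iff₀ (pow_pos (norm_pos_iff.2 hz) n)]
    linarith
  have hzero : ∀ {F : ℂ → ℂ}, ContDiff ℝ 1 (fun z => (z ^ n)⁻¹ * F z) → ∀ {B : ℝ},
      (∀ z ≠ 0, ‖dbar (fun z => (z ^ n)⁻¹ * F z) z‖ ≤ B) →
      ∀ z, ‖dbar (fun z => (z ^ n)⁻¹ * F z) z‖ ≤ B := by
    intro F hF B hB
    have h1 : IsClosed {z | ‖dbar (fun z => (z ^ n)⁻¹ * F z) z‖ ≤ B} :=
      isClosed_le (continuous_dbar hF).norm continuous_const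
    exact fun z => closure_minimal (fun z hz => hB z hz) h1 (dense_compl_singleton (0 : ℂ) z)
  have g1 : ContDiff ℝ 1 fun z : ℂ => (z ^ n)⁻¹ * h z := by
    have e := fun v => contDiff_one_inv_pow_mul (hsm v) (hsf v) hn
    have e2 : (fun z : ℂ => (z ^ n)⁻¹ * h z) = fun z => ((z ^ n)⁻¹ * (fderiv ℝ f z 1 : ℂ) -
        Complex.I * ((z ^ n)⁻¹ * (fderiv ℝ f z Complex.I : ℂ))) / 2 := by
      funext z
      simp only [hh]
      ring
    rw [e2]
    exact ((e 1).sub (contDiff_const.mul (e Complex.I))).div_const 2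
  have b1 : ∀ z, ‖(z ^ n)⁻¹ * h z‖ ≤ 4 * R * (A / 4) := by
    refine norm_le_of_norm_dbar_le g1 hR (fun z hz => ?_) (hzero g1 fun z hz => ?_)
    · simp [hh, hfd z hz]
    · rw [dbar_inv_pow_mul hhs hz, dbar_conj_dbar hf, norm_mul, norm_div, Complex.norm_real,
        Real.norm_eq_abs]
      refine hinv z hz _ _ ?_
      have := hA z
      rw [show ‖(4 : ℂ)‖ = 4 by simp]
      linarith
  have g2 := contDiff_one_inv_pow_mul hf hfl hn
  have b2 : ∀ z, ‖(z ^ n)⁻¹ * (f z : ℂ)‖ ≤ 4 * R * (4 * R * (A / 4)) := by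
    refine norm_le_of_norm_dbar_le g2 hR (fun z hz => ?_) (hzero g2 fun z hz => ?_)
    · simp [hfz z hz]
    · rw [dbar_inv_pow_mul (F := fun z => (f z : ℂ)) ((Complex.ofRealCLM.contDiff (n := 1)).comp (hf.of_le (m := 1) (by norm_cast))) hz,
        norm_mul, hdf, ← norm_mul]
      exact b1 z
  rcases eq_or_ne z 0 with rfl | hz
  · obtain ⟨C, hC⟩ := hfl 1
    have := hC 0 (by simp)
    simp at this
    simp [this, hn0]
  · have := b2 z
    rw [norm_mul, norm_inv, norm_pow, inv_mul_le_iff₀ (pow_pos (norm_pos_iff.2 hz) n),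
      Complex.norm_real, Real.norm_eq_abs] at this
    linarith

open Filter Topology in
/-- Local strong unique continuation for the inequality `|Δ w| ≤ C |w|`. -/
theorem eventually_eq_zero_of_vanishAt (hw : ContDiff ℝ ∞ w) (hfl : ∀ k, VanishAt w k) {C : ℝ}
    (hC : ∀ z, |lapC w z| ≤ C * |w z|) : ∀ᶠ z in 𝓝 (0 : ℂ), w z = 0 := by
  set R : ℝ := 1 / (3 * (1 + |C|)) with hRdef
  have hC0 := abs_nonneg C
  have hR : 0 < R := by positivity
  have hRC : R * (1 + |C|) = 1 / 3 := by rw [hRdef]; field_simp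
  have hR1 : R ≤ 1 / 3 := by nlinarith
  have hRC2 : 4 * R ^ 2 * |C| ≤ 1 / 2 := by nlinarith
  set r := R / 2 with hr
  have hr0 : 0 < r := by positivity
  obtain ⟨χ, h1, h2, h3, ⟨V, hV, hKV, hV1⟩, -⟩ := exists_smooth_cutoff
    (K := Metric.closedBall (0 : ℂ) r) (isCompact_closedBall _ _) (Metric.isOpen_ball (x := (0 : ℂ)) (ε := R))
    (Metric.closedBall_subset_ball (by simp only [hr]; linarith))
  set f : ℂ → ℝ := fun z => χ z * w z with hfdef
  have hf : ContDiff ℝ ∞ f := h1.mul hw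
  have hff : ∀ k, VanishAt f k := fun k => (hfl k).mul_of_bounded h1.continuous
  have hfs : tsupport f ⊆ Metric.ball 0 R := (tsupport_mul_subset_left).trans h3
  have hfc : HasCompactSupport f := h2.mul_right
  have hfr : ∀ z, ‖z‖ ≤ r → |lapC f z| ≤ |C| * |f z| := by
    intro z hz
    have hzV : V ∈ 𝓝 z := hV.mem_nhds (hKV (by simpa using hz))
    have he : f =ᶠ[𝓝 z] w := by
      filter_upwards [hzV] with y hy
      rw [hfdef]
      simp [hV1 y hy]
    have he2 : ∀ v, (fun y => fderiv ℝ f y v) =ᶠ[𝓝 z] fun y => fderiv ℝ w y v :=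
      fun v => he.eventuallyEq_nhds.mono fun y hy => by
        show fderiv ℝ f y v = _
        rw [hy.fderiv_eq]
    have hl : lapC f z = lapC w z := by
      rw [lapC, lapC, (he2 1).fderiv_eq, (he2 _).fderiv_eq]
    rw [hl, he.eq_of_nhds]
    exact (hC z).trans (mul_le_mul_of_nonneg_right (le_abs_self C) (abs_nonneg _))
  have hlc : Continuous (lapC f) := (contDiff_lapC hf).continuous
  obtain ⟨N, hN⟩ : ∃ N, ∀ z, |lapC f z| ≤ N := by
    obtain ⟨N, hN⟩ := (isCompact_closedBall (0 : ℂ) R).exists_bound_of_continuousOn hlc.continuousOn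
    refine ⟨N, fun z => ?_⟩
    by_cases hz : z ∈ tsupport f
    · exact hN z (Metric.ball_subset_closedBall (hfs hz))
    · have : lapC f z = 0 := by
        have h := fun v => fderiv_of_notMem_tsupport (𝕜 := ℝ) (f := fun y => fderiv ℝ f y v) (x := z)
          fun h => hz (tsupport_fderiv_apply_subset ℝ v h)
        rw [lapC, h, h]; simp
      rw [this, abs_zero]
      exact (norm_nonneg _).trans (hN 0 (by simp [hR.le]))
  have hN0 : 0 ≤ N := (abs_nonneg _).trans (hN 0)
  have key : ∀ n, 1 ≤ n → ∀ z, |f z| ≤ 8 * R ^ 2 * N * (‖z‖ / r) ^ n := by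
    intro n hn z
    set D := 4 * R ^ 2 * (N / r ^ n) with hD
    have hD0 : 0 ≤ D := by positivity
    obtain ⟨B, hB0, hB⟩ := (hff n).exists_nonneg
    have hB' : ∀ z, |f z| ≤ B * ‖z‖ ^ n := by
      intro z
      rcases le_or_gt ‖z‖ 1 with hz | hz
      · exact hB z hz
      · rw [show f z = 0 from image_eq_zero_of_notMem_tsupport fun h => by
          have := hfs h
          simp at this
          linarith, abs_zero]
        positivity
    have hit : ∀ j : ℕ, ∀ z, |f z| ≤ (B * (1 / 2) ^ j + 2 * D) * ‖z‖ ^ n := by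
      intro j
      induction j with
      | zero => exact fun z => (hB' z).trans (by gcongr; simp; exact hD0)
      | succ j ih =>
        have hb : ∀ z, |lapC f z| ≤ (|C| * (B * (1 / 2) ^ j + 2 * D) + N / r ^ n) * ‖z‖ ^ n := by
          intro z
          rw [add_mul]
          rcases le_or_gt ‖z‖ r with hz | hz
          · refine (hfr z hz).trans ?_
            have h5 := mul_le_mul_of_nonneg_left (ih z) hC0
            have h6 : 0 ≤ N / r ^ n * ‖z‖ ^ n := by positivity
            linarith
          · have h6 : 0 ≤ |C| * (B * (1 / 2) ^ j + 2 * D) * ‖z‖ ^ n := by positivity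
            have h7 : r ^ n ≤ ‖z‖ ^ n := by gcongr
            have h8 : N ≤ N / r ^ n * ‖z‖ ^ n := by
              rw [div_mul_eq_mul_div, le_div_iff₀ (by positivity)]
              gcongr
            linarith [hN z]
        intro z
        refine (abs_le_of_abs_lapC_le hf hff hn hR.le hfs hb z).trans ?_
        refine mul_le_mul_of_nonneg_right ?_ (by positivity)
        have h9 := mul_le_mul_of_nonneg_right hRC2 (show 0 ≤ B * (1 / 2) ^ j + 2 * D by positivity)
        rw [pow_succ (1 / 2 : ℝ) j]
        have h10 : 4 * R ^ 2 * (|C| * (B * (1 / 2) ^ j + 2 * D) + N / r ^ n) =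
            4 * R ^ 2 * |C| * (B * (1 / 2) ^ j + 2 * D) + D := by simp only [hD]; ring
        rw [h10]
        refine (add_le_add_left h9 D).trans_eq ?_
        ring
    have hlim : Tendsto (fun j : ℕ => (B * (1 / 2 : ℝ) ^ j + 2 * D) * ‖z‖ ^ n) atTop
        (𝓝 ((B * 0 + 2 * D) * ‖z‖ ^ n)) :=
      (((tendsto_pow_atTop_nhds_zero_of_lt_one (by norm_num) (by norm_num)).const_mul B).add_const _).mul_const _
    refine (ge_of_tendsto' hlim fun j => hit j z).trans_eq ?_
    rw [hD, div_pow]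
    ring_nf
  filter_upwards [Metric.ball_mem_nhds (0 : ℂ) hr0] with z hz
  have hz : ‖z‖ < r := by simpa using hz
  have hlim : Tendsto (fun n : ℕ => 8 * R ^ 2 * N * (‖z‖ / r) ^ n) atTop (𝓝 (8 * R ^ 2 * N * 0)) :=
    (tendsto_pow_atTop_nhds_zero_of_lt_one (by positivity) ((div_lt_one hr0).2 hz)).const_mul _
  rw [mul_zero] at hlim
  have h0 := ge_of_tendsto hlim (eventually_atTop.2 ⟨1, fun n hn => key n hn z⟩)
  have h10 : χ z * w z = 0 := abs_nonpos_iff.1 h0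
  rwa [hV1 z (hKV (by simpa using hz.le)), one_mul] at h10

/-- Strong unique continuation on the plane. -/
theorem eq_zero_of_vanishAt (hw : ContDiff ℝ ∞ w) (hfl : ∀ k, VanishAt w k) {C : ℝ}
    (hC : ∀ z, |lapC w z| ≤ C * |w z|) (z : ℂ) : w z = 0 := by
  have hshift : ∀ a z, lapC (fun y => w (a + y)) z = lapC w (a + z) := by
    intro a z
    have h1 : ∀ v, (fun y => fderiv ℝ (fun y => w (a + y)) y v) = fun y => fderiv ℝ w (a + y) v := by
      intro v
      funext y
      rw [fderiv_comp_add_left]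
    have h2 : ∀ v, fderiv ℝ (fun y => fderiv ℝ w (a + y) v) z = fderiv ℝ (fun y => fderiv ℝ w y v) (a + z) :=
      fun v => fderiv_comp_add_left (f := fun y => fderiv ℝ w y v) a
    rw [lapC, h1, h1, h2, h2, lapC]
  have hloc : ∀ a, (∀ k, VanishAt (fun y => w (a + y)) k) → w =ᶠ[nhds a] 0 := by
    intro a ha
    have h1 := eventually_eq_zero_of_vanishAt (w := fun y => w (a + y))
      (hw.comp (contDiff_const.add contDiff_id)) ha (C := C) fun z => by rw [hshift]; exact hC _
    have h2 : Filter.Tendsto (fun y => y - a) (nhds a) (nhds 0) :=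
      (continuous_id.sub continuous_const).tendsto' a 0 (by simp)
    filter_upwards [h2.eventually h1] with y hy
    simpa using hy
  set Z : Set ℂ := {a | w =ᶠ[nhds a] 0} with hZ
  have hZo : IsOpen Z := isOpen_iff_mem_nhds.2 fun a ha =>
    (Filter.EventuallyEq.eventuallyEq_nhds ha)
  have hZc : IsClosed Z := by
    refine isClosed_of_closure_subset fun a ha => hloc a fun k => ?_
    have hjet : ∀ j, iteratedFDeriv ℝ j w a = 0 := by
      intro j
      have h1 : IsClosed {a | iteratedFDeriv ℝ j w a = 0} :=
        isClosed_eq (hw.continuous_iteratedFDeriv (by norm_cast; exact le_top)) continuous_const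
      refine closure_minimal (fun b hb => ?_) h1 ha
      have h2 : w =ᶠ[nhds b] fun _ => (0 : ℝ) := hb
      show iteratedFDeriv ℝ j w b = 0
      rw [(Filter.EventuallyEq.iteratedFDeriv ℝ h2 j).eq_of_nhds]
      exact congrFun iteratedFDeriv_fun_zero b
    have hs : ContDiff ℝ ∞ fun y => w (a + y) := hw.comp (contDiff_const.add contDiff_id)
    refine ((vanishAt_sub_sum_jet hs k).of_le (Nat.le_succ k)).of_abs_le zero_le_one fun z _ => ?_
    rw [Finset.sum_eq_zero fun j _ => by
      rw [jet, iteratedFDeriv_comp_add_left, add_zero, hjet]; simp]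
    simp
  have hZu : Z = Set.univ := IsClopen.eq_univ ⟨hZc, hZo⟩ ⟨0, hloc 0 (by simpa using hfl)⟩
  have : z ∈ Z := hZu ▸ Set.mem_univ z
  exact Filter.EventuallyEq.eq_of_nhds this

end Carleman

theorem Real.abs_exp_sub_exp_le {a b M : ℝ} (ha : a ≤ M) (hb : b ≤ M) :
    |exp a - exp b| ≤ exp M * |a - b| := by
  wlog hab : b ≤ a generalizing a b
  · rw [abs_sub_comm, abs_sub_comm a]
    exact this hb ha (le_of_not_ge hab)
  rw [abs_of_nonneg (sub_nonneg.2 (exp_le_exp.2 hab)), abs_of_nonneg (sub_nonneg.2 hab)]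
  have h1 := add_one_le_exp (b - a)
  have h2 : exp b = exp a * exp (b - a) := by rw [← exp_add]; congr 1; ring
  have h3 : exp a ≤ exp M := exp_le_exp.2 ha
  have h4 := mul_le_mul_of_nonneg_left h1 (exp_pos a).le
  have h5 := mul_le_mul_of_nonneg_right h3 (sub_nonneg.2 hab)
  rw [h2]
  linarith

theorem sphDensity_le (z : ℂ) : sphDensity z ≤ 4 := by
  rw [sphDensity, div_le_iff₀ (by positivity)]
  have : 1 ≤ (1 + ‖z‖ ^ 2) ^ 2 := one_le_pow₀ (by linarith [sq_nonneg ‖z‖])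
  linarith

namespace PlaneSol
variable {v v' : ℂ → ℝ} {α b : ℝ}

theorem lapC_sub_eq (h : PlaneSol v α b) (h' : PlaneSol v' α b) (z : ℂ) :
    lapC (fun z => v z - v' z) z = sphDensity z * (exp (2 * v' z) - exp (2 * v z)) := by
  rw [lapC_sub isOpen_univ h.contDiff_two.contDiffOn h'.contDiff_two.contDiffOn (Set.mem_univ z),
    h.lap, h'.lap]
  ring

theorem exists_abs_lapC_sub_le (h : PlaneSol v α b) (h' : PlaneSol v' α b) :
    ∃ C, 0 ≤ C ∧ ∀ z, |lapC (fun z => v z - v' z) z| ≤ C * |v z - v' z| := by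
  obtain ⟨M, hM⟩ := h.exists_abs_le
  obtain ⟨M', hM'⟩ := h'.exists_abs_le
  refine ⟨4 * (exp (2 * max M M') * 2), by positivity, fun z => ?_⟩
  have h1 := (le_abs_self _).trans ((hM z).trans (le_max_left M M'))
  have h2 := (le_abs_self _).trans ((hM' z).trans (le_max_right M M'))
  rw [h.lapC_sub_eq h', abs_mul, abs_of_pos (sphDensity_pos z), mul_assoc]
  refine mul_le_mul (sphDensity_le z) ?_ (abs_nonneg _) (by norm_num)
  refine (Real.abs_exp_sub_exp_le (M := 2 * max M M') (by linarith) (by linarith)).trans_eq ?_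
  rw [← mul_sub, abs_mul, abs_sub_comm, abs_two]
  ring

theorem false_of_leading_term (h : PlaneSol v α b) (hα : 1 < α) (hα3 : α ≤ 3) {n : ℕ} (hn : 4 ≤ n)
    {γ C : ℝ} (hγ : 0 < γ) (hC0 : 0 ≤ C)
    (hw : ∀ z, ‖z‖ ≤ 1 → |v z - v (starRingEnd ℂ z) - γ * (z ^ n).im| ≤ C * ‖z‖ ^ (n + 1)) : False := by
  have hn4 : (4 : ℝ) ≤ n := by exact_mod_cast hn
  have hn0 : (n : ℝ) ≠ 0 := by positivity
  set L := min 0 (Real.log (γ / (2 * (C + 1)))) with hL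
  have hCL : ∀ x ≤ L, C * exp x < γ := by
    intro x hx
    have h1 : exp x ≤ γ / (2 * (C + 1)) := by
      rw [← Real.le_log_iff_exp_le (by positivity)]
      exact hx.trans (min_le_right _ _)
    calc C * exp x ≤ C * (γ / (2 * (C + 1))) := mul_le_mul_of_nonneg_left h1 hC0
      _ = γ * (C / (2 * (C + 1))) := by ring
      _ < γ * 1 := by
        refine mul_lt_mul_of_pos_left ?_ hγ
        rw [div_lt_one (by positivity)]
        linarith
      _ = γ := mul_one γ
  have key : ∀ (θ : ℝ) (x : ℝ), x ≤ L →
      |v (Complex.exp (x + θ * Complex.I)) - v (starRingEnd ℂ (Complex.exp (x + θ * Complex.I))) -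
        γ * (exp x ^ n * sin (n * θ))| < γ * exp x ^ n := by
    intro θ x hx
    have h1 : ‖Complex.exp (x + θ * Complex.I)‖ = exp x := by
      rw [Complex.norm_exp]; simp
    have h2 : (Complex.exp (x + θ * Complex.I) ^ n).im = exp x ^ n * sin (n * θ) := by
      rw [← Complex.exp_nat_mul, Complex.exp_im, ← Real.exp_nat_mul]
      simp
    have h3 := hw (Complex.exp (x + θ * Complex.I)) (by
      rw [h1]; exact exp_le_one_iff.2 (hx.trans (min_le_left _ _)))
    rw [h1, h2] at h3
    refine h3.trans_lt ?_
    have := mul_lt_mul_of_pos_right (hCL x hx) (pow_pos (exp_pos x) n)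
    rw [pow_succ]
    linarith
  have hs : ∀ j : ℕ, (n : ℝ) * (((2 * j + 1) * π) / (2 * n)) = π / 2 + j * π := by
    intro j
    field_simp
    ring
  have hpos : ∀ j : ℕ, Even j → ∀ x : ℝ, x ≤ L → 0 < v (Complex.exp (x + (((2 * j + 1) * π) / (2 * n) : ℝ) * Complex.I)) -
      v (starRingEnd ℂ (Complex.exp (x + (((2 * j + 1) * π) / (2 * n) : ℝ) * Complex.I))) := by
    intro j hj x hx
    have h1 := key (((2 * j + 1) * π) / (2 * n)) x hx
    rw [hs, Real.sin_add_nat_mul_pi, hj.neg_one_pow, sin_pi_div_two] at h1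
    have := (abs_lt.1 h1).1
    linarith
  have hneg : ∀ j : ℕ, Odd j → ∀ x : ℝ, x ≤ L → 0 <
      v (starRingEnd ℂ (Complex.exp (x + (((2 * j + 1) * π) / (2 * n) : ℝ) * Complex.I))) -
      v (Complex.exp (x + (((2 * j + 1) * π) / (2 * n) : ℝ) * Complex.I)) := by
    intro j hj x hx
    have h1 := key (((2 * j + 1) * π) / (2 * n)) x hx
    rw [hs, Real.sin_add_nat_mul_pi, hj.neg_one_pow, sin_pi_div_two] at h1
    have := (abs_lt.1 h1).2
    linarith
  have hlt : ∀ i j : ℕ, i < j → ((2 * i + 1) * π) / (2 * n) < ((2 * j + 1) * π) / (2 * n) := by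
    intro i j hij
    have : (i : ℝ) < j := by exact_mod_cast hij
    gcongr
  refine h.not_alternating hα hα3 ?_ (hlt 0 1 (by norm_num)) (hlt 1 2 (by norm_num))
    (hlt 2 3 (by norm_num)) ?_ (hpos 0 (by decide)) (hneg 1 (by decide)) (hpos 2 (by decide))
    (hneg 3 (by decide))
  · positivity
  · rw [div_lt_iff₀ (by positivity)]
    push_cast
    nlinarith [pi_pos]

/-- A solution that agrees with its reflection to fourth order is symmetric. -/
theorem eq_comp_conj (h : PlaneSol v α b) (hα : 1 < α) (hα3 : α ≤ 3)
    (hw : VanishAt (fun z => v z - v (starRingEnd ℂ z)) 4) (z : ℂ) : v z = v (starRingEnd ℂ z) := by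
  classical
  have hs := h.contDiff.sub h.comp_conj.contDiff
  obtain ⟨C, hC0, hC⟩ := h.exists_abs_lapC_sub_le h.comp_conj
  by_cases hfl : ∀ k, VanishAt (fun z => v z - v (starRingEnd ℂ z)) k
  · exact sub_eq_zero.1 (eq_zero_of_vanishAt hs hfl hC z)
  exfalso
  push Not at hfl
  have h1 : 5 ≤ Nat.find hfl := by
    by_contra h2
    exact Nat.find_spec hfl (hw.of_le (by omega))
  obtain ⟨m, hm⟩ : ∃ m, Nat.find hfl = m + 3 := ⟨Nat.find hfl - 3, by omega⟩
  have h2 : ¬ VanishAt (fun z => v z - v (starRingEnd ℂ z)) (m + 3) := hm ▸ Nat.find_spec hfl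
  have h3 : VanishAt (fun z => v z - v (starRingEnd ℂ z)) (m + 2) := by
    by_contra h4
    have := Nat.find_min' hfl h4
    omega
  obtain ⟨c, hc⟩ := h3.exists_sub_re_mul_pow hs
    ((h3.of_abs_le hC0 fun z _ => hC z).of_le (Nat.le_succ _))
  have h5 := hc.add (hc.comp Complex.norm_conj)
  have hre : c.re = 0 := by
    have h6 := VanishAt.eq_zero_of_homogeneous (k := m + 2)
      (f := fun z => (c * z ^ (m + 2)).re + (c * (starRingEnd ℂ z) ^ (m + 2)).re)
      (h5.of_abs_le zero_le_one fun z _ => ?_) (fun t _ z => ?_) 1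
    · simp at h6
      linarith
    · rw [one_mul, ← abs_neg]
      refine le_of_eq (congrArg _ ?_)
      simp only [Complex.conj_conj]
      ring
    · simp only [map_mul, Complex.conj_ofReal, mul_pow, ← Complex.ofReal_pow]
      rw [mul_left_comm, mul_left_comm c, Complex.re_ofReal_mul, Complex.re_ofReal_mul]
      ring
  obtain ⟨D, hD0, hD⟩ := hc.exists_nonneg
  have hcz : ∀ z : ℂ, (c * z ^ (m + 2)).re = -c.im * (z ^ (m + 2)).im := by
    intro z
    rw [Complex.mul_re, hre]
    ring
  simp only [hcz] at hD
  rcases lt_trichotomy c.im 0 with hi | hi | hi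
  · exact h.false_of_leading_term hα hα3 (n := m + 2) (by omega) (neg_pos.2 hi) hD0 hD
  · refine h2 ⟨D, fun z hz => ?_⟩
    have := hD z hz
    rwa [hi, neg_zero, zero_mul, sub_zero] at this
  · refine h.comp_conj.false_of_leading_term hα hα3 (n := m + 2) (by omega) hi hD0 fun z hz => ?_
    refine le_trans (le_of_eq ?_) (hD z hz)
    rw [← abs_neg]
    congr 1
    simp only [Complex.conj_conj]
    ring
end PlaneSol

theorem abs_sphDensity_sub_four_le (z : ℂ) : |sphDensity z - 4| ≤ 8 * ‖z‖ ^ 2 := by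
  have h : 0 ≤ ‖z‖ ^ 2 := sq_nonneg _
  have h1 : sphDensity z - 4 = -(4 * ‖z‖ ^ 2 * (2 + ‖z‖ ^ 2) / (1 + ‖z‖ ^ 2) ^ 2) := by
    rw [sphDensity]
    field_simp
    ring
  rw [h1, abs_neg, abs_of_nonneg (by positivity), div_le_iff₀ (by positivity)]
  nlinarith [mul_nonneg h h, mul_nonneg h (mul_nonneg h h)]

namespace PlaneSol
variable {v : ℂ → ℝ} {α b c : ℝ}

theorem vanishAt_sub_quadratic (h : PlaneSol v α b) (h1 : fderiv ℝ v 0 = 0)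
    (h2 : ∀ z, fderiv ℝ (fderiv ℝ v) 0 z z = c * ‖z‖ ^ 2) :
    VanishAt (fun z => v z - (c / 2 * ‖z‖ ^ 2 + v 0)) 3 := by
  refine (vanishAt_sub_sum_jet h.contDiff 2).of_abs_le zero_le_one fun z _ => ?_
  rw [one_mul]
  refine le_of_eq (congrArg _ (congrArg _ ?_))
  simp only [Finset.sum_range_succ, Finset.sum_range_zero, jet, iteratedFDeriv_zero_apply,
    iteratedFDeriv_one_apply, iteratedFDeriv_two_apply, h1, h2]
  simp
  ring

/-- The Taylor expansion of a solution at an umbilical critical point. -/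
theorem exists_cubic (h : PlaneSol v α b) (h1 : fderiv ℝ v 0 = 0)
    (h2 : ∀ z, fderiv ℝ (fderiv ℝ v) 0 z z = c * ‖z‖ ^ 2) :
    ∃ a : ℂ, VanishAt (fun z => v z - (c / 2 * ‖z‖ ^ 2 + v 0) - (a * z ^ 3).re) 4 := by
  have hq := h.vanishAt_sub_quadratic h1 h2
  have hqs : ContDiff ℝ ∞ fun z : ℂ => c / 2 * ‖z‖ ^ 2 + v 0 :=
    (contDiff_const.mul (contDiff_norm_sq ℝ)).add contDiff_const
  have hs : ContDiff ℝ ∞ fun z => v z - (c / 2 * ‖z‖ ^ 2 + v 0) := h.contDiff.sub hqs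
  have hl : ∀ z, lapC (fun z => v z - (c / 2 * ‖z‖ ^ 2 + v 0)) z =
      sphDensity z * (α - exp (2 * v z)) - 2 * c := by
    intro z
    rw [lapC_sub isOpen_univ h.contDiff_two.contDiffOn (hqs.of_le (by norm_cast)).contDiffOn
      (Set.mem_univ z), h.lap, lapC_const_mul_add_const (contDiff_norm_sq ℝ), lapC_normSq]
    ring
  have hv : VanishAt (fun z => v z - v 0) 2 := by
    have := (hq.of_le (j := 2) (by norm_num)).add
      (g := fun z => c / 2 * ‖z‖ ^ 2) ⟨|c / 2|, fun z _ => by rw [abs_mul, abs_pow, abs_norm]⟩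
    refine this.of_abs_le zero_le_one fun z _ => ?_
    rw [one_mul]
    refine le_of_eq (congrArg _ ?_)
    ring
  have h0 : 4 * (α - exp (2 * v 0)) = 2 * c := by
    obtain ⟨C, hC⟩ := VanishAt.laplace hs hq
    have := hC 0 (by simp)
    rw [hl] at this
    simp [sphDensity] at this
    linarith
  obtain ⟨M, hM⟩ := h.exists_abs_le
  have hM2 : ∀ z, 2 * v z ≤ 2 * M := fun z => by linarith [le_abs_self (v z), hM z]
  have he : VanishAt (fun z => exp (2 * v z) - exp (2 * v 0)) 2 :=
    hv.of_abs_le (M := exp (2 * M) * 2) (by positivity) fun z _ => by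
      refine (Real.abs_exp_sub_exp_le (hM2 z) (hM2 0)).trans_eq ?_
      rw [← mul_sub, abs_mul, abs_two, mul_assoc]
  have hρ : VanishAt (fun z => sphDensity z - 4) 2 := ⟨8, fun z _ => abs_sphDensity_sub_four_le z⟩
  have hL : VanishAt (lapC fun z => v z - (c / 2 * ‖z‖ ^ 2 + v 0)) 2 := by
    refine ((hρ.mul_of_bounded (g := fun z => α - exp (2 * v z)) ?_).sub
      (he.const_mul 4)).of_abs_le zero_le_one fun z _ => ?_
    · exact continuous_const.sub (Real.continuous_exp.comp
        (continuous_const.mul h.contDiff.continuous))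
    · rw [one_mul, hl, ← h0]
      refine le_of_eq (congrArg _ ?_)
      ring
  exact hq.exists_sub_re_mul_pow hs hL

theorem eq_comp_reflection (h : PlaneSol v α b) (hα : 1 < α) (hα3 : α ≤ 3) {a : ℂ}
    (ha : VanishAt (fun z => v z - (c / 2 * ‖z‖ ^ 2 + v 0) - (a * z ^ 3).re) 4) {φ : ℝ}
    (hφ : (a * Complex.exp (φ * Complex.I) ^ 3).im = 0) (z : ℂ) :
    v z = v (Complex.exp (φ * Complex.I) ^ 2 * starRingEnd ℂ z) := by
  have hn : ‖Complex.exp (φ * Complex.I)‖ = 1 := Complex.norm_exp_ofReal_mul_I φ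
  set ζ := Complex.exp (φ * Complex.I) with he
  have hne : ζ ≠ 0 := Complex.exp_ne_zero _
  have hvan : VanishAt (fun z => v (ζ * z) - v (ζ * starRingEnd ℂ z)) 4 := by
    refine ((ha.comp (e := fun z => ζ * z) (by simp [hn])).sub
      (ha.comp (e := fun z => ζ * starRingEnd ℂ z) (by simp [hn]))).of_abs_le zero_le_one fun z _ => ?_
    rw [one_mul]
    refine le_of_eq (congrArg _ ?_)
    have h3 : (a * (ζ * starRingEnd ℂ z) ^ 3).re = (a * (ζ * z) ^ 3).re := by
      rw [mul_pow, mul_pow, ← mul_assoc, ← mul_assoc, Complex.mul_re, Complex.mul_re (a * ζ ^ 3), hφ,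
        ← map_pow, Complex.conj_re]
      ring
    simp only [norm_mul, hn, h3, Complex.norm_conj]
    ring
  have h1 := (h.comp_mul hn).eq_comp_conj hα hα3 hvan (ζ⁻¹ * z)
  have h2 : starRingEnd ℂ ζ = ζ⁻¹ := by
    rw [Complex.inv_def, Complex.normSq_eq_norm_sq, hn]
    simp
  rw [mul_inv_cancel_left₀ hne, map_mul, map_inv₀, h2, inv_inv, ← mul_assoc, ← sq] at h1
  exact h1

/-- Solutions with an umbilical critical point at the origin have a threefold symmetry. -/
theorem eq_comp_rotation (h : PlaneSol v α b) (hα : 1 < α) (hα3 : α ≤ 3) (h1 : fderiv ℝ v 0 = 0)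
    (h2 : ∀ z, fderiv ℝ (fderiv ℝ v) 0 z z = c * ‖z‖ ^ 2) (z : ℂ) :
    v (Complex.exp ((2 * π / 3 : ℝ) * Complex.I) * z) = v z := by
  obtain ⟨a, ha⟩ := h.exists_cubic h1 h2
  have hpol := Complex.norm_mul_exp_arg_mul_I a
  have key : ∀ s : ℝ, a * Complex.exp (((s - a.arg / 3 : ℝ) : ℂ) * Complex.I) ^ 3 =
      ‖a‖ * Complex.exp ((3 * s : ℝ) * Complex.I) := by
    intro s
    nth_rw 1 [← hpol]
    rw [← Complex.exp_nat_mul, mul_assoc, ← Complex.exp_add]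
    congr 2
    push_cast
    ring
  have r1 := h.eq_comp_reflection hα hα3 ha (φ := 0 - a.arg / 3) (by rw [key]; simp)
  have r2 := h.eq_comp_reflection hα hα3 ha (φ := π / 3 - a.arg / 3) (by
    rw [key, mul_div_cancel₀ _ three_ne_zero, Complex.exp_pi_mul_I]; simp)
  have h3 := (r1 (Complex.exp (((0 - a.arg / 3 : ℝ) : ℂ) * Complex.I) ^ 2 * starRingEnd ℂ z)).symm.trans
    (r2 (Complex.exp (((0 - a.arg / 3 : ℝ) : ℂ) * Complex.I) ^ 2 * starRingEnd ℂ z))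
  have h4 : ∀ x : ℝ, Complex.exp (x * Complex.I) ^ 2 * starRingEnd ℂ
      (Complex.exp (((0 - a.arg / 3 : ℝ) : ℂ) * Complex.I) ^ 2 * starRingEnd ℂ z) =
      Complex.exp (((2 * (x + a.arg / 3) : ℝ) : ℂ) * Complex.I) * z := by
    intro x
    rw [map_mul, Complex.conj_conj, map_pow, ← Complex.exp_conj, map_mul, Complex.conj_ofReal,
      Complex.conj_I, ← mul_assoc, ← mul_pow, ← Complex.exp_add, ← Complex.exp_nat_mul]
    congr 2
    push_cast
    ring
  rw [h4, h4] at h3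
  rw [show 2 * (0 - a.arg / 3 + a.arg / 3) = 0 by ring,
    show 2 * (π / 3 - a.arg / 3 + a.arg / 3) = 2 * π / 3 by ring] at h3
  simpa using h3.symm
end PlaneSol

section Homogeneous
variable {u : E3 → ℝ}

theorem lap_eq_sum_basis (u : E3 → ℝ) (b : OrthonormalBasis (Fin 3) ℝ E3) (x : E3) :
    lap u x = ∑ i, fderiv ℝ (fderiv ℝ u) x (b i) (b i) := by
  have h := congrFun ((InnerProductSpace.laplacian_eq_iteratedFDeriv_orthonormalBasis u
    (EuclideanSpace.basisFun (Fin 3) ℝ)).symm.trans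
      (InnerProductSpace.laplacian_eq_iteratedFDeriv_orthonormalBasis u b)) x
  simp only [EuclideanSpace.basisFun_apply] at h
  rw [lap, h]
  simp [iteratedFDeriv_two_apply]

theorem Hom0.fderiv_smul (hu : Hom0 u) {r : ℝ} (hr : 0 < r) (x : E3) :
    fderiv ℝ u x = r • fderiv ℝ u (r • x) := by
  rw [← fderiv_comp_smul]
  congr 1
  funext y
  exact (hu y r hr).symm

theorem Hom0.lap_smul (hu : Hom0 u) {r : ℝ} (hr : 0 < r) (x : E3) :
    lap u x = r ^ 2 * lap u (r • x) := by
  have h : fderiv ℝ (fderiv ℝ u) x = (r * r) • fderiv ℝ (fderiv ℝ u) (r • x) := by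
    conv_lhs => rw [show fderiv ℝ u = fun x => r • fderiv ℝ u (r • x) from
      funext fun x => hu.fderiv_smul hr x]
    rw [show (fun x => r • fderiv ℝ u (r • x)) = r • fun x => fderiv ℝ u (r • x) from rfl,
      show fderiv ℝ (r • fun x => fderiv ℝ u (r • x)) x = _ from
        congrFun (fderiv_const_smul_field (f := fun x => fderiv ℝ u (r • x)) r) x,
      Pi.smul_apply, fderiv_comp_smul, smul_smul]
  simp only [lap, iteratedFDeriv_two_apply, h, Finset.mul_sum]
  simp [sq]

/-- Euler's identity in degree zero. -/
theorem Hom0.fderiv_self (hu : Hom0 u) {x : E3} (hd : DifferentiableAt ℝ u x) :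
    fderiv ℝ u x x = 0 := by
  have h1 : HasDerivAt (fun t : ℝ => u (t • x)) (fderiv ℝ u x x) 1 := by
    have h2 : HasDerivAt (fun t : ℝ => t • x) x 1 := by
      simpa using (hasDerivAt_id (1 : ℝ)).smul_const x
    have hd' : HasFDerivAt u (fderiv ℝ u x) ((1 : ℝ) • x) := by
      rw [one_smul]; exact hd.hasFDerivAt
    exact hd'.comp_hasDerivAt (1 : ℝ) h2
  have h3 : HasDerivAt (fun t : ℝ => u (t • x)) 0 1 := by
    refine (hasDerivAt_const (1 : ℝ) (u x)).congr_of_eventuallyEq ?_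
    filter_upwards [Ioi_mem_nhds one_pos] with t ht using hu x t ht
  exact h1.unique h3

theorem contDiffAt_of_contDiffOn_compl_zero (hc : ContDiffOn ℝ ∞ u {(0 : E3)}ᶜ) {x : E3}
    (hx : x ≠ 0) : ContDiffAt ℝ ∞ u x :=
  hc.contDiffAt (isOpen_compl_singleton.mem_nhds hx)

theorem differentiableAt_fderiv (hc : ContDiffOn ℝ ∞ u {(0 : E3)}ᶜ) {x : E3} (hx : x ≠ 0) :
    DifferentiableAt ℝ (fderiv ℝ u) x :=
  ((contDiffAt_of_contDiffOn_compl_zero hc hx).fderiv_right (m := 1)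
    (by norm_cast)).differentiableAt one_ne_zero

theorem Hom0.fderiv_fderiv_self (hu : Hom0 u) (hc : ContDiffOn ℝ ∞ u {(0 : E3)}ᶜ) {x : E3}
    (hx : x ≠ 0) (a : E3) : fderiv ℝ (fderiv ℝ u) x a x = -fderiv ℝ u x a := by
  have h1 := (differentiableAt_fderiv hc hx).hasFDerivAt.clm_apply (hasFDerivAt_id x)
  have h2 : HasFDerivAt (fun y => fderiv ℝ u y (id y)) (0 : E3 →L[ℝ] ℝ) x := by
    refine (hasFDerivAt_const (0 : ℝ) x).congr_of_eventuallyEq ?_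
    filter_upwards [isOpen_compl_singleton.mem_nhds hx] with y hy
    exact hu.fderiv_self ((contDiffAt_of_contDiffOn_compl_zero hc hy).differentiableAt (by simp))
  have := congrArg (fun L => L a) (h1.unique h2)
  simp at this
  linarith
end Homogeneous

noncomputable section
/-- Stereographic parametrization, up to a positive factor, centred at `p`. -/
def stereo (e₁ e₂ p : E3) (z : ℂ) : E3 :=
  (2 * z.re) • e₁ + (2 * z.im) • e₂ + (1 - ‖z‖ ^ 2) • p

/-- The differential of `stereo`. -/
def stereoDeriv (e₁ e₂ p : E3) (z w : ℂ) : E3 :=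
  (2 * w.re) • e₁ + (2 * w.im) • e₂ - (2 * inner ℝ z w) • p
end

section Stereo
variable {u : E3 → ℝ} {e₁ e₂ p : E3}

theorem contDiff_stereo (e₁ e₂ p : E3) : ContDiff ℝ ∞ (stereo e₁ e₂ p) :=
  (((contDiff_const.mul Complex.reCLM.contDiff).smul contDiff_const).add
    ((contDiff_const.mul Complex.imCLM.contDiff).smul contDiff_const)).add
    ((contDiff_const.sub (contDiff_norm_sq ℝ)).smul contDiff_const)

theorem fderiv_stereo (e₁ e₂ p : E3) (z w : ℂ) :
    fderiv ℝ (stereo e₁ e₂ p) z w = stereoDeriv e₁ e₂ p z w := by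
  have h := ((((Complex.reCLM.hasFDerivAt (x := z)).const_mul 2).smul_const e₁).add
    (((Complex.imCLM.hasFDerivAt (x := z)).const_mul 2).smul_const e₂)).add
    (((hasFDerivAt_const (1 : ℝ) z).sub (hasStrictFDerivAt_norm_sq z).hasFDerivAt).smul_const p)
  rw [show fderiv ℝ (stereo e₁ e₂ p) z = _ from h.fderiv]
  simp [stereoDeriv, sub_eq_add_neg]
  module

theorem hasFDerivAt_stereo (e₁ e₂ p : E3) (z : ℂ) :
    HasFDerivAt (stereo e₁ e₂ p) (fderiv ℝ (stereo e₁ e₂ p) z) z :=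
  ((contDiff_stereo e₁ e₂ p).differentiable (by simp) z).hasFDerivAt

theorem fderiv_comp_stereo {z : ℂ} (hd : DifferentiableAt ℝ u (stereo e₁ e₂ p z)) (w : ℂ) :
    fderiv ℝ (fun y => u (stereo e₁ e₂ p y)) z w =
      fderiv ℝ u (stereo e₁ e₂ p z) (stereoDeriv e₁ e₂ p z w) := by
  rw [show fderiv ℝ (fun y => u (stereo e₁ e₂ p y)) z = _ from
    (hd.hasFDerivAt.comp z (hasFDerivAt_stereo e₁ e₂ p z)).fderiv]
  simp [fderiv_stereo]

theorem norm_sq_stereo (b : OrthonormalBasis (Fin 3) ℝ E3) (z : ℂ) :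
    ‖stereo (b 0) (b 1) (b 2) z‖ ^ 2 = (1 + ‖z‖ ^ 2) ^ 2 := by
  rw [← real_inner_self_eq_norm_sq]
  have h : ∀ i j, inner ℝ (b i) (b j) = if i = j then (1 : ℝ) else 0 :=
    orthonormal_iff_ite.1 b.orthonormal
  simp only [stereo, inner_add_left, inner_add_right, real_inner_smul_left, real_inner_smul_right, h]
  rw [Complex.sq_norm, Complex.normSq_apply]
  simp
  ring

theorem norm_stereo (b : OrthonormalBasis (Fin 3) ℝ E3) (z : ℂ) :
    ‖stereo (b 0) (b 1) (b 2) z‖ = 1 + ‖z‖ ^ 2 := by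
  have := norm_sq_stereo b z
  rwa [sq_eq_sq₀ (norm_nonneg _) (by positivity)] at this

theorem stereo_ne_zero (b : OrthonormalBasis (Fin 3) ℝ E3) (z : ℂ) :
    stereo (b 0) (b 1) (b 2) z ≠ 0 := by
  rw [← norm_pos_iff, norm_stereo]
  positivity

theorem fderiv_fderiv_comp_stereo (hc : ContDiffOn ℝ ∞ u {(0 : E3)}ᶜ)
    (b : OrthonormalBasis (Fin 3) ℝ E3) (z w : ℂ) :
    fderiv ℝ (fun y => fderiv ℝ (fun y => u (stereo (b 0) (b 1) (b 2) y)) y w) z w =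
      fderiv ℝ (fderiv ℝ u) (stereo (b 0) (b 1) (b 2) z) (stereoDeriv (b 0) (b 1) (b 2) z w)
        (stereoDeriv (b 0) (b 1) (b 2) z w)
      - 2 * ‖w‖ ^ 2 * fderiv ℝ u (stereo (b 0) (b 1) (b 2) z) (b 2) := by
  have h1 : (fun y => fderiv ℝ (fun y => u (stereo (b 0) (b 1) (b 2) y)) y w) = fun y =>
      fderiv ℝ u (stereo (b 0) (b 1) (b 2) y) (stereoDeriv (b 0) (b 1) (b 2) y w) := by
    funext y
    exact fderiv_comp_stereo ((contDiffAt_of_contDiffOn_compl_zero hc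
      (stereo_ne_zero b y)).differentiableAt (by simp)) w
  have h2 : HasFDerivAt (fun y : ℂ => stereoDeriv (b 0) (b 1) (b 2) y w)
      ((0 : ℂ →L[ℝ] E3) - (((2 : ℝ) • innerSL ℝ w)).smulRight (b 2)) z := by
    have := (hasFDerivAt_const ((2 * w.re) • b 0 + (2 * w.im) • b 1) z).sub
      (((innerSL ℝ w).hasFDerivAt (x := z)).const_mul 2 |>.smul_const (b 2))
    refine this.congr_of_eventuallyEq (Filter.Eventually.of_forall fun y => ?_)
    simp [stereoDeriv, real_inner_comm]
  have h3 := ((differentiableAt_fderiv hc (stereo_ne_zero b z)).hasFDerivAt.comp z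
    (hasFDerivAt_stereo (b 0) (b 1) (b 2) z)).clm_apply h2
  rw [h1, show fderiv ℝ (fun y => fderiv ℝ u (stereo (b 0) (b 1) (b 2) y)
    (stereoDeriv (b 0) (b 1) (b 2) y w)) z = _ from h3.fderiv]
  simp only [add_apply, ContinuousLinearMap.comp_apply, ContinuousLinearMap.flip_apply, neg_apply,
    ContinuousLinearMap.smulRight_apply, smul_apply, innerSL_apply_apply, fderiv_stereo,
    real_inner_self_eq_norm_sq, smul_eq_mul, zero_sub, map_neg, map_smul, Function.comp_apply]
  ring_nf
end Stereo

theorem MFE.lap_eq {u : E3 → ℝ} {α : ℝ} (hu : MFE u α) {x : E3} (hx : x ≠ 0) :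
    lap u x = (‖x‖⁻¹) ^ 2 * (α - Real.exp (2 * u x)) := by
  have hr : 0 < ‖x‖⁻¹ := inv_pos.2 (norm_pos_iff.2 hx)
  have h := hu.2.2 (‖x‖⁻¹ • x) (by
    rw [S2, mem_sphere_zero_iff_norm, norm_smul, norm_inv, norm_norm,
      inv_mul_cancel₀ (norm_ne_zero_iff.2 hx)])
  rw [hu.2.1 x _ hr] at h
  rw [hu.2.1.lap_smul hr x]
  congr 1
  linarith

section Stereo
variable {u : E3 → ℝ}

theorem lapC_comp_stereo (hc : ContDiffOn ℝ ∞ u {(0 : E3)}ᶜ) (hu : Hom0 u)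
    (b : OrthonormalBasis (Fin 3) ℝ E3) (z : ℂ) :
    lapC (fun y => u (stereo (b 0) (b 1) (b 2) y)) z = 4 * lap u (stereo (b 0) (b 1) (b 2) z) := by
  have hne := stereo_ne_zero b z
  have hs : IsSymmSndFDerivAt ℝ u (stereo (b 0) (b 1) (b 2) z) :=
    (contDiffAt_of_contDiffOn_compl_zero hc hne).isSymmSndFDerivAt (by
      rw [minSmoothness_of_isRCLikeNormedField]
      norm_cast)
  have hE := hu.fderiv_fderiv_self hc hne (b 2)
  rw [lapC, fderiv_fderiv_comp_stereo hc, fderiv_fderiv_comp_stereo hc, lap_eq_sum_basis u b,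
    Fin.sum_univ_three]
  set B := fderiv ℝ (fderiv ℝ u) (stereo (b 0) (b 1) (b 2) z)
  have h1 := hs (b 0) (b 2)
  have h2 := hs (b 1) (b 2)
  have hz : ‖z‖ ^ 2 = z.re * z.re + z.im * z.im := by rw [Complex.sq_norm, Complex.normSq_apply]
  conv_lhs at hE => rw [stereo]
  simp only [map_add, map_smul, smul_eq_mul, hz] at hE
  have e1 : stereoDeriv (b 0) (b 1) (b 2) z 1 = (2 : ℝ) • b 0 - (2 * z.re) • b 2 := by
    simp [stereoDeriv]
  have e2 : stereoDeriv (b 0) (b 1) (b 2) z Complex.I = (2 : ℝ) • b 1 - (2 * z.im) • b 2 := by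
    simp [stereoDeriv]
  rw [e1, e2]
  simp only [map_sub, map_smul, sub_apply, smul_apply, smul_eq_mul, norm_one, Complex.norm_I]
  rw [h1, h2]
  linear_combination (-4) * hE

open Filter Topology in
theorem tendsto_comp_stereo (hc : ContDiffOn ℝ ∞ u {(0 : E3)}ᶜ) (hu : Hom0 u)
    (b : OrthonormalBasis (Fin 3) ℝ E3) :
    Tendsto (fun y => u (stereo (b 0) (b 1) (b 2) y)) (cocompact ℂ) (𝓝 (u (-b 2))) := by
  have hb : ∀ i, ‖b i‖ = 1 := b.orthonormal.1
  have hn : -b 2 ≠ 0 := by rw [← norm_pos_iff, norm_neg, hb]; exact one_pos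
  have h1 : Tendsto (fun z => (1 + ‖z‖ ^ 2)⁻¹ • stereo (b 0) (b 1) (b 2) z) (cocompact ℂ)
      (𝓝 (-b 2)) := by
    rw [tendsto_iff_norm_sub_tendsto_zero]
    have h6 : Tendsto (fun z : ℂ => 6 / ‖z‖) (cocompact ℂ) (𝓝 0) :=
      tendsto_norm_cocompact_atTop.const_div_atTop 6
    refine squeeze_zero' (Eventually.of_forall fun _ => norm_nonneg _) ?_ h6
    filter_upwards [tendsto_norm_cocompact_atTop.eventually_ge_atTop 1] with z hz
    have e : (1 + ‖z‖ ^ 2)⁻¹ • stereo (b 0) (b 1) (b 2) z - -b 2 =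
        (1 + ‖z‖ ^ 2)⁻¹ • ((2 * z.re) • b 0 + (2 * z.im) • b 1 + (2 : ℝ) • b 2) := by
      have h0 : (1 + ‖z‖ ^ 2 : ℝ) ≠ 0 := by positivity
      have : -b 2 = (1 + ‖z‖ ^ 2)⁻¹ • (-(1 + ‖z‖ ^ 2)) • b 2 := by
        rw [neg_smul, smul_neg, smul_smul, inv_mul_cancel₀ h0, one_smul]
      rw [this, ← smul_sub, stereo]
      congr 1
      module
    have h3 : ‖(2 * z.re) • b 0 + (2 * z.im) • b 1 + (2 : ℝ) • b 2‖ ≤ 6 * ‖z‖ := by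
      refine norm_add₃_le.trans ?_
      simp only [norm_smul, hb, mul_one, norm_mul, Real.norm_eq_abs, abs_two]
      linarith [Complex.abs_re_le_norm z, Complex.abs_im_le_norm z]
    rw [e, norm_smul, Real.norm_eq_abs, abs_of_pos (by positivity)]
    calc _ ≤ (1 + ‖z‖ ^ 2)⁻¹ * (6 * ‖z‖) := by gcongr
      _ ≤ 6 / ‖z‖ := by
        rw [inv_mul_le_iff₀ (by positivity), mul_div_assoc', le_div_iff₀ (by positivity)]
        nlinarith
  have h2 := ((contDiffAt_of_contDiffOn_compl_zero hc hn).continuousAt.tendsto).comp h1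
  exact h2.congr fun z => hu _ _ (by positivity)

theorem MFE.planeSol {α : ℝ} (hu : MFE u α) (b : OrthonormalBasis (Fin 3) ℝ E3) :
    PlaneSol (fun y => u (stereo (b 0) (b 1) (b 2) y)) α (u (-b 2)) where
  contDiff := contDiff_iff_contDiffAt.2 fun z =>
    (contDiffAt_of_contDiffOn_compl_zero hu.1 (stereo_ne_zero b z)).comp z
      (contDiff_stereo _ _ _).contDiffAt
  lap z := by
    rw [lapC_comp_stereo hu.1 hu.2.1, hu.lap_eq (stereo_ne_zero b z), norm_stereo, sphDensity,
      inv_pow]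
    ring
  lim := tendsto_comp_stereo hu.1 hu.2.1 b

theorem Hom0.comp_stereo_neg (hu : Hom0 u) (e₁ e₂ p : E3) {z : ℂ} (hz : z ≠ 0) :
    u (stereo e₁ e₂ (-p) z) = u (stereo e₁ e₂ p ((((‖z‖ ^ 2)⁻¹ : ℝ) : ℂ) * z)) := by
  have h0 : 0 < ‖z‖ ^ 2 := by positivity
  rw [← hu (stereo e₁ e₂ (-p) z) _ (inv_pos.2 h0)]
  congr 1
  simp only [stereo, Complex.re_ofReal_mul, Complex.im_ofReal_mul, norm_mul, Complex.norm_real,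
    Real.norm_eq_abs, abs_of_pos (inv_pos.2 h0), smul_add, smul_smul, smul_neg]
  have h1 : (‖z‖ ^ 2)⁻¹ * ‖z‖ ^ 2 = 1 := inv_mul_cancel₀ h0.ne'
  rw [← neg_smul, show -((‖z‖ ^ 2)⁻¹ * (1 - ‖z‖ ^ 2)) = 1 - ((‖z‖ ^ 2)⁻¹ * ‖z‖) ^ 2 by
    linear_combination (1 + (‖z‖ ^ 2)⁻¹) * h1]
  congr 3 <;> ring

theorem fderiv_comp_mul_of_invariant {g : ℂ → ℝ} {ζ : ℂ} (hd : DifferentiableAt ℝ g 0)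
    (hg : ∀ z, g (ζ * z) = g z) (w : ℂ) : fderiv ℝ g 0 (ζ * w) = fderiv ℝ g 0 w := by
  have hd' : HasFDerivAt g (fderiv ℝ g 0) (ContinuousLinearMap.mul ℝ ℂ ζ 0) := by
    simpa using hd.hasFDerivAt
  have h1 := hd'.comp 0 (ContinuousLinearMap.mul ℝ ℂ ζ).hasFDerivAt
  have h2 : (g ∘ ContinuousLinearMap.mul ℝ ℂ ζ) = g := funext hg
  rw [h2] at h1
  conv_rhs => rw [h1.fderiv]
  rfl

/-- A function with a threefold symmetry is critical at the centre. -/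
theorem fderiv_eq_zero_of_invariant {g : ℂ → ℝ} (hd : DifferentiableAt ℝ g 0)
    (hg : ∀ z, g (Complex.exp ((2 * π / 3 : ℝ) * Complex.I) * z) = g z) : fderiv ℝ g 0 = 0 := by
  have hprim : IsPrimitiveRoot (Complex.exp ((2 * π / 3 : ℝ) * Complex.I)) 3 := by
    have := Complex.isPrimitiveRoot_exp 3 three_ne_zero
    convert this using 2
    push_cast
    ring
  set ζ := Complex.exp ((2 * π / 3 : ℝ) * Complex.I)
  have hsum := hprim.geom_sum_eq_zero (by norm_num)
  simp only [Finset.sum_range_succ, Finset.sum_range_zero, pow_zero, pow_one, zero_add] at hsum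
  ext w
  have h1 := fderiv_comp_mul_of_invariant hd hg w
  have h2 := fderiv_comp_mul_of_invariant hd hg (ζ * w)
  have h3 : fderiv ℝ g 0 (w + ζ * w + ζ * (ζ * w)) = 0 := by
    rw [show w + ζ * w + ζ * (ζ * w) = (1 + ζ + ζ ^ 2) * w by ring, hsum, zero_mul, map_zero]
  rw [map_add, map_add, h2, h1] at h3
  rw [zero_apply]
  linarith
end Stereo

theorem exists_orthonormalBasis_apply_two {p : E3} (hp : p ∈ S2) :
    ∃ b : OrthonormalBasis (Fin 3) ℝ E3, b 2 = p := by
  have hv : Orthonormal ℝ (({2} : Set (Fin 3)).domRestrict fun _ => p) := by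
    rw [orthonormal_iff_ite]
    rintro ⟨i, rfl⟩ ⟨j, rfl⟩
    have : ‖p‖ = 1 := mem_sphere_zero_iff_norm.1 hp
    simp [this]
  obtain ⟨b, hb⟩ := hv.exists_orthonormalBasis_extension_of_card_eq (by simp)
  exact ⟨b, hb 2 rfl⟩

theorem stmt14 (α : ℝ) (hα1 : 2 < α) (hα2 : α ≤ 3) (u : E3 → ℝ) (hu : MFE u α)
    (p : E3) (hp : p ∈ S2) (hump : UmbilicalCritical u p) :
    fderiv ℝ u (-p) = 0 := by
  obtain ⟨b, rfl⟩ := exists_orthonormalBasis_apply_two hp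
  obtain ⟨hcrit, c, hc⟩ := hump
  have hite : ∀ i j, inner ℝ (b i) (b j) = if i = j then (1 : ℝ) else 0 :=
    orthonormal_iff_ite.1 b.orthonormal
  have hne : -b 2 ≠ 0 := by
    rw [← norm_pos_iff, norm_neg, b.orthonormal.1]; exact one_pos
  have hdiff : DifferentiableAt ℝ u (-b 2) :=
    (contDiffAt_of_contDiffOn_compl_zero hu.1 hne).differentiableAt (by simp)
  have hsol := hu.planeSol b
  have hS0 : stereo (b 0) (b 1) (b 2) 0 = b 2 := by simp [stereo]
  have h1 : fderiv ℝ (fun y => u (stereo (b 0) (b 1) (b 2) y)) 0 = 0 := by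
    ext w
    rw [fderiv_comp_stereo ((contDiffAt_of_contDiffOn_compl_zero hu.1
      (stereo_ne_zero b 0)).differentiableAt (by simp)), hS0, hcrit]
    rfl
  have h2 : ∀ z, fderiv ℝ (fderiv ℝ fun y => u (stereo (b 0) (b 1) (b 2) y)) 0 z z =
      4 * c * ‖z‖ ^ 2 := by
    intro z
    have h3 := fderiv_fderiv_comp_stereo hu.1 b 0 z
    rw [fderiv_clm_apply (((hsol.contDiff.fderiv_right (m := 1) (by norm_cast)).differentiable
      one_ne_zero) 0) (differentiableAt_const _)] at h3
    have h4 := hc (stereoDeriv (b 0) (b 1) (b 2) 0 z) (by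
      simp [stereoDeriv, inner_add_left, real_inner_smul_left, hite])
    have h5 : ‖stereoDeriv (b 0) (b 1) (b 2) 0 z‖ ^ 2 = 4 * ‖z‖ ^ 2 := by
      rw [← real_inner_self_eq_norm_sq, Complex.sq_norm, Complex.normSq_apply]
      simp only [stereoDeriv, inner_zero_left, mul_zero, zero_smul, sub_zero, inner_add_left,
        inner_add_right, real_inner_smul_left, real_inner_smul_right, hite]
      simp
      ring
    rw [iteratedFDeriv_two_apply] at h4
    simp only [Matrix.cons_val_zero, Matrix.cons_val_one] at h4
    rw [hS0, hcrit, h4, h5] at h3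
    simp at h3
    linarith
  have hrot := hsol.eq_comp_rotation (by linarith) hα2 h1 h2
  have hS0' : stereo (b 0) (b 1) (-b 2) 0 = -b 2 := by simp [stereo]
  have hd0 : DifferentiableAt ℝ u (stereo (b 0) (b 1) (-b 2) 0) := by rwa [hS0']
  have hz := fderiv_eq_zero_of_invariant (g := fun y => u (stereo (b 0) (b 1) (-b 2) y))
    (hd0.comp 0 (hasFDerivAt_stereo _ _ _ _).differentiableAt) fun z => by
      rcases eq_or_ne z 0 with rfl | hz
      · rw [mul_zero]
      · rw [hu.2.1.comp_stereo_neg _ _ _ hz,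
          hu.2.1.comp_stereo_neg _ _ _ (mul_ne_zero (Complex.exp_ne_zero _) hz), norm_mul,
          Complex.norm_exp_ofReal_mul_I, one_mul, mul_left_comm]
        exact hrot _
  have hL : ∀ w, fderiv ℝ u (-b 2) (stereoDeriv (b 0) (b 1) (-b 2) 0 w) = 0 := by
    intro w
    have := fderiv_comp_stereo hd0 w
    rw [hz, hS0'] at this
    exact this.symm
  have e0 := hL 1
  have e1 := hL Complex.I
  have e2 := hu.2.1.fderiv_self hdiff
  simp only [stereoDeriv, inner_zero_left, Complex.one_re, Complex.one_im, Complex.I_re,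
    Complex.I_im, mul_zero, zero_smul, sub_zero, add_zero, zero_add, mul_one, map_smul, smul_eq_mul,
    map_neg, neg_eq_zero, mul_eq_zero, OfNat.ofNat_ne_zero, false_or] at e0 e1 e2
  refine ContinuousLinearMap.coe_injective (b.toBasis.ext fun i => ?_)
  fin_cases i
  · simpa using e0
  · simpa using e1
  · simpa using e2
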